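/- There exists an absolute constant c > 0, independent of the prime, such that for every prime p there exist arbitrarily large finite sets A ⊆ ℤ_p (the p-adic integers) with max(|A+A|, |AA|) ≤ |A|^{2−c}; that is, for every N there is a finite A ⊆ ℤ_p with |A| ≥ N satisfying this bound. -/

import Mathlib

set_option linter.unusedSectionVars false

section

/-- A normalized discrete valuation of a field, written additively, with the junk value `0` at
`0`. -/
structure Pl (F : Type*) [Field F] where
  ord : F → ℤ
  ord_zero' : ord 0 = 0
  ord_mul' : ∀ x y, x ≠ 0 → y ≠ 0 → ord (x * y) = ord x + ord y
  ord_add' : ∀ x y, x ≠ 0 → y ≠ 0 → x + y ≠ 0 → min (ord x) (ord y) ≤ ord (x + y)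
  exists_one' : ∃ x, ord x = 1

namespace Pl

variable {F : Type*} [Field F] (P : Pl F)

instance : CoeFun (Pl F) (fun _ => F → ℤ) := ⟨Pl.ord⟩

@[ext] theorem ext {P Q : Pl F} (h : ∀ x, P x = Q x) : P = Q := by
  cases P; cases Q; congr; exact funext h

@[simp] theorem ord_zero : P 0 = 0 := P.ord_zero'

theorem ord_mul {x y : F} (hx : x ≠ 0) (hy : y ≠ 0) : P (x * y) = P x + P y :=
  P.ord_mul' x y hx hy

@[simp] theorem ord_one : P 1 = 0 := by
  have := P.ord_mul (one_ne_zero (α := F)) (one_ne_zero (α := F))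
  simp at this; exact this

theorem exists_unif : ∃ x : F, x ≠ 0 ∧ P x = 1 := by
  obtain ⟨x, hx⟩ := P.exists_one'
  refine ⟨x, ?_, hx⟩
  rintro rfl; simp at hx

theorem ord_pow (x : F) (n : ℕ) : P (x ^ n) = n * P x := by
  rcases eq_or_ne x 0 with rfl | hx
  · rcases n with _ | n <;> simp
  induction n with
  | zero => simp
  | succ n ih => rw [pow_succ, ord_mul P (pow_ne_zero _ hx) hx, ih]; push_cast; ring

theorem ord_sq (x : F) : P (x ^ 2) = 2 * P x := by
  rw [ord_pow]; rfl

@[simp] theorem ord_inv (x : F) : P x⁻¹ = - P x := by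
  rcases eq_or_ne x 0 with rfl | hx
  · simp
  have := P.ord_mul hx (inv_ne_zero hx)
  rw [mul_inv_cancel₀ hx, ord_one] at this
  omega

theorem ord_div {x y : F} (hx : x ≠ 0) (hy : y ≠ 0) : P (x / y) = P x - P y := by
  rw [div_eq_mul_inv, ord_mul P hx (inv_ne_zero hy), ord_inv]; ring

theorem ord_zpow (x : F) (n : ℤ) : P (x ^ n) = n * P x := by
  cases n with
  | ofNat n => simpa using ord_pow P x n
  | negSucc n => rw [zpow_negSucc, ord_inv, ord_pow]; push_cast [Int.negSucc_eq]; ring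

@[simp] theorem ord_neg_one : P (-1) = 0 := by
  have := P.ord_sq (-1)
  simp at this; exact this

@[simp] theorem ord_neg (x : F) : P (-x) = P x := by
  rcases eq_or_ne x 0 with rfl | hx
  · simp
  rw [neg_eq_neg_one_mul, ord_mul P (by simp) hx, ord_neg_one, zero_add]

/-- The fractional ideal of elements of valuation at least `n`. -/
def ge (n : ℤ) : AddSubgroup F where
  carrier := {x | x ≠ 0 → n ≤ P x}
  zero_mem' h := absurd rfl h
  add_mem' {x y} hx hy h := by
    rcases eq_or_ne x 0 with rfl | hx0
    · rw [zero_add] at h ⊢; exact hy h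
    rcases eq_or_ne y 0 with rfl | hy0
    · rw [add_zero] at h ⊢; exact hx h
    have := P.ord_add' x y hx0 hy0 h
    have := hx hx0; have := hy hy0
    omega
  neg_mem' {x} hx h := by
    rw [ord_neg]; exact hx (by simpa using h)

theorem mem_ge {n : ℤ} {x : F} : x ∈ P.ge n ↔ (x ≠ 0 → n ≤ P x) := Iff.rfl

theorem mem_ge_iff {n : ℤ} {x : F} (hx : x ≠ 0) : x ∈ P.ge n ↔ n ≤ P x :=
  ⟨fun h => h hx, fun h _ => h⟩

theorem mem_ge_self (x : F) : x ∈ P.ge (P x) := fun _ => le_rfl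

theorem ge_anti {m n : ℤ} (h : m ≤ n) {x : F} (hx : x ∈ P.ge n) : x ∈ P.ge m :=
  fun h0 => h.trans (hx h0)

theorem mul_mem_ge {m n : ℤ} {x y : F} (hx : x ∈ P.ge m) (hy : y ∈ P.ge n) :
    x * y ∈ P.ge (m + n) := by
  intro h
  have h1 := left_ne_zero_of_mul h
  have h2 := right_ne_zero_of_mul h
  rw [ord_mul P h1 h2]
  exact add_le_add (hx h1) (hy h2)

theorem mul_mem_ge_zero {n : ℤ} {x y : F} (hx : x ∈ P.ge 0) (hy : y ∈ P.ge n) :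
    x * y ∈ P.ge n := by simpa using P.mul_mem_ge hx hy

theorem one_mem_ge : (1 : F) ∈ P.ge 0 := fun _ => by simp

/-- The valuation ring. -/
def ring : Subring F where
  carrier := P.ge 0
  zero_mem' := (P.ge 0).zero_mem
  add_mem' := (P.ge 0).add_mem
  neg_mem' := (P.ge 0).neg_mem
  one_mem' := P.one_mem_ge
  mul_mem' := P.mul_mem_ge_zero

theorem natCast_mem_ge (n : ℕ) : (n : F) ∈ P.ge 0 := natCast_mem P.ring n

theorem intCast_mem_ge (n : ℤ) : (n : F) ∈ P.ge 0 := intCast_mem P.ring n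

theorem ord_natCast_nonneg (n : ℕ) : 0 ≤ P (n : F) := by
  rcases eq_or_ne (n : F) 0 with h | h
  · simp [h]
  exact P.natCast_mem_ge n h

theorem ord_intCast_nonneg (n : ℤ) : 0 ≤ P (n : F) := by
  rcases eq_or_ne (n : F) 0 with h | h
  · simp [h]
  exact P.intCast_mem_ge n h

theorem ord_two_nonneg : 0 ≤ P (2 : F) := by exact_mod_cast P.ord_natCast_nonneg 2

theorem ord_add_of_mem {x y : F} (hx : x ≠ 0) (hy : y ∈ P.ge (P x + 1)) :
    x + y ≠ 0 ∧ P (x + y) = P x := by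
  have h1 : x + y ≠ 0 := by
    intro h
    have h2 : y = -x := by linear_combination h
    rw [h2, mem_ge_iff P (by simpa), ord_neg] at hy
    omega
  refine ⟨h1, le_antisymm ?_ ?_⟩
  · by_contra! h
    have h2 : x + y ∈ P.ge (P x + 1) := fun _ => h
    have h3 := (P.ge (P x + 1)).sub_mem h2 hy
    rw [add_sub_cancel_right, mem_ge_iff P hx] at h3
    omega
  · exact (P.ge (P x)).add_mem (P.mem_ge_self x) (P.ge_anti (by omega) hy) h1

theorem ord_eq_of_sub_mem {x y : F} (hx : x ≠ 0) (hy : y - x ∈ P.ge (P x + 1)) :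
    y ≠ 0 ∧ P y = P x := by
  simpa using P.ord_add_of_mem hx hy

theorem ord_eq_zero_of_sub_one_mem {y : F} (hy : y - 1 ∈ P.ge 1) : y ≠ 0 ∧ P y = 0 := by
  simpa using P.ord_eq_of_sub_mem one_ne_zero (by simpa using hy)

/-- Transport of a place along a field isomorphism. -/
def comap {E : Type*} [Field E] (σ : E ≃+* F) : Pl E where
  ord x := P (σ x)
  ord_zero' := by simp
  ord_mul' x y hx hy := by
    rw [map_mul, ord_mul P (by simpa) (by simpa)]
  ord_add' x y hx hy h := by
    rw [map_add]
    exact P.ord_add' _ _ (by simpa) (by simpa) (by rwa [← map_add, ne_eq, map_eq_zero])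
  exists_one' := by
    obtain ⟨x, hx⟩ := P.exists_one'
    exact ⟨σ.symm x, by simpa⟩

@[simp] theorem comap_apply {E : Type*} [Field E] (σ : E ≃+* F) (x : E) :
    P.comap σ x = P (σ x) := rfl

theorem mem_comap_ge {E : Type*} [Field E] (σ : E ≃+* F) (x : E) (n : ℤ) :
    x ∈ (P.comap σ).ge n ↔ σ x ∈ P.ge n := by
  simp [mem_ge]

theorem mem_ge_zero_of_isIntegral_of_forall {R : Type*} [CommRing R] [Algebra R F]
    (hR : ∀ r : R, algebraMap R F r ∈ P.ge 0) {x : F} (hx : IsIntegral R x) : x ∈ P.ge 0 := by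
  intro h0
  by_contra! hneg
  obtain ⟨f, hf, hfx⟩ := hx
  have hdeg : f.natDegree ≠ 0 := by
    intro h
    rw [hf.natDegree_eq_zero.mp h] at hfx
    simp at hfx
  rw [Polynomial.eval₂_eq_sum_range, Finset.sum_range_succ] at hfx
  rw [hf.coeff_natDegree, map_one, one_mul] at hfx
  set n := f.natDegree
  have h1 : ∑ i ∈ Finset.range n, (algebraMap R F) (f.coeff i) * x ^ i ∈ P.ge (P (x ^ n) + 1) := by
    refine AddSubgroup.sum_mem _ fun i hi => ?_
    refine P.mul_mem_ge_zero (hR _) (fun _ => ?_)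
    rw [ord_pow, ord_pow]
    have : (i : ℤ) + 1 ≤ n := by exact_mod_cast Finset.mem_range.mp hi
    nlinarith
  exact (P.ord_add_of_mem (pow_ne_zero n h0) h1).1 (by rw [add_comm]; exact hfx)

theorem mem_ge_zero_of_isIntegral {x : F} (hx : IsIntegral ℤ x) : x ∈ P.ge 0 :=
  P.mem_ge_zero_of_isIntegral_of_forall (fun r => P.intCast_mem_ge r) hx

/-- Places with the same valuation ring coincide. -/
theorem eq_of_le {P Q : Pl F} (h : ∀ x, x ∈ P.ge 0 → x ∈ Q.ge 0) : P = Q := by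
  have hu : ∀ x, x ≠ 0 → P x = 0 → Q x = 0 := by
    intro x hx h0
    have h1 := h x (fun _ => h0.ge) hx
    have h2 := h x⁻¹ (fun _ => by simp [h0]) (inv_ne_zero hx)
    rw [ord_inv] at h2
    omega
  obtain ⟨π, hπ0, hπ⟩ := P.exists_unif
  have key : ∀ x, x ≠ 0 → Q x = P x * Q π := by
    intro x hx
    have h1 := hu (x / π ^ (P x)) (div_ne_zero hx (zpow_ne_zero _ hπ0)) (by
      rw [ord_div P hx (zpow_ne_zero _ hπ0), ord_zpow, hπ]; ring)
    rw [ord_div Q hx (zpow_ne_zero _ hπ0), ord_zpow] at h1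
    omega
  have h0 : 0 ≤ Q π := h π (fun _ => by omega) hπ0
  obtain ⟨x, hx, hx1⟩ := Q.exists_unif
  have h1 := key x hx
  rw [hx1] at h1
  have h2 : Q π = 1 := by
    have : Q π ∣ 1 := ⟨P x, by rw [h1]; ring⟩
    exact Int.eq_one_of_dvd_one h0 this
  ext y
  rcases eq_or_ne y 0 with rfl | hy
  · simp
  rw [key y hy, h2, mul_one]

end Pl

end

section

open NumberField IsDedekindDomain WithZero

namespace Pl

variable {F : Type*} [Field F]

section NF
variable [NumberField F]

/-- The place attached to a maximal ideal of the ring of integers. -/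
noncomputable def of (v : HeightOneSpectrum (𝓞 F)) : Pl F where
  ord x := - log (v.valuation F x)
  ord_zero' := by simp
  ord_mul' x y hx hy := by
    rw [map_mul, log_mul (by simpa) (by simpa)]; ring
  ord_add' x y hx hy h := by
    have := (v.valuation F).map_add x y
    have h1 : log (v.valuation F (x + y)) ≤ log (max (v.valuation F x) (v.valuation F y)) :=
      (log_le_log (by simpa) (by
        rcases max_choice (v.valuation F x) (v.valuation F y) with h | h <;> rw [h] <;> simpa)).2
        this
    rcases max_choice (v.valuation F x) (v.valuation F y) with h | h <;> rw [h] at h1 <;> omega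
  exists_one' := by
    obtain ⟨π, hπ⟩ := v.valuation_exists_uniformizer F
    exact ⟨π, by rw [hπ]; simp⟩

theorem of_apply (v : HeightOneSpectrum (𝓞 F)) (x : F) : of v x = - log (v.valuation F x) := rfl

theorem algebraMap_mem_of_ge {v : HeightOneSpectrum (𝓞 F)} {x : 𝓞 F} {n : ℕ} :
    algebraMap (𝓞 F) F x ∈ (of v).ge n ↔ x ∈ v.asIdeal ^ n := by
  rw [← v.intValuation_le_pow_iff_mem, ← v.valuation_of_algebraMap (K := F)]
  rcases eq_or_ne x 0 with rfl | hx
  · simp [(((of v).ge n)).zero_mem]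
  have hx' : algebraMap (𝓞 F) F x ≠ 0 := by simpa using hx
  change _ ↔ v.valuation F (algebraMap (𝓞 F) F x) ≤ _
  rw [mem_ge_iff _ hx', of_apply, ← log_le_log (by simpa using hx') (by simp)]
  rw [log_exp]
  omega

theorem algebraMap_mem_of_ge_one {v : HeightOneSpectrum (𝓞 F)} {x : 𝓞 F} :
    algebraMap (𝓞 F) F x ∈ (of v).ge 1 ↔ x ∈ v.asIdeal := by
  simpa using algebraMap_mem_of_ge (v := v) (x := x) (n := 1)

theorem of_injective : Function.Injective (of (F := F)) := by
  intro v w h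
  ext x
  rw [← algebraMap_mem_of_ge_one, h, algebraMap_mem_of_ge_one]

omit [NumberField F] in
theorem algebraMap_mem_ge (P : Pl F) (x : 𝓞 F) : algebraMap (𝓞 F) F x ∈ P.ge 0 :=
  P.mem_ge_zero_of_isIntegral x.isIntegral_coe

theorem of_surjective : Function.Surjective (of (F := F)) := by
  intro P
  let I : Ideal (𝓞 F) :=
    { carrier := {x | algebraMap (𝓞 F) F x ∈ P.ge 1}
      zero_mem' := by simp [(P.ge 1).zero_mem]
      add_mem' := fun {a b} ha hb => by
        simpa using (P.ge 1).add_mem ha hb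
      smul_mem' := fun c x hx => by
        simpa using P.mul_mem_ge_zero (P.algebraMap_mem_ge c) hx }
  have hmem : ∀ x, x ∈ I ↔ algebraMap (𝓞 F) F x ∈ P.ge 1 := fun _ => Iff.rfl
  have hI : I.IsPrime := by
    refine ⟨?_, ?_⟩
    · rw [Ideal.ne_top_iff_one, hmem, mem_ge]
      simp
    · intro x y hxy
      by_contra! h
      rw [hmem, hmem, mem_ge, mem_ge] at h
      push Not at h
      obtain ⟨⟨hx, hx'⟩, hy, hy'⟩ := h
      rw [hmem, map_mul, mem_ge_iff _ (mul_ne_zero hx hy), ord_mul P hx hy] at hxy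
      have := P.algebraMap_mem_ge x hx
      have := P.algebraMap_mem_ge y hy
      omega
  have hne : I ≠ ⊥ := by
    obtain ⟨x, hx0, hx⟩ := P.exists_unif
    obtain ⟨a, b, hb, rfl⟩ := IsFractionRing.div_surjective (A := 𝓞 F) x
    have hb0 : algebraMap (𝓞 F) F b ≠ 0 := by simpa using nonZeroDivisors.ne_zero hb
    have ha0 : algebraMap (𝓞 F) F a ≠ 0 := by intro h; rw [h] at hx0; simp at hx0
    rw [ord_div P ha0 hb0] at hx
    have := P.algebraMap_mem_ge b hb0
    rw [Submodule.ne_bot_iff]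
    exact ⟨a, (hmem a).2 fun _ => by omega, by simpa using ha0⟩
  refine ⟨⟨I, hI, hne⟩, eq_of_le ?_⟩
  set v : HeightOneSpectrum (𝓞 F) := ⟨I, hI, hne⟩
  intro x hx
  have : v.valuation F x ≤ 1 := by
    rcases eq_or_ne x 0 with rfl | h
    · simp
    have := hx h
    rw [of_apply] at this
    rw [← log_le_log (by simpa) (by simp), log_one]
    omega
  obtain ⟨n, d, hd⟩ := v.exists_primeCompl_mul_eq_of_integer x this
  have hd1 : (d : 𝓞 F) ∉ I := d.2
  have hd0 : algebraMap (𝓞 F) F d ≠ 0 := by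
    intro h
    apply hd1
    have : (d : 𝓞 F) = 0 := by simpa using h
    rw [this]; exact I.zero_mem
  rw [hmem, mem_ge_iff _ hd0] at hd1
  have hd2 := P.algebraMap_mem_ge d hd0
  intro hx0
  have h3 := P.algebraMap_mem_ge n (by rw [← hd]; exact mul_ne_zero hx0 hd0)
  rw [← hd, ord_mul P hx0 hd0] at h3
  omega

theorem support_finite {x : F} (hx : x ≠ 0) : {P : Pl F | P x ≠ 0}.Finite := by
  have key : ∀ a : 𝓞 F, a ≠ 0 → {P : Pl F | P (algebraMap (𝓞 F) F a) ≠ 0}.Finite := by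
    intro a ha
    have hs : Ideal.span {a} ≠ 0 := by simpa using ha
    refine ((Ideal.finite_factors hs).image of).subset ?_
    intro P hP
    obtain ⟨v, rfl⟩ := of_surjective P
    refine ⟨v, ?_, rfl⟩
    have h0 : algebraMap (𝓞 F) F a ≠ 0 := by simpa using ha
    have h1 := (of v).algebraMap_mem_ge a h0
    have h2 : algebraMap (𝓞 F) F a ∈ (of v).ge 1 := fun _ => by
      have : of v (algebraMap (𝓞 F) F a) ≠ 0 := hP
      omega
    rw [algebraMap_mem_of_ge_one] at h2
    simpa [Ideal.dvd_span_singleton] using h2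
  obtain ⟨a, b, hb, rfl⟩ := IsFractionRing.div_surjective (A := 𝓞 F) x
  have hb0 := nonZeroDivisors.ne_zero hb
  have ha0 : a ≠ 0 := by rintro rfl; simp at hx
  refine ((key a ha0).union (key b hb0)).subset ?_
  intro P hP
  by_contra! h
  simp only [Set.mem_union, Set.mem_ofPred_eq, not_or, not_not] at h
  apply hP
  rw [ord_div P (by simpa) (by simpa), h.1, h.2]; simp

theorem isIntegral_of_forall {x : F} (hx : ∀ P : Pl F, x ∈ P.ge 0) :
    ∃ y : 𝓞 F, algebraMap (𝓞 F) F y = x := by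
  refine HeightOneSpectrum.mem_integers_of_valuation_le_one F x fun v => ?_
  rcases eq_or_ne x 0 with rfl | h
  · simp
  have := hx (of v) h
  rw [of_apply] at this
  rw [← log_le_log (by simpa) (by simp), log_one]
  omega

/-- Enlarging a finite set of places so that the class group of the complement is trivial. -/
theorem exists_classGroup_trivial (S₀ : Set (Pl F)) (h₀ : S₀.Finite) :
    ∃ S : Set (Pl F), S.Finite ∧ S₀ ⊆ S ∧
      ∀ P ∉ S, ∃ x : F, x ≠ 0 ∧ P x = 1 ∧ ∀ Q ∉ S, Q ≠ P → Q x = 0 := by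
  choose I hI using ClassGroup.mk0_surjective (R := 𝓞 F)
  let T : Set (Pl F) := ⋃ c, of '' {v | v.asIdeal ∣ (I c : Ideal (𝓞 F))}
  have hT : T.Finite := Set.finite_iUnion fun c =>
    (Ideal.finite_factors (nonZeroDivisors.ne_zero (I c).2)).image _
  refine ⟨S₀ ∪ T, h₀.union hT, Set.subset_union_left, ?_⟩
  intro P hP
  obtain ⟨v, rfl⟩ := of_surjective P
  have hv0 : v.asIdeal ∈ nonZeroDivisors (Ideal (𝓞 F)) := mem_nonZeroDivisors_of_ne_zero v.ne_bot
  set c := (ClassGroup.mk0 ⟨v.asIdeal, hv0⟩)⁻¹ with hc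
  have h1 : ClassGroup.mk0 (⟨v.asIdeal, hv0⟩ * I c) = 1 := by
    rw [map_mul, hI c, hc, mul_inv_cancel]
  rw [ClassGroup.mk0_eq_one_iff] at h1
  obtain ⟨x, hx⟩ := h1.principal
  have hx' : v.asIdeal * (I c : Ideal (𝓞 F)) = Ideal.span {x} := by simpa using hx
  have hx0 : x ≠ 0 := by
    rintro rfl
    have h2 : v.asIdeal * (I c : Ideal (𝓞 F)) = 0 := by simpa using hx'
    rcases mul_eq_zero.mp h2 with h | h
    · exact v.ne_bot h
    · exact nonZeroDivisors.ne_zero (I c).2 h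
  have hx0' : algebraMap (𝓞 F) F x ≠ 0 := by simpa using hx0
  have hnd : ∀ w : HeightOneSpectrum (𝓞 F), of w ∉ S₀ ∪ T → ¬ w.asIdeal ∣ (I c : Ideal (𝓞 F)) := by
    intro w hw h
    exact hw (Or.inr (Set.mem_iUnion.2 ⟨c, w, h, rfl⟩))
  refine ⟨algebraMap (𝓞 F) F x, hx0', ?_, ?_⟩
  · have h2 : x ∈ v.asIdeal ^ 1 := by
      rw [pow_one, ← Ideal.dvd_span_singleton, ← hx']
      exact dvd_mul_right _ _
    have h3 : x ∉ v.asIdeal ^ 2 := by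
      rw [← Ideal.dvd_span_singleton, ← hx', pow_two, mul_dvd_mul_iff_left v.ne_bot]
      exact hnd v hP
    rw [← algebraMap_mem_of_ge, mem_ge_iff _ hx0'] at h2 h3
    push_cast at h2 h3
    omega
  · intro Q hQ hne
    obtain ⟨w, rfl⟩ := of_surjective Q
    have h2 : x ∉ w.asIdeal := by
      rw [← Ideal.dvd_span_singleton, ← hx', w.prime.dvd_mul, not_or]
      refine ⟨fun h => hne ?_, hnd w hQ⟩
      congr 1
      ext1
      exact ((v.isMaximal.eq_of_le w.isPrime.ne_top (Ideal.dvd_iff_le.1 h))).symm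
    rw [← algebraMap_mem_of_ge_one, mem_ge_iff _ hx0'] at h2
    have := (of w).algebraMap_mem_ge x hx0'
    omega

/-- Weak approximation. -/
theorem exists_approx (S : Set (Pl F)) (hS : S.Finite) (f : Pl F → 𝓞 F) (n : ℕ) :
    ∃ y : 𝓞 F, ∀ P ∈ S, algebraMap (𝓞 F) F y - algebraMap (𝓞 F) F (f P) ∈ P.ge n := by
  have hfin : (of ⁻¹' S).Finite := hS.preimage of_injective.injOn
  obtain ⟨y, hy⟩ := IsDedekindDomain.exists_forall_sub_mem_ideal (s := hfin.toFinset)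
    (fun v : HeightOneSpectrum (𝓞 F) => v.asIdeal) (fun _ => n) (fun v _ => v.prime)
    (fun v _ w _ hvw h => hvw (HeightOneSpectrum.ext h)) (fun v => f (of v))
  refine ⟨y, fun P hP => ?_⟩
  obtain ⟨v, rfl⟩ := of_surjective P
  have := hy v (by simpa using hP)
  rw [← map_sub, algebraMap_mem_of_ge]
  exact this

end NF

end Pl

end

section

open NumberField IsDedekindDomain WithZero

namespace Pl

section Over

variable {E F : Type*} [Field E] [Field F] [Algebra E F]

/-- `P` lies over `v` with ramification index `e`. -/
def Over (P : Pl F) (v : Pl E) (e : ℕ) : Prop :=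
  0 < e ∧ ∀ x : E, P (algebraMap E F x) = e * v x

theorem Over.mem_ge {P : Pl F} {v : Pl E} {e : ℕ} (h : P.Over v e) {n : ℤ} {x : E}
    (hx : x ∈ v.ge n) : algebraMap E F x ∈ P.ge (e * n) := by
  intro h0
  rw [h.2]
  have := hx (by simpa using h0)
  exact mul_le_mul_of_nonneg_left this (by positivity)

theorem Over.pos_iff {P : Pl F} {v : Pl E} {e : ℕ} (h : P.Over v e) (x : E) :
    0 < P (algebraMap E F x) ↔ 0 < v x := by
  rw [h.2]
  have : (0 : ℤ) < e := by exact_mod_cast h.1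
  exact mul_pos_iff_of_pos_left this

theorem Over.unique {P : Pl F} {v w : Pl E} {e f : ℕ} (h : P.Over v e) (h' : P.Over w f) :
    v = w := by
  apply eq_of_le
  intro x hx h0
  by_contra! hn
  have h1 := (h'.pos_iff x⁻¹).2 (by rw [ord_inv]; omega)
  have h2 := (h.pos_iff x⁻¹).1 h1
  rw [ord_inv] at h2
  have := hx h0
  omega

theorem exists_over [Algebra.IsAlgebraic E F] (P : Pl F) : ∃ (v : Pl E) (e : ℕ), P.Over v e := by
  have hpos : ∃ n : ℕ, 0 < n ∧ ∃ x : E, P (algebraMap E F x) = n := by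
    have : ∃ x : E, P (algebraMap E F x) ≠ 0 := by
      by_contra! h
      obtain ⟨x, hx0, hx⟩ := P.exists_unif
      have := P.mem_ge_zero_of_isIntegral_of_forall (R := E) (fun r _ => (h r).ge)
        (Algebra.IsAlgebraic.isAlgebraic (R := E) x⁻¹).isIntegral (inv_ne_zero hx0)
      rw [ord_inv, hx] at this
      omega
    obtain ⟨x, hx⟩ := this
    rcases lt_or_gt_of_ne hx with h | h
    · exact ⟨(P (algebraMap E F x⁻¹)).toNat, by simp; omega, x⁻¹, by simp; omega⟩
    · exact ⟨(P (algebraMap E F x)).toNat, by omega, x, by omega⟩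
  classical
  obtain ⟨he, π, hπ⟩ := Nat.find_spec hpos
  set e := Nat.find hpos
  have hπ0 : π ≠ 0 := by rintro rfl; simp at hπ; omega
  have hdvd : ∀ x : E, (e : ℤ) ∣ P (algebraMap E F x) := by
    intro x
    rcases eq_or_ne x 0 with rfl | hx
    · simp
    by_contra hnd
    have hr : 0 < P (algebraMap E F x) % e :=
      lt_of_le_of_ne (Int.emod_nonneg _ (by omega))
        (fun h => hnd (Int.dvd_of_emod_eq_zero h.symm))
    have hlt : P (algebraMap E F x) % e < e := Int.emod_lt_of_pos _ (by omega)
    have := Nat.find_min hpos (m := (P (algebraMap E F x) % e).toNat)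
      (by have : Nat.find hpos = e := rfl
          omega)
    apply this
    refine ⟨by omega, x / π ^ (P (algebraMap E F x) / e), ?_⟩
    rw [map_div₀, map_zpow₀, ord_div P (by simpa) (zpow_ne_zero _ (by simpa)), ord_zpow, hπ]
    have := Int.emod_add_mul_ediv (P (algebraMap E F x)) e
    rw [Int.toNat_of_nonneg hr.le]
    linarith
  have hmul : ∀ x : E, (e : ℤ) * (P (algebraMap E F x) / e) = P (algebraMap E F x) :=
    fun x => Int.mul_ediv_cancel' (hdvd x)
  have he' : (0 : ℤ) < e := by exact_mod_cast he
  refine ⟨⟨fun x => P (algebraMap E F x) / e, by simp, ?_, ?_, π, ?_⟩,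
      e, he, fun x => (hmul x).symm⟩
  · intro x y hx hy
    apply mul_left_cancel₀ he'.ne'
    rw [mul_add, hmul, hmul, hmul, map_mul, ord_mul P (by simpa) (by simpa)]
  · intro x y hx hy hxy
    have := P.ord_add' (algebraMap E F x) (algebraMap E F y) (by simpa) (by simpa)
      (by rwa [← map_add, ne_eq, map_eq_zero])
    rw [← map_add] at this
    rcases min_choice (P (algebraMap E F x)) (P (algebraMap E F y)) with h | h <;> rw [h] at this
    · exact (min_le_left _ _).trans (Int.ediv_le_ediv he' this)
    · exact (min_le_right _ _).trans (Int.ediv_le_ediv he' this)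
  · rw [hπ, Int.ediv_self he'.ne']

end Over

section NF
variable {F : Type*} [Field F] [NumberField F]

theorem exists_int_approx (P : Pl F) {z : F} (hz : z ∈ P.ge 0) (n : ℕ) :
    ∃ y : 𝓞 F, z - algebraMap (𝓞 F) F y ∈ P.ge n := by
  obtain ⟨v, rfl⟩ := of_surjective P
  have h1 : v.valuation F z ≤ 1 := by
    rcases eq_or_ne z 0 with rfl | h
    · simp
    have := hz h
    rw [of_apply] at this
    rw [← log_le_log (by simpa) (by simp), log_one]
    omega
  obtain ⟨y, hy⟩ := v.exists_valuation_sub_lt_of_integer h1 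
    (γ := Units.mk0 (exp (-(n : ℤ))) exp_ne_zero)
  refine ⟨y, fun h0 => ?_⟩
  replace hy : v.valuation F (algebraMap (𝓞 F) F y - z) < exp (-(n : ℤ)) := hy
  rw [Valuation.map_sub_swap, ← log_lt_log (by simpa) (by simp), log_exp] at hy
  rw [of_apply]
  omega

/-- Weak approximation, with arbitrary targets. -/
theorem exists_approx' (S : Set (Pl F)) (hS : S.Finite) (f : Pl F → F) (n : ℕ) :
    ∃ y : F, ∀ P ∈ S, y - f P ∈ P.ge n := by
  classical
  obtain ⟨d, hd⟩ := IsLocalization.exist_integer_multiples_of_finset (nonZeroDivisors (𝓞 F))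
    (hS.toFinset.image f)
  have hd0 : algebraMap (𝓞 F) F d ≠ 0 := by simp
  have hd' : ∀ P : Pl F, ∃ g : 𝓞 F, P ∈ S → algebraMap (𝓞 F) F g = algebraMap (𝓞 F) F d * f P := by
    intro P
    by_cases hP : P ∈ S
    · obtain ⟨g, hg⟩ := hd (f P) (Finset.mem_image_of_mem _ (by simpa using hP))
      exact ⟨g, fun _ => by rw [hg, Algebra.smul_def]⟩
    · exact ⟨0, fun h => absurd h hP⟩
  choose g hg using hd'
  obtain ⟨y, hy⟩ := exists_approx S hS g (n + ∑ P ∈ hS.toFinset, (P (algebraMap (𝓞 F) F d)).toNat)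
  refine ⟨algebraMap (𝓞 F) F y / algebraMap (𝓞 F) F d, fun P hP => ?_⟩
  have h1 := hy P hP
  rw [hg P hP] at h1
  have h2 : algebraMap (𝓞 F) F y / algebraMap (𝓞 F) F d - f P =
      (algebraMap (𝓞 F) F y - algebraMap (𝓞 F) F d * f P) * (algebraMap (𝓞 F) F d)⁻¹ := by
    field_simp
  rw [h2]
  have h3 := P.mul_mem_ge h1 (P.mem_ge_self (algebraMap (𝓞 F) F d)⁻¹)
  refine P.ge_anti ?_ h3
  rw [ord_inv]
  have h4 : (P (algebraMap (𝓞 F) F d)).toNat ≤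
      ∑ P ∈ hS.toFinset, (P (algebraMap (𝓞 F) F d)).toNat :=
    Finset.single_le_sum (f := fun P : Pl F => (P (algebraMap (𝓞 F) F d)).toNat)
      (fun _ _ => Nat.zero_le _) (by simpa using hP)
  push_cast
  have h5 := P.algebraMap_mem_ge d hd0
  zify at h4
  have h6 : ((P (algebraMap (𝓞 F) F d)).toNat : ℤ) = P (algebraMap (𝓞 F) F d) :=
      Int.toNat_of_nonneg h5
  rw [h6] at h4
  linarith

variable {E : Type*} [Field E] [NumberField E] [Algebra E F]

theorem exists_above (v : Pl E) : ∃ (P : Pl F) (e : ℕ), P.Over v e := by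
  obtain ⟨p, rfl⟩ := of_surjective v
  have : Algebra.IsIntegral (𝓞 E) (𝓞 F) := inferInstance
  obtain ⟨Q, hQ, hQ'⟩ := Ideal.exists_ideal_over_prime_of_isIntegral_of_isDomain (S := 𝓞 F)
    p.asIdeal (by
      rw [(RingHom.injective_iff_ker_eq_bot _).1 (FaithfulSMul.algebraMap_injective (𝓞 E) (𝓞 F))]
      exact bot_le)
  have hb : Q ≠ ⊥ := by
    rintro rfl
    apply p.ne_bot
    rw [← hQ']
    exact (RingHom.injective_iff_ker_eq_bot _).1 (FaithfulSMul.algebraMap_injective (𝓞 E) (𝓞 F))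
  set q : HeightOneSpectrum (𝓞 F) := ⟨Q, hQ, hb⟩
  obtain ⟨w, e, h⟩ := (of q).exists_over (E := E)
  obtain ⟨r, rfl⟩ := of_surjective w
  have : p = r := by
    ext1
    apply p.isMaximal.eq_of_le r.isPrime.ne_top
    intro x hx
    rw [← algebraMap_mem_of_ge_one]
    intro h0
    have h1 : algebraMap (𝓞 E) (𝓞 F) x ∈ Q := by rw [← hQ'] at hx; exact hx
    have h2 := (algebraMap_mem_of_ge_one (v := q) (x := algebraMap (𝓞 E) (𝓞 F) x)).2 h1
    rw [← IsScalarTower.algebraMap_apply (𝓞 E) (𝓞 F) F, IsScalarTower.algebraMap_apply (𝓞 E) E F,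
      mem_ge_iff _ (by simpa using h0)] at h2
    exact (h.pos_iff _).1 (by omega)
  subst this
  exact ⟨of q, e, h⟩

end NF

end Pl

end

section

open NumberField IsDedekindDomain WithZero

namespace Pl

theorem exists_normalized_relation {E V ι : Type*} [Field E] [AddCommGroup V] [Module E V]
    [Fintype ι] (v : Pl E) (x : ι → V) (h : ¬ LinearIndependent E x) :
    ∃ (c : ι → E) (i₀ : ι), c i₀ = 1 ∧ (∀ i, c i ∈ v.ge 0) ∧ ∑ i, c i • x i = 0 := by
  classical
  rw [Fintype.not_linearIndependent_iff] at h
  obtain ⟨g, hg, i₁, hi₁⟩ := h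
  obtain ⟨i₀, hi₀, hmin⟩ := Finset.exists_min_image (Finset.univ.filter fun i => g i ≠ 0)
    (fun i => v (g i)) ⟨i₁, by simpa⟩
  simp only [Finset.mem_filter, Finset.mem_univ, true_and] at hi₀ hmin
  refine ⟨fun i => g i / g i₀, i₀, div_self hi₀, fun i h0 => ?_, ?_⟩
  · have h1 : g i ≠ 0 := fun h => h0 (by simp [h])
    rw [ord_div v h1 hi₀]
    have := hmin i h1
    omega
  · have : ∑ i, (g i / g i₀) • x i = (g i₀)⁻¹ • ∑ i, g i • x i := by
      rw [Finset.smul_sum]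
      exact Finset.sum_congr rfl fun i _ => by rw [smul_smul, div_eq_inv_mul]
    rw [this, hg, smul_zero]

variable {E F : Type*} [Field E] [NumberField E] [Field F] [NumberField F] [Algebra E F]

theorem card_over_le (v : Pl E) (S : Finset (Pl F)) (hS : ∀ P ∈ S, ∃ e, P.Over v e) :
    S.card ≤ Module.finrank E F := by
  classical
  have happ : ∀ Q : S, ∃ x : 𝓞 F, ∀ P ∈ S, algebraMap (𝓞 F) F x -
      algebraMap (𝓞 F) F (if P = Q then 1 else 0) ∈ P.ge (1 : ℕ) := fun Q =>
    exists_approx (S : Set (Pl F)) S.finite_toSet (fun P => if P = Q then 1 else 0) 1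
  choose x hx using happ
  have hli : LinearIndependent E fun Q : S => algebraMap (𝓞 F) F (x Q) := by
    by_contra hcon
    obtain ⟨c, Q, hQ, hc, hsum⟩ := exists_normalized_relation v _ hcon
    obtain ⟨e, he⟩ := hS Q Q.2
    rw [← Finset.add_sum_erase _ _ (Finset.mem_univ Q), hQ, one_smul] at hsum
    have h1 : ∑ R ∈ Finset.univ.erase Q, c R • algebraMap (𝓞 F) F (x R) ∈ Q.1.ge 1 := by
      refine AddSubgroup.sum_mem _ fun R hR => ?_
      rw [Algebra.smul_def]
      refine mul_mem_ge_zero _ (by simpa using he.mem_ge (hc R)) ?_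
      have := hx R Q.1 Q.2
      rw [if_neg (fun h => (Finset.ne_of_mem_erase hR) (Subtype.ext h.symm))] at this
      simpa using this
    have h2 := hx Q Q.1 Q.2
    rw [if_pos rfl, map_one] at h2
    have h3 := ord_eq_zero_of_sub_one_mem Q.1 (by simpa using h2)
    exact (ord_add_of_mem Q.1 h3.1 (by rw [h3.2]; simpa using h1)).1 hsum
  simpa using hli.fintype_card_le_finrank

/-- If the number of places over `v` equals the degree then the completions agree. -/
theorem exists_approx_of_card_eq (v : Pl E) (S : Finset (Pl F)) (hS : ∀ P ∈ S, ∃ e, P.Over v e)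
    (hcard : Module.finrank E F ≤ S.card) (P : Pl F) (hP : P ∈ S) (z : F) (hz : z ∈ P.ge 0) :
    ∃ c ∈ v.ge 0, z - algebraMap E F c ∈ P.ge 2 := by
  classical
  have happ : ∀ Q : S, ∃ x : 𝓞 F, ∀ P ∈ S, algebraMap (𝓞 F) F x -
      algebraMap (𝓞 F) F (if P = Q then 1 else 0) ∈ P.ge (2 : ℕ) := fun Q =>
    exists_approx (S : Set (Pl F)) S.finite_toSet (fun P => if P = Q then 1 else 0) 2
  choose x hx using happ
  obtain ⟨y, hy⟩ := exists_approx' (S : Set (Pl F)) S.finite_toSet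
      (fun Q => if Q = P then z else 0) 2
  have hdep : ¬ LinearIndependent E
      fun i : Option S => i.elim y (fun Q => algebraMap (𝓞 F) F (x Q)) := by
    intro h
    have := h.fintype_card_le_finrank
    simp at this
    omega
  obtain ⟨c, i, hi, hc, hsum⟩ := exists_normalized_relation v _ hdep
  rw [Fintype.sum_option] at hsum
  simp only [Option.elim_none, Option.elim_some] at hsum
  have hmul : ∀ (Q : S) (i : Option S) (w : F) (n : ℤ), w ∈ Q.1.ge n → c i • w ∈ Q.1.ge n := by
    intro Q i w n hw
    obtain ⟨e, he⟩ := hS Q Q.2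
    rw [Algebra.smul_def]
    exact mul_mem_ge_zero _ (by simpa using he.mem_ge (hc i)) hw
  -- the relation at each place
  have hrel : ∀ Q : S, c none • y + algebraMap E F (c (some Q)) ∈ Q.1.ge 2 := by
    intro Q
    have h0 := hsum
    rw [← Finset.add_sum_erase _ _ (Finset.mem_univ Q)] at h0
    have h1 : ∑ R ∈ Finset.univ.erase Q, c (some R) • algebraMap (𝓞 F) F (x R) ∈ Q.1.ge 2 := by
      refine AddSubgroup.sum_mem _ fun R hR => hmul Q _ _ _ ?_
      have := hx R Q.1 Q.2
      rw [if_neg (fun h => (Finset.ne_of_mem_erase hR) (Subtype.ext h.symm))] at this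
      simpa using this
    have h2 := hx Q Q.1 Q.2
    rw [if_pos rfl, map_one] at h2
    have h3 := hmul Q (some Q) _ _ h2
    have h4 : c none • y + algebraMap E F (c (some Q)) =
      - (c (some Q) • (algebraMap (𝓞 F) F (x Q) - 1)) -
        ∑ R ∈ Finset.univ.erase Q, c (some R) • algebraMap (𝓞 F) F (x R) := by
      rw [smul_sub, Algebra.smul_def (c (some Q)) (1 : F), mul_one]
      linear_combination h0
    rw [h4]
    exact (Q.1.ge 2).sub_mem ((Q.1.ge 2).neg_mem (by exact_mod_cast h3)) h1
  have hunit : ∀ Q : S, c (some Q) = 1 → algebraMap E F (c (some Q)) ∈ Q.1.ge 1 → False := by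
    intro Q h1 h2
    rw [h1, map_one] at h2
    simp [mem_ge] at h2
  -- the coefficient of `y` is a unit
  have hyP : ∀ Q : S, Q.1 ≠ P → y ∈ Q.1.ge 2 := by
    intro Q h
    have := hy Q.1 Q.2
    rw [if_neg h] at this
    simpa using this
  have hyP' : y - z ∈ P.ge 2 := by
    have := hy P hP
    rw [if_pos rfl] at this
    exact_mod_cast this
  have hy0 : y ∈ P.ge 0 := by
    simpa using (P.ge 0).add_mem (P.ge_anti (by norm_num) hyP') hz
  have hcP : c none ≠ 0 ∧ v (c none) = 0 := by
    by_contra hcon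
    have hc1 : c none ∈ v.ge 1 := by
      intro h0
      have := hc none h0
      have : v (c none) ≠ 0 := fun h => hcon ⟨h0, h⟩
      omega
    have h1 : ∀ Q : S, algebraMap E F (c (some Q)) ∈ Q.1.ge 1 := by
      intro Q
      have hyQ : c none • y ∈ Q.1.ge 1 := by
        by_cases hQ : Q.1 = P
        · rw [Algebra.smul_def, mul_comm]
          obtain ⟨e, he⟩ := hS Q Q.2
          have h4 := he.mem_ge hc1
          refine mul_mem_ge_zero _ (by rw [hQ]; exact hy0) (ge_anti _ ?_ h4)
          have := he.1
          omega
        · exact hmul Q none y 1 (ge_anti _ (by norm_num) (hyP Q hQ))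
      have := (Q.1.ge 1).sub_mem (ge_anti _ (by norm_num) (hrel Q)) hyQ
      simpa using this
    match i, hi with
    | none, hi => rw [hi] at hc1; simp [mem_ge] at hc1
    | some Q, hi => exact hunit Q hi (h1 Q)
  refine ⟨- c (some ⟨P, hP⟩) / c none, ?_, ?_⟩
  · have : - c (some ⟨P, hP⟩) / c none = (c none)⁻¹ * (- c (some ⟨P, hP⟩)) := by
      rw [div_eq_inv_mul]
    rw [this]
    exact v.mul_mem_ge_zero (fun _ => by rw [ord_inv, hcP.2, neg_zero]) ((v.ge 0).neg_mem (hc _))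
  · have h1 := hrel ⟨P, hP⟩
    obtain ⟨e, he⟩ := hS P hP
    have h0 : algebraMap E F (c none) ≠ 0 := by simpa using hcP.1
    have h2 : z - algebraMap E F (- c (some ⟨P, hP⟩) / c none) =
      -(y - z) + (algebraMap E F (c none))⁻¹ *
          (c none • y + algebraMap E F (c (some ⟨P, hP⟩))) := by
      rw [Algebra.smul_def, map_div₀, map_neg]
      field_simp
      ring
    rw [h2]
    refine (P.ge 2).add_mem ((P.ge 2).neg_mem hyP') (P.mul_mem_ge_zero (fun _ => ?_) h1)
    rw [ord_inv, he.2, hcP.2]; simp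

end Pl

end

section

open NumberField IsDedekindDomain WithZero

namespace Pl

section
variable {F : Type*} [Field F]

theorem ord_prime_pos_ne_zero {P : Pl F} {x : F} (h : 0 < P x) : x ≠ 0 := by
  rintro rfl; simp at h

/-- Integers prime to the residue characteristic are units. -/
theorem ord_intCast_of_coprime (P : Pl F) {q : ℕ} (hq : 0 < P (q : F)) {n : ℤ}
    (hn : IsCoprime n q) : (n : F) ≠ 0 ∧ P (n : F) = 0 := by
  obtain ⟨a, b, hab⟩ := hn
  have h1 : (a : F) * n + b * q = 1 := by exact_mod_cast congrArg (Int.cast (R := F)) hab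
  have h0 : (n : F) ∈ P.ge 1 → False := by
    intro h
    have h2 : (1 : F) ∈ P.ge 1 := by
      rw [← h1]
      exact (P.ge 1).add_mem (P.mul_mem_ge_zero (P.intCast_mem_ge a) h)
        (P.mul_mem_ge_zero (P.intCast_mem_ge b) (fun _ => hq))
    simp [mem_ge] at h2
  have hn0 : (n : F) ≠ 0 := fun h => h0 (by rw [h]; exact (P.ge 1).zero_mem)
  refine ⟨hn0, ?_⟩
  by_contra hne
  exact h0 fun _ => by
    have := P.ord_intCast_nonneg n
    omega

end

section Rat

variable {q : ℕ} [hq : Fact q.Prime]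

theorem rat_mem_ge_iff (v : Pl ℚ) (hv : 0 < v (q : ℚ)) (c : ℚ) : c ∈ v.ge 0 ↔ ¬ q ∣ c.den := by
  have hden : ∀ c : ℚ, ¬ q ∣ c.den → c ∈ v.ge 0 := by
    intro c hc
    have h1 : IsCoprime (c.den : ℤ) q :=
      Nat.isCoprime_iff_coprime.2
          ((Nat.coprime_comm.1 ((Nat.Prime.coprime_iff_not_dvd hq.out).2 hc)))
    have h2 := v.ord_intCast_of_coprime hv h1
    rw [← Rat.num_div_den c, div_eq_mul_inv]
    push_cast at h2
    refine v.mul_mem_ge (m := 0) (n := 0) (v.intCast_mem_ge _)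
        (fun _ => by rw [ord_inv, h2.2]; simp)
  refine ⟨fun h hd => ?_, hden c⟩
  have hnum : IsCoprime c.num q := by
    have h3 := c.reduced
    rw [Int.isCoprime_iff_gcd_eq_one]
    exact Nat.Coprime.coprime_dvd_right hd h3
  have h2 := v.ord_intCast_of_coprime hv hnum
  have hc0 : c ≠ 0 := by rintro rfl; simp at h2
  have h4 : v (c.den : ℚ) = - v c := by
    have h6 : (c.den : ℚ) = c.num / c := by
      rw [eq_div_iff hc0, mul_comm, Rat.mul_den_eq_num]
    rw [h6, ord_div _ (by simpa using hc0) hc0, h2.2]; ring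
  have h5 : 0 < v (c.den : ℚ) := by
    obtain ⟨k, hk⟩ := hd
    have hk0 : (k : ℚ) ≠ 0 := by
      intro h; have := c.den_ne_zero; rw [hk] at this; apply this
      have : k = 0 := by exact_mod_cast h
      simp [this]
    rw [hk, Nat.cast_mul, ord_mul _ (ord_prime_pos_ne_zero hv) hk0]
    have := v.ord_natCast_nonneg k
    omega
  have := h hc0
  omega

theorem rat_unique {v w : Pl ℚ} (hv : 0 < v (q : ℚ)) (hw : 0 < w (q : ℚ)) : v = w :=
  eq_of_le fun x hx => by
    rw [rat_mem_ge_iff w hw]; rwa [rat_mem_ge_iff v hv] at hx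

theorem rat_ord_self {v : Pl ℚ} (hv : 0 < v (q : ℚ)) : v (q : ℚ) = 1 := by
  obtain ⟨x, hx0, hx⟩ := v.exists_unif
  have h1 : ¬ q ∣ x.den := (rat_mem_ge_iff v hv x).1 (fun _ => by omega)
  have hq0 : (q : ℚ) ≠ 0 := by exact_mod_cast hq.out.ne_zero
  have hdx : ((x.den : ℤ) : ℚ) ≠ 0 := by simp
  have h7 : (q : ℤ) ∣ x.num := by
    by_contra hnd
    have hco : IsCoprime x.num (q : ℤ) := by
      rw [isCoprime_comm]
      exact (Nat.prime_iff_prime_int.1 hq.out).irreducible.coprime_iff_not_dvd.2 hnd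
    have h2 := v.ord_intCast_of_coprime hv hco
    rw [← Rat.num_div_den x, ord_div _ h2.1 (by simp), h2.2] at hx
    have := v.ord_natCast_nonneg x.den
    omega
  obtain ⟨k, hk⟩ := h7
  have h8 : x / q = Rat.divInt k x.den := by
    rw [Rat.divInt_eq_div]
    conv_lhs => rw [← Rat.num_div_den x, hk]
    push_cast; field_simp
  have h9 : x / q ∈ v.ge 0 := by
    rw [rat_mem_ge_iff v hv, h8]
    intro h
    exact h1 (Int.natCast_dvd_natCast.1 ((Int.natCast_dvd_natCast.2 h).trans (Rat.den_dvd k x.den)))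
  have := h9 (div_ne_zero hx0 hq0)
  rw [ord_div _ hx0 hq0] at this
  omega

theorem rat_approx {v : Pl ℚ} (hv : 0 < v (q : ℚ)) {c : ℚ} (hc : c ∈ v.ge 0) :
    ∃ i : ℤ, c - i ∈ v.ge 2 := by
  rw [rat_mem_ge_iff v hv] at hc
  have hd : IsCoprime (c.den : ℤ) ((q : ℤ) ^ 2) := IsCoprime.pow_right
    (Nat.isCoprime_iff_coprime.2 (Nat.coprime_comm.1 ((Nat.Prime.coprime_iff_not_dvd hq.out).2 hc)))
  obtain ⟨a, b, hab⟩ := hd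
  refine ⟨a * c.num, ?_⟩
  have h1 : (a : ℚ) * c.den + b * q ^ 2 = 1 := by exact_mod_cast congrArg (Int.cast (R := ℚ)) hab
  have h2 : c - ((a * c.num : ℤ) : ℚ) = (b * c) * q ^ 2 := by
    have : (c.num : ℚ) = c * c.den := (Rat.mul_den_eq_num c).symm
    push_cast
    rw [this]
    linear_combination (-c) * h1
  rw [h2]
  refine v.mul_mem_ge_zero ?_ (fun _ => by rw [ord_sq, rat_ord_self hv]; norm_num)
  exact v.mul_mem_ge_zero (v.intCast_mem_ge b) ((rat_mem_ge_iff v hv c).2 hc)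

end Rat

section Split
variable {F : Type*} [Field F] [NumberField F]

/-- The rational prime `q` splits completely in `F`. -/
def SpSplit (q : ℕ) (F : Type*) [Field F] [NumberField F] : Prop :=
  ∃ S : Finset (Pl F), (∀ P ∈ S, 0 < P (q : F)) ∧ Module.finrank ℚ F ≤ S.card

variable {q : ℕ} [hq : Fact q.Prime]

theorem exists_rat_place (P : Pl F) (hP : 0 < P (q : F)) (v : Pl ℚ) (hv : 0 < v (q : ℚ)) :
    ∃ e, P.Over v e := by
  obtain ⟨w, e, he⟩ := P.exists_over (E := ℚ)
  have hw : 0 < w (q : ℚ) := by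
    rw [← he.pos_iff]; simpa using hP
  rw [rat_unique hv hw]
  exact ⟨e, he⟩

theorem card_le_finrank (S : Finset (Pl F)) (hS : ∀ P ∈ S, 0 < P (q : F)) :
    S.card ≤ Module.finrank ℚ F := by
  rcases S.eq_empty_or_nonempty with rfl | ⟨P, hP⟩
  · simp
  obtain ⟨v, e, he⟩ := P.exists_over (E := ℚ)
  have hv : 0 < v (q : ℚ) := by
    rw [← he.pos_iff]; simpa using hS P hP
  exact card_over_le v S fun Q hQ => exists_rat_place Q (hS Q hQ) v hv

theorem SpSplit.approx_two (h : SpSplit q F) {P : Pl F} (hP : 0 < P (q : F)) {z : F}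
    (hz : z ∈ P.ge 0) : ∃ i : ℤ, z - i ∈ P.ge 2 := by
  classical
  obtain ⟨S, hS, hcard⟩ := h
  have hPS : P ∈ S := by
    by_contra hn
    have := card_le_finrank (q := q) (insert P S) (by
      intro Q hQ
      rcases Finset.mem_insert.1 hQ with rfl | hQ
      exacts [hP, hS Q hQ])
    rw [Finset.card_insert_of_notMem hn] at this
    omega
  obtain ⟨v, e, he⟩ := P.exists_over (E := ℚ)
  have hv : 0 < v (q : ℚ) := by
    rw [← he.pos_iff]; simpa using hP
  obtain ⟨c, hc, hzc⟩ := exists_approx_of_card_eq v S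
    (fun Q hQ => exists_rat_place Q (hS Q hQ) v hv) hcard P hPS z hz
  obtain ⟨i, hi⟩ := rat_approx hv hc
  refine ⟨i, ?_⟩
  have h1 := he.mem_ge hi
  have h2 : z - i = (z - algebraMap ℚ F c) + algebraMap ℚ F (c - i) := by
    simp
  rw [h2]
  refine (P.ge 2).add_mem hzc (P.ge_anti ?_ h1)
  have := he.1
  omega

theorem SpSplit.ord_self (h : SpSplit q F) {P : Pl F} (hP : 0 < P (q : F)) : P (q : F) = 1 := by
  obtain ⟨π, hπ0, hπ⟩ := P.exists_unif
  obtain ⟨i, hi⟩ := h.approx_two hP (z := π) (fun _ => by omega)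
  have h1 := P.ord_eq_of_sub_mem (x := π) (y := i) hπ0 (by
    rw [hπ, ← neg_sub]; exact (P.ge 2).neg_mem hi)
  rw [hπ] at h1
  have hd : (q : ℤ) ∣ i := by
    by_contra hnd
    have hco : IsCoprime i (q : ℤ) := by
      rw [isCoprime_comm]
      exact (Nat.prime_iff_prime_int.1 hq.out).irreducible.coprime_iff_not_dvd.2 hnd
    have := P.ord_intCast_of_coprime hP hco
    omega
  obtain ⟨k, rfl⟩ := hd
  push_cast at h1
  have hk : (k : F) ≠ 0 := right_ne_zero_of_mul h1.1
  rw [ord_mul P (left_ne_zero_of_mul h1.1) hk] at h1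
  have := P.ord_intCast_nonneg k
  omega

theorem SpSplit.approx (h : SpSplit q F) {P : Pl F} (hP : 0 < P (q : F)) {z : F}
    (hz : z ∈ P.ge 0) (n : ℕ) : ∃ i : ℤ, z - i ∈ P.ge n := by
  have hq0 : (q : F) ≠ 0 := ord_prime_pos_ne_zero hP
  induction n with
  | zero => exact ⟨0, by simpa using hz⟩
  | succ n ih =>
    obtain ⟨i, hi⟩ := ih
    have h1 : (z - i) * ((q : F) ^ n)⁻¹ ∈ P.ge 0 := by
      have := P.mul_mem_ge hi (P.mem_ge_self ((q : F) ^ n)⁻¹)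
      rwa [ord_inv, ord_pow, h.ord_self hP, mul_one, add_neg_cancel] at this
    obtain ⟨j, hj⟩ := h.approx_two hP h1
    refine ⟨i + j * q ^ n, ?_⟩
    have h2 : z - ((i + j * q ^ n : ℤ) : F) = (z - i) * ((q : F) ^ n)⁻¹ * q ^ n - j * q ^ n := by
      push_cast; field_simp; ring
    rw [h2, ← sub_mul]
    have := P.mul_mem_ge hj (P.mem_ge_self ((q : F) ^ n))
    rw [ord_pow, h.ord_self hP] at this
    exact P.ge_anti (by push_cast; omega) this

theorem SpSplit.of_algebra {E : Type*} [Field E] [NumberField E] [Algebra E F]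
    (h : SpSplit q F) : SpSplit q E := by
  classical
  obtain ⟨S, hS, hcard⟩ := h
  choose below e he using fun P : Pl F => P.exists_over (E := E)
  have := Classical.decEq (Pl E)
  refine ⟨S.image below, ?_, ?_⟩
  · intro v hv
    obtain ⟨P, hP, rfl⟩ := Finset.mem_image.1 hv
    rw [← (he P).pos_iff]
    simpa using hS P hP
  · have h1 : S.card ≤ (S.image below).card * Module.finrank E F := by
      rw [mul_comm]
      refine Finset.card_le_mul_card_image S _ ?_
      intro v _
      refine card_over_le v _ fun P hP => ?_
      obtain ⟨_, rfl⟩ := Finset.mem_filter.1 hP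
      exact ⟨e P, he P⟩
    have h2 : Module.finrank ℚ E * Module.finrank E F = Module.finrank ℚ F :=
      Module.finrank_mul_finrank ℚ E F
    have h3 : 0 < Module.finrank E F := Module.finrank_pos
    rw [← h2] at hcard
    exact Nat.le_of_mul_le_mul_right (hcard.trans h1) h3

end Split

end Pl

end

section

open NumberField IsDedekindDomain WithZero

theorem Subgroup.index_le_of_cover {G ι : Type*} [CommGroup G] [Fintype ι] (H : Subgroup G)
    (r : ι → G) (h : ∀ g, ∃ i, g * r i ∈ H) : H.index ≠ 0 ∧ H.index ≤ Fintype.card ι := by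
  have hs : Function.Surjective fun i => ((r i)⁻¹ : G ⧸ H) := by
    intro x
    induction x using QuotientGroup.induction_on with
    | H g =>
      obtain ⟨i, hi⟩ := h g
      refine ⟨i, ?_⟩
      have h2 := (QuotientGroup.eq_one_iff _).2 hi
      rw [QuotientGroup.mk_mul] at h2
      exact (eq_inv_of_mul_eq_one_left h2).symm
  have : Finite (G ⧸ H) := Finite.of_surjective _ hs
  refine ⟨Subgroup.index_ne_zero_of_finite, ?_⟩
  rw [Subgroup.index, ← Nat.card_eq_fintype_card]
  exact Nat.card_le_card_of_surjective _ hs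

namespace Pl

section
variable {F : Type*} [Field F] (v : Pl F)

/-- The elements that are squares up to a factor congruent to `1` modulo more than `4`. -/
def lsq : Subgroup Fˣ where
  carrier := {x | ∃ c : F, c ≠ 0 ∧ c ^ 2 * x - 1 ∈ v.ge (2 * v 2 + 1)}
  one_mem' := ⟨1, one_ne_zero, by simp⟩
  mul_mem' := by
    rintro x y ⟨c, hc, hx⟩ ⟨d, hd, hy⟩
    refine ⟨c * d, mul_ne_zero hc hd, ?_⟩
    have h2 := v.ord_two_nonneg
    have h1 := v.ord_eq_zero_of_sub_one_mem (v.ge_anti (by omega) hx)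
    have : (c * d) ^ 2 * ((x * y : Fˣ) : F) - 1 =
      (c ^ 2 * x) * (d ^ 2 * y - 1) + (c ^ 2 * x - 1) := by push_cast; ring
    rw [this]
    exact (v.ge _).add_mem (v.mul_mem_ge_zero (fun _ => h1.2.ge) hy) hx
  inv_mem' := by
    rintro x ⟨c, hc, hx⟩
    refine ⟨c⁻¹, inv_ne_zero hc, ?_⟩
    have h2 := v.ord_two_nonneg
    have h1 := v.ord_eq_zero_of_sub_one_mem (v.ge_anti (by omega) hx)
    have : c⁻¹ ^ 2 * ((x⁻¹ : Fˣ) : F) - 1 = (c ^ 2 * x)⁻¹ * (-(c ^ 2 * x - 1)) := by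
      have := x.ne_zero
      push_cast; field_simp; ring
    rw [this]
    exact v.mul_mem_ge_zero (fun _ => by rw [ord_inv, h1.2]; simp) ((v.ge _).neg_mem hx)

theorem sq_mem_lsq (x : Fˣ) : x ^ 2 ∈ v.lsq :=
  ⟨(x : F)⁻¹, inv_ne_zero x.ne_zero, by
    have := x.ne_zero
    push_cast; rw [← mul_pow, inv_mul_cancel₀ this]; simp⟩

theorem mul_sq_mem_lsq {x y : Fˣ} : x * y ^ 2 ∈ v.lsq ↔ x ∈ v.lsq :=
  v.lsq.mul_mem_cancel_right (v.sq_mem_lsq y)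

theorem even_of_mem_lsq {x : Fˣ} (hx : x ∈ v.lsq) : Even (v (x : F)) := by
  obtain ⟨c, hc, h⟩ := hx
  have h2 := v.ord_two_nonneg
  have h1 := v.ord_eq_zero_of_sub_one_mem (v.ge_anti (by omega) h)
  rw [ord_mul _ (pow_ne_zero _ hc) x.ne_zero, ord_sq] at h1
  exact ⟨- v c, by omega⟩

/-- The units of even valuation. -/
def evenVal : Subgroup Fˣ where
  carrier := {x | Even (v (x : F))}
  one_mem' := by simp
  mul_mem' := by
    intro x y hx hy
    simp only [Set.mem_ofPred_eq, Units.val_mul] at *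
    rw [ord_mul _ x.ne_zero y.ne_zero]
    exact hx.add hy
  inv_mem' := by
    intro x hx
    simp only [Set.mem_ofPred_eq, Units.val_inv_eq_inv_val] at *
    rw [ord_inv]; exact hx.neg

theorem mem_evenVal {x : Fˣ} : x ∈ v.evenVal ↔ Even (v (x : F)) := Iff.rfl

theorem lsq_le_evenVal : v.lsq ≤ v.evenVal := fun _ hx => v.even_of_mem_lsq hx

theorem exists_unit_unif : ∃ π : Fˣ, v (π : F) = 1 := by
  obtain ⟨π, h0, h⟩ := v.exists_unif
  exact ⟨Units.mk0 π h0, h⟩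

/-- Multiplying by an even power of a uniformizer. -/
theorem exists_unit_of_even {x : Fˣ} (hx : Even (v (x : F))) :
    ∃ y : Fˣ, v ((x * y ^ 2 : Fˣ) : F) = 0 := by
  obtain ⟨π, hπ⟩ := v.exists_unit_unif
  obtain ⟨k, hk⟩ := hx
  refine ⟨π ^ (-k), ?_⟩
  push_cast
  rw [ord_mul _ x.ne_zero (pow_ne_zero _ (zpow_ne_zero _ π.ne_zero)), ord_sq, ord_zpow, hπ, hk]
  ring

end

section
variable {F : Type*} [Field F] [NumberField F] (v : Pl F)

theorem mul_mem_lsq_of_unit (h2 : v 2 = 0) {x y : Fˣ} (hx : v (x : F) = 0) (hy : v (y : F) = 0)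
    (hxn : x ∉ v.lsq) (hyn : y ∉ v.lsq) : x * y ∈ v.lsq := by
  obtain ⟨w, rfl⟩ := of_surjective v
  have hfin : Finite (𝓞 F ⧸ w.asIdeal) := Ideal.finiteQuotientOfFreeOfNeBot _ w.ne_bot
  have := Fintype.ofFinite (𝓞 F ⧸ w.asIdeal)
  have : w.asIdeal.IsMaximal := w.isMaximal
  let : Field (𝓞 F ⧸ w.asIdeal) := Ideal.Quotient.field _
  have key : ∀ (x : Fˣ) (a : 𝓞 F), of w (x : F) = 0 →
      (x : F) - algebraMap (𝓞 F) F a ∈ (of w).ge 1 →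
      IsSquare (Ideal.Quotient.mk w.asIdeal a) → x ∈ (of w).lsq := by
    rintro x a hx hxa ⟨z, hz⟩
    obtain ⟨z, rfl⟩ := Ideal.Quotient.mk_surjective z
    rw [← map_mul, Ideal.Quotient.eq, ← algebraMap_mem_of_ge_one, map_sub, map_mul] at hz
    have h3 : (x : F) - algebraMap (𝓞 F) F z * algebraMap (𝓞 F) F z ∈ (of w).ge 1 := by
      simpa using ((of w).ge 1).add_mem hxa hz
    have h4 := (of w).ord_eq_of_sub_mem (x := (x : F))
      (y := algebraMap (𝓞 F) F z * algebraMap (𝓞 F) F z) x.ne_zero (by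
        rw [hx, ← neg_sub]; exact ((of w).ge _).neg_mem (by simpa using h3))
    have hz0 := left_ne_zero_of_mul h4.1
    refine ⟨(algebraMap (𝓞 F) F z)⁻¹, inv_ne_zero hz0, ?_⟩
    have h5 : (algebraMap (𝓞 F) F z)⁻¹ ^ 2 * (x : F) - 1 =
        (algebraMap (𝓞 F) F z * algebraMap (𝓞 F) F z)⁻¹ *
          (x - algebraMap (𝓞 F) F z * algebraMap (𝓞 F) F z) := by field_simp
    rw [h5, h2]
    exact mul_mem_ge_zero _ (fun _ => by rw [ord_inv, h4.2, hx]; simp) (by simpa using h3)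
  obtain ⟨a, ha⟩ := exists_int_approx (of w) (z := (x : F)) (fun _ => hx.ge) 1
  obtain ⟨b, hb⟩ := exists_int_approx (of w) (z := (y : F)) (fun _ => hy.ge) 1
  refine key (x * y) (a * b) ?_ ?_ ?_
  · push_cast; rw [ord_mul _ x.ne_zero y.ne_zero, hx, hy]; rfl
  · have : ((x * y : Fˣ) : F) - algebraMap (𝓞 F) F (a * b) =
      x * (y - algebraMap (𝓞 F) F b) + algebraMap (𝓞 F) F b * (x - algebraMap (𝓞 F) F a) := by
      rw [map_mul, Units.val_mul]; ring
    rw [this]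
    exact ((of w).ge 1).add_mem (mul_mem_ge_zero _ (fun _ => hx.ge) (by exact_mod_cast hb))
      (mul_mem_ge_zero _ (algebraMap_mem_ge _ _) (by exact_mod_cast ha))
  · classical
    have h1 : ¬ IsSquare (Ideal.Quotient.mk w.asIdeal a) := fun h =>
      hxn (key x a hx (by exact_mod_cast ha) h)
    have h3 : ¬ IsSquare (Ideal.Quotient.mk w.asIdeal b) := fun h =>
      hyn (key y b hy (by exact_mod_cast hb) h)
    have hch : ringChar (𝓞 F ⧸ w.asIdeal) ≠ 2 := by
      intro h
      exact h1 (FiniteField.isSquare_of_char_two h _)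
    have h1' := (quadraticChar_neg_one_iff_not_isSquare).2 h1
    have h3' := (quadraticChar_neg_one_iff_not_isSquare).2 h3
    have hne : (Ideal.Quotient.mk w.asIdeal (a * b)) ≠ 0 := by
      rw [map_mul]
      refine mul_ne_zero ?_ ?_ <;> rintro h
      · exact h1 (by rw [h]; exact IsSquare.zero)
      · exact h3 (by rw [h]; exact IsSquare.zero)
    rw [← quadraticChar_one_iff_isSquare hne, map_mul, map_mul, h1', h3']; norm_num

theorem mul_mem_lsq_of_even (h2 : v 2 = 0) {x y : Fˣ} (hx : Even (v (x : F)))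
    (hy : Even (v (y : F))) (hxn : x ∉ v.lsq) (hyn : y ∉ v.lsq) : x * y ∈ v.lsq := by
  obtain ⟨c, hc⟩ := v.exists_unit_of_even hx
  obtain ⟨d, hd⟩ := v.exists_unit_of_even hy
  have := v.mul_mem_lsq_of_unit h2 hc hd (by rwa [mul_sq_mem_lsq]) (by rwa [mul_sq_mem_lsq])
  rwa [show x * c ^ 2 * (y * d ^ 2) = (x * y) * (c * d) ^ 2 by rw [mul_pow, mul_mul_mul_comm],
    mul_sq_mem_lsq] at this

theorem index_lsq_le_four (h2 : v 2 = 0) : v.lsq.index ≠ 0 ∧ v.lsq.index ≤ 4 := by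
  obtain ⟨π, hπ⟩ := v.exists_unit_unif
  have hsplit : ∀ g : Fˣ, Even (v (g : F)) ∨ Even (v ((g * π : Fˣ) : F)) := by
    intro g
    push_cast
    rw [ord_mul _ g.ne_zero π.ne_zero, hπ]
    rcases Int.even_or_odd (v (g : F)) with h | h
    · exact .inl h
    · exact .inr (h.add_odd odd_one)
  by_cases hu : ∃ u : Fˣ, Even (v (u : F)) ∧ u ∉ v.lsq
  · obtain ⟨u, hu, hun⟩ := hu
    have := v.lsq.index_le_of_cover (ι := Fin 2 × Fin 2) (fun i => u ^ i.1.1 * π ^ i.2.1) (by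
      intro g
      obtain ⟨j, hj⟩ : ∃ j : Fin 2, Even (v ((g * π ^ j.1 : Fˣ) : F)) := by
        rcases hsplit g with h | h
        · exact ⟨0, by simpa using h⟩
        · exact ⟨1, by simpa using h⟩
      by_cases h : g * π ^ j.1 ∈ v.lsq
      · exact ⟨(0, j), by simpa using h⟩
      · refine ⟨(1, j), ?_⟩
        have := v.mul_mem_lsq_of_even h2 hj hu h hun
        simpa [mul_comm, mul_left_comm, mul_assoc] using this)
    simpa using this
  · push Not at hu
    have := v.lsq.index_le_of_cover (ι := Fin 2) (fun i => π ^ i.1) (by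
      intro g
      rcases hsplit g with h | h
      · exact ⟨0, by simpa using hu g h⟩
      · exact ⟨1, by simpa using hu _ h⟩)
    exact ⟨this.1, this.2.trans (by simp)⟩

theorem index_lsq_le_eight (h : SpSplit 2 F) (h2 : 0 < v 2) :
    v.lsq.index ≠ 0 ∧ v.lsq.index ≤ 8 := by
  have hv2 : v 2 = 1 := by exact_mod_cast h.ord_self (P := v) (by exact_mod_cast h2)
  have h20 : (2 : F) ≠ 0 := two_ne_zero
  have hoddF : ∀ n : ℤ, Odd n → (n : F) ≠ 0 ∧ v (n : F) = 0 := by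
    intro n hn
    refine v.ord_intCast_of_coprime (q := 2) (by exact_mod_cast h2) ?_
    rw [isCoprime_comm]
    exact (Int.prime_two).irreducible.coprime_iff_not_dvd.2 (by
      rw [← even_iff_two_dvd]; exact Int.not_even_iff_odd.2 hn)
  have hodd0 : ∀ i : Fin 4, ((2 * i.1 + 1 : ℤ) : F) ≠ 0 := fun i => (hoddF _ ⟨i.1, rfl⟩).1
  have := v.lsq.index_le_of_cover (ι := Fin 2 × Fin 4) (fun i =>
      (Units.mk0 (2 : F) h20) ^ i.1.1 * (Units.mk0 ((2 * i.2.1 + 1 : ℤ) : F) (hodd0 i.2))) (by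
    intro g
    obtain ⟨j, hj⟩ : ∃ j : Fin 2, Even (v ((g * (Units.mk0 (2 : F) h20) ^ j.1 : Fˣ) : F)) := by
      rcases Int.even_or_odd (v (g : F)) with h | h
      · exact ⟨0, by simpa using h⟩
      · refine ⟨1, ?_⟩
        simp only [Fin.val_one, pow_one, Units.val_mul, Units.val_mk0]
        rw [ord_mul _ g.ne_zero h20, hv2]
        exact h.add_odd odd_one
    obtain ⟨y, hy⟩ := v.exists_unit_of_even hj
    set g' := g * (Units.mk0 (2 : F) h20) ^ j.1 with hg'
    obtain ⟨n, hn⟩ := h.approx (P := v) (by exact_mod_cast h2)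
      (z := (((g' * y ^ 2)⁻¹ : Fˣ) : F)) (fun _ => by
        rw [Units.val_inv_eq_inv_val, ord_inv, hy]; simp) 3
    have hnodd : Odd n := by
      rw [← Int.not_even_iff_odd]
      rintro ⟨k, rfl⟩
      have h3 := v.ord_eq_of_sub_mem (x := (((g' * y ^ 2)⁻¹ : Fˣ) : F)) (y := ((k + k : ℤ) : F))
        (Units.ne_zero _) (by
          rw [← neg_sub]
          refine (v.ge _).neg_mem (v.ge_anti ?_ hn)
          rw [Units.val_inv_eq_inv_val, ord_inv, hy]; norm_num)
      have h4 := h3.2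
      rw [Units.val_inv_eq_inv_val, ord_inv, hy] at h4
      have h5 : ((k + k : ℤ) : F) = 2 * k := by push_cast; ring
      rw [h5] at h4 h3
      rw [ord_mul _ h20 (right_ne_zero_of_mul h3.1)] at h4
      have := v.ord_intCast_nonneg k
      omega
    obtain ⟨m, rfl⟩ := hnodd
    refine ⟨(j, ⟨(m % 4).toNat, by omega⟩), ?_⟩
    rw [← mul_assoc, ← hg', ← mul_sq_mem_lsq v (y := y)]
    refine ⟨1, one_ne_zero, ?_⟩
    have hcast : ((2 * ((m % 4).toNat : ℤ) + 1 : ℤ) : F) =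
        ((2 * m + 1 : ℤ) : F) - 2 ^ 3 * ((m / 4 : ℤ) : F) := by
      have : (2 * ((m % 4).toNat : ℤ) + 1 : ℤ) = 2 * m + 1 - 2 ^ 3 * (m / 4) := by omega
      rw [this]; push_cast; ring
    clear_value g'
    have hgy0 := (g' * y ^ 2).ne_zero
    have h6 : 1 ^ 2 * ((g' * Units.mk0 ((2 * ((m % 4).toNat : ℤ) + 1 : ℤ) : F)
          (hodd0 ⟨(m % 4).toNat, by omega⟩) * y ^ 2 : Fˣ) : F) - 1 =
        ((g' * y ^ 2 : Fˣ) : F) * (-((((g' * y ^ 2)⁻¹ : Fˣ) : F) - ((2 * m + 1 : ℤ) : F))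
          - 2 ^ 3 * ((m / 4 : ℤ) : F)) := by
      rw [Units.val_inv_eq_inv_val, mul_sub, mul_neg, mul_sub, mul_inv_cancel₀ hgy0]
      rw [Units.val_mul, Units.val_mul, Units.val_mk0, hcast, Units.val_mul g' (y ^ 2)]
      ring
    have h7 : ((2 : F) ^ 3) * ((m / 4 : ℤ) : F) ∈ v.ge 3 := by
      rw [mul_comm]
      exact v.mul_mem_ge_zero (v.intCast_mem_ge _) (fun _ => by rw [ord_pow, hv2]; norm_num)
    rw [h6, hv2]
    exact v.mul_mem_ge_zero (fun _ => hy.ge) ((v.ge _).sub_mem ((v.ge _).neg_mem hn) h7))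
  simpa using this

end

end Pl

end

section

open NumberField IsDedekindDomain WithZero Polynomial

/-- `E` is obtained from `F` by adjoining a square root `s` of the nonsquare `e`. -/
structure IsQuad {F E : Type*} [Field F] [Field E] [Algebra F E] (e : F) (s : E) : Prop where
  nonsq : ¬ IsSquare e
  sq : s ^ 2 = algebraMap F E e
  span : ∀ y, ∃ a b, y = algebraMap F E a + algebraMap F E b * s

namespace IsQuad

variable {F E : Type*} [Field F] [Field E] [Algebra F E] {e : F} {s : E}

theorem ne_zero (h : IsQuad e s) : e ≠ 0 := by
  rintro rfl; exact h.nonsq IsSquare.zero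

theorem root_ne_zero (h : IsQuad e s) : s ≠ 0 := by
  rintro rfl
  have := h.sq
  rw [zero_pow two_ne_zero, eq_comm, map_eq_zero] at this
  exact h.ne_zero this

theorem unique (h : IsQuad e s) {a b a' b' : F}
    (hab : algebraMap F E a + algebraMap F E b * s = algebraMap F E a' + algebraMap F E b' * s) :
    a = a' ∧ b = b' := by
  have hb : b = b' := by
    by_contra hb
    apply h.nonsq
    refine ⟨(a' - a) / (b - b'), (algebraMap F E).injective ?_⟩
    have hb' : algebraMap F E b - algebraMap F E b' ≠ 0 := by
      rwa [← map_sub, ne_eq, map_eq_zero, sub_eq_zero]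
    have h1 : s = algebraMap F E ((a' - a) / (b - b')) := by
      rw [map_div₀, map_sub, map_sub, eq_div_iff hb']
      linear_combination hab
    rw [← h.sq, h1, map_mul]; ring
  subst hb
  exact ⟨(algebraMap F E).injective (by linear_combination hab), rfl⟩

/-- The coordinates in the basis `1, s`. -/
noncomputable def re (h : IsQuad e s) (y : E) : F := (h.span y).choose
/-- The coordinates in the basis `1, s`. -/
noncomputable def im (h : IsQuad e s) (y : E) : F := (h.span y).choose_spec.choose

theorem eq_re_im (h : IsQuad e s) (y : E) :
    y = algebraMap F E (h.re y) + algebraMap F E (h.im y) * s :=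
  (h.span y).choose_spec.choose_spec

theorem re_im_of_eq (h : IsQuad e s) {y : E} {a b : F}
    (hy : y = algebraMap F E a + algebraMap F E b * s) : h.re y = a ∧ h.im y = b :=
  h.unique (by rw [← hy, ← eq_re_im])

/-- The nontrivial automorphism, as an algebra homomorphism. -/
noncomputable def conjHom (h : IsQuad e s) : E →ₐ[F] E where
  toFun y := algebraMap F E (h.re y) - algebraMap F E (h.im y) * s
  map_one' := by
    obtain ⟨h1, h2⟩ := h.re_im_of_eq (y := 1) (a := 1) (b := 0) (by simp)
    rw [h1, h2]; simp
  map_zero' := by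
    obtain ⟨h1, h2⟩ := h.re_im_of_eq (y := 0) (a := 0) (b := 0) (by simp)
    rw [h1, h2]; simp
  commutes' r := by
    obtain ⟨h1, h2⟩ := h.re_im_of_eq (y := algebraMap F E r) (a := r) (b := 0) (by simp)
    rw [h1, h2]; simp
  map_add' x y := by
    obtain ⟨h1, h2⟩ := h.re_im_of_eq (y := x + y) (a := h.re x + h.re y) (b := h.im x + h.im y) (by
      conv_lhs => rw [h.eq_re_im x, h.eq_re_im y]
      rw [map_add, map_add]; ring)
    rw [h1, h2, map_add, map_add]; ring
  map_mul' x y := by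
    obtain ⟨h1, h2⟩ := h.re_im_of_eq (y := x * y) (a := h.re x * h.re y + e * (h.im x * h.im y))
      (b := h.re x * h.im y + h.im x * h.re y) (by
      conv_lhs => rw [h.eq_re_im x, h.eq_re_im y]
      simp only [map_add, map_mul]; rw [← h.sq]; ring)
    rw [h1, h2]
    simp only [map_add, map_mul]; rw [← h.sq]; ring

/-- The nontrivial automorphism. -/
noncomputable def conj (h : IsQuad e s) : E ≃ₐ[F] E :=
  AlgEquiv.ofAlgHom h.conjHom h.conjHom (by
    ext y
    obtain ⟨h1, h2⟩ := h.re_im_of_eq (y := h.conjHom y) (a := h.re y) (b := - h.im y) (by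
      change algebraMap F E (h.re y) - algebraMap F E (h.im y) * s = _
      rw [map_neg]; ring)
    change algebraMap F E (h.re (h.conjHom y)) - algebraMap F E (h.im (h.conjHom y)) * s = y
    rw [h1, h2, map_neg, neg_mul, sub_neg_eq_add, ← h.eq_re_im]) (by
    ext y
    obtain ⟨h1, h2⟩ := h.re_im_of_eq (y := h.conjHom y) (a := h.re y) (b := - h.im y) (by
      change algebraMap F E (h.re y) - algebraMap F E (h.im y) * s = _
      rw [map_neg]; ring)
    change algebraMap F E (h.re (h.conjHom y)) - algebraMap F E (h.im (h.conjHom y)) * s = y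
    rw [h1, h2, map_neg, neg_mul, sub_neg_eq_add, ← h.eq_re_im])

theorem conj_apply (h : IsQuad e s) (y : E) :
    h.conj y = algebraMap F E (h.re y) - algebraMap F E (h.im y) * s := rfl

@[simp] theorem conj_root (h : IsQuad e s) : h.conj s = - s := by
  obtain ⟨h1, h2⟩ := h.re_im_of_eq (y := s) (a := 0) (b := 1) (by simp)
  rw [conj_apply, h1, h2]; simp

@[simp] theorem conj_conj (h : IsQuad e s) (y : E) : h.conj (h.conj y) = y := by
  conv_rhs => rw [h.eq_re_im y]
  rw [conj_apply h y]
  simp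

theorem mul_conj (h : IsQuad e s) (y : E) :
    y * h.conj y = algebraMap F E (h.re y ^ 2 - e * h.im y ^ 2) := by
  rw [conj_apply]
  nth_rw 1 [h.eq_re_im y]
  simp only [map_sub, map_pow, map_mul]; rw [← h.sq]; ring

theorem norm_mk (h : IsQuad e s) (a b : F) :
    (algebraMap F E a + algebraMap F E b * s) * h.conj (algebraMap F E a + algebraMap F E b * s) =
      algebraMap F E (a ^ 2 - e * b ^ 2) := by
  obtain ⟨h1, h2⟩ := h.re_im_of_eq (y := algebraMap F E a + algebraMap F E b * s) rfl
  rw [mul_conj, h1, h2]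

theorem exists_of_conj_eq [CharZero E] (h : IsQuad e s) {y : E} (hy : h.conj y = y) :
    ∃ a, algebraMap F E a = y := by
  rw [conj_apply] at hy
  have h1 := h.eq_re_im y
  refine ⟨h.re y, ?_⟩
  have : 2 * algebraMap F E (h.re y) = 2 * y := by linear_combination -h1 + hy
  exact mul_left_cancel₀ two_ne_zero this

theorem exists_of_conj_eq_neg [CharZero E] (h : IsQuad e s) {y : E} (hy : h.conj y = - y) :
    ∃ a, algebraMap F E a * s = y := by
  rw [conj_apply] at hy
  have h1 := h.eq_re_im y
  refine ⟨h.im y, ?_⟩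
  have : 2 * (algebraMap F E (h.im y) * s) = 2 * y := by linear_combination -h1 - hy
  exact mul_left_cancel₀ two_ne_zero this

theorem finrank_eq (h : IsQuad e s) : Module.finrank F E = 2 := by
  have hli : LinearIndependent F ![(1 : E), s] := by
    rw [LinearIndependent.pair_iff]
    intro a b hab
    rw [Algebra.smul_def, Algebra.smul_def, mul_one] at hab
    exact h.unique (a' := 0) (b' := 0) (by simpa using hab)
  have hsp : ⊤ ≤ Submodule.span F (Set.range ![(1 : E), s]) := by
    intro y _
    obtain ⟨a, b, hy⟩ := h.span y
    rw [Matrix.range_cons, Matrix.range_cons, Matrix.range_empty, Set.union_empty,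
      Set.singleton_union, Submodule.mem_span_pair]
    exact ⟨a, b, by rw [hy, Algebra.smul_def, Algebra.smul_def, mul_one]⟩
  simpa using Module.finrank_eq_card_basis (Module.Basis.mk hli hsp)

theorem finite (h : IsQuad e s) : FiniteDimensional F E :=
  Module.finite_of_finrank_pos (by rw [h.finrank_eq]; norm_num)

end IsQuad

universe u in
theorem exists_isQuad {F : Type u} [Field F] [NumberField F] {e : F} (he : ¬ IsSquare e) :
    ∃ (E : Type u) (_ : Field E) (_ : NumberField E) (_ : Algebra F E) (s : E),
      IsQuad e s := by
  have hirr : Irreducible (X ^ 2 - C e : F[X]) := by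
    refine X_pow_sub_C_irreducible_of_prime Nat.prime_two fun b hb => he ⟨b, ?_⟩
    rw [← hb, sq]
  have := Fact.mk hirr
  have hm : (X ^ 2 - C e : F[X]).Monic := monic_X_pow_sub_C e two_ne_zero
  have hq : IsQuad e (AdjoinRoot.root (X ^ 2 - C e : F[X])) := by
    refine ⟨he, ?_, fun y => ?_⟩
    · have := AdjoinRoot.eval₂_root (X ^ 2 - C e : F[X])
      rw [eval₂_sub, eval₂_pow, eval₂_X, eval₂_C, sub_eq_zero] at this
      exact this
    · obtain ⟨p, rfl⟩ := AdjoinRoot.mk_surjective y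
      have h1 : AdjoinRoot.mk (X ^ 2 - C e) p =
          AdjoinRoot.mk (X ^ 2 - C e) (p %ₘ (X ^ 2 - C e)) := by
        conv_lhs => rw [← modByMonic_add_div p (X ^ 2 - C e)]
        rw [map_add, map_mul, AdjoinRoot.mk_self, zero_mul, add_zero]
      have h2 : (p %ₘ (X ^ 2 - C e)).degree ≤ 1 := by
        have h3 := degree_modByMonic_lt p hm
        rw [degree_X_pow_sub_C two_pos] at h3
        exact Order.le_of_lt_succ h3
      refine ⟨(p %ₘ (X ^ 2 - C e)).coeff 0, (p %ₘ (X ^ 2 - C e)).coeff 1, ?_⟩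
      rw [h1, eq_X_add_C_of_degree_le_one h2]
      simp only [map_add, map_mul, AdjoinRoot.mk_C, AdjoinRoot.mk_X, coeff_add, coeff_C_mul,
        coeff_X_zero, coeff_X_one, coeff_C_zero, mul_zero, mul_one, zero_add, coeff_C_succ,
        add_zero, AdjoinRoot.algebraMap_eq]
      ring
  have := hq.finite
  have hc : CharZero (AdjoinRoot (X ^ 2 - C e : F[X])) :=
    charZero_of_injective_algebraMap (algebraMap F _).injective
  let : Algebra ℚ (AdjoinRoot (X ^ 2 - C e : F[X])) := DivisionRing.toRatAlgebra
  have : IsScalarTower ℚ F (AdjoinRoot (X ^ 2 - C e : F[X])) :=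
      IsScalarTower.of_algebraMap_eq' (Subsingleton.elim _ _)
  have hf : FiniteDimensional ℚ (AdjoinRoot (X ^ 2 - C e : F[X])) :=
    Module.Finite.trans F _
  exact ⟨_, _, { to_charZero := hc, to_finiteDimensional := hf }, _, _, hq⟩

/-- Positivity at all real embeddings. -/
def TotPos {F : Type*} [Field F] (e : F) : Prop := ∀ φ : F →+* ℝ, 0 < φ e

theorem IsQuad.isTotallyReal {F E : Type*} [Field F] [Field E] [Algebra F E] {e : F} {s : E}
    [NumberField F] [NumberField E] [hF : IsTotallyReal F] (h : IsQuad e s) (hpos : TotPos e) :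
    IsTotallyReal E := by
  refine ⟨fun w => ?_⟩
  rw [← InfinitePlace.mk_embedding w, InfinitePlace.isReal_mk_iff]
  set φ := w.embedding
  have hψ : ComplexEmbedding.IsReal (φ.comp (algebraMap F E)) :=
    IsTotallyReal.complexEmbedding_isReal _
  have hre : ∀ x : F, φ (algebraMap F E x) = (hψ.embedding x : ℂ) := fun x =>
    (ComplexEmbedding.IsReal.coe_embedding_apply hψ x).symm
  have hs : (φ s) ^ 2 = ((hψ.embedding e : ℝ) : ℂ) := by rw [← map_pow, h.sq, hre]
  have hpe := hpos hψ.embedding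
  obtain ⟨t, ht⟩ : ∃ t : ℝ, φ s = t := by
    have h2 : (φ s - (Real.sqrt (hψ.embedding e) : ℂ)) *
        (φ s + (Real.sqrt (hψ.embedding e) : ℂ)) = 0 := by
      have : ((Real.sqrt (hψ.embedding e) : ℝ) : ℂ) ^ 2 = ((hψ.embedding e : ℝ) : ℂ) := by
        rw [← Complex.ofReal_pow, Real.sq_sqrt hpe.le]
      linear_combination hs - this
    rcases mul_eq_zero.1 h2 with h2 | h2
    · exact ⟨_, sub_eq_zero.1 h2⟩
    · exact ⟨- Real.sqrt (hψ.embedding e), by push_cast; exact eq_neg_of_add_eq_zero_left h2⟩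
  rw [ComplexEmbedding.isReal_iff]
  ext y
  rw [ComplexEmbedding.conjugate_coe_eq, h.eq_re_im y, map_add, map_mul, hre (h.re y),
      hre (h.im y), ht]
  simp only [map_add, map_mul, Complex.conj_ofReal]

namespace IsQuad
variable {F E : Type*} [Field F] [Field E] [Algebra F E] {e : F} {s : E}

theorem over_comap (h : IsQuad e s) {P : Pl E} {v : Pl F} {k : ℕ} (hP : P.Over v k) :
    (P.comap (h.conj : E ≃+* E)).Over v k :=
  ⟨hP.1, fun x => by rw [← hP.2, Pl.comap_apply]; congr 1; exact h.conj.commutes x⟩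

theorem comap_comap (h : IsQuad e s) (P : Pl E) :
    (P.comap (h.conj : E ≃+* E)).comap (h.conj : E ≃+* E) = P := by
  ext x; simp

theorem comap_ne_of_mem_lsq [CharZero E] (h : IsQuad e s) {P : Pl E} {v : Pl F} {k : ℕ}
    (hP : P.Over v k) {u : Fˣ} (hu : (u : F) = e) (hl : u ∈ v.lsq) :
    P.comap (h.conj : E ≃+* E) ≠ P := by
  intro hcon
  obtain ⟨c, hc, hce⟩ := hl
  rw [hu] at hce
  have hv2 := v.ord_two_nonneg
  have hce' := hP.mem_ge hce
  set w := algebraMap F E c * s with hw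
  have hw2 : algebraMap F E (c ^ 2 * e - 1) = (w - 1) * (w + 1) := by
    rw [map_sub, map_mul, ← h.sq, hw, map_pow, map_one]; ring
  have hσw : h.conj w = - w := by rw [hw, map_mul, h.conj.commutes, conj_root]; ring
  have h2k : P (2 : E) = k * v 2 := by rw [← hP.2, map_ofNat]
  have h20 : (2 : E) ≠ 0 := two_ne_zero
  have hk := hP.1
  have hord : P (w - 1) = P (w + 1) := by
    conv_lhs => rw [← hcon]
    rw [Pl.comap_apply]
    have : (h.conj : E ≃+* E) (w - 1) = - (w + 1) := by
      change h.conj (w - 1) = _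
      rw [map_sub, hσw, map_one]; ring
    rw [this, Pl.ord_neg]
  have hne : ∀ t : E, t = 1 ∨ t = -1 → w ≠ t := by
    rintro t ht hwt
    have h1 : h.conj w = w := by
      rcases ht with rfl | rfl <;> rw [hwt] <;> simp
    have : (2 : E) * w = 0 := by linear_combination h1.symm.trans hσw
    rcases mul_eq_zero.1 this with h3 | h3
    · exact h20 h3
    · rw [h3] at hwt; rcases ht with rfl | rfl <;> simp at hwt
  have h1 : w - 1 ≠ 0 := sub_ne_zero.2 (hne 1 (.inl rfl))
  have h1' : w + 1 ≠ 0 := by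
    intro h3; exact hne (-1) (.inr rfl) (eq_neg_of_add_eq_zero_left h3)
  rw [hw2, Pl.mem_ge_iff _ (mul_ne_zero h1 h1'), Pl.ord_mul _ h1 h1', hord] at hce'
  have h3 : (k : ℤ) * v 2 + 1 ≤ P (w + 1) := by
    have : (1:ℤ) ≤ k := by exact_mod_cast hk
    nlinarith
  have h4 : (2 : E) ∈ P.ge (k * v 2 + 1) := by
    have := (P.ge (k * v 2 + 1)).sub_mem (x := w + 1) (y := w - 1) (fun _ => h3)
      (fun _ => by omega)
    have h5 : w + 1 - (w - 1) = 2 := by ring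
    rwa [h5] at this
  rw [Pl.mem_ge_iff _ h20] at h4
  omega

end IsQuad

end

section

open Filter Topology

/-- A multiplicative family of positive density cannot have its square embedded in a family of
positive density. -/
theorem false_of_prod_embedding {α β : Type*} (N : α → ℕ) (N' : β → ℕ) (hN : ∀ a, 0 < N a)
    (hfin : ∀ X : ℝ, {a | (N a : ℝ) ≤ X}.Finite) (hfin' : ∀ X : ℝ, {b | (N' b : ℝ) ≤ X}.Finite)
    {κ κ' : ℝ} (hκ : 0 < κ)
    (h : Tendsto (fun X : ℝ => (Nat.card {a // (N a : ℝ) ≤ X} : ℝ) / X) atTop (𝓝 κ))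
    (h' : Tendsto (fun X : ℝ => (Nat.card {b // (N' b : ℝ) ≤ X} : ℝ) / X) atTop (𝓝 κ'))
    (Φ : α → α → β) (hΦ : ∀ a b c d, Φ a b = Φ c d → a = c ∧ b = d)
    (hNΦ : ∀ a b, N' (Φ a b) = N a * N b) : False := by
  have hN' : ∀ a, (0 : ℝ) < N a := fun a => by exact_mod_cast hN a
  have hcount : ∀ (J : Finset α) (X : ℝ), ∑ j ∈ J, (Nat.card {a // (N a : ℝ) ≤ X / N j} : ℝ) ≤
      Nat.card {b // (N' b : ℝ) ≤ X} := by
    intro J X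
    have hf : ∀ X, Finite {a // (N a : ℝ) ≤ X} := fun X => hfin X
    have hf' : Finite {b // (N' b : ℝ) ≤ X} := hfin' X
    have : ∑ j ∈ J, Nat.card {a // (N a : ℝ) ≤ X / N j} =
        Nat.card (Σ j : J, {a // (N a : ℝ) ≤ X / N j.1}) := by
      rw [Nat.card_sigma, ← Finset.sum_coe_sort J fun j => Nat.card {a // (N a : ℝ) ≤ X / N j}]
    rw [← Nat.cast_sum, this, Nat.cast_le]
    refine Nat.card_le_card_of_injective (fun x => ⟨Φ x.2.1 x.1.1, ?_⟩) ?_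
    · rw [hNΦ]; push_cast
      exact (le_div_iff₀ (hN' _)).1 x.2.2
    · rintro ⟨⟨j, hj⟩, ⟨a, ha⟩⟩ ⟨⟨k, hk⟩, ⟨b, hb⟩⟩ hab
      obtain ⟨rfl, rfl⟩ := hΦ _ _ _ _ (Subtype.ext_iff.1 hab)
      rfl
  have hbound : ∀ J : Finset α, ∑ j ∈ J, (1 : ℝ) / N j ≤ κ' / κ := by
    intro J
    have h1 : Tendsto (fun X : ℝ => ∑ j ∈ J, (Nat.card {a // (N a : ℝ) ≤ X / N j} : ℝ) / X) atTop
        (𝓝 (∑ j ∈ J, κ * (1 / N j))) := by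
      refine tendsto_finsetSum _ fun j _ => ?_
      have h2 : Tendsto (fun X : ℝ => X / N j) atTop atTop :=
        tendsto_id.atTop_div_const (hN' j)
      refine ((h.comp h2).mul_const (1 / (N j : ℝ))).congr fun X => ?_
      have := (hN' j).ne'
      simp only [Function.comp]
      generalize (Nat.card {a // (N a : ℝ) ≤ X / N j} : ℝ) = t
      rcases eq_or_ne X 0 with rfl | hX
      · simp
      · field_simp
    have h3 := le_of_tendsto_of_tendsto h1 h' (by
      filter_upwards [eventually_gt_atTop 0] with X hX
      rw [← Finset.sum_div]
      exact div_le_div_of_nonneg_right (hcount J X) hX.le)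
    rw [← Finset.mul_sum] at h3
    rw [le_div_iff₀ hκ, mul_comm]; exact h3
  have hsum : Summable fun a => (1 : ℝ) / N a :=
    summable_of_sum_le (fun a => by positivity) hbound
  obtain ⟨s, hs⟩ := hsum.vanishing (Metric.ball_mem_nhds (0 : ℝ) (half_pos hκ))
  have hle : κ ≤ κ / 2 := by
    have hlim : Tendsto (fun X : ℝ => κ / 2 + (s.card : ℝ) / X) atTop (𝓝 (κ / 2 + 0)) :=
      tendsto_const_nhds.add (tendsto_const_nhds.div_atTop tendsto_id)
    rw [add_zero] at hlim
    refine le_of_tendsto_of_tendsto h hlim ?_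
    filter_upwards [eventually_gt_atTop 0] with X hX
    classical
    set T := (hfin X).toFinset with hT
    have h1 : (Nat.card {a // (N a : ℝ) ≤ X} : ℝ) ≤ (T \ s).card + s.card := by
      have : Nat.card {a // (N a : ℝ) ≤ X} = T.card := by
        rw [hT, ← Set.ncard_eq_toFinset_card _ (hfin X)]; rfl
      rw [this]
      exact_mod_cast Finset.card_le_card_sdiff_add_card
    have h2 : ((T \ s).card : ℝ) / X ≤ κ / 2 := by
      have h3 := hs (T \ s) Finset.sdiff_disjoint
      rw [Metric.mem_ball, dist_zero_right] at h3
      have h4 := (le_abs_self _).trans h3.le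
      refine le_trans ?_ h4
      rw [div_eq_mul_one_div, ← nsmul_eq_mul]
      refine Finset.card_nsmul_le_sum _ _ _ fun a ha => ?_
      have : (N a : ℝ) ≤ X := by
        have := (Finset.mem_sdiff.1 ha).1
        rw [hT] at this; simpa using this
      exact one_div_le_one_div_of_le (hN' a) this
    calc _ ≤ (((T \ s).card : ℝ) + s.card) / X := div_le_div_of_nonneg_right h1 hX.le
      _ ≤ _ := by rw [add_div]; linarith
  linarith

end

section

open Filter Topology NumberField IsDedekindDomain nonZeroDivisors

namespace Pl

variable (F : Type*) [Field F] [NumberField F]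

/-- Nonzero ideals prime to a finite set of primes. -/
abbrev PrimeTo (T : Finset (HeightOneSpectrum (𝓞 F))) : Type _ :=
  {I : Ideal (𝓞 F) // I ≠ 0 ∧ ∀ w ∈ T, ¬ w.asIdeal ∣ I}

variable {F}

theorem finite_absNorm_le (T : Finset (HeightOneSpectrum (𝓞 F))) (X : ℝ) :
    {I : PrimeTo F T | (Ideal.absNorm I.1 : ℝ) ≤ X}.Finite := by
  refine Set.Finite.of_finite_image (f := Subtype.val)
    ((Ideal.finite_setOfPred_absNorm_le (S := 𝓞 F) ⌊X⌋₊).subset ?_) Subtype.val_injective.injOn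
  rintro _ ⟨I, hI, rfl⟩
  exact Nat.le_floor hI

theorem absNorm_asIdeal_ge (w : HeightOneSpectrum (𝓞 F)) : 2 ≤ Ideal.absNorm w.asIdeal := by
  have h0 : Ideal.absNorm w.asIdeal ≠ 0 := by
    rw [ne_eq, Ideal.absNorm_eq_zero_iff]; exact w.ne_bot
  have h1 : Ideal.absNorm w.asIdeal ≠ 1 := by
    rw [ne_eq, Ideal.absNorm_eq_one_iff]; exact w.isPrime.ne_top
  omega

theorem exists_density (T : Finset (HeightOneSpectrum (𝓞 F))) : ∃ κ : ℝ, 0 < κ ∧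
    Tendsto (fun X : ℝ => (Nat.card {I : PrimeTo F T // (Ideal.absNorm I.1 : ℝ) ≤ X} : ℝ) / X)
      atTop (𝓝 κ) := by
  classical
  induction T using Finset.induction_on with
  | empty =>
    refine ⟨dedekindZeta_residue F, dedekindZeta_residue_pos F, ?_⟩
    refine (NumberField.Ideal.tendsto_norm_le_div_atTop₀ F).congr fun X => ?_
    congr 2
    refine Nat.card_congr ⟨fun I => ⟨⟨I.1.1, nonZeroDivisors.coe_ne_zero I.1, by simp⟩, I.2⟩,
      fun I => ⟨⟨I.1.1, mem_nonZeroDivisors_of_ne_zero I.1.2.1⟩, I.2⟩, fun _ => rfl, fun _ => rfl⟩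
  | insert P T hP ih =>
    obtain ⟨κ, hκ, h⟩ := ih
    set q : ℝ := ((Ideal.absNorm P.asIdeal : ℕ) : ℝ) with hq
    have hq2 : 2 ≤ q := by rw [hq]; exact_mod_cast absNorm_asIdeal_ge P
    refine ⟨κ * (1 - 1 / q), mul_pos hκ (sub_pos.2 ?_), ?_⟩
    · rw [div_lt_one] <;> linarith
    have h2 : Tendsto (fun X : ℝ => X / q) atTop atTop :=
      tendsto_id.atTop_div_const (by linarith)
    have h3 := h.sub ((h.comp h2).mul_const (1 / q))
    rw [← mul_one_sub] at h3
    refine h3.congr fun X => ?_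
    have hcard : Nat.card {I : PrimeTo F T // (Ideal.absNorm I.1 : ℝ) ≤ X} =
        Nat.card {I : PrimeTo F (insert P T) // (Ideal.absNorm I.1 : ℝ) ≤ X} +
        Nat.card {I : PrimeTo F T // (Ideal.absNorm I.1 : ℝ) ≤ X / q} := by
      have hf1 : Finite {I : PrimeTo F (insert P T) // (Ideal.absNorm I.1 : ℝ) ≤ X} :=
        finite_absNorm_le _ X
      have hf2 : Finite {I : PrimeTo F T // (Ideal.absNorm I.1 : ℝ) ≤ X / q} :=
        finite_absNorm_le _ _
      have hdvd : ∀ I : PrimeTo F T, ∀ w ∈ T, ¬ w.asIdeal ∣ P.asIdeal * I.1 := by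
        intro I w hw hd
        rcases (Ideal.prime_of_isPrime w.ne_bot w.isPrime).dvd_or_dvd hd with h | h
        · have h4 := Ideal.dvd_iff_le.1 h
          have h5 : P.asIdeal = w.asIdeal := P.isMaximal.eq_of_le w.isPrime.ne_top h4
          exact hP (by rwa [HeightOneSpectrum.ext h5])
        · exact I.2.2 w hw h
      have hnorm : ∀ I : PrimeTo F T, (Ideal.absNorm I.1 : ℝ) ≤ X / q →
          (Ideal.absNorm (P.asIdeal * I.1) : ℝ) ≤ X := by
        intro I hI
        rw [map_mul]; push_cast
        rw [mul_comm]
        exact (le_div_iff₀ (by linarith)).1 hI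
      rw [← Nat.card_sum]
      refine (Nat.card_congr (Equiv.ofBijective (Sum.elim
        (fun I => ⟨⟨I.1.1, I.1.2.1, fun w hw => I.1.2.2 w (Finset.mem_insert_of_mem hw)⟩, I.2⟩)
        (fun I => ⟨⟨P.asIdeal * I.1.1, mul_ne_zero P.ne_bot I.1.2.1, hdvd I.1⟩, hnorm I.1 I.2⟩))
        ⟨?_, ?_⟩)).symm
      · rintro (⟨⟨I, hI0, hI⟩, hIX⟩ | ⟨⟨I, hI0, hI⟩, hIX⟩)
          (⟨⟨J, hJ0, hJ⟩, hJX⟩ | ⟨⟨J, hJ0, hJ⟩, hJX⟩) hIJ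
        · simp only [Sum.elim_inl, Subtype.mk.injEq] at hIJ
          subst hIJ; rfl
        · simp only [Sum.elim_inl, Sum.elim_inr, Subtype.mk.injEq] at hIJ
          exact absurd ⟨_, hIJ⟩ (hI P (Finset.mem_insert_self _ _))
        · simp only [Sum.elim_inl, Sum.elim_inr, Subtype.mk.injEq] at hIJ
          exact absurd ⟨_, hIJ.symm⟩ (hJ P (Finset.mem_insert_self _ _))
        · simp only [Sum.elim_inr, Subtype.mk.injEq] at hIJ
          obtain rfl := mul_left_cancel₀ (show P.asIdeal ≠ 0 from P.ne_bot) hIJ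
          rfl
      · rintro ⟨⟨I, hI0, hI⟩, hIX⟩
        by_cases hd : P.asIdeal ∣ I
        · obtain ⟨J, rfl⟩ := hd
          refine ⟨.inr ⟨⟨J, right_ne_zero_of_mul hI0,
            fun w hw hd => hI w hw (hd.mul_left _)⟩, ?_⟩, rfl⟩
          rw [map_mul] at hIX; push_cast at hIX
          rw [le_div_iff₀ (by linarith), mul_comm]; exact hIX
        · refine ⟨.inl ⟨⟨I, hI0, fun w hw => ?_⟩, hIX⟩, rfl⟩
          rcases Finset.mem_insert.1 hw with rfl | hw
          exacts [hd, hI w hw]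
    rw [hcard]
    push_cast
    have : q ≠ 0 := by linarith
    simp only [Function.comp]
    generalize (Nat.card {I : PrimeTo F T // (Ideal.absNorm I.1 : ℝ) ≤ X / q} : ℝ) = t
    rcases eq_or_ne X 0 with rfl | hX
    · simp
    · field_simp; ring

/-- Multiplicative extension of a map on primes to ideals. -/
noncomputable def mapPrimes {E : Type*} [Field E] [NumberField E]
    (φ : Ideal (𝓞 F) → Ideal (𝓞 E)) (I : Ideal (𝓞 F)) : Ideal (𝓞 E) :=
  ((UniqueFactorizationMonoid.normalizedFactors I).map φ).prod

end Pl

open Pl UniqueFactorizationMonoid in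
/-- There cannot be two families of primes of `E` over almost all primes of `F`
with the same norm. -/
theorem false_of_two_primes {F E : Type*} [Field F] [NumberField F] [Field E] [NumberField E]
    (T : Finset (HeightOneSpectrum (𝓞 F))) (φ φ' : Ideal (𝓞 F) → Ideal (𝓞 E))
    (hφ : ∀ w : HeightOneSpectrum (𝓞 F), w ∉ T → Prime (φ w.asIdeal) ∧
      Ideal.absNorm (φ w.asIdeal) = Ideal.absNorm w.asIdeal)
    (hφ' : ∀ w : HeightOneSpectrum (𝓞 F), w ∉ T → Prime (φ' w.asIdeal) ∧
      Ideal.absNorm (φ' w.asIdeal) = Ideal.absNorm w.asIdeal)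
    (ψ : Ideal (𝓞 E) → Ideal (𝓞 F))
    (hψ : ∀ w : HeightOneSpectrum (𝓞 F), w ∉ T → ψ (φ w.asIdeal) = w.asIdeal)
    (hψ' : ∀ w : HeightOneSpectrum (𝓞 F), w ∉ T → ψ (φ' w.asIdeal) = w.asIdeal)
    (hne : ∀ w : HeightOneSpectrum (𝓞 F), w ∉ T → φ w.asIdeal ≠ φ' w.asIdeal) : False := by
  classical
  obtain ⟨κ, hκ, h⟩ := exists_density (F := F) T
  obtain ⟨κ', -, h'⟩ := exists_density (F := E) ∅
  have hfac : ∀ (I : PrimeTo F T) (p : Ideal (𝓞 F)), p ∈ normalizedFactors I.1 →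
      ∃ w : HeightOneSpectrum (𝓞 F), w ∉ T ∧ p = w.asIdeal := by
    intro I p hp
    have hpr := prime_of_normalized_factor p hp
    refine ⟨⟨p, Ideal.isPrime_of_prime hpr, hpr.ne_zero⟩, fun hT => ?_, rfl⟩
    exact I.2.2 _ hT (dvd_of_mem_normalizedFactors hp)
  have hnf : ∀ I : PrimeTo F T, (normalizedFactors I.1).prod = I.1 := fun I =>
    Ideal.prod_normalizedFactors_eq_self I.2.1
  have hprime : ∀ (I : PrimeTo F T) (p : Ideal (𝓞 E)), p ∈ (normalizedFactors I.1).map φ →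
      Prime p := by
    intro I p hp
    obtain ⟨x, hx, rfl⟩ := Multiset.mem_map.1 hp
    obtain ⟨w, hw, rfl⟩ := hfac I x hx
    exact (hφ w hw).1
  have hprime' : ∀ (I : PrimeTo F T) (p : Ideal (𝓞 E)), p ∈ (normalizedFactors I.1).map φ' →
      Prime p := by
    intro I p hp
    obtain ⟨x, hx, rfl⟩ := Multiset.mem_map.1 hp
    obtain ⟨w, hw, rfl⟩ := hfac I x hx
    exact (hφ' w hw).1
  have hprod : ∀ I J : PrimeTo F T, normalizedFactors (mapPrimes φ I.1 * mapPrimes φ' J.1) =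
      (normalizedFactors I.1).map φ + (normalizedFactors J.1).map φ' := by
    intro I J
    rw [mapPrimes, mapPrimes, ← Multiset.prod_add]
    refine normalizedFactors_prod_of_prime fun p hp => ?_
    rcases Multiset.mem_add.1 hp with hp | hp
    exacts [hprime I p hp, hprime' J p hp]
  have hz : ∀ I J : PrimeTo F T, mapPrimes φ I.1 * mapPrimes φ' J.1 ≠ 0 := by
    intro I J
    refine mul_ne_zero ?_ ?_
    · exact Multiset.prod_ne_zero fun h0 => (hprime I 0 h0).ne_zero rfl
    · exact Multiset.prod_ne_zero fun h0 => (hprime' J 0 h0).ne_zero rfl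
  -- the set of images of `φ`
  let A : Ideal (𝓞 E) → Prop := fun p => ∃ w : HeightOneSpectrum (𝓞 F), w ∉ T ∧ p = φ w.asIdeal
  have hA' : ∀ w : HeightOneSpectrum (𝓞 F), w ∉ T → ¬ A (φ' w.asIdeal) := by
    rintro w hw ⟨u, hu, hwu⟩
    have : w.asIdeal = u.asIdeal := by rw [← hψ' w hw, hwu, hψ u hu]
    rw [← this] at hwu
    exact hne w hw hwu.symm
  have hrec : ∀ I J : PrimeTo F T,
      (((normalizedFactors I.1).map φ + (normalizedFactors J.1).map φ').filter A).map ψ =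
        normalizedFactors I.1 ∧
      (((normalizedFactors I.1).map φ + (normalizedFactors J.1).map φ').filter
          (fun x => ¬ A x)).map ψ =
        normalizedFactors J.1 := by
    intro I J
    have hI : ∀ p ∈ (normalizedFactors I.1).map φ, A p := by
      intro p hp
      obtain ⟨x, hx, rfl⟩ := Multiset.mem_map.1 hp
      obtain ⟨w, hw, rfl⟩ := hfac I x hx
      exact ⟨w, hw, rfl⟩
    have hJ : ∀ p ∈ (normalizedFactors J.1).map φ', ¬ A p := by
      intro p hp
      obtain ⟨x, hx, rfl⟩ := Multiset.mem_map.1 hp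
      obtain ⟨w, hw, rfl⟩ := hfac J x hx
      exact hA' w hw
    rw [Multiset.filter_add, Multiset.filter_add, Multiset.filter_eq_self.2 hI,
      Multiset.filter_eq_self.2 hJ, Multiset.filter_eq_nil.2 hJ,
      Multiset.filter_eq_nil.2 (fun p hp => not_not.2 (hI p hp)), add_zero, zero_add,
      Multiset.map_map, Multiset.map_map]
    constructor
    · conv_rhs => rw [← Multiset.map_id (normalizedFactors I.1)]
      refine Multiset.map_congr rfl fun x hx => ?_
      obtain ⟨w, hw, rfl⟩ := hfac I x hx
      exact hψ w hw
    · conv_rhs => rw [← Multiset.map_id (normalizedFactors J.1)]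
      refine Multiset.map_congr rfl fun x hx => ?_
      obtain ⟨w, hw, rfl⟩ := hfac J x hx
      exact hψ' w hw
  refine false_of_prod_embedding (α := PrimeTo F T) (β := PrimeTo E ∅)
    (fun I => Ideal.absNorm I.1) (fun I => Ideal.absNorm I.1)
    (fun I => Nat.pos_of_ne_zero (by rw [ne_eq, Ideal.absNorm_eq_zero_iff]; exact I.2.1))
    (finite_absNorm_le T) (finite_absNorm_le ∅) hκ h h'
    (fun I J => ⟨mapPrimes φ I.1 * mapPrimes φ' J.1, hz I J, by simp⟩) ?_ ?_
  · intro a b c d habcd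
    have h1 := congrArg normalizedFactors (Subtype.ext_iff.1 habcd)
    simp only [hprod] at h1
    obtain ⟨h2, h3⟩ := hrec a b
    obtain ⟨h4, h5⟩ := hrec c d
    rw [h1] at h2 h3
    refine ⟨Subtype.ext ?_, Subtype.ext ?_⟩
    · exact (hnf a).symm.trans ((congrArg Multiset.prod (h2.symm.trans h4)).trans (hnf c))
    · exact (hnf b).symm.trans ((congrArg Multiset.prod (h3.symm.trans h5)).trans (hnf d))
  · intro I J
    have key : ∀ (I : PrimeTo F T) (χ : Ideal (𝓞 F) → Ideal (𝓞 E)),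
        (∀ w : HeightOneSpectrum (𝓞 F), w ∉ T →
          Ideal.absNorm (χ w.asIdeal) = Ideal.absNorm w.asIdeal) →
        Ideal.absNorm (mapPrimes χ I.1) = Ideal.absNorm I.1 := by
      intro I χ hχ
      conv_rhs => rw [← hnf I]
      rw [mapPrimes, map_multiset_prod, map_multiset_prod, Multiset.map_map]
      congr 1
      refine Multiset.map_congr rfl fun x hx => ?_
      obtain ⟨w, hw, rfl⟩ := hfac I x hx
      exact hχ w hw
    change Ideal.absNorm (mapPrimes φ I.1 * mapPrimes φ' J.1) = _
    rw [map_mul, key I φ fun w hw => (hφ w hw).2, key J φ' fun w hw => (hφ' w hw).2]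

end

section

open NumberField IsDedekindDomain

namespace Pl

theorem absNorm_eq_of_over {F E : Type*} [Field F] [NumberField F] [Field E] [NumberField E]
    [Algebra F E] {v : HeightOneSpectrum (𝓞 F)} {Q : HeightOneSpectrum (𝓞 E)} {k : ℕ}
    (hQ : (of Q).Over (of v) k)
    (hs : ∀ z ∈ (of Q).ge 0, ∃ c ∈ (of v).ge 0, z - algebraMap F E c ∈ (of Q).ge 1) :
    Ideal.comap (algebraMap (𝓞 F) (𝓞 E)) Q.asIdeal = v.asIdeal ∧
      Ideal.absNorm Q.asIdeal = Ideal.absNorm v.asIdeal := by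
  have hcomp : ∀ x : 𝓞 F, algebraMap (𝓞 E) E (algebraMap (𝓞 F) (𝓞 E) x) =
      algebraMap F E (algebraMap (𝓞 F) F x) := fun x => by
    rw [← IsScalarTower.algebraMap_apply (𝓞 F) (𝓞 E) E, ← IsScalarTower.algebraMap_apply (𝓞 F) F E]
  have hc : Ideal.comap (algebraMap (𝓞 F) (𝓞 E)) Q.asIdeal = v.asIdeal := by
    ext x
    rw [Ideal.mem_comap, ← algebraMap_mem_of_ge_one, ← algebraMap_mem_of_ge_one, hcomp]
    rcases eq_or_ne x 0 with rfl | hx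
    · simp [(((of Q).ge 1)).zero_mem, (((of v).ge 1)).zero_mem]
    have hx1 : algebraMap (𝓞 F) F x ≠ 0 := by simpa using hx
    have hx2 : algebraMap F E (algebraMap (𝓞 F) F x) ≠ 0 := by simpa using hx
    rw [mem_ge_iff _ hx1, mem_ge_iff _ hx2]
    have := hQ.pos_iff (algebraMap (𝓞 F) F x)
    omega
  refine ⟨hc, ?_⟩
  let f : 𝓞 F →+* 𝓞 E ⧸ Q.asIdeal := (Ideal.Quotient.mk _).comp (algebraMap (𝓞 F) (𝓞 E))
  have hf : Function.Surjective f := by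
    intro z
    obtain ⟨z, rfl⟩ := Ideal.Quotient.mk_surjective z
    obtain ⟨c, hc0, hcz⟩ := hs _ ((of Q).algebraMap_mem_ge z)
    obtain ⟨y, hy⟩ := (of v).exists_int_approx hc0 1
    refine ⟨y, ?_⟩
    change Ideal.Quotient.mk _ _ = _
    rw [Ideal.Quotient.eq, ← neg_mem_iff, neg_sub, ← algebraMap_mem_of_ge_one, map_sub, hcomp]
    have h1 : algebraMap F E (c - algebraMap (𝓞 F) F y) ∈ (of Q).ge 1 := by
      refine (of Q).ge_anti ?_ (hQ.mem_ge hy)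
      have := hQ.1
      push_cast
      omega
    have := ((of Q).ge 1).add_mem hcz h1
    rwa [map_sub, sub_add_sub_cancel] at this
  have hk : RingHom.ker f = v.asIdeal := by
    rw [← hc]
    ext x
    rw [RingHom.mem_ker, Ideal.mem_comap]
    exact Ideal.Quotient.eq_zero_iff_mem
  have e := RingHom.quotientKerEquivOfSurjective hf
  rw [Ideal.absNorm_apply, Ideal.absNorm_apply, Submodule.cardQuot_apply, Submodule.cardQuot_apply,
    ← hk]
  exact Nat.card_congr e.symm.toEquiv

/-- A nonsquare fails to be a local square at infinitely many places. -/
theorem exists_notMem_lsq {F : Type*} [Field F] [NumberField F] (e : Fˣ)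
    (he : ¬ IsSquare (e : F)) (S : Set (Pl F)) (hS : S.Finite) :
    ∃ v ∉ S, v 2 = 0 ∧ v (e : F) = 0 ∧ e ∉ v.lsq := by
  by_contra! hcon
  obtain ⟨E, _, _, _, s, h⟩ := exists_isQuad he
  have := h.finite
  classical
  let S' : Set (Pl F) := S ∪ {P | P 2 ≠ 0} ∪ {P | P (e : F) ≠ 0}
  have hS' : S'.Finite :=
    (hS.union (support_finite two_ne_zero)).union (support_finite e.ne_zero)
  have hl : ∀ v ∉ S', e ∈ v.lsq := by
    intro v hv
    simp only [S', Set.mem_union, not_or, Set.mem_ofPred_eq, not_not] at hv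
    exact hcon v hv.1.1 hv.1.2 hv.2
  have hT := hS'.preimage (f := of) of_injective.injOn
  have key : ∀ w : HeightOneSpectrum (𝓞 F), w ∉ hT.toFinset →
      ∃ Q Q' : Ideal (𝓞 E), Q ≠ Q' ∧
      (Prime Q ∧ Ideal.comap (algebraMap (𝓞 F) (𝓞 E)) Q = w.asIdeal ∧
        Ideal.absNorm Q = Ideal.absNorm w.asIdeal) ∧
      (Prime Q' ∧ Ideal.comap (algebraMap (𝓞 F) (𝓞 E)) Q' = w.asIdeal ∧
        Ideal.absNorm Q' = Ideal.absNorm w.asIdeal) := by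
    intro w hw
    have hw' : of w ∉ S' := by simpa using hw
    obtain ⟨P, k, hP⟩ := exists_above (F := E) (of w)
    have hP' := h.over_comap hP
    have hne := h.comap_ne_of_mem_lsq hP rfl (hl _ hw')
    have happ : ∀ R ∈ ({P, P.comap (h.conj : E ≃+* E)} : Finset (Pl E)), ∀ z ∈ R.ge 0,
        ∃ c ∈ (of w).ge 0, z - algebraMap F E c ∈ R.ge 1 := by
      intro R hR z hz
      obtain ⟨c, hc, hc'⟩ := exists_approx_of_card_eq (of w) {P, P.comap (h.conj : E ≃+* E)}
        (by simpa using ⟨⟨k, hP⟩, ⟨k, hP'⟩⟩)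
        (by rw [h.finrank_eq, Finset.card_pair hne.symm]) R hR z hz
      exact ⟨c, hc, R.ge_anti (by norm_num) hc'⟩
    obtain ⟨Q, hQ⟩ := of_surjective P
    obtain ⟨Q', hQ'⟩ := of_surjective (P.comap (h.conj : E ≃+* E))
    refine ⟨Q.asIdeal, Q'.asIdeal, ?_, ⟨Q.prime, absNorm_eq_of_over (hQ ▸ hP) ?_⟩,
      ⟨Q'.prime, absNorm_eq_of_over (hQ' ▸ hP') ?_⟩⟩
    · intro heq
      obtain rfl := HeightOneSpectrum.ext heq
      exact hne (hQ'.symm.trans hQ)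
    · rw [hQ]; exact happ _ (by simp)
    · rw [hQ']; exact happ _ (by simp)
  choose! q q' hne hq hq' using key
  let g : (HeightOneSpectrum (𝓞 F) → Ideal (𝓞 E)) → Ideal (𝓞 F) → Ideal (𝓞 E) :=
    fun q I => if hI : ∃ w : HeightOneSpectrum (𝓞 F), w.asIdeal = I then q hI.choose else ⊥
  have hg : ∀ q w, g q w.asIdeal = q w := by
    intro q w
    have hI : ∃ w' : HeightOneSpectrum (𝓞 F), w'.asIdeal = w.asIdeal := ⟨w, rfl⟩
    have : hI.choose = w := HeightOneSpectrum.ext hI.choose_spec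
    simp only [g, dif_pos hI, this]
  refine false_of_two_primes (E := E) hT.toFinset (g q) (g q') ?_ ?_
    (Ideal.comap (algebraMap (𝓞 F) (𝓞 E))) ?_ ?_ ?_
  · intro w hw; rw [hg]; exact ⟨(hq w hw).1, (hq w hw).2.2⟩
  · intro w hw; rw [hg]; exact ⟨(hq' w hw).1, (hq' w hw).2.2⟩
  · intro w hw; rw [hg]; exact (hq w hw).2.1
  · intro w hw; rw [hg]; exact (hq' w hw).2.1
  · intro w hw; rw [hg, hg]; exact hne w hw

end Pl

end

section

open NumberField

section TwoIndex

theorem AddMonoidHom.index_range_equiv {A B : Type*} [AddCommGroup A] [AddCommGroup B]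
    (e : A ≃+ B) :
    (nsmulAddMonoidHom 2 : A →+ A).range.index = (nsmulAddMonoidHom 2 : B →+ B).range.index ∧
    Nonempty ((nsmulAddMonoidHom 2 : A →+ A).ker ≃ (nsmulAddMonoidHom 2 : B →+ B).ker) := by
  constructor
  · rw [← AddSubgroup.index_map_equiv _ e]
    congr 1
    ext b
    simp only [AddSubgroup.mem_map, AddMonoidHom.mem_range, nsmulAddMonoidHom_apply]
    constructor
    · rintro ⟨_, ⟨a, rfl⟩, rfl⟩
      exact ⟨e a, by simp⟩
    · rintro ⟨c, rfl⟩
      exact ⟨2 • e.symm c, ⟨_, rfl⟩, by simp⟩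
  · refine ⟨e.toEquiv.subtypeEquiv fun a => ?_⟩
    change 2 • a = 0 ↔ 2 • e a = 0
    rw [← map_nsmul, map_eq_zero_iff _ e.injective]

theorem AddCommGroup.index_range_two (A : Type*) [AddCommGroup A] [Module.Finite ℤ A] :
    (nsmulAddMonoidHom 2 : A →+ A).range.index = 2 ^ Module.finrank ℤ A *
      Nat.card (nsmulAddMonoidHom 2 : A →+ A).ker ∧ Finite (nsmulAddMonoidHom 2 : A →+ A).ker := by
  have hfg : AddGroup.FG A := Module.Finite.iff_addGroup_fg.mp inferInstance
  obtain ⟨n, ι, _, p, hp, k, ⟨e₀⟩⟩ := AddCommGroup.equiv_free_prod_directSum_zmod (G := A)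
  classical
  have (i : ι) : NeZero (p i ^ k i) := ⟨pow_ne_zero _ (hp i).ne_zero⟩
  let T := ∀ i : ι, ZMod (p i ^ k i)
  have hT : Finite T := inferInstance
  let e : A ≃+ (Fin n → ℤ) × T := e₀.trans
    ((Finsupp.linearEquivFunOnFinite ℤ ℤ (Fin n)).toAddEquiv.prodCongr (DirectSum.addEquivProd _))
  obtain ⟨h1, ⟨h2⟩⟩ := AddMonoidHom.index_range_equiv e
  have hrk : Module.finrank ℤ A = n := by
    rw [e.toIntLinearEquiv.finrank_eq]
    have hTf : Module.finrank ℤ T = 0 := by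
      rw [Module.finrank_eq_zero_iff_isTorsion, ← isAddTorsion_iff_isTorsion_int]
      exact isAddTorsion_of_finite
    have hq := Submodule.finrank_quotient_add_finrank
        (LinearMap.ker (LinearMap.fst ℤ (Fin n → ℤ) T))
    rw [((LinearMap.fst ℤ (Fin n → ℤ) T).quotKerEquivOfSurjective
      LinearMap.fst_surjective).finrank_eq, LinearMap.ker_fst,
      LinearMap.finrank_range_of_inj LinearMap.inr_injective, hTf] at hq
    simpa using hq.symm
  have hker : (nsmulAddMonoidHom 2 : (Fin n → ℤ) × T →+ _).ker =
      (⊥ : AddSubgroup (Fin n → ℤ)).prod (nsmulAddMonoidHom 2 : T →+ T).ker := by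
    ext ⟨x, y⟩
    have hx : 2 • x = 0 ↔ x = 0 := by simp [funext_iff]
    rw [AddSubgroup.mem_prod, AddMonoidHom.mem_ker, AddMonoidHom.mem_ker, AddSubgroup.mem_bot,
      nsmulAddMonoidHom_apply, nsmulAddMonoidHom_apply, Prod.smul_mk, Prod.mk_eq_zero, hx]
  have hran : (nsmulAddMonoidHom 2 : (Fin n → ℤ) × T →+ _).range =
      (AddSubgroup.pi Set.univ fun _ : Fin n => AddSubgroup.zmultiples (2 : ℤ)).prod
        (nsmulAddMonoidHom 2 : T →+ T).range := by
    ext ⟨x, y⟩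
    simp only [AddSubgroup.mem_prod, AddMonoidHom.mem_range, AddSubgroup.mem_pi,
      nsmulAddMonoidHom_apply, Int.mem_zmultiples_iff, Prod.smul_mk, Prod.exists, Prod.mk.injEq,
      Set.mem_univ, true_imp_iff]
    constructor
    · rintro ⟨a, b, rfl, rfl⟩
      exact ⟨fun i => ⟨a i, by simp⟩, b, rfl⟩
    · rintro ⟨h, b, rfl⟩
      choose a ha using h
      exact ⟨a, b, by ext i; simp [ha], rfl⟩
  rw [h1, hrk, Nat.card_congr h2, hker, hran, AddSubgroup.index_prod, AddSubgroup.index_pi,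
    Nat.card_congr (AddSubgroup.prodEquiv _ _).toEquiv, Nat.card_prod, AddSubgroup.index_range]
  refine ⟨by simp [Int.index_zmultiples], ?_⟩
  have : Finite (nsmulAddMonoidHom 2 : (Fin n → ℤ) × T →+ _).ker := by
    rw [hker]
    exact Finite.of_equiv _ (AddSubgroup.prodEquiv _ _).toEquiv.symm
  exact Finite.of_equiv _ h2.symm

theorem CommGroup.index_range_sq (A : Type*) [CommGroup A] [Module.Finite ℤ (Additive A)] :
    (powMonoidHom 2 : A →* A).range.index = 2 ^ Module.finrank ℤ (Additive A) *
      Nat.card (powMonoidHom 2 : A →* A).ker ∧ Finite (powMonoidHom 2 : A →* A).ker :=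
  AddCommGroup.index_range_two (Additive A)

end TwoIndex

end

section

open NumberField IsDedekindDomain

namespace Pl

variable {F : Type*} [Field F]

/-- The units outside `S`. -/
def sUnits (S : Set (Pl F)) : Subgroup Fˣ where
  carrier := {x | ∀ P ∉ S, P (x : F) = 0}
  one_mem' := fun P _ => P.ord_one
  mul_mem' := fun {a b} ha hb P hP => by
    rw [Units.val_mul, ord_mul _ a.ne_zero b.ne_zero, ha P hP, hb P hP, add_zero]
  inv_mem' := fun {a} ha P hP => by
    rw [Units.val_inv_eq_inv_val, ord_inv, ha P hP, neg_zero]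

theorem sUnits_mono {S T : Set (Pl F)} (h : S ⊆ T) : sUnits S ≤ sUnits T :=
  fun _ hx P hP => hx P fun hs => hP (h hs)

variable [NumberField F]

theorem exists_pos_off (P : Pl F) : ∃ x : Fˣ, 0 < P (x : F) ∧ ∀ Q ≠ P, Q (x : F) = 0 := by
  obtain ⟨v, rfl⟩ := of_surjective P
  have hv0 : v.asIdeal ∈ nonZeroDivisors (Ideal (𝓞 F)) := mem_nonZeroDivisors_of_ne_zero v.ne_bot
  have h1 : ClassGroup.mk0 ((⟨v.asIdeal, hv0⟩ : nonZeroDivisors (Ideal (𝓞 F))) ^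
      Fintype.card (ClassGroup (𝓞 F))) = 1 := by
    rw [map_pow, pow_card_eq_one]
  rw [ClassGroup.mk0_eq_one_iff] at h1
  obtain ⟨x, hx⟩ := h1.1
  rw [SubmonoidClass.coe_pow] at hx
  change v.asIdeal ^ Fintype.card (ClassGroup (𝓞 F)) = Ideal.span {x} at hx
  have hx0 : x ≠ 0 := by
    rintro rfl
    have : v.asIdeal ^ Fintype.card (ClassGroup (𝓞 F)) = 0 := by simpa using hx
    exact v.ne_bot (pow_eq_zero_iff (Fintype.card_ne_zero) |>.1 this)
  have hx0' : algebraMap (𝓞 F) F x ≠ 0 := by simpa using hx0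
  have hxm : x ∈ v.asIdeal ^ Fintype.card (ClassGroup (𝓞 F)) := by
    rw [hx]; exact Ideal.mem_span_singleton_self x
  refine ⟨Units.mk0 _ hx0', ?_, fun Q hQ => ?_⟩
  · have := algebraMap_mem_of_ge_one.2 (Ideal.pow_le_self Fintype.card_ne_zero hxm) hx0'
    rw [Units.val_mk0]; omega
  · obtain ⟨w, rfl⟩ := of_surjective Q
    rw [Units.val_mk0]
    have h2 := (of w).algebraMap_mem_ge x hx0'
    by_contra hne
    have h3 : x ∈ w.asIdeal := algebraMap_mem_of_ge_one.1 fun _ => by omega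
    have h4 : w.asIdeal ∣ v.asIdeal ^ Fintype.card (ClassGroup (𝓞 F)) := by
      rw [hx, Ideal.dvd_span_singleton]; exact h3
    have h5 := w.prime.dvd_of_dvd_pow h4
    rw [Prime.dvd_prime_iff_associated w.prime v.prime, associated_iff_eq] at h5
    exact hQ (by rw [HeightOneSpectrum.ext h5])

theorem exists_unit_of_ord_eq_zero {x : F} (hx0 : x ≠ 0) (hx : ∀ P : Pl F, P x = 0) :
    ∃ u : (𝓞 F)ˣ, algebraMap (𝓞 F) F u = x := by
  obtain ⟨y, hy⟩ := isIntegral_of_forall (x := x) fun P _ => (hx P).ge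
  obtain ⟨z, hz⟩ := isIntegral_of_forall (x := x⁻¹) fun P _ => by rw [ord_inv, hx, neg_zero]
  refine ⟨⟨y, z, ?_, ?_⟩, hy⟩ <;>
  · apply RingOfIntegers.coe_injective
    rw [map_mul, hy, hz, map_one]
    field_simp

omit [NumberField F] in
theorem ord_unit (u : (𝓞 F)ˣ) (P : Pl F) : P (algebraMap (𝓞 F) F u) = 0 := by
  have h0 : algebraMap (𝓞 F) F u ≠ 0 := by simp
  have h1 : algebraMap (𝓞 F) F ↑u⁻¹ ≠ 0 := by simp
  have h2 := P.algebraMap_mem_ge (u : 𝓞 F) h0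
  have h3 := P.algebraMap_mem_ge (↑u⁻¹ : 𝓞 F) h1
  have h4 : P (algebraMap (𝓞 F) F u * algebraMap (𝓞 F) F ↑u⁻¹) = 0 := by
    rw [← map_mul]; simp
  rw [ord_mul _ h0 h1] at h4
  omega

theorem finrank_sUnits (S : Finset (Pl F)) :
    Module.Finite ℤ (Additive (sUnits (S : Set (Pl F)))) ∧
      Module.finrank ℤ (Additive (sUnits (S : Set (Pl F)))) = Units.rank F + S.card := by
  classical
  let φ : Additive (sUnits (S : Set (Pl F))) →ₗ[ℤ] (S → ℤ) := AddMonoidHom.toIntLinearMap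
    { toFun := fun x v => v.1 ((x.toMul : Fˣ) : F)
      map_zero' := by ext v; exact v.1.ord_one
      map_add' := fun x y => by
        ext v
        exact v.1.ord_mul (Units.ne_zero _) (Units.ne_zero _) }
  have hφ : ∀ x v, φ x v = v.1 ((x.toMul : Fˣ) : F) := fun _ _ => rfl
  let ι : Additive (𝓞 F)ˣ →ₗ[ℤ] Additive (sUnits (S : Set (Pl F))) := AddMonoidHom.toIntLinearMap
    (MonoidHom.toAdditive ((Units.map (algebraMap (𝓞 F) F).toMonoidHom).codRestrict
      (sUnits (S : Set (Pl F))) fun u P _ => ord_unit u P))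
  have hι : ∀ u : Additive (𝓞 F)ˣ, (((ι u).toMul : Fˣ) : F) = algebraMap (𝓞 F) F u.toMul :=
    fun _ => rfl
  have hιi : Function.Injective ι := by
    intro u v huv
    have := congrArg (fun x : Additive (sUnits (S : Set (Pl F))) => ((x.toMul : Fˣ) : F)) huv
    simp only [hι] at this
    exact Additive.toMul.injective (Units.ext (RingOfIntegers.coe_injective this))
  have hker : LinearMap.range ι = LinearMap.ker φ := by
    ext x
    rw [LinearMap.mem_ker, LinearMap.mem_range]
    constructor
    · rintro ⟨u, rfl⟩
      ext v
      rw [hφ, hι]; exact ord_unit _ _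
    · intro h
      obtain ⟨u, hu⟩ := exists_unit_of_ord_eq_zero (x := ((x.toMul : Fˣ) : F)) (Units.ne_zero _)
        fun P => by
          by_cases hP : P ∈ S
          · rw [← hφ x ⟨P, hP⟩, h]; rfl
          · exact x.toMul.2 P hP
      exact ⟨Additive.ofMul u, Additive.toMul.injective
          (Subtype.ext (Units.ext (by rw [hι]; exact hu)))⟩
  have hfin : Module.Finite ℤ (LinearMap.ker φ) := by
    rw [← hker]; infer_instance
  have hfin2 : Module.Finite ℤ (Additive (sUnits (S : Set (Pl F))) ⧸ LinearMap.ker φ) :=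
    Module.Finite.equiv φ.quotKerEquivRange.symm
  have hfin3 := Module.Finite.of_submodule_quotient (LinearMap.ker φ)
  refine ⟨hfin3, ?_⟩
  rw [← Submodule.finrank_quotient_add_finrank (LinearMap.ker φ), φ.quotKerEquivRange.finrank_eq,
    ← hker, LinearMap.finrank_range_of_inj hιi, Units.finrank_eq, add_comm]
  congr 1
  apply le_antisymm
  · refine (Submodule.finrank_le _).trans ?_
    simp
  · choose x hx hx' using exists_pos_off (F := F)
    let y : S → LinearMap.range φ := fun v => ⟨φ (Additive.ofMul ⟨x v, fun P hP =>
      hx' _ _ fun h => hP (h ▸ v.2)⟩), LinearMap.mem_range_self _ _⟩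
    have hy : ∀ v w, (y v).1 w = if w = v then v.1 (x v : F) else 0 := by
      intro v w
      change w.1 (x v : F) = _
      split_ifs with h
      · rw [h]
      · exact hx' _ _ fun hh => h (Subtype.ext hh)
    have hli : LinearIndependent ℤ y := by
      rw [Fintype.linearIndependent_iff]
      intro g hg i
      have := congrFun (congrArg Subtype.val hg) i
      simp only [Submodule.coe_sum, Submodule.coe_smul, Finset.sum_apply, Pi.smul_apply, hy,
        smul_eq_mul, mul_ite, mul_zero, Finset.sum_ite_eq, Finset.mem_univ, if_true,
        ZeroMemClass.coe_zero, Pi.zero_apply, mul_eq_zero] at this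
      exact this.resolve_right (hx i.1).ne'
    simpa using hli.fintype_card_le_finrank

theorem card_ker_sq {A : Subgroup Fˣ} (hA : (-1 : Fˣ) ∈ A) :
    Nat.card (powMonoidHom 2 : A →* A).ker = 2 := by
  have h1 : (⟨-1, hA⟩ : A) ≠ 1 := by
    intro h
    have := congrArg (fun x : A => ((x : Fˣ) : F)) h
    simp only [Units.val_neg, Units.val_one, OneMemClass.coe_one] at this
    norm_num at this
  have : ((powMonoidHom 2 : A →* A).ker : Set A) = {1, ⟨-1, hA⟩} := by
    ext x
    simp only [SetLike.mem_coe, MonoidHom.mem_ker, powMonoidHom_apply, Set.mem_insert_iff,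
      Set.mem_singleton_iff]
    rw [Subtype.ext_iff, Subtype.ext_iff, Subtype.ext_iff, ← Units.val_inj, ← Units.val_inj,
      ← Units.val_inj]
    simp
  rw [← SetLike.coe_sort_coe, this, Nat.card_coe_set_eq, Set.ncard_pair h1.symm]

omit [NumberField F] in
theorem neg_one_mem_sUnits (S : Set (Pl F)) : (-1 : Fˣ) ∈ sUnits S := fun P _ => by
  rw [Units.val_neg, Units.val_one, ord_neg_one]

/-- Squares in the group of `S`-units. -/
theorem index_sq_sUnits (S : Finset (Pl F)) :
    (powMonoidHom 2 : sUnits (S : Set (Pl F)) →* _).range.index =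
      2 ^ (Units.rank F + S.card + 1) := by
  obtain ⟨h1, h2⟩ := finrank_sUnits S
  rw [(CommGroup.index_range_sq _).1, h2, card_ker_sq (neg_one_mem_sUnits _), pow_succ]

end Pl

end

section

open NumberField IsDedekindDomain

/-- The units of the form `x ^ 2 - e * y ^ 2`. -/
def normGroup {F : Type*} [Field F] (e : F) : Subgroup Fˣ where
  carrier := {b | ∃ x y : F, (b : F) = x ^ 2 - e * y ^ 2}
  one_mem' := ⟨1, 0, by simp⟩
  mul_mem' := by
    rintro a b ⟨x, y, h⟩ ⟨z, w, h'⟩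
    exact ⟨x * z + e * y * w, x * w + y * z, by rw [Units.val_mul, h, h']; ring⟩
  inv_mem' := by
    rintro a ⟨x, y, h⟩
    refine ⟨x / a, y / a, ?_⟩
    rw [div_pow, div_pow, mul_div_assoc', ← sub_div, ← h, Units.val_inv_eq_inv_val]
    field_simp

theorem mem_normGroup {F : Type*} [Field F] {e : F} {b : Fˣ} :
    b ∈ normGroup e ↔ ∃ x y : F, (b : F) = x ^ 2 - e * y ^ 2 := Iff.rfl

/-- The norm map of a quadratic extension. -/
noncomputable def IsQuad.nm {F E : Type*} [Field F] [Field E] [Algebra F E] {e : F} {s : E}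
    (h : IsQuad e s) : E →* F where
  toFun y := h.re y ^ 2 - e * h.im y ^ 2
  map_one' := (algebraMap F E).injective (by rw [← h.mul_conj]; simp)
  map_mul' x y := (algebraMap F E).injective (by
    rw [map_mul, ← h.mul_conj, ← h.mul_conj, ← h.mul_conj, map_mul]; ring)

theorem IsQuad.algebraMap_nm {F E : Type*} [Field F] [Field E] [Algebra F E] {e : F} {s : E}
    (h : IsQuad e s) (y : E) : algebraMap F E (h.nm y) = y * h.conj y := (h.mul_conj y).symm

namespace Pl

/-- The places outside `S` can be given arbitrary valuations. -/
def ClTrivial {F : Type*} [Field F] (S : Set (Pl F)) : Prop :=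
  ∀ P ∉ S, ∃ x : F, x ≠ 0 ∧ P x = 1 ∧ ∀ Q ∉ S, Q ≠ P → Q x = 0

theorem ClTrivial.exists_ord_eq {F : Type*} [Field F] {S : Set (Pl F)} (h : ClTrivial S)
    (f : Pl F → ℤ) (hf : {v | v ∉ S ∧ f v ≠ 0}.Finite) :
    ∃ y : Fˣ, ∀ v ∉ S, v (y : F) = f v := by
  classical
  have key : ∀ P, ∃ x : Fˣ, P ∉ S → P (x : F) = 1 ∧ ∀ Q ∉ S, Q ≠ P → Q (x : F) = 0 := by
    intro P
    by_cases hP : P ∈ S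
    · exact ⟨1, fun h => absurd hP h⟩
    · obtain ⟨x, h0, h1, h2⟩ := h P hP
      exact ⟨Units.mk0 x h0, fun _ => ⟨h1, h2⟩⟩
  choose x hx using key
  have hprod : ∀ (T : Finset (Pl F)) (v : Pl F),
      v ((∏ w ∈ T, x w ^ f w : Fˣ) : F) = ∑ w ∈ T, f w * v (x w : F) := by
    intro T v
    induction T using Finset.induction_on with
    | empty => simp
    | insert w T hw ih =>
      rw [Finset.prod_insert hw, Finset.sum_insert hw, Units.val_mul,
        ord_mul _ (Units.ne_zero _) (Units.ne_zero _), ih, Units.val_zpow_eq_zpow_val, ord_zpow]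
  refine ⟨∏ w ∈ hf.toFinset, x w ^ f w, fun v hv => ?_⟩
  rw [hprod]
  by_cases hfv : f v = 0
  · rw [hfv]
    refine Finset.sum_eq_zero fun w hw => ?_
    simp only [Set.Finite.mem_toFinset, Set.mem_ofPred_eq] at hw
    rw [(hx w hw.1).2 v hv (by rintro rfl; exact hw.2 hfv), mul_zero]
  · rw [Finset.sum_eq_single_of_mem v (by simpa using ⟨hv, hfv⟩), (hx v hv).1, mul_one]
    intro w hw hwv
    simp only [Set.Finite.mem_toFinset, Set.mem_ofPred_eq] at hw
    rw [(hx w hw.1).2 v hv hwv.symm, mul_zero]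

section

variable {F E : Type*} [Field F] [NumberField F] [Field E] [NumberField E]
  [Algebra F E]

theorem Over.eq_zero_iff {P : Pl E} {v : Pl F} {k : ℕ} (h : P.Over v k) (x : F) :
    P (algebraMap F E x) = 0 ↔ v x = 0 := by
  rw [h.2]
  have := h.1
  simp only [mul_eq_zero, Nat.cast_eq_zero]
  omega

theorem finite_over (S : Set (Pl F)) (hS : S.Finite) :
    {P : Pl E | ∃ v ∈ S, ∃ k, P.Over v k}.Finite := by
  have : {P : Pl E | ∃ v ∈ S, ∃ k, P.Over v k} = ⋃ v ∈ S, {P : Pl E | ∃ k, P.Over v k} := by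
    ext; simp
  rw [this]
  refine hS.biUnion fun v _ => ?_
  obtain ⟨x, hx0, hx⟩ := v.exists_unif
  refine (support_finite (F := E) (x := algebraMap F E x) (by simpa using hx0)).subset ?_
  rintro P ⟨k, hP⟩
  rw [Set.mem_ofPred_eq, ne_eq, hP.eq_zero_iff, hx]
  norm_num

/-- The places of `E` above `S`. -/
def above (E : Type*) [Field E] [Algebra F E] (S : Set (Pl F)) : Set (Pl E) :=
  {P | ∃ v ∈ S, ∃ k, P.Over v k}

theorem Over.mem_above_iff {P : Pl E} {v : Pl F} {k : ℕ} (h : P.Over v k) {S : Set (Pl F)} :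
    P ∈ above E S ↔ v ∈ S := by
  constructor
  · rintro ⟨w, hw, k', h'⟩
    rwa [h.unique h']
  · exact fun hv => ⟨v, hv, k, h⟩

theorem exists_over_notMem {P : Pl E} {S : Set (Pl F)} (hP : P ∉ above E S) :
    ∃ v ∉ S, ∃ k, P.Over v k := by
  have : Algebra.IsAlgebraic F E := Algebra.IsAlgebraic.tower_top (K := ℚ) F
  obtain ⟨v, k, h⟩ := P.exists_over (E := F)
  exact ⟨v, by rwa [h.mem_above_iff] at hP, k, h⟩

theorem card_above_ge {e : F} {s : E} (h : IsQuad e s) {S S₁ : Finset (Pl F)} (hS₁ : S₁ ⊆ S)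
    (hl : ∀ v ∈ S₁, ∃ u : Fˣ, (u : F) = e ∧ u ∈ v.lsq) :
    S.card + S₁.card ≤ (finite_over (E := E) (S : Set (Pl F)) S.finite_toSet).toFinset.card := by
  classical
  have : Algebra.IsAlgebraic F E := Algebra.IsAlgebraic.tower_top (K := ℚ) F
  choose r k hr using fun P : Pl E => P.exists_over (E := F)
  set A := (finite_over (E := E) (S : Set (Pl F)) S.finite_toSet).toFinset with hA
  have hmem : ∀ P, P ∈ A ↔ r P ∈ S := fun P => by
    rw [hA, Set.Finite.mem_toFinset]
    exact (hr P).mem_above_iff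
  rw [Finset.card_eq_sum_card_fiberwise (f := r) (t := S) (fun P hP => (hmem P).1 hP)]
  have h1 : S.card + S₁.card = ∑ v ∈ S, (1 + if v ∈ S₁ then 1 else 0) := by
    rw [Finset.sum_add_distrib, Finset.sum_ite_mem, Finset.inter_eq_right.2 hS₁]; simp
  rw [h1]
  refine Finset.sum_le_sum fun v hv => ?_
  obtain ⟨P, k', hP⟩ := exists_above (F := E) v
  have hin : ∀ {P : Pl E} {k}, P.Over v k → P ∈ A.filter fun P => r P = v := by
    intro P k hP
    rw [Finset.mem_filter, hmem, (hr P).unique hP]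
    exact ⟨hv, rfl⟩
  split_ifs with hv1
  · obtain ⟨u, hu, hul⟩ := hl v hv1
    rw [Nat.succ_le_iff, Finset.one_lt_card]
    exact ⟨_, hin (h.over_comap hP), _, hin hP, h.comap_ne_of_mem_lsq hP hu hul⟩
  · exact Finset.card_pos.2 ⟨P, hin hP⟩

theorem map_mem_sUnits {S : Set (Pl F)} {x : Fˣ} (hx : x ∈ sUnits S) :
    Units.map (algebraMap F E).toMonoidHom x ∈ sUnits (above E S) := by
  intro P hP
  obtain ⟨v, hv, k, h⟩ := exists_over_notMem hP
  exact (h.eq_zero_iff _).2 (hx v hv)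

theorem nm_mem_sUnits {e : F} {s : E} (h : IsQuad e s) {S : Set (Pl F)} {u : Eˣ}
    (hu : u ∈ sUnits (above E S)) : Units.map h.nm u ∈ sUnits S := by
  intro v hv
  obtain ⟨P, k, hP⟩ := exists_above (F := E) v
  rw [← hP.eq_zero_iff, Units.coe_map, h.algebraMap_nm,
    ord_mul _ u.ne_zero (by simp), hu P (by rwa [hP.mem_above_iff]), zero_add]
  have := hu _ (show P.comap (h.conj : E ≃+* E) ∉ above E S by
    rwa [(h.over_comap hP).mem_above_iff])
  simpa using this

end

end Pl

end

section

open NumberField IsDedekindDomain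

namespace Pl

variable {F E : Type*} [Field F] [NumberField F] [Field E] [NumberField E] [Algebra F E]

theorem exists_eq_div_conj {e : F} {s : E} (h : IsQuad e s) {S : Set (Pl F)}
    (h2 : ∀ v : Pl F, v ∉ S → v 2 = 0) (hcl : ClTrivial S) (he : ∀ v : Pl F, v ∉ S → v e = 0)
    {u : E} (hu : h.nm u = 1) (huS : ∀ P ∉ above E S, P u = 0) :
    ∃ t : Eˣ, t ∈ sUnits (above E S) ∧ u * h.conj t = t := by
  have huu : u * h.conj u = 1 := by rw [← h.algebraMap_nm, hu, map_one]
  have hu0 : u ≠ 0 := by rintro rfl; simp at huu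
  obtain ⟨x, hx0, hx⟩ : ∃ x : E, x ≠ 0 ∧ u * h.conj x = x := by
    rcases eq_or_ne u (-1) with rfl | hne
    · exact ⟨s, h.root_ne_zero, by simp⟩
    · refine ⟨1 + u, fun hh => hne (by linear_combination hh), ?_⟩
      rw [map_add, map_one, mul_add, huu, mul_one, add_comm]
  classical
  set α := h.re x
  set β := h.im x
  have hxe : x = algebraMap F E α + algebraMap F E β * s := h.eq_re_im x
  have hne : α ≠ 0 ∨ β ≠ 0 := by
    by_contra! hh
    rw [hh.1, hh.2] at hxe
    exact hx0 (by simpa using hxe)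
  let m : Pl F → ℤ := fun v =>
    if α = 0 then v β else if β = 0 then v α else min (v α) (v β)
  have hm1 : ∀ v : Pl F, α ∈ v.ge (m v) := by
    intro v h0
    simp only [m, if_neg h0]
    split_ifs <;> simp
  have hm2 : ∀ v : Pl F, β ∈ v.ge (m v) := by
    intro v h0
    simp only [m, if_neg h0]
    split_ifs <;> simp
  have hm3 : ∀ v : Pl F, (α ≠ 0 ∧ v α = m v) ∨ (β ≠ 0 ∧ v β = m v) := by
    intro v
    simp only [m]
    by_cases ha : α = 0
    · rw [if_pos ha]
      exact Or.inr ⟨hne.resolve_left (not_not.2 ha), rfl⟩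
    · rw [if_neg ha]
      by_cases hb : β = 0
      · rw [if_pos hb]; exact Or.inl ⟨ha, rfl⟩
      · rw [if_neg hb]
        rcases le_total (v α) (v β) with hh | hh
        · exact Or.inl ⟨ha, (min_eq_left hh).symm⟩
        · exact Or.inr ⟨hb, (min_eq_right hh).symm⟩
  have hmf : {v | v ∉ S ∧ m v ≠ 0}.Finite := by
    have hf : ∀ a : F, {v : Pl F | v a ≠ 0}.Finite := by
      intro a
      rcases eq_or_ne a 0 with rfl | ha
      · simp
      · exact support_finite ha
    refine ((hf α).union (hf β)).subset ?_
    rintro v ⟨-, hv⟩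
    rcases hm3 v with hh | hh
    · exact Or.inl (by rw [Set.mem_ofPred_eq, hh.2]; exact hv)
    · exact Or.inr (by rw [Set.mem_ofPred_eq, hh.2]; exact hv)
  obtain ⟨y, hy⟩ := hcl.exists_ord_eq m hmf
  have hy0 : algebraMap F E y ≠ 0 := by simp
  set x' := x / algebraMap F E y with hx'
  have hx'0 : x' ≠ 0 := div_ne_zero hx0 hy0
  have hux' : u * h.conj x' = x' := by
    rw [hx', map_div₀, AlgEquiv.commutes, mul_div_assoc', hx]
  set a := α / y
  set b := β / y
  have hab : x' = algebraMap F E a + algebraMap F E b * s := by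
    rw [hx', hxe, map_div₀, map_div₀]; ring
  have hcab : h.conj x' = algebraMap F E a - algebraMap F E b * s := by
    rw [hab, map_add, map_mul, AlgEquiv.commutes, AlgEquiv.commutes, h.conj_root]; ring
  refine ⟨Units.mk0 x' hx'0, ?_, hux'⟩
  have hPs : ∀ P ∉ above E S, P s = 0 := by
    intro P hP
    obtain ⟨v, hv, k, hPv⟩ := exists_over_notMem hP
    have h1 := (hPv.eq_zero_iff e).2 (he v hv)
    rw [← h.sq, ord_sq] at h1
    omega
  have hge : ∀ P ∉ above E S, 0 ≤ P x' := by
    intro P hP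
    obtain ⟨v, hv, k, hPv⟩ := exists_over_notMem hP
    have ha : a ∈ v.ge 0 := by
      intro h0
      have hα : α ≠ 0 := by rintro hh; exact h0 (by simp [a, hh])
      rw [ord_div _ hα y.ne_zero, hy v hv]
      have := hm1 v hα
      omega
    have hb : b ∈ v.ge 0 := by
      intro h0
      have hβ : β ≠ 0 := by rintro hh; exact h0 (by simp [b, hh])
      rw [ord_div _ hβ y.ne_zero, hy v hv]
      have := hm2 v hβ
      omega
    have hs : s ∈ P.ge 0 := fun _ => (hPs P hP).ge
    have h1 := hPv.mem_ge ha
    have h2 := hPv.mem_ge hb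
    rw [mul_zero] at h1 h2
    have h3 := (P.ge 0).add_mem h1 (P.mul_mem_ge_zero h2 hs)
    rw [← hab] at h3
    exact h3 hx'0
  intro P hP
  rw [Units.val_mk0]
  by_contra hne0
  have hpos : 0 < P x' := lt_of_le_of_ne (hge P hP) (Ne.symm hne0)
  have hcpos : 1 ≤ P (h.conj x') := by
    have := congrArg P hux'
    rw [P.ord_mul hu0 (by simpa using hx'0), huS P hP] at this
    omega
  obtain ⟨v, hv, k, hPv⟩ := exists_over_notMem hP
  have hP2 : P 2 = 0 := by
    have := (hPv.eq_zero_iff 2).2 (h2 v hv)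
    rwa [map_ofNat] at this
  have hx1 : x' ∈ P.ge 1 := fun _ => hpos
  have hx2 : h.conj x' ∈ P.ge 1 := fun _ => hcpos
  have hsum := (P.ge 1).add_mem hx1 hx2
  have hdif := (P.ge 1).sub_mem hx1 hx2
  rw [hcab] at hsum hdif
  nth_rw 1 [hab] at hsum hdif
  rw [show algebraMap F E a + algebraMap F E b * s + (algebraMap F E a - algebraMap F E b * s) =
    2 * algebraMap F E a by ring] at hsum
  rw [show algebraMap F E a + algebraMap F E b * s - (algebraMap F E a - algebraMap F E b * s) =
    2 * (algebraMap F E b * s) by ring] at hdif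
  rcases hm3 v with ⟨h0, hh⟩ | ⟨h0, hh⟩
  · have ha0 : a ≠ 0 := div_ne_zero h0 y.ne_zero
    have ha0' : algebraMap F E a ≠ 0 := by simpa using ha0
    have hva : P (algebraMap F E a) = 0 := by
      rw [hPv.eq_zero_iff, ord_div _ h0 y.ne_zero, hy v hv, hh, sub_self]
    have := hsum (mul_ne_zero two_ne_zero ha0')
    rw [P.ord_mul two_ne_zero ha0', hP2, hva] at this
    omega
  · have hb0 : b ≠ 0 := div_ne_zero h0 y.ne_zero
    have hb0' : algebraMap F E b ≠ 0 := by simpa using hb0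
    have hvb : P (algebraMap F E b) = 0 := by
      rw [hPv.eq_zero_iff, ord_div _ h0 y.ne_zero, hy v hv, hh, sub_self]
    have := hdif (mul_ne_zero two_ne_zero (mul_ne_zero hb0' h.root_ne_zero))
    rw [P.ord_mul two_ne_zero (mul_ne_zero hb0' h.root_ne_zero),
      P.ord_mul hb0' h.root_ne_zero, hP2, hvb, hPs P hP] at this
    omega


theorem index_sup_sq_ge {G : Type*} [CommGroup G] [Module.Finite ℤ (Additive G)] (H : Subgroup G)
    {m : ℕ} (hm : m + Module.finrank ℤ (Additive H) ≤ Module.finrank ℤ (Additive G))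
    (s : G) (hs : s ∉ H) (hs2 : s ^ 2 ∈ H) :
    2 ^ (m + 1) ≤ (H ⊔ (powMonoidHom 2 : G →* G).range).index := by
  let π : Additive G →ₗ[ℤ] Additive (G ⧸ H) :=
    AddMonoidHom.toIntLinearMap (MonoidHom.toAdditive (QuotientGroup.mk' H))
  have hπ : Function.Surjective π := fun x => by
    obtain ⟨y, hy⟩ := QuotientGroup.mk'_surjective H x.toMul
    exact ⟨Additive.ofMul y, congrArg Additive.ofMul hy⟩
  let ι : Additive H →ₗ[ℤ] Additive G :=
    AddMonoidHom.toIntLinearMap (MonoidHom.toAdditive H.subtype)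
  have hker : LinearMap.ker π ≤ LinearMap.range ι := by
    intro x hx
    have : (QuotientGroup.mk x.toMul : G ⧸ H) = 1 := hx
    rw [QuotientGroup.eq_one_iff] at this
    exact ⟨Additive.ofMul ⟨_, this⟩, rfl⟩
  have : Module.Finite ℤ (Additive (G ⧸ H)) := Module.Finite.of_surjective π hπ
  have hιi : Function.Injective ι := fun x y hxy =>
    Additive.toMul.injective (Subtype.ext (congrArg Additive.toMul hxy))
  have hrk : m ≤ Module.finrank ℤ (Additive (G ⧸ H)) := by
    have h1 := Submodule.finrank_quotient_add_finrank (LinearMap.ker π)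
    rw [(π.quotKerEquivOfSurjective hπ).finrank_eq] at h1
    have h2 := Submodule.finrank_mono hker
    rw [LinearMap.finrank_range_of_inj hιi] at h2
    omega
  have hcomap : H ⊔ (powMonoidHom 2 : G →* G).range =
      (powMonoidHom 2 : G ⧸ H →* G ⧸ H).range.comap (QuotientGroup.mk' H) := by
    ext x
    rw [Subgroup.mem_sup, Subgroup.mem_comap, MonoidHom.mem_range]
    constructor
    · rintro ⟨a, ha, _, ⟨b, rfl⟩, rfl⟩
      refine ⟨QuotientGroup.mk b, ?_⟩
      rw [map_mul, QuotientGroup.mk'_apply, (QuotientGroup.eq_one_iff a).2 ha, one_mul]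
      rfl
    · rintro ⟨b, hb⟩
      obtain ⟨b, rfl⟩ := QuotientGroup.mk'_surjective H b
      refine ⟨x / b ^ 2, ?_, b ^ 2, ⟨b, rfl⟩, div_mul_cancel _ _⟩
      rw [← QuotientGroup.eq_one_iff, ← QuotientGroup.mk'_apply, map_div, ← hb, map_pow]
      exact div_self' _
  rw [hcomap, Subgroup.index_comap_of_surjective _ (QuotientGroup.mk'_surjective H)]
  obtain ⟨h1, h2⟩ := CommGroup.index_range_sq (G ⧸ H)
  rw [h1, pow_succ]
  refine Nat.mul_le_mul (Nat.pow_le_pow_right two_pos hrk) ?_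
  have : Nontrivial (powMonoidHom 2 : G ⧸ H →* G ⧸ H).ker := by
    refine ⟨⟨⟨QuotientGroup.mk s, ?_⟩, 1, fun hh => hs ?_⟩⟩
    · rw [MonoidHom.mem_ker, powMonoidHom_apply, ← QuotientGroup.mk_pow, QuotientGroup.eq_one_iff]
      exact hs2
    · rw [← QuotientGroup.eq_one_iff]
      exact congrArg Subtype.val hh
  exact Finite.one_lt_card

theorem rank_add_one_eq [IsTotallyReal F] : Units.rank F + 1 = Module.finrank ℚ F := by
  rw [Units.rank, IsTotallyReal.finrank]
  have := InfinitePlace.card_eq_nrRealPlaces_add_nrComplexPlaces F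
  have := Fintype.card_pos (α := InfinitePlace F)
  have := IsTotallyReal.nrComplexPlaces_eq_zero F
  omega

/-- Upper bound for the index of norms from a quadratic extension in the group of `S`-units. -/
theorem relIndex_normGroup_le [IsTotallyReal F] (S : Finset (Pl F))
    (h2 : ∀ v : Pl F, v ∉ S → v 2 = 0) (hcl : ClTrivial (S : Set (Pl F))) {e : Fˣ}
    (heS : e ∈ sUnits (S : Set (Pl F))) (he : ¬ IsSquare (e : F)) (hpos : TotPos (e : F))
    (S₁ : Finset (Pl F)) (hS₁ : S₁ ⊆ S) (hl : ∀ v ∈ S₁, e ∈ v.lsq) :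
    (normGroup (e : F)).relIndex (sUnits (S : Set (Pl F))) ≠ 0 ∧
      (normGroup (e : F)).relIndex (sUnits (S : Set (Pl F))) * 2 ^ (S₁.card + 1) ≤ 2 ^ S.card := by
  obtain ⟨E, _, _, _, s, h⟩ := exists_isQuad he
  have := h.finite
  have hE := h.isTotallyReal hpos
  set H := sUnits (S : Set (Pl F)) with hH
  set U : Subgroup Eˣ := sUnits (above E (S : Set (Pl F))) with hU
  have hcard := card_above_ge h hS₁ fun v hv => ⟨e, rfl, hl v hv⟩
  set A := (finite_over (E := E) (S : Set (Pl F)) S.finite_toSet).toFinset with hA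
  have hAU : (A : Set (Pl E)) = above E (S : Set (Pl F)) := by
    rw [hA, Set.Finite.coe_toFinset]; rfl
  obtain ⟨hUf, hUr⟩ := finrank_sUnits A
  rw [hAU, ← hU] at hUf hUr
  obtain ⟨hHf, hHr⟩ := finrank_sUnits S
  rw [← hH] at hHf hHr
  have hnF := rank_add_one_eq (F := F)
  have hnE := rank_add_one_eq (F := E)
  rw [← Module.finrank_mul_finrank ℚ F E, h.finrank_eq, ← hnF] at hnE
  let N : Eˣ →* Fˣ := Units.map h.nm
  let ι : Fˣ →* Eˣ := Units.map (algebraMap F E).toMonoidHom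
  let H2 : Subgroup Fˣ := H.map (powMonoidHom 2)
  have hNU : U.map N ≤ H := by
    rintro _ ⟨u, hu, rfl⟩
    exact nm_mem_sUnits h hu
  have hNι : ∀ x : Fˣ, N (ι x) = x ^ 2 := by
    intro x
    apply Units.ext
    apply (algebraMap F E).injective
    change algebraMap F E (h.nm (algebraMap F E x)) = _
    rw [h.algebraMap_nm, AlgEquiv.commutes, Units.val_pow_eq_pow_val, map_pow, sq]
  have hH2 : H2 ≤ U.map N := by
    rintro _ ⟨x, hx, rfl⟩
    exact ⟨ι x, map_mem_sUnits hx, hNι x⟩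
  have hidx1 : H2.relIndex H = 2 ^ (Units.rank F + S.card + 1) := by
    rw [← index_sq_sUnits, Subgroup.relIndex]
    congr 1
    ext x
    simp only [Subgroup.mem_subgroupOf, MonoidHom.mem_range, H2, Subgroup.mem_map]
    constructor
    · rintro ⟨y, hy, hyx⟩
      exact ⟨⟨y, hy⟩, Subtype.ext hyx⟩
    · rintro ⟨y, rfl⟩
      exact ⟨y, y.2, rfl⟩
  have hmul := Subgroup.relIndex_mul_relIndex _ _ _ hH2 hNU
  have hnorm : U.map N ≤ normGroup (e : F) := by
    rintro _ ⟨u, hu, rfl⟩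
    exact ⟨_, _, rfl⟩
  have hdvd : (normGroup (e : F)).relIndex H ∣ (U.map N).relIndex H :=
    Subgroup.relIndex_dvd_of_le_left H hnorm
  have hstep : (H2.comap N) ⊓ U ≤ H.map ι ⊔ U.map (powMonoidHom 2) := by
    rintro u ⟨⟨a, ha, hau⟩, hu⟩
    have hau' : a ^ 2 = N u := hau
    have h1 : N (u / ι a) = 1 := by rw [map_div, hNι, hau', div_self']
    have hua : u / ι a ∈ U := U.div_mem hu (map_mem_sUnits ha)
    obtain ⟨t, ht, htu⟩ := exists_eq_div_conj h (S := (S : Set (Pl F))) h2 hcl heS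
      (u := ((u / ι a : Eˣ) : E)) (by exact congrArg Units.val h1) hua
    have hNt : ι (N t) = t * Units.map (h.conj : E ≃+* E).toRingHom.toMonoidHom t :=
      Units.ext (h.algebraMap_nm (t : E))
    have htu' : u / ι a * Units.map (h.conj : E ≃+* E).toRingHom.toMonoidHom t = t :=
      Units.ext htu
    have hfin : u = ι (a / N t) * t ^ 2 := by
      rw [map_div, hNt]
      have : u = t / Units.map (h.conj : E ≃+* E).toRingHom.toMonoidHom t * ι a := by
        nth_rw 1 [← htu']; simp
      rw [this]
      have key : ∀ t c a : Eˣ, t / c * a = a / (t * c) * t ^ 2 := fun t c a => by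
        apply Units.ext
        push_cast
        field_simp
      exact key _ _ _
    rw [hfin]
    exact Subgroup.mul_mem_sup ⟨_, H.div_mem ha (nm_mem_sUnits h ht), rfl⟩ ⟨t, ht, rfl⟩
  have hidx2 : (H.map ι ⊔ U.map (powMonoidHom 2)).relIndex U ∣ H2.relIndex (U.map N) := by
    rw [← Subgroup.relIndex_comap, ← Subgroup.inf_relIndex_right (H2.comap N)]
    exact Subgroup.relIndex_dvd_of_le_left U hstep
  have hιU : H.map ι ≤ U := by
    rintro _ ⟨x, hx, rfl⟩
    exact map_mem_sUnits hx
  have hsU : Units.mk0 s h.root_ne_zero ∈ U := by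
    intro P hP
    have h1 := map_mem_sUnits (E := E) heS P hP
    change P (algebraMap F E (e : F)) = 0 at h1
    rw [← h.sq, ord_sq] at h1
    rw [Units.val_mk0]
    omega
  have hidx3 : 2 ^ (Units.rank F + 1 + S₁.card + 1) ≤
      (H.map ι ⊔ U.map (powMonoidHom 2)).relIndex U := by
    have hsub : (H.map ι ⊔ U.map (powMonoidHom 2)).subgroupOf U =
        (H.map ι).subgroupOf U ⊔ (powMonoidHom 2 : U →* U).range := by
      have hU2 : U.map (powMonoidHom 2) ≤ U := by
        rintro _ ⟨x, hx, rfl⟩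
        exact U.pow_mem hx 2
      rw [Subgroup.subgroupOf_sup hιU hU2]
      congr 1
      ext x
      simp only [Subgroup.mem_subgroupOf, MonoidHom.mem_range, Subgroup.mem_map]
      constructor
      · rintro ⟨y, hy, hyx⟩
        exact ⟨⟨y, hy⟩, Subtype.ext hyx⟩
      · rintro ⟨y, rfl⟩
        exact ⟨y, y.2, rfl⟩
    rw [Subgroup.relIndex, hsub]
    have hle : Module.finrank ℤ (Additive ((H.map ι).subgroupOf U)) ≤
        Module.finrank ℤ (Additive H) := by
      let j : Additive H →ₗ[ℤ] Additive ((H.map ι).subgroupOf U) := AddMonoidHom.toIntLinearMap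
        (MonoidHom.toAdditive
          { toFun := fun x => ⟨⟨ι x, hιU ⟨x, x.2, rfl⟩⟩, ⟨x, x.2, rfl⟩⟩
            map_one' := by ext; simp
            map_mul' := fun x y => by ext; simp })
      have hj : Function.Surjective j := by
        rintro ⟨x, y, hy, hyx⟩
        exact ⟨Additive.ofMul ⟨y, hy⟩, Subtype.ext (Subtype.ext hyx)⟩
      exact LinearMap.finrank_le_finrank_of_surjective hj
    refine index_sup_sq_ge _ (by omega) ⟨_, hsU⟩ ?_ ?_
    · rw [Subgroup.mem_subgroupOf]
      rintro ⟨x, -, hx⟩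
      have hx' : algebraMap F E x = s := congrArg Units.val hx
      apply he
      refine ⟨x, (algebraMap F E).injective ?_⟩
      rw [← h.sq, ← hx', map_mul, sq]
    · rw [Subgroup.mem_subgroupOf]
      refine ⟨e, heS, Units.ext ?_⟩
      exact h.sq.symm
  have hne : H2.relIndex (U.map N) * (U.map N).relIndex H ≠ 0 := by
    rw [hmul, hidx1]; positivity
  have hne1 : H2.relIndex (U.map N) ≠ 0 := left_ne_zero_of_mul hne
  have hne2 : (U.map N).relIndex H ≠ 0 := right_ne_zero_of_mul hne
  refine ⟨fun h0 => hne2 (Nat.eq_zero_of_zero_dvd (h0 ▸ hdvd)), ?_⟩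
  have hA1 := Nat.le_of_dvd (Nat.pos_of_ne_zero hne2) hdvd
  have hA2 := hidx3.trans (Nat.le_of_dvd (Nat.pos_of_ne_zero hne1) hidx2)
  have hA3 := Nat.mul_le_mul hA2 hA1
  rw [hmul, hidx1, show Units.rank F + 1 + S₁.card + 1 = (S₁.card + 1) + (Units.rank F + 1) by ring,
    show Units.rank F + S.card + 1 = S.card + (Units.rank F + 1) by ring, pow_add 2 (S₁.card + 1),
    pow_add 2 S.card, mul_right_comm] at hA3
  rw [mul_comm]
  exact Nat.le_of_mul_le_mul_right hA3 (by positivity)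

end Pl

end

section

open NumberField IsDedekindDomain

namespace Subgroup

theorem two_pow_le_relIndex {G ι : Type*} [CommGroup G] (E N : Subgroup G) (I : Finset ι)
    (T : ι → Subgroup G) (ε : ι → G) (hE : ∀ i ∈ I, ε i ∈ E) (hn : ∀ i ∈ I, ε i ∉ T i)
    (hT : ∀ i ∈ I, ∀ j ∈ I, j ≠ i → ε i ∈ T j) (hN : ∀ i ∈ I, N ⊓ E ≤ T i)
    (h0 : N.relIndex E ≠ 0) : 2 ^ I.card ≤ N.relIndex E := by
  classical
  have key : ∀ J ⊆ I, ∀ i ∈ I, (∏ j ∈ J, ε j ∈ T i ↔ i ∉ J) := by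
    intro J hJ i hi
    by_cases hiJ : i ∈ J
    · rw [← Finset.mul_prod_erase J ε hiJ, mul_mem_cancel_right]
      · simp [hiJ, hn i hi]
      · exact _root_.prod_mem fun j hj => hT j (hJ (Finset.mem_of_mem_erase hj)) i hi
          (Finset.ne_of_mem_erase hj).symm
    · simp only [hiJ, not_false_eq_true, iff_true]
      exact _root_.prod_mem fun j hj => hT j (hJ hj) i hi (by rintro rfl; exact hiJ hj)
  have : Finite (E ⧸ N.subgroupOf E) := Nat.finite_of_card_ne_zero h0
  let f : I.powerset → E ⧸ N.subgroupOf E := fun J =>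
    ((⟨∏ j ∈ J.1, ε j, _root_.prod_mem fun j hj => hE j (Finset.mem_powerset.1 J.2 hj)⟩ : E) :
      E ⧸ N.subgroupOf E)
  have hf : Function.Injective f := by
    rintro ⟨J, hJ⟩ ⟨J', hJ'⟩ h
    rw [Finset.mem_powerset] at hJ hJ'
    have h1 := QuotientGroup.eq.1 h
    rw [mem_subgroupOf] at h1
    have h2 : ∀ i ∈ I, (i ∈ J ↔ i ∈ J') := by
      intro i hi
      have h3 := hN i hi ⟨h1, SetLike.coe_mem _⟩
      have h4 : (∏ j ∈ J, ε j ∈ T i ↔ ∏ j ∈ J', ε j ∈ T i) := by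
        constructor
        · intro h5
          exact ((T i).mul_mem_cancel_left (inv_mem h5)).1 h3
        · intro h5
          exact inv_mem_iff.1 (((T i).mul_mem_cancel_right h5).1 h3)
      rw [key J hJ i hi, key J' hJ' i hi] at h4
      tauto
    ext i
    simp only
    constructor
    · intro hi; exact (h2 i (hJ hi)).1 hi
    · intro hi; exact (h2 i (hJ' hi)).2 hi
  have := Nat.card_le_card_of_injective f hf
  rwa [Nat.card_eq_fintype_card, Fintype.card_coe, Finset.card_powerset] at this

theorem inf_le_of_relIndex_le {G : Type*} [CommGroup G] {E H K : Subgroup G} (h : H ⊓ E ≤ K)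
    (hle : H.relIndex E ≤ K.relIndex E) (h0 : H.relIndex E ≠ 0) : K ⊓ E ≤ H := by
  have h1 : (H ⊓ E).relIndex (K ⊓ E) * (K ⊓ E).relIndex E = (H ⊓ E).relIndex E :=
    relIndex_mul_relIndex _ _ _ (le_inf h inf_le_right) inf_le_right
  rw [inf_relIndex_right, inf_relIndex_right] at h1
  have h2 : (H ⊓ E).relIndex (K ⊓ E) ≠ 0 := fun h => h0 (by rw [← h1, h, zero_mul])
  have h3 : (H ⊓ E).relIndex (K ⊓ E) = 1 := by
    have hK : K.relIndex E ≠ 0 := fun h => h0 (by rw [← h1, h, mul_zero])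
    by_contra h4
    have : 2 * K.relIndex E ≤ H.relIndex E := by
      rw [← h1]; exact Nat.mul_le_mul_right _ (by omega)
    omega
  exact (relIndex_eq_one.1 h3).trans inf_le_left

end Subgroup

namespace Pl

variable {F : Type*} [Field F] (v : Pl F)

/-- `x ^ 2 - e y ^ 2` has even valuation at a place where `e` has even valuation and is not a
local square. -/
theorem even_of_mem_normGroup {e b : Fˣ} (hv : v 2 = 0) (he : e ∉ v.lsq) (hev : Even (v e))
    (hb : b ∈ normGroup (e : F)) : Even (v b) := by
  obtain ⟨x, y, hxy⟩ := mem_normGroup.1 hb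
  rcases eq_or_ne x 0 with rfl | hx
  · have hy : y ≠ 0 := by rintro rfl; simp at hxy
    rw [hxy, show (0:F) ^ 2 - e * y ^ 2 = - (e * y ^ 2) by ring, ord_neg,
      ord_mul _ e.ne_zero (by positivity), ord_sq]
    exact hev.add (by simp)
  rcases eq_or_ne y 0 with rfl | hy
  · rw [hxy, show x ^ 2 - (e : F) * 0 ^ 2 = x ^ 2 by ring, ord_sq]; simp
  by_contra hodd
  obtain ⟨k, hk⟩ := hev
  have hex : v (e * y ^ 2) = 2 * (k + v y) := by
    rw [ord_mul _ e.ne_zero (by positivity), ord_sq]; omega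
  have hx2 : v (x ^ 2) = 2 * v x := by rw [ord_sq]
  have hb0 : x ^ 2 - (e : F) * y ^ 2 ≠ 0 := hxy ▸ b.ne_zero
  have hey : (e : F) * y ^ 2 ≠ 0 := mul_ne_zero e.ne_zero (by positivity)
  have heven : ∀ z w : F, z ≠ 0 → w ≠ 0 → Even (v z) → v z < v w → Even (v (z - w)) := by
    intro z w hz hw he hlt
    rw [sub_eq_add_neg, (v.ord_add_of_mem hz (y := -w) ((v.ge _).neg_mem
      ((v.mem_ge_iff hw).2 (by omega)))).2]
    exact he
  rw [hxy] at hodd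
  rcases lt_trichotomy (v (x ^ 2)) (v (e * y ^ 2)) with h | h | h
  · exact hodd (heven _ _ (by positivity) hey (by rw [hx2]; simp) h)
  · apply he
    refine ⟨y / x, by positivity, ?_⟩
    rw [hv]
    have h1 : (y / x) ^ 2 * (e : F) - 1 = -((x ^ 2 - e * y ^ 2) / x ^ 2) := by
      field_simp; ring
    rw [h1]
    refine (v.ge _).neg_mem ((v.mem_ge_iff (div_ne_zero hb0 (by positivity))).2 ?_)
    rw [ord_div _ hb0 (by positivity)]
    have h2 : v (x ^ 2) ≤ v (x ^ 2 - e * y ^ 2) := by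
      rw [← v.mem_ge_iff hb0]
      exact (v.ge _).sub_mem (v.mem_ge_self _) ((v.mem_ge_iff hey).2 h.le)
    have h3 : v (x ^ 2) ≠ v (x ^ 2 - e * y ^ 2) := by
      intro h4; exact hodd (by rw [← h4, hx2]; simp)
    omega
  · refine hodd ?_
    rw [← ord_neg, neg_sub]
    exact heven _ _ hey (by positivity) (by rw [hex]; simp) h

/-- At a place where `e` has odd valuation, `x ^ 2 - e y ^ 2` is locally a square or `-e` times
a square. -/
theorem mem_lsq_or_of_mem_normGroup {e b : Fˣ} (hv : v 2 = 0) (hodd : ¬ Even (v e))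
    (hb : b ∈ normGroup (e : F)) : b ∈ v.lsq ∨ -e * b ∈ v.lsq := by
  obtain ⟨x, y, hxy⟩ := mem_normGroup.1 hb
  rcases eq_or_ne y 0 with rfl | hy
  · left
    have hx : x ≠ 0 := by rintro rfl; simp at hxy
    have : b = (Units.mk0 x hx) ^ 2 := Units.ext (by push_cast; rw [hxy]; simp)
    rw [this]; exact v.sq_mem_lsq _
  rcases eq_or_ne x 0 with rfl | hx
  · right
    have : -e * b = (e * Units.mk0 y hy) ^ 2 :=
        Units.ext (by push_cast; rw [hxy, Units.val_mk0]; ring)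
    rw [this]; exact v.sq_mem_lsq _
  have hey : (e : F) * y ^ 2 ≠ 0 := mul_ne_zero e.ne_zero (by positivity)
  have hex : v (e * y ^ 2) = v e + 2 * v y := by
    rw [ord_mul _ e.ne_zero (by positivity), ord_sq]
  rw [Int.not_even_iff_odd] at hodd
  obtain ⟨k, hk⟩ := hodd
  rcases lt_or_ge (2 * v x) (v (e * y ^ 2)) with h | h
  · left
    refine ⟨1 / x, one_div_ne_zero hx, ?_⟩
    have h1 : (1 / x) ^ 2 * (b : F) - 1 = -((e * y ^ 2) / x ^ 2) := by
      rw [hxy]; field_simp; ring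
    rw [h1, hv]
    refine (v.ge _).neg_mem ((v.mem_ge_iff (div_ne_zero hey (by positivity))).2 ?_)
    rw [ord_div _ hey (by positivity), ord_sq]
    omega
  · right
    refine ⟨1 / (e * y), one_div_ne_zero (mul_ne_zero e.ne_zero hy), ?_⟩
    have h1 : (1 / ((e : F) * y)) ^ 2 * ((-e * b : Fˣ) : F) - 1 = -(x ^ 2 / (e * y ^ 2)) := by
      have := e.ne_zero
      push_cast; rw [hxy]; field_simp; ring
    rw [h1, hv]
    refine (v.ge _).neg_mem ((v.mem_ge_iff (div_ne_zero (by positivity) hey)).2 ?_)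
    rw [ord_div _ (by positivity) hey, ord_sq]
    omega

end Pl

end

section

open NumberField IsDedekindDomain

theorem IsQuad.isSquare_or_of_isSquare {F E : Type*} [Field F] [CharZero F] [Field E] [Algebra F E]
    {a : F} {s : E} (h : IsQuad a s) {e : F} (he : IsSquare (algebraMap F E e)) :
    IsSquare e ∨ IsSquare (e * a) := by
  obtain ⟨y, hy⟩ := he
  obtain ⟨x, z, rfl⟩ := h.span y
  have h1 : algebraMap F E e + algebraMap F E 0 * s =
      algebraMap F E (x ^ 2 + a * z ^ 2) + algebraMap F E (2 * x * z) * s := by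
    simp only [map_add, map_mul, map_pow, map_ofNat, map_zero]
    rw [hy, ← h.sq]; ring
  obtain ⟨h2, h3⟩ := h.unique h1
  rcases mul_eq_zero.1 h3.symm with h4 | h4
  · right
    have : x = 0 := by simpa using h4
    exact ⟨a * z, by rw [h2, this]; ring⟩
  · left
    exact ⟨x, by rw [h2, h4]; ring⟩

namespace Pl

theorem Over.map_mem_lsq {F E : Type*} [Field F] [Field E] [Algebra F E] {P : Pl E} {v : Pl F}
    {k : ℕ} (h : P.Over v k) {x : Fˣ} (hx : x ∈ v.lsq) :
    Units.map (algebraMap F E).toMonoidHom x ∈ P.lsq := by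
  obtain ⟨c, hc, hx⟩ := hx
  refine ⟨algebraMap F E c, by simpa using hc, ?_⟩
  have h1 := h.mem_ge hx
  have h2 := h.2 2
  rw [map_ofNat] at h2
  have h3 := h.1
  have : algebraMap F E c ^ 2 * ((Units.map (algebraMap F E).toMonoidHom x : Eˣ) : E) - 1 =
      algebraMap F E (c ^ 2 * x - 1) := by
    rw [map_sub, map_mul, map_pow, map_one]; rfl
  rw [this, h2]
  refine P.ge_anti ?_ h1
  nlinarith

variable {F : Type*} [Field F] [NumberField F]

/-- A new test place: it splits `F(√a)` and detects `e`. -/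
theorem exists_test_place {a e : Fˣ} (ha : ¬ IsSquare (a : F)) (he : ¬ IsSquare (e : F))
    (hea : ¬ IsSquare ((e * a : Fˣ) : F)) (S : Set (Pl F)) (hS : S.Finite) :
    ∃ v ∉ S, v 2 = 0 ∧ v (e : F) = 0 ∧ e ∉ v.lsq ∧ (v (a : F) = 0 → a ∈ v.lsq) := by
  obtain ⟨E, _, _, _, s, h⟩ := exists_isQuad ha
  have hes : ¬ IsSquare ((Units.map (algebraMap F E).toMonoidHom e : Eˣ) : E) := by
    intro hc
    rcases h.isSquare_or_of_isSquare hc with h1 | h1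
    · exact he h1
    · exact hea (by rwa [Units.val_mul])
  obtain ⟨P, hPS, hP2, hPe, hPl⟩ := exists_notMem_lsq _ hes (above E S) (finite_over S hS)
  obtain ⟨v, hv, k, hPv⟩ := exists_over_notMem hPS
  have hv2 : v 2 = 0 := by rw [← hPv.eq_zero_iff, map_ofNat]; exact hP2
  have hve : v e = 0 := by rw [← hPv.eq_zero_iff]; exact hPe
  refine ⟨v, hv, hv2, hve, fun hl => hPl (hPv.map_mem_lsq hl), fun hva => ?_⟩
  by_contra hal
  have h1 := v.mul_mem_lsq_of_unit hv2 hve hva (fun hl => hPl (hPv.map_mem_lsq hl)) hal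
  have h2 := hPv.map_mem_lsq h1
  rw [map_mul] at h2
  have h3 : Units.map (algebraMap F E).toMonoidHom a = (Units.mk0 s h.root_ne_zero) ^ 2 :=
    Units.ext h.sq.symm
  rw [h3, mul_sq_mem_lsq] at h2
  exact hPl h2

theorem exists_test_places {a : Fˣ} (ha : ¬ IsSquare (a : F)) (S : Finset (Pl F))
    (h2 : ∀ v ∉ S, v 2 = 0) (haS : a ∈ sUnits (S : Set (Pl F))) {s : ℕ}
    (hs : (powMonoidHom 2 : sUnits (S : Set (Pl F)) →* _).range.index = 2 ^ s) :
    ∀ k, k < s → ∃ (V : Finset (Pl F)) (η : Pl F → Fˣ), V.card = k ∧ (∀ v ∈ V, v ∉ S) ∧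
      (∀ v ∈ V, a ∈ v.lsq) ∧ (∀ v ∈ V, η v ∈ sUnits (S : Set (Pl F))) ∧
      (∀ v ∈ V, η v ∉ v.lsq) ∧ ∀ v ∈ V, ∀ w ∈ V, w ≠ v → η v ∈ w.lsq := by
  classical
  intro k
  induction k with
  | zero => exact fun _ => ⟨∅, fun _ => 1, by simp⟩
  | succ k ih =>
    intro hk
    obtain ⟨V, η, hc, hVS, hVa, hηS, hη, hηw⟩ := ih (by omega)
    have hsq : ∀ g h : sUnits (S : Set (Pl F)), IsSquare (((g * h : sUnits _) : Fˣ) : F) →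
        g * h ∈ (powMonoidHom 2 : sUnits (S : Set (Pl F)) →* _).range := by
      intro g h hgh
      obtain ⟨x, hx⟩ := hgh
      have hx0 : x ≠ 0 := by
        rintro rfl
        exact ((g * h : sUnits _) : Fˣ).ne_zero (by rw [hx]; simp)
      refine ⟨⟨Units.mk0 x hx0, fun P hP => ?_⟩, Subtype.ext (Units.ext ?_)⟩
      · have h1 := (g * h).2 P hP
        change P (((g * h : sUnits _) : Fˣ) : F) = 0 at h1
        rw [hx, ← sq, ord_sq] at h1
        rw [Units.val_mk0]; omega
      · exact (sq x).trans hx.symm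
    obtain ⟨e, heS, hev, he1, he2⟩ : ∃ e ∈ sUnits (S : Set (Pl F)), (∀ v ∈ V, e ∈ v.lsq) ∧
        ¬ IsSquare (e : F) ∧ ¬ IsSquare ((e * a : Fˣ) : F) := by
      by_contra hcon
      push Not at hcon
      let r : V.powerset × Bool → sUnits (S : Set (Pl F)) := fun x =>
        ⟨(∏ v ∈ x.1.1, η v) * (if x.2 then a else 1), mul_mem (_root_.prod_mem fun v hv =>
          hηS v (Finset.mem_powerset.1 x.1.2 hv)) (by split_ifs; exacts [haS, one_mem _])⟩
      have h3 := Subgroup.index_le_of_cover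
        (powMonoidHom 2 : sUnits (S : Set (Pl F)) →* _).range r ?_
      · rw [hs, Fintype.card_prod, Fintype.card_coe, Finset.card_powerset, hc,
          Fintype.card_bool, ← pow_succ] at h3
        exact absurd h3.2 (by rw [not_le]; exact Nat.pow_lt_pow_right (by norm_num) hk)
      · intro g
        let J := V.filter fun v => (g : Fˣ) ∉ v.lsq
        have hJV : J ⊆ V := Finset.filter_subset _ _
        have hJ : ∀ v ∈ V, (g : Fˣ) * ∏ w ∈ J, η w ∈ v.lsq := by
          intro v hv
          by_cases hvJ : v ∈ J
          · rw [← Finset.mul_prod_erase J η hvJ, ← mul_assoc]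
            refine mul_mem (v.mul_mem_lsq_of_unit (h2 v (hVS v hv)) (g.2 v (hVS v hv))
              (hηS v hv v (hVS v hv)) (Finset.mem_filter.1 hvJ).2 (hη v hv)) ?_
            exact _root_.prod_mem fun w hw => hηw w (hJV (Finset.mem_of_mem_erase hw)) v hv
              (Finset.ne_of_mem_erase hw).symm
          · refine mul_mem ?_ (_root_.prod_mem fun w hw => hηw w (hJV hw) v hv
              (by rintro rfl; exact hvJ hw))
            by_contra hg
            exact hvJ (Finset.mem_filter.2 ⟨hv, hg⟩)
        by_cases hsqe : IsSquare (((g : Fˣ) * ∏ w ∈ J, η w : Fˣ) : F)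
        · refine ⟨(⟨J, Finset.mem_powerset.2 hJV⟩, false), hsq _ _ ?_⟩
          simpa [r] using hsqe
        · refine ⟨(⟨J, Finset.mem_powerset.2 hJV⟩, true), hsq _ _ ?_⟩
          have := hcon _ (mul_mem g.2 (_root_.prod_mem fun w hw => hηS w (hJV hw))) hJ hsqe
          rw [mul_assoc] at this
          simpa [r] using this
    obtain ⟨v, hvS, hv2, hve, hvl, hva⟩ := exists_test_place ha he1 he2 (S ∪ V : Set (Pl F))
      (S.finite_toSet.union V.finite_toSet)
    have hvS' : v ∉ S := fun h => hvS (Or.inl h)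
    have hvV' : v ∉ V := fun h => hvS (Or.inr h)
    have hne : ∀ w ∈ V, w ≠ v := by rintro w hw rfl; exact hvV' hw
    let η' : Pl F → Fˣ := fun w => if w = v then e else if η w ∈ v.lsq then η w else η w * e
    have hη'v : η' v = e := if_pos rfl
    have hη'w : ∀ w ∈ V, η' w = η w ∨ η' w = η w * e := by
      intro w hw
      simp only [η', if_neg (hne w hw)]
      split_ifs <;> simp
    refine ⟨insert v V, η', by rw [Finset.card_insert_of_notMem hvV', hc], ?_, ?_, ?_, ?_, ?_⟩
    · intro w hw
      rcases Finset.mem_insert.1 hw with rfl | hw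
      exacts [hvS', hVS w hw]
    · intro w hw
      rcases Finset.mem_insert.1 hw with rfl | hw
      exacts [hva (haS _ hvS'), hVa w hw]
    · intro w hw
      rcases Finset.mem_insert.1 hw with rfl | hw
      · rw [hη'v]; exact heS
      · rcases hη'w w hw with h | h <;> rw [h]
        exacts [hηS w hw, mul_mem (hηS w hw) heS]
    · intro w hw
      rcases Finset.mem_insert.1 hw with rfl | hw
      · rwa [hη'v]
      · rcases hη'w w hw with h | h <;> rw [h]
        · exact hη w hw
        · rw [mul_mem_cancel_right (hev w hw)]; exact hη w hw
    · intro w hw u hu huw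
      rcases Finset.mem_insert.1 hw with rfl | hw'
      · rw [hη'v]
        exact hev u ((Finset.mem_insert.1 hu).resolve_left huw)
      · rcases Finset.mem_insert.1 hu with rfl | hu'
        · simp only [η', if_neg (hne w hw')]
          split_ifs with h
          · exact h
          · exact u.mul_mem_lsq_of_unit hv2 (hηS w hw' u hvS') hve h hvl
        · rcases hη'w w hw' with h | h <;> rw [h]
          exacts [hηw w hw' u hu' huw, mul_mem (hηw w hw' u hu' huw) (hev u hu')]

end Pl

end

section

open NumberField IsDedekindDomain

/-- The units that are positive at every real embedding. -/
def totPosUnits (F : Type*) [Field F] : Subgroup Fˣ where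
  carrier := {x | TotPos (x : F)}
  one_mem' φ := by simp
  mul_mem' hx hy φ := by
    rw [Units.val_mul, map_mul]; exact mul_pos (hx φ) (hy φ)
  inv_mem' hx φ := by
    rw [Units.val_inv_eq_inv_val, map_inv₀]; exact inv_pos.2 (hx φ)

/-- The units that are positive at a real embedding. -/
def posUnits {F : Type*} [Field F] (φ : F →+* ℝ) : Subgroup Fˣ where
  carrier := {x | 0 < φ x}
  one_mem' := by simp
  mul_mem' hx hy := by
    change 0 < φ _
    rw [Units.val_mul, map_mul]; exact mul_pos hx hy
  inv_mem' hx := by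
    change 0 < φ _
    rw [Units.val_inv_eq_inv_val, map_inv₀]; exact inv_pos.2 hx

theorem index_posUnits_le {F : Type*} [Field F] (φ : F →+* ℝ) :
    (posUnits φ).index ≠ 0 ∧ (posUnits φ).index ≤ 2 := by
  refine Subgroup.index_le_of_cover _ (fun i : Bool => if i then (1 : Fˣ) else -1) fun g => ?_
  have h0 : φ g ≠ 0 := by simp
  rcases lt_or_gt_of_ne h0 with h | h
  · refine ⟨false, ?_⟩
    change 0 < φ _
    simpa using h
  · refine ⟨true, ?_⟩
    change 0 < φ _
    simpa using h

theorem index_totPosUnits_le (F : Type*) [Field F] [NumberField F] :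
    (totPosUnits F).index ≠ 0 ∧ (totPosUnits F).index ≤ 2 ^ Module.finrank ℚ F := by
  classical
  let j : (F →+* ℝ) → (F →+* ℂ) := fun φ => Complex.ofRealHom.comp φ
  have hj : Function.Injective j := fun φ ψ h => by
    ext x
    have := DFunLike.congr_fun h x
    exact Complex.ofReal_injective this
  have : Finite (F →+* ℝ) := Finite.of_injective j hj
  have := Fintype.ofFinite (F →+* ℝ)
  have hc : Fintype.card (F →+* ℝ) ≤ Module.finrank ℚ F := by
    rw [← NumberField.Embeddings.card F ℂ]
    exact Fintype.card_le_of_injective j hj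
  have he : totPosUnits F = ⨅ φ : F →+* ℝ, posUnits φ := by
    ext x
    rw [Subgroup.mem_iInf]; rfl
  rw [he]
  refine ⟨Subgroup.index_iInf_ne_zero fun φ => (index_posUnits_le φ).1,
    (Subgroup.index_iInf_le _).trans ?_⟩
  calc ∏ φ : F →+* ℝ, (posUnits φ).index ≤ ∏ φ : F →+* ℝ, 2 :=
        Finset.prod_le_prod' fun φ _ => (index_posUnits_le φ).2
    _ = 2 ^ Fintype.card (F →+* ℝ) := by simp
    _ ≤ _ := Nat.pow_le_pow_right (by norm_num) hc

namespace Pl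

variable {F : Type*} [Field F]

/-- The group generated by the local squares and `-e`. -/
def oddNorm (v : Pl F) (e : Fˣ) : Subgroup Fˣ where
  carrier := {b | b ∈ v.lsq ∨ -e * b ∈ v.lsq}
  one_mem' := Or.inl (one_mem _)
  mul_mem' := by
    rintro x y (hx | hx) (hy | hy)
    · exact Or.inl (mul_mem hx hy)
    · right; rw [mul_left_comm]; exact mul_mem hx hy
    · right; rw [← mul_assoc]; exact mul_mem hx hy
    · left
      have : -e * x * (-e * y) = x * y * e ^ 2 := by
        rw [show -e * x * (-e * y) = x * y * (-e * -e) by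
          rw [mul_mul_mul_comm, mul_comm], neg_mul_neg, sq]
      have h := mul_mem hx hy
      rwa [this, v.mul_sq_mem_lsq] at h
  inv_mem' := by
    rintro x (hx | hx)
    · exact Or.inl (inv_mem hx)
    · right
      have h := hx
      have : -e * x = -e * x⁻¹ * x ^ 2 := by rw [sq, mul_assoc, inv_mul_cancel_left]
      rwa [this, v.mul_sq_mem_lsq] at h

theorem mem_oddNorm {v : Pl F} {e b : Fˣ} :
    b ∈ v.oddNorm e ↔ b ∈ v.lsq ∨ -e * b ∈ v.lsq := Iff.rfl

variable [NumberField F]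

theorem index_lsq_inf_totPosUnits_le (h : SpSplit 2 F) (S : Finset (Pl F)) :
    ((⨅ v : S, v.1.lsq) ⊓ totPosUnits F).index ≠ 0 ∧
      ((⨅ v : S, v.1.lsq) ⊓ totPosUnits F).index ≤ 2 ^ (2 * (S.card + Module.finrank ℚ F)) := by
  classical
  have hv : ∀ v : Pl F, v.lsq.index ≠ 0 ∧ v.lsq.index ≤ 4 * (if 0 < v 2 then 2 else 1) := by
    intro v
    split_ifs with h2
    · exact v.index_lsq_le_eight h h2
    · exact v.index_lsq_le_four (by have := v.ord_two_nonneg; omega)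
  have h1 := index_totPosUnits_le F
  have h0 : (⨅ v : S, v.1.lsq).index ≠ 0 := Subgroup.index_iInf_ne_zero fun v => (hv v).1
  refine ⟨Subgroup.index_inf_ne_zero h0 h1.1, Subgroup.index_inf_le.trans ?_⟩
  have h2 : (⨅ v : S, v.1.lsq).index ≤ 2 ^ (2 * S.card + Module.finrank ℚ F) := by
    refine (Subgroup.index_iInf_le _).trans ?_
    calc ∏ v : S, v.1.lsq.index ≤ ∏ v : S, 4 * (if 0 < v.1 2 then 2 else 1) :=
          Finset.prod_le_prod' fun v _ => (hv v).2
      _ = ∏ v ∈ S, 4 * (if 0 < v 2 then 2 else 1) :=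
          Finset.prod_coe_sort S fun v : Pl F => 4 * (if 0 < v 2 then 2 else 1)
      _ = 4 ^ S.card * 2 ^ (S.filter fun v : Pl F => 0 < v 2).card := by
          rw [Finset.prod_mul_distrib, Finset.prod_const, ← Finset.prod_filter, Finset.prod_const]
      _ ≤ 4 ^ S.card * 2 ^ Module.finrank ℚ F := by
          gcongr
          · norm_num
          · exact card_le_finrank (q := 2) _ fun P hP => by
              exact_mod_cast (Finset.mem_filter.1 hP).2
      _ = _ := by rw [pow_add, pow_mul]; norm_num
  calc _ ≤ 2 ^ (2 * S.card + Module.finrank ℚ F) * 2 ^ Module.finrank ℚ F := Nat.mul_le_mul h2 h1.2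
    _ = _ := by rw [← pow_add]; congr 1; ring

/-- A totally positive `S ∪ V`-unit that is a local square on `S` is a square. -/
theorem isSquare_of_mem_lsq [IsTotallyReal F] {S V : Finset (Pl F)} (h2 : ∀ v ∉ S, v 2 = 0)
    (hcl : ClTrivial (S : Set (Pl F))) [DecidableEq (Pl F)] (hVS : ∀ v ∈ V, v ∉ S) {η : Pl F → Fˣ}
    (hηS : ∀ v ∈ V, η v ∈ sUnits (S : Set (Pl F))) (hη : ∀ v ∈ V, η v ∉ v.lsq)
    (hηw : ∀ v ∈ V, ∀ w ∈ V, w ≠ v → η v ∈ w.lsq) {e : Fˣ}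
    (heS : e ∈ sUnits ((S ∪ V : Finset (Pl F)) : Set (Pl F))) (hel : ∀ v ∈ S, e ∈ v.lsq)
    (hpos : TotPos (e : F)) : IsSquare (e : F) := by
  classical
  by_contra he
  set I := V.filter fun v => e ∉ v.lsq with hI
  set S₁ := (S ∪ V).filter fun v => e ∈ v.lsq with hS₁
  have hIV : ∀ {v}, v ∈ I → v ∈ V ∧ e ∉ v.lsq := fun h => Finset.mem_filter.1 h
  have hcard : (S ∪ V).card = S₁.card + I.card := by
    rw [← Finset.card_filter_add_card_filter_not (s := S ∪ V) (fun v => e ∈ v.lsq)]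
    congr 2
    ext v
    simp only [hI, Finset.mem_filter, Finset.mem_union]
    have := hel v
    tauto
  have hsub : S ⊆ S ∪ V := Finset.subset_union_left
  obtain ⟨h0, hle⟩ := relIndex_normGroup_le (S ∪ V)
    (fun v hv => h2 v fun h => hv (hsub h))
    (fun P hP => by
      obtain ⟨x, hx, h1, h3⟩ := hcl P (fun h => hP (hsub h))
      exact ⟨x, hx, h1, fun Q hQ => h3 Q fun h => hQ (hsub h)⟩) heS he hpos S₁
    (Finset.filter_subset _ _) (fun v hv => (Finset.mem_filter.1 hv).2)
  have hρ : ∀ v : Pl F, ∃ ρ : Fˣ, v ∉ S → v (ρ : F) = 1 ∧ ∀ Q ∉ S, Q ≠ v → Q (ρ : F) = 0 := by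
    intro v
    by_cases hv : v ∈ S
    · exact ⟨1, fun h => absurd hv h⟩
    · obtain ⟨x, hx, h1, h3⟩ := hcl v hv
      exact ⟨Units.mk0 x hx, fun _ => ⟨h1, h3⟩⟩
  choose ρ hρ using hρ
  let J : Pl F → Finset (Pl F) := fun v => I.filter fun w => ¬ Even (w e) ∧ ρ v ∉ w.lsq
  have hJI : ∀ v, J v ⊆ I := fun v => Finset.filter_subset _ _
  let T : Pl F → Subgroup Fˣ := fun v => if Even (v e) then v.evenVal else v.oddNorm e
  let ε : Pl F → Fˣ := fun v => if Even (v e) then ρ v * ∏ w ∈ J v, η w else η v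
  have hsU : ∀ {x}, x ∈ sUnits (S : Set (Pl F)) →
      x ∈ sUnits ((S ∪ V : Finset (Pl F)) : Set (Pl F)) :=
    fun hx => sUnits_mono (Finset.coe_subset.2 hsub) hx
  have hηv : ∀ w ∈ I, ∀ v ∉ S, v (η w : F) = 0 := fun w hw v hv => hηS w (hIV hw).1 v hv
  have hprod : ∀ v, (∏ w ∈ J v, η w) ∈ sUnits (S : Set (Pl F)) := fun v =>
    _root_.prod_mem fun w hw => hηS w (hIV (hJI v hw)).1
  have hεv : ∀ v ∈ I, ∀ w ∉ S, Even (v e) → w (ε v : F) = w (ρ v : F) := by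
    intro v hv w hw hev
    simp only [ε, if_pos hev]
    rw [Units.val_mul, ord_mul _ (Units.ne_zero _) (Units.ne_zero _), hprod v w hw, add_zero]
  have hfin := Subgroup.two_pow_le_relIndex (sUnits ((S ∪ V : Finset (Pl F)) : Set (Pl F)))
    (normGroup (e : F)) I T ε ?_ ?_ ?_ ?_ h0
  · rw [hcard, pow_add, pow_add] at hle
    have h4 : (2 : ℕ) ^ S₁.card * 2 ^ I.card < 2 ^ S₁.card * 2 ^ I.card := by
      calc 2 ^ S₁.card * 2 ^ I.card < 2 ^ S₁.card * (2 ^ I.card * 2) := by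
            have : 0 < 2 ^ I.card := by positivity
            gcongr; omega
        _ ≤ 2 ^ S₁.card * ((normGroup (e : F)).relIndex _ * 2) := by gcongr
        _ = (normGroup (e : F)).relIndex _ * (2 ^ S₁.card * 2 ^ 1) := by ring
        _ ≤ _ := hle
    exact absurd h4 (lt_irrefl _)
  · intro v hv w hw
    have hvS := hVS v (hIV hv).1
    have hw' : w ∉ S ∧ w ≠ v := by
      have : w ∉ S ∪ V := hw
      rw [Finset.mem_union, not_or] at this
      exact ⟨this.1, by rintro rfl; exact this.2 (hIV hv).1⟩
    by_cases hev : Even (v e)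
    · rw [hεv v hv w hw'.1 hev]
      exact (hρ v hvS).2 w hw'.1 hw'.2
    · simp only [ε, if_neg hev]
      exact hηv v hv w hw'.1
  · intro v hv
    have hvS := hVS v (hIV hv).1
    by_cases hev : Even (v e)
    · simp only [T, if_pos hev, mem_evenVal, hεv v hv v hvS hev, (hρ v hvS).1]
      decide
    · simp only [T, ε, if_neg hev, mem_oddNorm, not_or]
      refine ⟨hη v (hIV hv).1, fun hc => hev ?_⟩
      have h3 := v.even_of_mem_lsq hc
      rw [Units.val_mul, ord_mul _ (Units.ne_zero _) (Units.ne_zero _), hηv v hv v hvS, add_zero,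
        Units.val_neg, ord_neg] at h3
      exact h3
  · intro v hv w hw hwv
    have hvS := hVS v (hIV hv).1
    have hwS := hVS w (hIV hw).1
    by_cases hew : Even (w e)
    · simp only [T, if_pos hew, mem_evenVal]
      by_cases hev : Even (v e)
      · rw [hεv v hv w hwS hev, (hρ v hvS).2 w hwS hwv]; simp
      · simp only [ε, if_neg hev, hηv v hv w hwS]; simp
    · simp only [T, if_neg hew, mem_oddNorm]
      left
      by_cases hev : Even (v e)
      · simp only [ε, if_pos hev]
        by_cases hwJ : w ∈ J v
        · rw [← Finset.mul_prod_erase _ _ hwJ, ← mul_assoc]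
          refine mul_mem (w.mul_mem_lsq_of_unit (h2 w hwS) ((hρ v hvS).2 w hwS hwv)
            (hηv w hw w hwS) (Finset.mem_filter.1 hwJ).2.2 (hη w (hIV hw).1)) ?_
          exact _root_.prod_mem fun u hu => hηw u (hIV (hJI v (Finset.mem_of_mem_erase hu))).1 w
            (hIV hw).1 (Finset.ne_of_mem_erase hu).symm
        · refine mul_mem ?_ (_root_.prod_mem fun u hu => hηw u (hIV (hJI v hu)).1 w (hIV hw).1
            (by rintro rfl; exact hwJ hu))
          by_contra hc
          exact hwJ (Finset.mem_filter.2 ⟨hw, hew, hc⟩)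
      · simp only [ε, if_neg hev]
        exact hηw v (hIV hv).1 w (hIV hw).1 hwv
  · rintro v hv b ⟨hb, -⟩
    have hv2 := h2 v (hVS v (hIV hv).1)
    by_cases hev : Even (v e)
    · simp only [T, if_pos hev]
      exact v.even_of_mem_normGroup hv2 (hIV hv).2 hev hb
    · simp only [T, if_neg hev]
      exact v.mem_lsq_or_of_mem_normGroup hv2 hev hb

theorem two_pow_le_index_evenVal (I : Finset (Pl F)) :
    2 ^ I.card ≤ (⨅ v : I, v.1.evenVal).index := by
  classical
  have hidx : ∀ v : Pl F, v.evenVal.index ≠ 0 := by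
    intro v
    obtain ⟨π, hπ⟩ := v.exists_unit_unif
    refine (Subgroup.index_le_of_cover _ (fun i : Bool => if i then (1 : Fˣ) else π)
      fun g => ?_).1
    by_cases h : Even (v g)
    · exact ⟨true, by simpa [mem_evenVal] using h⟩
    · refine ⟨false, ?_⟩
      simp only [Bool.false_eq_true, if_false]
      rw [mem_evenVal, Units.val_mul, ord_mul _ (Units.ne_zero _) (Units.ne_zero _), hπ,
        Int.even_add_one]
      exact h
  choose π hπ using fun v : Pl F => v.exists_unif
  have hε : ∀ v : Pl F, ∃ y : Fˣ, v ∈ I → v (y : F) = 1 ∧ ∀ w ∈ I, w ≠ v → w (y : F) = 0 := by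
    intro v
    obtain ⟨y, hy⟩ := exists_approx' (I : Set (Pl F)) I.finite_toSet
      (fun w => if w = v then π v else 1) 2
    by_cases hv : v ∈ I
    · have h1 := hy v hv
      rw [if_pos rfl] at h1
      have h3 := v.ord_eq_of_sub_mem (hπ v).1 (v.ge_anti (by rw [(hπ v).2]; norm_num) h1)
      refine ⟨Units.mk0 y h3.1, fun _ => ⟨by rw [Units.val_mk0, h3.2, (hπ v).2], ?_⟩⟩
      intro w hw hwv
      have h4 := hy w hw
      rw [if_neg hwv] at h4
      exact (w.ord_eq_zero_of_sub_one_mem (w.ge_anti (by norm_num) h4)).2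
    · exact ⟨1, fun h => absurd h hv⟩
  choose ε hε using hε
  rw [← Subgroup.relIndex_top_right]
  refine Subgroup.two_pow_le_relIndex ⊤ _ I evenVal ε (by simp) ?_ ?_ ?_ ?_
  · intro v hv
    rw [mem_evenVal, (hε v hv).1]; decide
  · intro v hv w hw hwv
    rw [mem_evenVal, (hε v hv).2 w hw hwv]; simp
  · intro v hv
    exact inf_le_left.trans (iInf_le (fun v : I => v.1.evenVal) ⟨v, hv⟩)
  · rw [Subgroup.relIndex_top_right]
    exact Subgroup.index_iInf_ne_zero fun v => hidx v

/-- Hasse norm principle for `F(√a)/F`, when `a` is totally positive, has even valuations, and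
is a square at the places over `2`. -/
theorem mem_normGroup_of_even [IsTotallyReal F] (hsp : SpSplit 2 F) {a b : Fˣ}
    (ha : ¬ IsSquare (a : F)) (hpos : TotPos (a : F)) (ha2 : ∀ v : Pl F, 0 < v 2 → a ∈ v.lsq)
    (hae : ∀ v : Pl F, Even (v a)) (hb : ∀ v : Pl F, a ∉ v.lsq → Even (v b)) :
    b ∈ normGroup (a : F) := by
  classical
  obtain ⟨S', hS', hS0, hcl⟩ := exists_classGroup_trivial
    ({v : Pl F | v 2 ≠ 0} ∪ {v : Pl F | v a ≠ 0} ∪ {v : Pl F | v b ≠ 0})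
    (((support_finite two_ne_zero).union (support_finite a.ne_zero)).union
      (support_finite b.ne_zero))
  lift S' to Finset (Pl F) using hS' with S
  have h2 : ∀ v ∉ S, v 2 = 0 := fun v hv => by
    by_contra h; exact hv (hS0 (Or.inl (Or.inl h)))
  have haS : a ∈ sUnits (S : Set (Pl F)) := fun v hv => by
    by_contra h; exact hv (hS0 (Or.inl (Or.inr h)))
  have hbS : b ∈ sUnits (S : Set (Pl F)) := fun v hv => by
    by_contra h; exact hv (hS0 (Or.inr h))
  have hrank := rank_add_one_eq (F := F)
  have hn : 0 < Module.finrank ℚ F := Module.finrank_pos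
  obtain ⟨V, η, hVc, hVS, hVa, hηS, hη, hηw⟩ := exists_test_places ha S h2 haS
    (s := S.card + Module.finrank ℚ F)
    (by rw [index_sq_sUnits, ← hrank]; congr 1; ring) (S.card + Module.finrank ℚ F - 1)
    (by omega)
  have hsub : S ⊆ S ∪ V := Finset.subset_union_left
  have hdisj : Disjoint S V := Finset.disjoint_left.2 fun v hv hvV => hVS v hvV hv
  set E := sUnits ((S ∪ V : Finset (Pl F)) : Set (Pl F)) with hE
  have hsU : sUnits (S : Set (Pl F)) ≤ E := sUnits_mono (Finset.coe_subset.2 hsub)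
  set K := (⨅ v : S, v.1.lsq) ⊓ totPosUnits F with hK
  obtain ⟨hK0, hK⟩ := index_lsq_inf_totPosUnits_le hsp S
  have hKE : 2 ^ (2 * (S.card + Module.finrank ℚ F) - 1) ≤ K.relIndex E := by
    have h3 := index_sq_sUnits (S ∪ V)
    rw [Finset.card_union_of_disjoint hdisj, hVc,
      show Units.rank F + (S.card + (S.card + Module.finrank ℚ F - 1)) + 1 =
        2 * (S.card + Module.finrank ℚ F) - 1 by omega] at h3
    rw [← h3]
    have h4 : K.subgroupOf E ≤ (powMonoidHom 2 : E →* E).range := by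
      intro x hx
      obtain ⟨hx1, hx2⟩ := Subgroup.mem_subgroupOf.1 hx
      have hx3 : ∀ v ∈ S, (x : Fˣ) ∈ v.lsq := fun v hv =>
        (Subgroup.mem_iInf.1 hx1 ⟨v, hv⟩ :)
      obtain ⟨y, hy⟩ := isSquare_of_mem_lsq h2 hcl hVS hηS hη hηw x.2 hx3 hx2
      have hy0 : y ≠ 0 := by
        rintro rfl
        exact (x : Fˣ).ne_zero (by rw [hy]; simp)
      refine ⟨⟨Units.mk0 y hy0, fun P hP => ?_⟩, Subtype.ext (Units.ext ?_)⟩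
      · have h5 : P (x : Fˣ) = 0 := x.2 P hP
        rw [hy, ← sq, ord_sq] at h5
        rw [Units.val_mk0]; omega
      · exact (sq y).trans hy.symm
    refine Nat.le_of_dvd (Nat.pos_of_ne_zero fun h => hK0 ?_) (Subgroup.index_dvd_of_le h4)
    exact Nat.eq_zero_of_zero_dvd (h ▸ Subgroup.relIndex_dvd_index_of_normal K E)
  have hsup : (E ⊔ K).index ≤ 2 := by
    have h3 := Subgroup.relIndex_mul_index (le_sup_right : K ≤ E ⊔ K)
    rw [Subgroup.relIndex_sup_right] at h3
    have h4 := Nat.mul_le_mul_right (E ⊔ K).index hKE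
    have h5 := h4.trans (h3.le.trans hK)
    rw [show 2 * (S.card + Module.finrank ℚ F) = 2 * (S.card + Module.finrank ℚ F) - 1 + 1 by omega,
      pow_succ] at h5
    exact Nat.le_of_mul_le_mul_left h5 (by positivity)
  set I := S.filter fun v => a ∉ v.lsq with hI
  have hI2 : ∀ v ∈ I, v 2 = 0 := by
    intro v hv
    by_contra h
    have := v.ord_two_nonneg
    exact (Finset.mem_filter.1 hv).2 (ha2 v (by omega))
  set W := ⨅ v : I, v.1.evenVal with hW
  have hKW : K ≤ W := by
    refine le_iInf fun v => inf_le_left.trans ?_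
    exact (iInf_le (fun v : S => v.1.lsq) ⟨v.1, (Finset.mem_filter.1 v.2).1⟩).trans
      v.1.lsq_le_evenVal
  have hPW : 2 ^ I.card ≤ W.relIndex E * 2 := by
    refine (two_pow_le_index_evenVal I).trans ?_
    rw [← Subgroup.relIndex_mul_index (le_sup_right : W ≤ E ⊔ W), Subgroup.relIndex_sup_right]
    refine Nat.mul_le_mul_left _ (le_trans ?_ hsup)
    refine Nat.le_of_dvd (Nat.pos_of_ne_zero fun h => hK0 ?_)
      (Subgroup.index_dvd_of_le (sup_le_sup_left hKW E))
    exact Nat.eq_zero_of_zero_dvd (h ▸ Subgroup.index_dvd_of_le le_sup_right)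
  set S₁ := (S ∪ V).filter fun v => a ∈ v.lsq with hS₁
  have hcard : (S ∪ V).card = S₁.card + I.card := by
    rw [← Finset.card_filter_add_card_filter_not (s := S ∪ V) (fun v => a ∈ v.lsq)]
    congr 2
    ext v
    simp only [hI, Finset.mem_filter, Finset.mem_union]
    have := hVa v
    tauto
  obtain ⟨h0, hle⟩ := relIndex_normGroup_le (S ∪ V)
    (fun v hv => h2 v fun h => hv (hsub h))
    (fun P hP => by
      obtain ⟨x, hx, h1, h3⟩ := hcl P (fun h => hP (hsub h))
      exact ⟨x, hx, h1, fun Q hQ => h3 Q fun h => hQ (hsub h)⟩) (hsU haS) ha hpos S₁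
    (Finset.filter_subset _ _) (fun v hv => (Finset.mem_filter.1 hv).2)
  have hNE : (normGroup (a : F)).relIndex E * 2 ≤ 2 ^ I.card := by
    rw [hcard, pow_add, pow_add] at hle
    have h3 : 2 ^ S₁.card * ((normGroup (a : F)).relIndex E * 2) ≤ 2 ^ S₁.card * 2 ^ I.card := by
      refine le_trans (le_of_eq ?_) hle
      ring
    exact Nat.le_of_mul_le_mul_left h3 (by positivity)
  have hle' : (normGroup (a : F)).relIndex E ≤ W.relIndex E := by omega
  have hbW : b ∈ W := by
    rw [hW, Subgroup.mem_iInf]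
    exact fun v => hb v (Finset.mem_filter.1 v.2).2
  refine Subgroup.inf_le_of_relIndex_le (K := W) ?_ hle' h0 ⟨hbW, hsU hbS⟩
  · rintro x ⟨hx, -⟩
    rw [hW, Subgroup.mem_iInf]
    intro v
    exact v.1.even_of_mem_normGroup (hI2 v v.2) (Finset.mem_filter.1 v.2).2 (hae v) hx

end Pl

end

section

open NumberField IsDedekindDomain

namespace Pl

/-- The twist of a place by an automorphism. -/
def tw {K L : Type*} [Field K] [Field L] [Algebra K L] (P : Pl L) (σ : L ≃ₐ[K] L) : Pl L :=
  P.comap (σ : L ≃+* L)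

section
variable {K L : Type*} [Field K] [Field L] [Algebra K L] (P : Pl L) (σ τ : L ≃ₐ[K] L)

@[simp] theorem tw_apply (x : L) : P.tw σ x = P (σ x) := rfl

@[simp] theorem tw_one : P.tw (1 : L ≃ₐ[K] L) = P := rfl

theorem tw_mul : P.tw (σ * τ) = (P.tw σ).tw τ := rfl

theorem mem_tw_ge {x : L} {n : ℤ} : x ∈ (P.tw σ).ge n ↔ σ x ∈ P.ge n := P.mem_comap_ge _ x n

variable {P σ}

theorem Over.tw {M : Type*} [Field M] [Algebra K M] [Algebra M L] {v : Pl M} {k : ℕ}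
    (h : P.Over v k) {ρ : M ≃ₐ[K] M} (hσ : ∀ x, algebraMap M L (ρ x) = σ (algebraMap M L x)) :
    (P.tw σ).Over (v.tw ρ) k :=
  ⟨h.1, fun x => by rw [tw_apply, tw_apply, ← h.2, hσ]⟩

end

variable {F E : Type*} [Field F] [NumberField F] [Field E] [NumberField E] [Algebra F E]

theorem exists_int_two {P Q : Pl E} (hPQ : P ≠ Q) {x y : E} (hx : x ∈ P.ge 0) (hy : y ∈ Q.ge 0)
    (n : ℕ) : ∃ z : 𝓞 E, algebraMap (𝓞 E) E z - x ∈ P.ge n ∧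
      algebraMap (𝓞 E) E z - y ∈ Q.ge n := by
  classical
  obtain ⟨x', hx'⟩ := P.exists_int_approx hx n
  obtain ⟨y', hy'⟩ := Q.exists_int_approx hy n
  obtain ⟨z, hz⟩ := exists_approx {P, Q} (Set.toFinite _) (fun R => if R = P then x' else y') n
  refine ⟨z, ?_, ?_⟩
  · have h1 := hz P (by simp)
    rw [if_pos rfl] at h1
    have := (P.ge n).sub_mem h1 hx'
    convert this using 1
    ring
  · have h1 := hz Q (by simp)
    rw [if_neg (Ne.symm hPQ)] at h1
    have := (Q.ge n).sub_mem h1 hy'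
    convert this using 1
    ring

theorem ord_eq_zero_of_mem_of_notMem {P : Pl E} {w : E} (h0 : w ∈ P.ge 0) (h1 : w ∉ P.ge 1) :
    w ≠ 0 ∧ P w = 0 := by
  have hw : w ≠ 0 := by rintro rfl; exact h1 (P.ge 1).zero_mem
  rw [mem_ge_iff _ hw] at h0 h1
  exact ⟨hw, by omega⟩

end Pl

namespace IsQuad

open Pl

variable {F E : Type*} [Field F] [NumberField F] [Field E] [NumberField E] [Algebra F E]
  {e : F} {s : E} (h : IsQuad e s) {P Q : Pl E} {v : Pl F} {k l : ℕ}
include h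

theorem tw_tw : (P.tw h.conj).tw h.conj = P := h.comap_comap P

theorem eq_or_eq_tw (hP : P.Over v k) (hQ : Q.Over v l) : Q = P ∨ Q = P.tw h.conj := by
  by_contra! hcon
  classical
  obtain ⟨z, hz⟩ := exists_approx {P, Q, Q.tw h.conj} (Set.toFinite _)
    (fun R => if R = P then 0 else 1) 1
  have hQP : Q.tw h.conj ≠ P := fun hc => hcon.2 (by rw [← hc, h.tw_tw])
  have h1 := hz P (by simp)
  have h2 := hz Q (by simp)
  have h3 := hz (Q.tw h.conj) (by simp)
  rw [if_pos rfl, map_zero, sub_zero] at h1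
  rw [if_neg hcon.1, map_one] at h2
  rw [if_neg hQP, map_one] at h3
  set y := algebraMap (𝓞 E) E z
  obtain ⟨hy0, h2⟩ := Q.ord_eq_zero_of_sub_one_mem h2
  have h3 := ((Q.tw h.conj).ord_eq_zero_of_sub_one_mem h3).2
  have hc0 : h.conj y ≠ 0 := by simpa using hy0
  have hQn : Q (algebraMap F E (h.nm y)) = 0 := by
    rw [h.algebraMap_nm, Q.ord_mul hy0 hc0, h2]
    simpa using h3
  rw [hQ.eq_zero_iff, ← hP.eq_zero_iff, h.algebraMap_nm, P.ord_mul hy0 hc0] at hQn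
  have h4 := (P.mem_ge_iff hy0).1 h1
  have h5 := ((P.tw h.conj).mem_ge_iff hy0).1 (algebraMap_mem_ge _ z)
  rw [tw_apply] at h5
  push_cast at h4
  omega

theorem exists_trace (y : E) : ∃ m : F, algebraMap F E m = y + h.conj y :=
  h.exists_of_conj_eq (by rw [map_add, h.conj_conj, add_comm])

theorem conj_mem (hP : P.tw h.conj = P) {y : E} {n : ℤ} (hy : y ∈ P.ge n) : h.conj y ∈ P.ge n := by
  rw [← mem_tw_ge, hP]; exact hy

theorem over_one (hP : P.Over v k)
    (hy : P.tw h.conj ≠ P ∨ ∃ y ∈ P.ge 0, h.conj y - y ∉ P.ge 1) : k = 1 := by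
  suffices hs : ∃ x : F, P (algebraMap F E x) = 1 by
    obtain ⟨x, hx⟩ := hs
    rw [hP.2] at hx
    have := Int.isUnit_iff.1 (IsUnit.of_mul_eq_one _ hx)
    omega
  obtain ⟨π, hπ0, hπ⟩ := P.exists_unif
  classical
  by_cases hne : P.tw h.conj = P
  · obtain ⟨y, hy0, hy⟩ := hy.resolve_left (not_not_intro hne)
    by_cases hu : π + h.conj π ∈ P.ge 2
    · obtain ⟨m, hm⟩ := h.exists_trace (π * y)
      refine ⟨m, ?_⟩
      have hw := ord_eq_zero_of_mem_of_notMem ((P.ge 0).sub_mem (h.conj_mem hne hy0) hy0) hy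
      have hx0 : -(π * (h.conj y - y)) ≠ 0 := neg_ne_zero.2 (mul_ne_zero hπ0 hw.1)
      have hx : P (-(π * (h.conj y - y))) = 1 := by
        rw [ord_neg, P.ord_mul hπ0 hw.1, hπ, hw.2, add_zero]
      rw [← hx]
      refine (P.ord_eq_of_sub_mem hx0 ?_).2
      rw [hx, hm, map_mul]
      have h3 := P.mul_mem_ge hu (h.conj_mem hne hy0)
      rw [add_zero] at h3
      rw [one_add_one_eq_two]
      convert h3 using 1
      ring
    · obtain ⟨m, hm⟩ := h.exists_trace π
      refine ⟨m, ?_⟩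
      rw [hm]
      have h1 : π ∈ P.ge 1 := (P.mem_ge_iff hπ0).2 hπ.ge
      have h2 := (P.ge 1).add_mem h1 (h.conj_mem hne h1)
      have h0 : π + h.conj π ≠ 0 := by intro h0; rw [h0] at hu; exact hu (P.ge 2).zero_mem
      rw [mem_ge_iff _ h0] at hu h2
      omega
  · obtain ⟨y, hy⟩ := exists_approx' {P, P.tw h.conj} (Set.toFinite _)
      (fun R => if R = P then π else 1) 2
    have h1 := hy P (by simp)
    have h2 := hy (P.tw h.conj) (by simp)
    rw [if_pos rfl] at h1
    rw [if_neg hne] at h2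
    obtain ⟨hy0, h1⟩ := P.ord_eq_of_sub_mem hπ0 (by rw [hπ]; exact h1)
    have h2 := ((P.tw h.conj).ord_eq_zero_of_sub_one_mem
      ((P.tw h.conj).ge_anti (by norm_num) h2)).2
    refine ⟨h.nm y, ?_⟩
    rw [h.algebraMap_nm, P.ord_mul hy0 (by simpa using hy0), h1, hπ]
    rw [tw_apply] at h2
    rw [h2, add_zero]

theorem even_of_int (hP : P.Over v k) {y : 𝓞 E}
    (hy : h.conj (algebraMap (𝓞 E) E y) - algebraMap (𝓞 E) E y ∉ P.ge 1) : Even (v e) := by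
  set z := algebraMap (𝓞 E) E y
  have hz : z ∈ P.ge 0 := algebraMap_mem_ge P y
  have hz' : h.conj z ∈ P.ge 0 := by
    rw [← mem_tw_ge]; exact algebraMap_mem_ge _ y
  obtain ⟨hw0, hw⟩ := ord_eq_zero_of_mem_of_notMem ((P.ge 0).sub_mem hz' hz) hy
  obtain ⟨c, hc⟩ := h.exists_of_conj_eq_neg (y := h.conj z - z) (by rw [map_sub, h.conj_conj]; ring)
  have hc0 : c ≠ 0 := by rintro rfl; rw [map_zero, zero_mul] at hc; exact hw0 hc.symm
  have h1 : P (algebraMap F E (c ^ 2 * e)) = 0 := by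
    rw [map_mul, map_pow, ← h.sq, ← mul_pow, hc, ord_sq, hw, mul_zero]
  rw [hP.eq_zero_iff, ord_mul _ (pow_ne_zero 2 hc0) h.ne_zero, ord_sq] at h1
  exact ⟨-v c, by omega⟩

theorem approx_of_split (hP : P.tw h.conj ≠ P) {y : E} (hy : y ∈ P.ge 0) (n : ℕ) :
    ∃ m : F, y - algebraMap F E m ∈ P.ge n := by
  classical
  obtain ⟨z, h1, h2⟩ := exists_int_two (Ne.symm hP) hy (Q := P.tw h.conj) (y := 0)
    (AddSubgroup.zero_mem _) n
  obtain ⟨m, hm⟩ := h.exists_trace (algebraMap (𝓞 E) E z)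
  refine ⟨m, ?_⟩
  rw [hm]
  rw [sub_zero, mem_tw_ge] at h2
  convert (P.ge n).neg_mem ((P.ge n).add_mem h1 h2) using 1
  ring

theorem isTotPos [IsTotallyReal E] : TotPos e := by
  intro φ
  have := h.finite
  obtain ⟨ψ, hψ⟩ : ∃ ψ : E →+* ℂ, ψ.comp (algebraMap F E) = (algebraMap ℝ ℂ).comp φ := by
    let := ((algebraMap ℝ ℂ).comp φ).toAlgebra
    let ψ := IsAlgClosed.lift (R := F) (S := E) (M := ℂ)
    exact ⟨ψ.toRingHom, by ext x; exact ψ.commutes x⟩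
  have hr : ComplexEmbedding.IsReal ψ := IsTotallyReal.complexEmbedding_isReal ψ
  have h1 : (φ e : ℂ) = ((hr.embedding s) ^ 2 : ℝ) := by
    push_cast
    rw [ComplexEmbedding.IsReal.coe_embedding_apply, ← map_pow, h.sq]
    exact (RingHom.congr_fun hψ e).symm
  have h2 : φ e = hr.embedding s ^ 2 := by exact_mod_cast h1
  rw [h2]
  have : hr.embedding s ≠ 0 := by simpa using h.root_ne_zero
  positivity

theorem mem_lsq_of_split (hP : P.Over v k) (hne : P.tw h.conj ≠ P) {u : Fˣ} (hu : (u : F) = e) :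
    u ∈ v.lsq := by
  obtain ⟨z, h1, h2⟩ := exists_int_two (Ne.symm hne) P.one_mem_ge (Q := P.tw h.conj) (y := 0)
    (AddSubgroup.zero_mem _) 1
  rw [sub_zero, mem_tw_ge] at h2
  push_cast at h1 h2
  set y := algebraMap (𝓞 E) E z
  obtain ⟨hw0, hw⟩ := P.ord_eq_zero_of_sub_one_mem (y := y - h.conj y) (by
    convert (P.ge 1).sub_mem h1 h2 using 1; ring)
  obtain ⟨c, hc⟩ := h.exists_of_conj_eq_neg (y := y - h.conj y) (by rw [map_sub, h.conj_conj]; ring)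
  obtain ⟨n, hn⟩ : ∃ n : ℕ, (n : ℤ) = 2 * v 2 + 1 :=
    ⟨(2 * v 2 + 1).toNat, Int.toNat_of_nonneg (by linarith [v.ord_two_nonneg])⟩
  obtain ⟨m, hm⟩ := h.approx_of_split hne (y := y - h.conj y) (fun _ => hw.ge) (k * n)
  have hkn : 0 < k * n := Nat.mul_pos hP.1 (by have := v.ord_two_nonneg; omega)
  have hm1 := P.ord_eq_of_sub_mem hw0 (y := algebraMap F E m) (by
    rw [← neg_sub (y - h.conj y)]
    refine (P.ge _).neg_mem (P.ge_anti ?_ hm)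
    rw [hw]; exact_mod_cast hkn)
  rw [hw, hP.eq_zero_iff] at hm1
  have hm0 : m ≠ 0 := by rintro rfl; exact hm1.1 (map_zero _)
  have hc0 : c ≠ 0 := by rintro rfl; rw [map_zero, zero_mul] at hc; exact hw0 hc.symm
  have h4 : algebraMap F E (c ^ 2 * e - m ^ 2) ∈ P.ge (k * n : ℕ) := by
    have : algebraMap F E (c ^ 2 * e - m ^ 2) =
        (y - h.conj y + algebraMap F E m) * (y - h.conj y - algebraMap F E m) := by
      rw [map_sub, map_mul, map_pow, map_pow, ← h.sq, ← mul_pow, hc]; ring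
    rw [this]
    refine P.mul_mem_ge_zero ((P.ge 0).add_mem (fun _ => hw.ge) fun _ => ?_) hm
    rw [hP.2, hm1.2, mul_zero]
  refine ⟨c / m, div_ne_zero hc0 hm0, ?_⟩
  have h5 : (c / m) ^ 2 * (u : F) - 1 = (m ^ 2)⁻¹ * (c ^ 2 * e - m ^ 2) := by
    rw [hu]; field_simp
  rw [h5]
  refine v.mul_mem_ge_zero (fun _ => by rw [ord_inv, ord_sq, hm1.2]; simp) fun h0 => ?_
  have h6 := h4 ((map_ne_zero _).2 h0)
  rw [hP.2, Nat.cast_mul, hn] at h6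
  exact le_of_mul_le_mul_left h6 (by exact_mod_cast hP.1)

end IsQuad

namespace Pl

variable {K L : Type*} [Field K] [Field L] [NumberField L] [Algebra K L]

/-- All inertia groups of `L` over `K` are trivial. -/
def NoInertia (K L : Type*) [Field K] [Field L] [NumberField L] [Algebra K L] : Prop :=
  ∀ σ : L ≃ₐ[K] L, σ ≠ 1 → ∀ P : Pl L,
    ∃ y : 𝓞 L, σ (algebraMap (𝓞 L) L y) - algebraMap (𝓞 L) L y ∉ P.ge 1

theorem exists_int_of_tw_ne {P : Pl L} {σ : L ≃ₐ[K] L} (h : P.tw σ ≠ P) :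
    ∃ y : 𝓞 L, σ (algebraMap (𝓞 L) L y) - algebraMap (𝓞 L) L y ∉ P.ge 1 := by
  obtain ⟨z, h1, h2⟩ := exists_int_two (Ne.symm h) P.one_mem_ge (Q := P.tw σ) (y := 0)
    (AddSubgroup.zero_mem _) 1
  refine ⟨z, fun h3 => ?_⟩
  rw [sub_zero, mem_tw_ge] at h2
  push_cast at h1 h2
  have h4 := (P.ge 1).sub_mem ((P.ge 1).sub_mem h2 h3) h1
  have : (1 : L) ∈ P.ge 1 := by convert h4 using 1; ring
  have := this one_ne_zero
  simp at this

theorem exists_int_of_mem {P : Pl L} {σ : L ≃ₐ[K] L} {y : L} (hy : y ∈ P.ge 0)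
    (h : σ y - y ∉ P.ge 1) :
    ∃ y : 𝓞 L, σ (algebraMap (𝓞 L) L y) - algebraMap (𝓞 L) L y ∉ P.ge 1 := by
  by_cases hP : P.tw σ = P
  · obtain ⟨z, hz⟩ := P.exists_int_approx hy 1
    refine ⟨z, fun h3 => h ?_⟩
    have h4 : σ (y - algebraMap (𝓞 L) L z) ∈ P.ge 1 := by
      rw [← mem_tw_ge, hP]; exact_mod_cast hz
    push_cast at hz
    rw [map_sub] at h4
    convert (P.ge 1).add_mem ((P.ge 1).sub_mem h4 hz) h3 using 1
    ring
  · exact exists_int_of_tw_ne hP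

theorem SpSplit.tw_ne {q : ℕ} [Fact q.Prime] (hs : SpSplit q L) {P : Pl L} (hP : 0 < P (q : L))
    {σ : L ≃ₐ[K] L}
    (h : ∃ y : 𝓞 L, σ (algebraMap (𝓞 L) L y) - algebraMap (𝓞 L) L y ∉ P.ge 1) : P.tw σ ≠ P := by
  intro hc
  obtain ⟨y, hy⟩ := h
  obtain ⟨i, hi⟩ := hs.approx hP (algebraMap_mem_ge P y) 1
  refine hy ?_
  have h4 : σ (algebraMap (𝓞 L) L y - i) ∈ P.ge 1 := by
    rw [← mem_tw_ge, hc]; exact_mod_cast hi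
  push_cast at hi
  rw [map_sub, map_intCast] at h4
  convert (P.ge 1).sub_mem h4 hi using 1
  ring

end Pl

end

section

/-- The (multiplicative, inhomogeneous) two-cocycle condition. -/
def IsCocycle {G A : Type*} [Group G] [CommGroup A] [MulDistribMulAction G A]
    (f : G → G → A) : Prop :=
  ∀ g h k, f g h * f (g * h) k = g • f h k * f g (h * k)

/-- The coboundary of a one-cochain. -/
def cob {G A : Type*} [Group G] [CommGroup A] [MulDistribMulAction G A] (x : G → A) (g h : G) : A :=
  x g * g • x h / x (g * h)

namespace IsCocycle

variable {G A : Type*} [Group G] [CommGroup A] [MulDistribMulAction G A] {f : G → G → A}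

theorem _root_.cob_mul (x y : G → A) : cob (x * y) = cob x * cob y := by
  funext g h
  simp only [cob, Pi.mul_apply, smul_mul']
  rw [div_mul_div_comm, mul_mul_mul_comm]

theorem _root_.isCocycle_cob (x : G → A) : IsCocycle (cob x) := by
  intro g h k
  simp only [cob, smul_mul', smul_div', mul_smul, mul_assoc]
  rw [div_mul_div_comm, div_mul_eq_mul_div, mul_div_assoc', div_div, div_eq_div_iff_mul_eq_mul]
  simp only [mul_comm, mul_left_comm, mul_assoc]

theorem div {f' : G → G → A} (hf : IsCocycle f) (hf' : IsCocycle f') : IsCocycle (f / f') := by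
  intro g h k
  simp only [Pi.div_apply, smul_div']
  rw [div_mul_div_comm, div_mul_div_comm, hf, hf']

theorem one_left (hf : IsCocycle f) (k : G) : f 1 k = f 1 1 := by
  have := hf 1 1 k
  simp only [mul_one, one_mul, one_smul] at this
  exact (mul_right_cancel this).symm

theorem one_right (hf : IsCocycle f) (g : G) : f g 1 = g • f 1 1 := by
  have := hf g 1 1
  simp only [mul_one] at this
  exact mul_right_cancel this

variable {z : G}

/-- Normalisation along the quotient by a central subgroup of order two, first step. -/
theorem exists_right (hf : IsCocycle f) (h1 : f 1 1 = 1) (hz : z * z = 1) (hz1 : z ≠ 1)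
    (hzz : f z z = 1) : ∃ x : G → A, (f / cob x) 1 1 = 1 ∧ ∀ g, (f / cob x) g z = 1 := by
  classical
  have hzzg : ∀ g, g * z * z = g := fun g => by rw [mul_assoc, hz, mul_one]
  obtain ⟨r, hr, hrz, hr1⟩ : ∃ r : G → G, (∀ g, r g = g ∨ r g = g * z) ∧
      (∀ g, r (g * z) = r g) ∧ r 1 = 1 := by
    let r := fun g : G => if g = 1 ∨ g = z then 1 else
      if WellOrderingRel g (g * z) then g else g * z
    refine ⟨r, fun g => ?_, fun g => ?_, if_pos (Or.inl rfl)⟩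
    · by_cases h : g = 1 ∨ g = z
      · have : r g = 1 := if_pos h
        rcases h with rfl | rfl
        · exact Or.inl this
        · exact Or.inr (by rw [this, hz])
      · by_cases h' : WellOrderingRel g (g * z)
        · left; simp only [r]; rw [if_neg h, if_pos h']
        · right; simp only [r]; rw [if_neg h, if_neg h']
    · by_cases h : g = 1 ∨ g = z
      · have h' : g * z = 1 ∨ g * z = z := by
          rcases h with rfl | rfl
          · exact Or.inr (one_mul _)
          · exact Or.inl hz
        simp only [r]; rw [if_pos h, if_pos h']
      · have h' : ¬ (g * z = 1 ∨ g * z = z) := by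
          rintro (h' | h')
          · exact h (Or.inr (by rw [← hzzg g, h', one_mul]))
          · exact h (Or.inl (by rw [← hzzg g, h', hz]))
        simp only [r]; rw [if_neg h, if_neg h', hzzg]
        have hne : g ≠ g * z := fun hc => hz1 (by simpa using hc.symm)
        rcases trichotomous_of WellOrderingRel g (g * z) with h2 | h2 | h2
        · rw [if_pos h2, if_neg (asymm_of WellOrderingRel h2)]
        · exact absurd h2 hne
        · rw [if_pos h2, if_neg (asymm_of WellOrderingRel h2)]
  have hf1 : ∀ g, f 1 g = 1 := fun g => by rw [hf.one_left, h1]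
  let x : G → A := fun g => if g = r g then 1 else (f (r g) z)⁻¹
  have hx1 : x 1 = 1 := if_pos hr1.symm
  have hrz1 : r z = 1 := by rw [← one_mul z, hrz, hr1]
  have hxz : x z = 1 := by
    simp only [x]; rw [hrz1, if_neg hz1, hf1, inv_one]
  set f' := f / cob x with hf'
  have hc : IsCocycle f' := hf.div (isCocycle_cob x)
  have h1' : f' 1 1 = 1 := by simp [hf', cob, h1, hx1]
  refine ⟨x, h1', ?_⟩
  have hzz' : f' z z = 1 := by simp [hf', cob, hzz, hxz, hz, hx1]
  have hrr : ∀ g, r g = g → f' g z = 1 := by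
    intro g hg
    have hxg : x g = 1 := if_pos hg.symm
    have hne : g * z ≠ r (g * z) := by
      rw [hrz, hg]; intro hc; exact hz1 (by simpa using hc)
    have hxgz : x (g * z) = (f g z)⁻¹ := by
      simp only [x]; rw [if_neg hne, hrz, hg]
    simp [hf', cob, hxg, hxgz, hxz]
  intro g
  rcases hr g with h | h
  · exact hrr g h
  · have h2 : r (g * z) = g * z := by rw [hrz, h]
    have h3 := hc (g * z) z z
    rw [hrr _ h2, hzz', hzzg, hz, hc.one_right, h1', smul_one, one_mul, mul_one] at h3
    exact h3

/-- Normalisation along the quotient by a central subgroup of order two, second step. -/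
theorem exists_left (hf : IsCocycle f) (h1 : f 1 1 = 1) (hz : z * z = 1)
    (hcen : ∀ g, g * z = z * g) (h90 : ∀ u : A, u * z • u = 1 → ∃ w, u = w / z • w)
    (hr : ∀ g, f g z = 1) :
    ∃ x : G → A, (∀ g, (f / cob x) g z = 1) ∧ ∀ g, (f / cob x) z g = 1 := by
  classical
  have hf1 : ∀ g, f 1 g = 1 := fun g => by rw [hf.one_left, h1]
  have hu : ∀ g, f z (g * z) = f z g := by
    intro g
    have := hf z g z
    rw [hr, hr, smul_one, mul_one, one_mul] at this
    exact this.symm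
  have hu2 : ∀ g, f z g * z • f z g = 1 := by
    intro g
    have := hf z z g
    rw [hr, hz, hf1, ← hcen, hu] at this
    rw [mul_comm, ← this, one_mul]
  have hΦ : ∃ Φ : A → A, Φ 1 = 1 ∧ ∀ u, u * z • u = 1 → u = z • Φ u / Φ u := by
    choose! Φ hΦ using h90
    refine ⟨fun u => if u = 1 then 1 else (Φ u)⁻¹, if_pos rfl, fun u h => ?_⟩
    by_cases h' : u = 1
    · simp [h']
    · simp only [if_neg h', smul_inv', div_inv_eq_mul]
      rw [mul_comm, ← div_eq_mul_inv]
      exact hΦ u h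
  obtain ⟨Φ, hΦ1, hΦ⟩ := hΦ
  refine ⟨fun g => Φ (f z g), fun g => ?_, fun g => ?_⟩
  · simp [cob, hr, hu, hΦ1]
  · have := hΦ _ (hu2 g)
    simp only [Pi.div_apply, cob, hr, hΦ1, ← hcen, hu, one_mul]
    rw [← this, div_self']

theorem exists_normalized (hf : IsCocycle f) (h1 : f 1 1 = 1) (hz : z * z = 1) (hz1 : z ≠ 1)
    (hcen : ∀ g, g * z = z * g) (h90 : ∀ u : A, u * z • u = 1 → ∃ w, u = w / z • w)
    {y : A} (hy : f z z = y * z • y) :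
    ∃ x : G → A, (∀ g, (f / cob x) g z = 1) ∧ ∀ g, (f / cob x) z g = 1 := by
  classical
  let x₁ : G → A := fun g => if g = z then y else 1
  have hx1 : x₁ 1 = 1 := if_neg hz1.symm
  have hxz : x₁ z = y := if_pos rfl
  have hf₁ := hf.div (isCocycle_cob x₁)
  obtain ⟨x₂, ha, hb⟩ := hf₁.exists_right (by simp [cob, h1, hx1]) hz hz1
    (by simp [cob, hy, hxz, hz, hx1])
  have hf₂ := hf₁.div (isCocycle_cob x₂)
  obtain ⟨x₃, hc, hd⟩ := hf₂.exists_left ha hz hcen h90 hb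
  refine ⟨x₁ * x₂ * x₃, ?_⟩
  rw [cob_mul, cob_mul, ← div_div, ← div_div]
  exact ⟨hc, hd⟩

theorem apply_mul_right (hf : IsCocycle f) (hr : ∀ g, f g z = 1) (g h : G) :
    f g (h * z) = f g h := by
  have := hf g h z
  rw [hr, hr, smul_one, mul_one, one_mul] at this
  exact this.symm

theorem apply_mul_left (hf : IsCocycle f) (hcen : ∀ g, g * z = z * g) (hr : ∀ g, f g z = 1)
    (hl : ∀ g, f z g = 1) (g h : G) : f (g * z) h = f g h := by
  have := hf g z h
  rwa [hr, hl, smul_one, one_mul, one_mul, ← hcen, hf.apply_mul_right hr] at this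

theorem smul_eq (hf : IsCocycle f) (hcen : ∀ g, g * z = z * g) (hr : ∀ g, f g z = 1)
    (hl : ∀ g, f z g = 1) (g h : G) : z • f g h = f g h := by
  have := hf z g h
  rw [hl, hl, ← hcen, hf.apply_mul_left hcen hr hl, mul_one, one_mul] at this
  exact this.symm

end IsCocycle

end

section

open NumberField IsDedekindDomain

/-- `L` is quadratic over `M` with conjugation `z`, and `Gal(M/K)` is the quotient by `z`. -/
structure QuadTower {K M L : Type*} [Field K] [Field M] [Field L] [Algebra K M] [Algebra K L]
    [Algebra M L] (e : M) (s : L) (z : L ≃ₐ[K] L) (π : (L ≃ₐ[K] L) →* (M ≃ₐ[K] M)) : Prop where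
  quad : IsQuad e s
  conj_eq : ∀ y, quad.conj y = z y
  compat : ∀ σ x, algebraMap M L (π σ x) = σ (algebraMap M L x)
  surj : Function.Surjective π
  ker : ∀ σ, π σ = 1 → σ = 1 ∨ σ = z
  central : ∀ σ, σ * z = z * σ

namespace QuadTower

open Pl

variable {K M L : Type*} [Field K] [Field M] [Field L] [NumberField M] [NumberField L]
  [Algebra K M] [Algebra K L] [Algebra M L] {e : M} {s : L} {z : L ≃ₐ[K] L}
  {π : (L ≃ₐ[K] L) →* (M ≃ₐ[K] M)} (h : QuadTower e s z π) {P Q : Pl L} {v : Pl M} {k l : ℕ}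
include h

theorem tw_conj : P.tw h.quad.conj = P.tw z := Pl.ext fun x => by
  rw [tw_apply, tw_apply, h.conj_eq]

theorem z_z (y : L) : z (z y) = y := by
  rw [← h.conj_eq, ← h.conj_eq, h.quad.conj_conj]

theorem mul_self : z * z = 1 := AlgEquiv.ext h.z_z

theorem z_root : z s = -s := by rw [← h.conj_eq, h.quad.conj_root]

theorem ne_one : z ≠ 1 := by
  intro hc
  have := h.z_root
  rw [hc, AlgEquiv.one_apply, eq_comm, neg_eq_self] at this
  exact h.quad.root_ne_zero this

theorem map_z : π z = 1 := AlgEquiv.ext fun x => (algebraMap M L).injective <| by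
  rw [h.compat, ← h.conj_eq, AlgEquiv.commutes, AlgEquiv.one_apply]

theorem eq_or_of_map_eq {σ τ : L ≃ₐ[K] L} (hst : π σ = π τ) : τ = σ ∨ τ = σ * z := by
  rcases h.ker (σ⁻¹ * τ) (by rw [map_mul, map_inv, hst, inv_mul_cancel]) with h1 | h1
  · left; exact (inv_mul_eq_one.1 h1).symm
  · right; exact inv_mul_eq_iff_eq_mul.1 h1

theorem eq_or_eq_tw (hP : P.Over v k) (hQ : Q.Over v l) : Q = P ∨ Q = P.tw z := by
  rw [← h.tw_conj]; exact h.quad.eq_or_eq_tw hP hQ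

theorem tw_z_tw_z (P : Pl L) : (P.tw z).tw z = P := by rw [← tw_mul, h.mul_self, tw_one]

theorem over_tw (hP : P.Over v k) (σ : L ≃ₐ[K] L) : (P.tw σ).Over (v.tw (π σ)) k :=
  hP.tw fun x => h.compat σ x

theorem exists_of_fixed {y : L} (hy : z y = y) : ∃ a, algebraMap M L a = y :=
  h.quad.exists_of_conj_eq (by rw [h.conj_eq, hy])

theorem map_mem_ge_one_iff (hP : P.Over v k) (σ : L ≃ₐ[K] L) (m : M) :
    σ (algebraMap M L m) - algebraMap M L m ∈ P.ge 1 ↔ π σ m - m ∈ v.ge 1 := by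
  rw [← h.compat, ← map_sub]
  by_cases h0 : π σ m - m = 0
  · simp [h0]
  · rw [mem_ge_iff _ h0, mem_ge_iff _ ((map_ne_zero _).2 h0)]
    exact (hP.pos_iff _)

theorem mem_ge_zero_of (hP : P.Over v k) {m : M} (hm : algebraMap M L m ∈ P.ge 0) :
    m ∈ v.ge 0 := by
  intro h0
  have := hm ((map_ne_zero _).2 h0)
  rw [hP.2] at this
  exact nonneg_of_mul_nonneg_right this (by exact_mod_cast hP.1)

/-- Trivial inertia descends along a quadratic step. -/
theorem noInertia (hN : NoInertia K L) : NoInertia K M := by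
  intro σ' hσ' v
  by_cases hv : v.tw σ' = v
  swap
  · exact exists_int_of_tw_ne hv
  obtain ⟨P, k, hP⟩ := exists_above (F := L) v
  obtain ⟨σ, hσ, hPσ⟩ : ∃ σ, π σ = σ' ∧ P.tw σ = P := by
    obtain ⟨σ, hσ⟩ := h.surj σ'
    have h1 := h.over_tw hP σ
    rw [hσ, hv] at h1
    rcases h.eq_or_eq_tw hP h1 with h2 | h2
    · exact ⟨σ, hσ, h2⟩
    · exact ⟨σ * z, by rw [map_mul, hσ, h.map_z, mul_one], by rw [tw_mul, h2, h.tw_z_tw_z]⟩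
  have hσ1 : σ ≠ 1 := by rintro rfl; exact hσ' (by rw [← hσ, map_one])
  have hσz : z * σ ≠ 1 := by
    intro hc
    refine hσ' ?_
    have := congrArg π hc
    rwa [map_mul, h.map_z, one_mul, map_one, hσ] at this
  have hmem : ∀ {n : ℤ} {y : L}, y ∈ P.ge n → σ y ∈ P.ge n := fun hy => by
    rw [← mem_tw_ge, hPσ]; exact hy
  suffices hs : ∃ m : M, algebraMap M L m ∈ P.ge 0 ∧
      σ (algebraMap M L m) - algebraMap M L m ∉ P.ge 1 by
    obtain ⟨m, hm0, hm⟩ := hs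
    rw [h.map_mem_ge_one_iff hP, hσ] at hm
    exact exists_int_of_mem (h.mem_ge_zero_of hP hm0) hm
  by_cases hz : P.tw z = P
  · by_contra! hcon
    have hzmem : ∀ {n : ℤ} {y : L}, y ∈ P.ge n → z y ∈ P.ge n := fun hy => by
      rw [← mem_tw_ge, hz]; exact hy
    have hfix : ∀ w : L, w ∈ P.ge 0 → z w = w → σ w - w ∈ P.ge 1 := by
      intro w hw hzw
      obtain ⟨m, rfl⟩ := h.exists_of_fixed hzw
      exact hcon m hw
    have key : ∀ y ∈ P.ge 0, σ y - y ∈ P.ge 1 ∨ σ y - z y ∈ P.ge 1 := by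
      intro y hy
      have h1 := hfix (y + z y) ((P.ge 0).add_mem hy (hzmem hy))
        (by rw [map_add, h.z_z, add_comm])
      have h2 := hfix (y * z y) (P.mul_mem_ge_zero hy (hzmem hy))
        (by rw [map_mul, h.z_z, mul_comm])
      have h3 : (σ y - y) * (σ y - z y) ∈ P.ge 1 := by
        have := (P.ge 1).sub_mem (P.mul_mem_ge_zero (hmem hy) h1) h2
        convert this using 1
        rw [map_add, map_mul]; ring
      by_contra! h4
      have h5 := ord_eq_zero_of_mem_of_notMem ((P.ge 0).sub_mem (hmem hy) hy) h4.1
      have h6 := ord_eq_zero_of_mem_of_notMem ((P.ge 0).sub_mem (hmem hy) (hzmem hy)) h4.2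
      have := h3 (mul_ne_zero h5.1 h6.1)
      rw [P.ord_mul h5.1 h6.1, h5.2, h6.2] at this
      omega
    obtain ⟨y₁, hy₁⟩ := hN σ hσ1 P
    obtain ⟨y₂, hy₂⟩ := hN (z * σ) hσz P
    set a := algebraMap (𝓞 L) L y₁
    set b := algebraMap (𝓞 L) L y₂
    have ha := algebraMap_mem_ge P y₁
    have hb := algebraMap_mem_ge P y₂
    have hb' : σ b - z b ∉ P.ge 1 := by
      intro hc
      refine hy₂ ?_
      have := hzmem hc
      rwa [map_sub, h.z_z] at this
    have ha1 := (key a ha).resolve_left hy₁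
    have hb1 := (key b hb).resolve_right hb'
    rcases key (a + b) ((P.ge 0).add_mem ha hb) with h1 | h1
    · refine hy₁ ?_
      convert (P.ge 1).sub_mem h1 hb1 using 1
      rw [map_add]; ring
    · refine hb' ?_
      convert (P.ge 1).sub_mem h1 ha1 using 1
      rw [map_add, map_add]; ring
  · obtain ⟨y, hy⟩ := hN σ hσ1 P
    obtain ⟨m, hm⟩ := h.quad.approx_of_split (by rwa [h.tw_conj]) (algebraMap_mem_ge P y) 1
    push_cast at hm
    refine ⟨m, ?_, fun hc => hy ?_⟩
    · convert (P.ge 0).sub_mem (algebraMap_mem_ge P y) (P.ge_anti zero_le_one hm) using 1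
      ring
    · have h1 := hmem hm
      rw [map_sub] at h1
      convert (P.ge 1).add_mem ((P.ge 1).sub_mem h1 hm) hc using 1
      ring

theorem over_one (hN : NoInertia K L) (hP : P.Over v k) : k = 1 := by
  obtain ⟨y, hy⟩ := hN z h.ne_one P
  refine h.quad.over_one hP (Or.inr ⟨_, algebraMap_mem_ge P y, ?_⟩)
  rwa [h.conj_eq]

/-- The idelic obstruction for the value at `(z, z)` of a cocycle vanishes. -/
theorem exists_norm [IsTotallyReal M] [IsTotallyReal L] (hs : SpSplit 2 L) (hN : NoInertia K L)
    {b : Lˣ} (hb : z b = b) (hev : ∀ P : Pl L, P.tw z = P → Even (P b)) :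
    ∃ y : Lˣ, b = y * z • y := by
  obtain ⟨b', hb'⟩ := h.exists_of_fixed hb
  have hb0 : b' ≠ 0 := by rintro rfl; rw [map_zero] at hb'; exact b.ne_zero hb'.symm
  have hsM : SpSplit 2 M := hs.of_algebra
  have hnorm := mem_normGroup_of_even hsM (a := Units.mk0 e h.quad.ne_zero)
    (b := Units.mk0 b' hb0) h.quad.nonsq h.quad.isTotPos (fun v hv => by
      obtain ⟨P, k, hP⟩ := exists_above (F := L) v
      refine h.quad.mem_lsq_of_split hP ?_ rfl
      rw [h.tw_conj]
      refine hs.tw_ne ?_ (hN z h.ne_one P)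
      have := hP.2 2
      rw [map_ofNat] at this
      push_cast
      rw [this]
      exact mul_pos (by exact_mod_cast hP.1) hv) (fun v => by
      obtain ⟨P, k, hP⟩ := exists_above (F := L) v
      obtain ⟨y, hy⟩ := hN z h.ne_one P
      exact h.quad.even_of_int hP (y := y) (by rwa [h.conj_eq])) (fun v hv => by
      obtain ⟨P, k, hP⟩ := exists_above (F := L) v
      obtain rfl := h.over_one hN hP
      have h1 : P.tw z = P := by
        by_contra hne
        exact hv (h.quad.mem_lsq_of_split hP (by rwa [h.tw_conj]) rfl)
      have h2 := hev P h1
      rw [← hb', hP.2, Nat.cast_one, one_mul] at h2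
      exact h2)
  obtain ⟨x, y, hxy⟩ := hnorm
  have h1 := h.quad.norm_mk x y
  rw [h.conj_eq, Units.val_mk0] at *
  rw [Units.val_mk0] at hxy
  rw [← hxy, hb'] at h1
  refine ⟨Units.mk0 _ (left_ne_zero_of_mul (h1.trans_ne b.ne_zero)), Units.ext h1.symm⟩

theorem hilbert90 {u : L} (hu : u * z u = 1) : ∃ w, w ≠ 0 ∧ u * z w = w := by
  by_cases h1 : 1 + u = 0
  · obtain rfl : u = -1 := by linear_combination h1
    exact ⟨s, h.quad.root_ne_zero, by rw [h.z_root]; ring⟩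
  · exact ⟨1 + u, h1, by rw [map_add, map_one]; linear_combination hu⟩

theorem hilbert90_units (u : Lˣ) (hu : u * z • u = 1) : ∃ w : Lˣ, u = w / z • w := by
  obtain ⟨w, hw0, hw⟩ := h.hilbert90 (u := u) (by simpa using congrArg Units.val hu)
  refine ⟨Units.mk0 w hw0, eq_div_of_mul_eq' (Units.ext hw)⟩

end QuadTower

end

section

open NumberField IsDedekindDomain

universe u

theorem exists_quadTower {K L : Type*} [Field K] [Field L] [NumberField K] [NumberField L]
    [Algebra K L] [IsGalois K L] (hG : IsPGroup 2 (L ≃ₐ[K] L)) [Nontrivial (L ≃ₐ[K] L)] :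
    ∃ (M : IntermediateField K L) (e : M) (s : L) (z : L ≃ₐ[K] L)
      (π : (L ≃ₐ[K] L) →* (M ≃ₐ[K] M)), QuadTower e s z π ∧ IsGalois K M ∧ z ≠ 1 := by
  have : FiniteDimensional K L := Module.Finite.of_restrictScalars_finite ℚ K L
  obtain ⟨z, hz, hz2⟩ : ∃ z ∈ Subgroup.center (L ≃ₐ[K] L), orderOf z = 2 := by
    have := hG.center_nontrivial
    obtain ⟨w, hw⟩ := exists_ne (1 : Subgroup.center (L ≃ₐ[K] L))
    obtain ⟨n, hn⟩ := (IsPGroup.iff_orderOf.1 (hG.to_subgroup (Subgroup.center _))) w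
    have hn0 : n ≠ 0 := by
      rintro rfl; rw [pow_zero, orderOf_eq_one_iff] at hn; exact hw hn
    obtain ⟨m, rfl⟩ := Nat.exists_eq_succ_of_ne_zero hn0
    refine ⟨_, (w ^ 2 ^ m).2, ?_⟩
    rw [Subgroup.orderOf_coe, orderOf_pow' _ (by positivity), hn, Nat.gcd_eq_right
      (pow_dvd_pow 2 (Nat.le_succ m)), pow_succ, Nat.mul_div_cancel_left _ (by positivity)]
  have hz1 : z ≠ 1 := by rintro rfl; simp at hz2
  have hzz : z * z = 1 := by rw [← sq, ← hz2, pow_orderOf_eq_one]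
  have hzzy : ∀ y, z (z y) = y := fun y => by rw [← AlgEquiv.mul_apply, hzz, AlgEquiv.one_apply]
  have hcen : ∀ σ, σ * z = z * σ := fun σ => Subgroup.mem_center_iff.1 hz σ
  have hN : (Subgroup.zpowers z).Normal := by
    refine ⟨fun n hn g => ?_⟩
    obtain ⟨i, rfl⟩ := Subgroup.mem_zpowers_iff.1 hn
    have : g * z ^ i = z ^ i * g := (Commute.zpow_right (hcen g) i).eq
    rw [this, mul_inv_cancel_right]; exact hn
  let M := IntermediateField.fixedField (Subgroup.zpowers z)
  have hM : ∀ y : L, z y = y → y ∈ M := by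
    intro y hy
    rw [IntermediateField.mem_fixedField_iff]
    intro σ hσ
    obtain ⟨i, rfl⟩ := Subgroup.mem_zpowers_iff.1 hσ
    exact MulAction.mem_stabilizer_iff.1 ((MulAction.stabilizer (L ≃ₐ[K] L) y).zpow_mem
      (MulAction.mem_stabilizer_iff.2 hy) i)
  have hM' : ∀ y : M, z (y : L) = y := fun y =>
    (IntermediateField.mem_fixedField_iff _ _).1 y.2 z (Subgroup.mem_zpowers z)
  have hgal : IsGalois K M := inferInstance
  obtain ⟨y, hy⟩ : ∃ y, z y ≠ y := by
    by_contra! hcon; exact hz1 (AlgEquiv.ext hcon)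
  let s := y - z y
  have hs0 : s ≠ 0 := sub_ne_zero.2 (Ne.symm hy)
  have hzs : z s = -s := by simp only [s]; rw [map_sub, hzzy, neg_sub]
  let e : M := ⟨s ^ 2, hM _ (by rw [map_pow, hzs, neg_sq])⟩
  have hq : IsQuad e s := by
    refine ⟨?_, rfl, fun y => ?_⟩
    · rintro ⟨c, hc⟩
      have hc' : s ^ 2 = (c : L) * c := congrArg Subtype.val hc
      rw [← sq, sq_eq_sq_iff_eq_or_eq_neg] at hc'
      have : z s = s := by
        rcases hc' with h | h
        · rw [h, hM']
        · rw [h, map_neg, hM']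
      rw [hzs, neg_eq_self] at this
      exact hs0 this
    · refine ⟨⟨(y + z y) / 2, hM _ ?_⟩, ⟨(y - z y) / (2 * s), hM _ ?_⟩, ?_⟩
      · rw [map_div₀, map_add, hzzy, map_ofNat, add_comm]
      · rw [map_div₀, map_mul, map_sub, hzzy, hzs, map_ofNat, mul_neg, div_neg, ← neg_div, neg_sub]
      · change y = (y + z y) / 2 + (y - z y) / (2 * s) * s
        field_simp; ring
  refine ⟨M, e, s, z, AlgEquiv.restrictNormalHom M, ⟨hq, fun y => ?_, fun σ x => ?_, ?_, ?_, hcen⟩,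
    hgal, hz1⟩
  · obtain ⟨a, b, rfl⟩ := hq.span y
    rw [map_add, map_mul, hq.conj.commutes, hq.conj.commutes, hq.conj_root, map_add, map_mul, hzs]
    congr 1
    · exact (hM' a).symm
    · exact congrArg (· * -s) (hM' b).symm
  · exact AlgEquiv.restrictNormal_commutes σ M x
  · exact AlgEquiv.restrictNormalHom_surjective L
  · intro σ hσ
    have h1 : σ ∈ (AlgEquiv.restrictNormalHom (F := K) (K₁ := L) M).ker := hσ
    rw [IntermediateField.restrictNormalHom_ker, IntermediateField.fixingSubgroup_fixedField] at h1
    obtain ⟨i, rfl⟩ := Subgroup.mem_zpowers_iff.1 h1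
    rw [← zpow_mod_orderOf, hz2]
    have h2 : i % ((2 : ℕ) : ℤ) = 0 ∨ i % ((2 : ℕ) : ℤ) = 1 := by omega
    rcases h2 with h | h <;> rw [h]
    · exact Or.inl (zpow_zero z)
    · exact Or.inr (zpow_one z)

theorem AlgEquiv.coe_smul_units {K L : Type*} [Field K] [Field L] [Algebra K L] (σ : L ≃ₐ[K] L)
    (x : Lˣ) : ((σ • x : Lˣ) : L) = σ x := rfl

namespace Pl

/-- A cochain of places whose coboundary is the cochain of orders of `f`. -/
def OrdCob {K L : Type*} [Field K] [Field L] [Algebra K L]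
    (f : (L ≃ₐ[K] L) → (L ≃ₐ[K] L) → Lˣ) (H : (L ≃ₐ[K] L) → Pl L → ℤ) : Prop :=
  ∀ g h (P : Pl L), P (f g h : L) = H g P + H h (P.tw g) - H (g * h) P

variable {K L : Type*} [Field K] [Field L] [Algebra K L]

theorem OrdCob.div_cob {f : (L ≃ₐ[K] L) → (L ≃ₐ[K] L) → Lˣ} {H : (L ≃ₐ[K] L) → Pl L → ℤ}
    (h : OrdCob f H) (x : (L ≃ₐ[K] L) → Lˣ) :
    OrdCob (f / cob x) fun g P => H g P - P (x g) := by
  intro σ τ P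
  have h1 : (((f / cob x) σ τ : Lˣ) : L) = f σ τ * x (σ * τ) / (x σ * σ (x τ)) := by
    simp only [Pi.div_apply, cob]
    rw [Units.val_div_eq_div_val, Units.val_div_eq_div_val, Units.val_mul,
      div_div_eq_mul_div, AlgEquiv.coe_smul_units]
  have h2 : σ (x τ : L) ≠ 0 := by simp
  rw [h1, ord_div _ (mul_ne_zero (Units.ne_zero _) (Units.ne_zero _)) (mul_ne_zero
    (Units.ne_zero _) h2), ord_mul _ (Units.ne_zero _) (Units.ne_zero _),
    ord_mul _ (Units.ne_zero _) h2, h]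
  simp only [tw_apply]
  ring

end Pl

namespace QuadTower

open Pl

variable {K M L : Type*} [Field K] [Field M] [Field L] [NumberField M] [NumberField L]
  [Algebra K M] [Algebra K L] [Algebra M L] {e : M} {s : L} {z : L ≃ₐ[K] L}
  {π : (L ≃ₐ[K] L) →* (M ≃ₐ[K] M)} (h : QuadTower e s z π)
  {f : (L ≃ₐ[K] L) → (L ≃ₐ[K] L) → Lˣ} {H : (L ≃ₐ[K] L) → Pl L → ℤ}
include h

theorem exists_ordCob_invariant (hf : IsCocycle f) (hH : OrdCob f H) (hr : ∀ g, f g z = 1)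
    (hl : ∀ g, f z g = 1) :
    ∃ H', OrdCob f H' ∧ (∀ g P, H' (g * z) P = H' g P) ∧ ∀ g P, H' g (P.tw z) = H' g P := by
  classical
  have h1 : ∀ P : Pl L, H 1 P = 0 := by
    intro P
    have := hH 1 1 P
    rw [← hf.one_left z, hr, Units.val_one, ord_one, one_mul, tw_one] at this
    omega
  have hzz : ∀ P : Pl L, H z P + H z (P.tw z) = 0 := by
    intro P
    have := hH z z P
    rw [hr, Units.val_one, ord_one, h.mul_self, h1] at this
    omega
  let t : Pl L → ℤ := fun P => if WellOrderingRel P (P.tw z) then 0 else H z P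
  have ht : ∀ P, H z P - t P + t (P.tw z) = 0 := by
    intro P
    have := hzz P
    simp only [t, h.tw_z_tw_z]
    rcases trichotomous_of WellOrderingRel P (P.tw z) with h2 | h2 | h2
    · rw [if_pos h2, if_neg (asymm_of WellOrderingRel h2)]; omega
    · rw [← h2] at this ⊢
      simp only [irrefl_of WellOrderingRel, if_false]; omega
    · rw [if_pos h2, if_neg (asymm_of WellOrderingRel h2)]; omega
  let H' : (L ≃ₐ[K] L) → Pl L → ℤ := fun g P => H g P - t P + t (P.tw g)
  have hH' : OrdCob f H' := by
    intro σ τ P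
    rw [hH]
    simp only [H', tw_mul]
    ring
  have hgz : ∀ g P, H' (g * z) P = H' g P := by
    intro g P
    have h2 := hH' g z P
    rw [hr, Units.val_one, ord_one] at h2
    have h3 : H' z (P.tw g) = 0 := ht _
    omega
  refine ⟨H', hH', hgz, fun g P => ?_⟩
  have h2 := hH' z g P
  rw [hl, Units.val_one, ord_one, ← h.central, hgz] at h2
  have h3 : H' z P = 0 := ht _
  omega

/-- A cocycle that is normalised along the kernel is inflated from the quotient. -/
theorem exists_descent (hN : NoInertia K L) (hf : IsCocycle f) (hH : OrdCob f H)
    (hr : ∀ g, f g z = 1) (hl : ∀ g, f z g = 1) :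
    ∃ (f' : (M ≃ₐ[K] M) → (M ≃ₐ[K] M) → Mˣ) (H' : (M ≃ₐ[K] M) → Pl M → ℤ), IsCocycle f' ∧
      OrdCob f' H' ∧ ∀ g k, f g k = Units.map (algebraMap M L) (f' (π g) (π k)) := by
  obtain ⟨H₁, hH₁, hinv, hinv'⟩ := h.exists_ordCob_invariant hf hH hr hl
  have hval : ∀ g k, ∃ b : Mˣ, algebraMap M L b = f g k := by
    intro g k
    obtain ⟨b, hb⟩ := h.exists_of_fixed (y := f g k) (by
      exact congrArg Units.val (hf.smul_eq h.central hr hl g k))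
    have hb0 : b ≠ 0 := by rintro rfl; rw [map_zero] at hb; exact (f g k).ne_zero hb.symm
    exact ⟨Units.mk0 b hb0, hb⟩
  choose b hb using hval
  choose l hl' using h.surj
  choose Q k hQ using fun v : Pl M => exists_above (F := L) v
  have hQ1 : ∀ v, (Q v).Over v 1 := fun v => by
    have := hQ v
    rwa [h.over_one hN this] at this
  have hfl : ∀ g k, f (l (π g)) (l (π k)) = f g k := by
    intro g k
    rcases h.eq_or_of_map_eq (hl' (π g)) with hg | hg <;>
    rcases h.eq_or_of_map_eq (hl' (π k)) with hk | hk <;>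
    · generalize l (π g) = g' at *
      generalize l (π k) = k' at *
      subst hg; subst hk
      simp only [hf.apply_mul_right hr, hf.apply_mul_left h.central hr hl]
  have hHl : ∀ g, H₁ (l (π g)) = H₁ g := by
    intro g
    rcases h.eq_or_of_map_eq (hl' (π g)) with hg | hg
    · rw [← hg]
    · generalize l (π g) = g' at *
      subst hg
      funext P; rw [hinv]
  have hHQ : ∀ g (P : Pl L) (v : Pl M), P.Over v 1 → H₁ g (Q v) = H₁ g P := by
    intro g P v hP
    rcases h.eq_or_eq_tw hP (hQ1 v) with h1 | h1 <;> rw [h1]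
    rw [hinv']
  have key : ∀ g k, f g k = Units.map (algebraMap M L) (b (l (π g)) (l (π k))) := by
    intro g k
    refine Units.ext ?_
    rw [← hfl]
    exact (hb _ _).symm
  refine ⟨fun g k => b (l g) (l k), fun g v => H₁ (l g) (Q v), ?_, ?_, key⟩
  · intro g' k' m'
    obtain ⟨g, rfl⟩ := h.surj g'
    obtain ⟨k, rfl⟩ := h.surj k'
    obtain ⟨m, rfl⟩ := h.surj m'
    refine Units.ext ((algebraMap M L).injective ?_)
    have := congrArg Units.val (hf g k m)
    rw [key g k, key (g * k) m, key k m, key g (k * m)] at this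
    simp only [map_mul, Units.val_mul, Units.coe_map, AlgEquiv.coe_smul_units,
      MonoidHom.coe_coe] at this ⊢
    rw [h.compat]
    exact this
  · intro g' k' v
    obtain ⟨g, rfl⟩ := h.surj g'
    obtain ⟨k, rfl⟩ := h.surj k'
    have h1 := hH₁ g k (Q v)
    have h2 := (hQ1 v).2 (b (l (π g)) (l (π k)))
    have h3 := congrArg Units.val (key g k)
    rw [Units.coe_map] at h3
    rw [Nat.cast_one, one_mul] at h2
    rw [← h2, ← map_mul]
    simp only [hHl]
    rw [hHQ k _ _ (h.over_tw (hQ1 v) g), ← h1, h3]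
    rfl

end QuadTower

namespace Pl

/-- A two-cocycle of a totally real unramified `2`-extension with trivial idelic obstruction
is a coboundary. -/
theorem exists_eq_cob {K : Type*} [Field K] [NumberField K] (n : ℕ) :
    ∀ (L : Type u) [Field L] [NumberField L] [Algebra K L] [IsGalois K L] [IsTotallyReal L],
      Nat.card (L ≃ₐ[K] L) ≤ n → SpSplit 2 L → NoInertia K L → IsPGroup 2 (L ≃ₐ[K] L) →
      ∀ (f : (L ≃ₐ[K] L) → (L ≃ₐ[K] L) → Lˣ) (H : (L ≃ₐ[K] L) → Pl L → ℤ), IsCocycle f →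
        OrdCob f H → ∃ x, f = cob x := by
  induction n with
  | zero =>
    intro L _ _ _ _ _ hn
    have : FiniteDimensional K L := Module.Finite.of_restrictScalars_finite ℚ K L
    have := Nat.card_pos (α := L ≃ₐ[K] L)
    omega
  | succ n ih =>
    intro L _ _ _ _ _ hn hs hN hG f H hf hH
    have : FiniteDimensional K L := Module.Finite.of_restrictScalars_finite ℚ K L
    rcases subsingleton_or_nontrivial (L ≃ₐ[K] L) with hsub | hnt
    · refine ⟨fun _ => f 1 1, ?_⟩
      funext g h
      obtain rfl : g = 1 := Subsingleton.elim _ _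
      obtain rfl : h = 1 := Subsingleton.elim _ _
      simp [cob]
    obtain ⟨M, e, s, z, π, h, hgal, hz1⟩ := exists_quadTower hG
    have hreal : IsTotallyReal M := IsTotallyReal.of_algebra M L
    have hsM : SpSplit 2 M := hs.of_algebra
    have hNM := h.noInertia hN
    have hGM : IsPGroup 2 (M ≃ₐ[K] M) := hG.of_surjective π h.surj
    have hcard : Nat.card (M ≃ₐ[K] M) < Nat.card (L ≃ₐ[K] L) := by
      refine lt_of_le_of_ne (Nat.card_le_card_of_surjective _ h.surj) fun hc => ?_
      have := (Nat.bijective_iff_surjective_and_card π).2 ⟨h.surj, hc.symm⟩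
      exact hz1 (this.1 (by rw [h.map_z, map_one]))
    let x₀ : (L ≃ₐ[K] L) → Lˣ := fun _ => f 1 1
    have hf₀ := hf.div (isCocycle_cob x₀)
    have hH₀ := hH.div_cob x₀
    have h11 : (f / cob x₀) 1 1 = 1 := by simp [cob, x₀]
    set f₀ := f / cob x₀
    set H₀ := fun g (P : Pl L) => H g P - P (x₀ g)
    have hzzz : z • f₀ z z = f₀ z z := by
      have := hf₀ z z z
      rw [h.mul_self, hf₀.one_left, hf₀.one_right z, h11, smul_one, mul_one, mul_one] at this
      exact this.symm
    obtain ⟨y, hy⟩ := h.exists_norm hs hN (b := f₀ z z) (congrArg Units.val hzzz) fun P hP => by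
      have h1 := hH₀ z z P
      have h2 := hH₀ 1 1 P
      rw [h11, one_mul, tw_one, Units.val_one, ord_one] at h2
      rw [hP, h.mul_self] at h1
      exact ⟨H₀ z P, by omega⟩
    obtain ⟨x₁, hr, hl⟩ := hf₀.exists_normalized h11 h.mul_self h.ne_one h.central
      h.hilbert90_units hy
    obtain ⟨f', H', hf', hH', hff'⟩ := h.exists_descent hN (hf₀.div (isCocycle_cob x₁))
      (hH₀.div_cob x₁) hr hl
    obtain ⟨x', hx'⟩ := ih M (by omega) hsM hNM hGM f' H' hf' hH'
    refine ⟨x₀ * x₁ * fun g => Units.map (algebraMap M L) (x' (π g)), ?_⟩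
    rw [cob_mul, cob_mul]
    have h5 : f₀ / cob x₁ = cob fun g => Units.map (algebraMap M L) (x' (π g)) := by
      funext g k
      rw [hff', hx']
      simp only [cob, map_div, map_mul]
      congr 2
      refine Units.ext ?_
      exact h.compat g _
    rw [← h5, mul_assoc, mul_div_cancel, mul_div_cancel]

end Pl

end

section

theorem Submodule.exists_relative_dual_basis {F A : Type*} [Field F] [AddCommGroup A] [Module F A]
    [FiniteDimensional F A] {U V : Submodule F A} (h : U ≤ V) :
    ∃ (n : ℕ) (b : Fin n → A) (l : Fin n → A →ₗ[F] F),
      n + Module.finrank F U = Module.finrank F V ∧ (∀ i, b i ∈ V) ∧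
      (∀ i j, l i (b j) = if i = j then 1 else 0) ∧ ∀ w ∈ V, (w ∈ U ↔ ∀ i, l i w = 0) := by
  let Q := V.map U.mkQ
  let β := Module.finBasis F Q
  have hb : ∀ i, ∃ b ∈ V, U.mkQ b = β i := fun i => (Submodule.mem_map).1 (β i).2
  choose b hbV hb using hb
  have hl : ∀ i, ∃ l : (A ⧸ U) →ₗ[F] F, l.comp Q.subtype = β.coord i := fun i =>
    LinearMap.exists_extend _
  choose l hl using hl
  have hl' : ∀ i (q : Q), l i q = β.repr q i := fun i q => LinearMap.congr_fun (hl i) q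
  refine ⟨Module.finrank F Q, b, fun i => (l i).comp U.mkQ, ?_, hbV, fun i j => ?_, fun w hw => ?_⟩
  · have h1 := LinearMap.finrank_range_add_finrank_ker (U.mkQ.comp V.subtype)
    rw [LinearMap.range_comp, Submodule.range_subtype, LinearMap.ker_comp, Submodule.ker_mkQ] at h1
    rw [← h1, (Submodule.comapSubtypeEquivOfLe h).finrank_eq]
  · rw [LinearMap.comp_apply, hb, hl', Module.Basis.repr_self, Finsupp.single_apply]
    simp only [eq_comm]
  · have h1 : ∀ i, (l i).comp U.mkQ w = β.repr ⟨U.mkQ w, Submodule.mem_map_of_mem hw⟩ i :=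
      fun i => hl' i ⟨U.mkQ w, Submodule.mem_map_of_mem hw⟩
    simp only [h1]
    rw [← Submodule.Quotient.mk_eq_zero U]
    constructor
    · intro h0 i
      have : (⟨U.mkQ w, Submodule.mem_map_of_mem hw⟩ : Q) = 0 := Subtype.ext h0
      rw [this, map_zero]; rfl
    · intro h0
      have : β.repr ⟨U.mkQ w, Submodule.mem_map_of_mem hw⟩ = 0 := Finsupp.ext h0
      rw [LinearEquiv.map_eq_zero_iff] at this
      exact congrArg Subtype.val this

namespace GolodShafarevich

variable {G : Type*} [Group G]

/-- Right translation on functions. -/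
def tr (g : G) : (G → ZMod 2) →ₗ[ZMod 2] (G → ZMod 2) := LinearMap.funLeft _ _ (· * g)

theorem tr_apply (g : G) (f : G → ZMod 2) (x : G) : tr g f x = f (x * g) := rfl

theorem tr_mul (g h : G) (f : G → ZMod 2) : tr (g * h) f = tr g (tr h f) := by
  funext x; simp only [tr_apply, mul_assoc]

/-- The functions killed by the `k`-th power of the augmentation ideal. -/
def fil (G : Type*) [Group G] : ℕ → Submodule (ZMod 2) (G → ZMod 2)
  | 0 => ⊥
  | k + 1 => ⨅ g : G, (fil G k).comap (tr g - LinearMap.id)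

theorem mem_fil_succ {k : ℕ} {f : G → ZMod 2} : f ∈ fil G (k + 1) ↔ ∀ g, tr g f - f ∈ fil G k := by
  simp [fil, Submodule.mem_iInf]

theorem fil_le_succ (k : ℕ) : fil G k ≤ fil G (k + 1) := by
  induction k with
  | zero => exact bot_le
  | succ k ih => exact fun f hf => mem_fil_succ.2 fun g => ih (mem_fil_succ.1 hf g)

theorem tr_mem {k : ℕ} {f : G → ZMod 2} (hf : f ∈ fil G k) (g : G) : tr g f ∈ fil G k := by
  have := (fil G k).add_mem (mem_fil_succ.1 (fil_le_succ k hf) g) hf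
  rwa [sub_add_cancel] at this

/-- The coboundary of a one-cochain with values in functions. -/
def bd (x : G → G → ZMod 2) (g h : G) : G → ZMod 2 := tr g (x h) - x (g * h) + x g

theorem bd_sub (x y : G → G → ZMod 2) (g h : G) : bd (x - y) g h = bd x g h - bd y g h := by
  simp only [bd, Pi.sub_apply, map_sub]; abel

theorem bd_add (x y : G → G → ZMod 2) (g h : G) : bd (x + y) g h = bd x g h + bd y g h := by
  simp only [bd, Pi.add_apply, map_add]; abel

/-- The two-cocycle condition for values in functions. -/
def IsCoc (c : G → G → G → ZMod 2) : Prop :=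
  ∀ g h k, tr g (c h k) + c g (h * k) = c (g * h) k + c g h

theorem isCoc_bd (x : G → G → ZMod 2) : IsCoc (bd x) := by
  intro g h k
  simp only [bd, map_sub, map_add, tr_mul, mul_assoc]; abel

theorem IsCoc.sub {c c' : G → G → G → ZMod 2} (h : IsCoc c) (h' : IsCoc c') : IsCoc (c - c') := by
  intro g k m
  have h1 := h g k m
  have h2 := h' g k m
  simp only [Pi.sub_apply, map_sub]
  rw [sub_add_sub_comm, h1, h2, add_sub_add_comm]

theorem exists_of_bd_eq_zero {x : G → G → ZMod 2} (h : ∀ g k, bd x g k = 0) :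
    ∃ f : G → ZMod 2, ∀ g, x g = tr g f - f := by
  refine ⟨fun y => x y 1, fun g => ?_⟩
  funext y
  have := congrFun (h y g) 1
  simp only [bd, Pi.add_apply, Pi.sub_apply, Pi.zero_apply, tr_apply, one_mul] at this
  rw [Pi.sub_apply, tr_apply]
  linear_combination this

variable (T : Finset (G → G → ZMod 2))

/-- Every trivial-coefficient cocycle is cohomologous to a member of `T`. -/
def Covers : Prop := ∀ c : G → G → ZMod 2,
  (∀ g h k, c h k + c g (h * k) = c (g * h) k + c g h) →
    ∃ t ∈ T, ∃ x : G → ZMod 2, ∀ g h, c g h = t g h + (x h - x (g * h) + x g)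

variable [Finite G] {T}

theorem exists_reps (hT : Covers T) (k : ℕ) : ∃ S : Finset (G → G → G → ZMod 2),
    S.card ≤ T.card ^ Module.finrank (ZMod 2) (fil G k) ∧
    ∀ c, IsCoc c → (∀ g h, c g h ∈ fil G k) →
      ∃ t ∈ S, ∃ x : G → G → ZMod 2, (∀ g, x g ∈ fil G k) ∧ c - t = bd x := by
  classical
  induction k with
  | zero =>
    refine ⟨{0}, by
      have h0 : Module.finrank (ZMod 2) (fil G 0) = 0 := finrank_bot _ _
      rw [h0]; simp, fun c _ hc => ⟨0, by simp, 0, fun g => Submodule.zero_mem _, ?_⟩⟩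
    funext g h
    have := hc g h
    simp only [fil, Submodule.mem_bot] at this
    simp [bd, this]
  | succ k ih =>
    obtain ⟨S, hS, hSc⟩ := ih
    obtain ⟨n, b, l, hn, hb, hlb, hl⟩ :=
        Submodule.exists_relative_dual_basis (fil_le_succ (G := G) k)
    have hltr : ∀ i g, ∀ f ∈ fil G (k + 1), l i (tr g f) = l i f := fun i g f hf => by
      have h1 := mem_fil_succ.1 hf g
      have := (hl _ (fil_le_succ k h1)).1 h1 i
      rwa [map_sub, sub_eq_zero] at this
    let good : (Fin n → T) → (G → G → G → ZMod 2) → Prop := fun s c =>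
      IsCoc c ∧ (∀ g h, c g h ∈ fil G (k + 1)) ∧ ∃ x : Fin n → G → ZMod 2,
        ∀ i g h, l i (c g h) = (s i).1 g h + (x i h - x i (g * h) + x i g)
    let c₀ : (Fin n → T) → (G → G → G → ZMod 2) := fun s =>
      if h : ∃ c, good s c then h.choose else 0
    have hc₀ : ∀ s c, good s c → good s (c₀ s) := fun s c h => by
      have h' : ∃ c, good s c := ⟨c, h⟩
      simp only [c₀, dif_pos h']
      exact h'.choose_spec
    refine ⟨(Finset.univ ×ˢ S).image fun p : (Fin n → T) × _ => c₀ p.1 + p.2, ?_, ?_⟩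
    · refine Finset.card_image_le.trans ?_
      rw [Finset.card_product, Finset.card_univ, Fintype.card_fun, Fintype.card_fin,
        Fintype.card_coe, ← hn, pow_add]
      exact Nat.mul_le_mul_left _ hS
    · intro c hc hcm
      have h1 : ∀ i, ∃ t ∈ T, ∃ x : G → ZMod 2, ∀ g h,
          l i (c g h) = t g h + (x h - x (g * h) + x g) := fun i => by
        refine hT (fun g h => l i (c g h)) fun g h m => ?_
        have := congrArg (l i) (hc g h m)
        rwa [map_add, map_add, hltr i g _ (hcm _ _)] at this
      choose t ht x hx using h1
      obtain ⟨hd, hdm, y, hy⟩ := hc₀ (fun i => ⟨t i, ht i⟩) c ⟨hc, hcm, x, hx⟩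
      set d := c₀ fun i => ⟨t i, ht i⟩ with hd_def
      let w : G → G → ZMod 2 := fun g => ∑ i, (x i g - y i g) • b i
      have hw : ∀ g, w g ∈ fil G (k + 1) := fun g =>
        Submodule.sum_mem _ fun i _ => Submodule.smul_mem _ _ (hb i)
      have hlw : ∀ i g, l i (w g) = x i g - y i g := fun i g => by
        simp [w, map_sum, hlb]
      have hm : ∀ g h, (c - d - bd w) g h ∈ fil G k := fun g h => by
        have h2 : (c - d - bd w) g h ∈ fil G (k + 1) :=
          Submodule.sub_mem _ (Submodule.sub_mem _ (hcm g h) (hdm g h))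
            (Submodule.add_mem _ (Submodule.sub_mem _ (tr_mem (hw h) g) (hw _)) (hw g))
        rw [hl _ h2]
        intro i
        simp only [Pi.sub_apply, bd, map_sub, map_add, hltr i g _ (hw h), hlw, hx, hy]
        ring
      obtain ⟨t', ht', u, hu, hu'⟩ := hSc _ ((hc.sub hd).sub (isCoc_bd w)) hm
      refine ⟨d + t', Finset.mem_image.2 ⟨(_, t'), Finset.mem_product.2
        ⟨Finset.mem_univ _, ht'⟩, rfl⟩, w + u, fun g => Submodule.add_mem _ (hw g)
        (fil_le_succ k (hu g)), ?_⟩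
      funext g h
      have h3 := congrFun (congrFun hu' g) h
      rw [bd_add, ← h3]
      simp only [Pi.sub_apply, Pi.add_apply]
      abel

theorem key_inequality (hT : Covers T) {d r : ℕ} (hr : T.card ≤ 2 ^ r)
    {X : Finset (G → ZMod 2)} (hX : ∀ χ ∈ X, ∀ g h, χ (g * h) = χ g + χ h) (hd : 2 ^ d ≤ X.card)
    (k : ℕ) :
    (d + 1) * Module.finrank (ZMod 2) (fil G (k + 1)) ≤
      Module.finrank (ZMod 2) (fil G (k + 2)) + (d + r) * Module.finrank (ZMod 2) (fil G k) := by
  classical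
  obtain ⟨S, hS, hSc⟩ := exists_reps hT k
  obtain ⟨n, b, l, hn, hb, hlb, hl⟩ := Submodule.exists_relative_dual_basis (fil_le_succ (G := G) k)
  obtain ⟨m, -, l', hm, -, -, hl'⟩ :=
    Submodule.exists_relative_dual_basis (fil_le_succ (G := G) (k + 1))
  let w : (Fin n → X) → G → G → ZMod 2 := fun χ g => ∑ i, (χ i).1 g • b i
  have hw : ∀ χ g, w χ g ∈ fil G (k + 1) := fun χ g =>
    Submodule.sum_mem _ fun i _ => Submodule.smul_mem _ _ (hb i)
  have hlw : ∀ χ i g, l i (w χ g) = (χ i).1 g := fun χ i g => by simp [w, map_sum, hlb]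
  have hbd : ∀ χ g h, bd (w χ) g h ∈ fil G k := by
    intro χ g h
    have : bd (w χ) g h = tr g (w χ h) - w χ h := by
      simp only [bd, w]
      simp only [hX _ (χ _).2, add_smul, Finset.sum_add_distrib]
      abel
    rw [this]
    exact mem_fil_succ.1 (hw χ h) g
  have h1 : ∀ χ, ∃ t ∈ S, ∃ y : G → G → ZMod 2, (∀ g, y g ∈ fil G k) ∧ bd (w χ) - t = bd y :=
    fun χ => hSc _ (isCoc_bd _) (hbd χ)
  choose t ht y hy hty using h1
  have hmem : ∀ χ g f, w χ g - y χ g = f → f ∈ fil G (k + 1) := fun χ g f h => by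
    rw [← h]; exact Submodule.sub_mem _ (hw χ g) (fil_le_succ k (hy χ g))
  let rep : S → (Fin n → X) := fun s =>
    if h : ∃ χ, t χ = s.1 then h.choose else fun _ => ⟨X.toList.head (by
      intro hc
      rw [Finset.toList_eq_nil] at hc
      rw [hc, Finset.card_empty] at hd
      exact absurd hd (by simp)), by
      rw [← Finset.mem_toList]; exact List.head_mem _⟩
  have hrep : ∀ χ, t (rep ⟨t χ, ht χ⟩) = t χ := fun χ => by
    have h : ∃ χ', t χ' = t χ := ⟨χ, rfl⟩
    simp only [rep, dif_pos h]
    exact h.choose_spec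
  have h2 : ∀ χ χ', t χ = t χ' → ∃ f ∈ fil G (k + 2), ∀ g,
      (w χ g - y χ g) - (w χ' g - y χ' g) = tr g f - f := by
    intro χ χ' htt
    obtain ⟨f, hf⟩ := exists_of_bd_eq_zero (x := (w χ - y χ) - (w χ' - y χ')) (fun g h => by
      rw [bd_sub, bd_sub, bd_sub, ← hty, ← hty, htt]
      simp only [Pi.sub_apply]; abel)
    refine ⟨f, mem_fil_succ.2 fun g => ?_, hf⟩
    rw [← hf g]
    exact Submodule.sub_mem _ (hmem _ _ _ rfl) (hmem _ _ _ rfl)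
  choose f hf hf' using fun χ => h2 χ (rep ⟨t χ, ht χ⟩) (hrep χ).symm
  have hinj : Function.Injective fun χ : Fin n → X =>
      ((⟨t χ, ht χ⟩, fun j => l' j (f χ)) : S × (Fin m → ZMod 2)) := by
    intro χ χ' h
    have ha : (⟨t χ, ht χ⟩ : S) = ⟨t χ', ht χ'⟩ := congrArg Prod.fst h
    have hc : ∀ j, l' j (f χ) = l' j (f χ') := fun j => congrFun (congrArg Prod.snd h) j
    have hff : f χ - f χ' ∈ fil G (k + 1) := by
      rw [hl' _ (Submodule.sub_mem _ (hf χ) (hf χ'))]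
      intro j
      rw [map_sub, hc, sub_self]
    funext i
    refine Subtype.ext (funext fun g => ?_)
    have e1 := hf' χ g
    have e2 := hf' χ' g
    rw [ha] at e1
    have e3 : w χ g - w χ' g ∈ fil G k := by
      have : w χ g - w χ' g = (tr g (f χ - f χ') - (f χ - f χ')) + (y χ g - y χ' g) := by
        rw [map_sub]
        linear_combination e1 - e2
      rw [this]
      exact Submodule.add_mem _ (mem_fil_succ.1 hff g) (Submodule.sub_mem _ (hy _ _) (hy _ _))
    have e4 := (hl _ (fil_le_succ k e3)).1 e3 i
    rwa [map_sub, hlw, hlw, sub_eq_zero] at e4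
  have hcard := Fintype.card_le_of_injective _ hinj
  rw [Fintype.card_prod, Fintype.card_fun, Fintype.card_fun, Fintype.card_coe, Fintype.card_coe,
    Fintype.card_fin, Fintype.card_fin, ZMod.card] at hcard
  have h5 : 2 ^ (d * n) ≤ 2 ^ (r * Module.finrank (ZMod 2) (fil G k) + m) := by
    calc 2 ^ (d * n) = (2 ^ d) ^ n := pow_mul _ _ _
      _ ≤ X.card ^ n := Nat.pow_le_pow_left hd n
      _ ≤ S.card * 2 ^ m := hcard
      _ ≤ (2 ^ r) ^ Module.finrank (ZMod 2) (fil G k) * 2 ^ m :=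
        Nat.mul_le_mul_right _ (hS.trans (Nat.pow_le_pow_left hr _))
      _ = _ := by rw [← pow_mul, ← pow_add]
  have h6 := (Nat.pow_le_pow_iff_right (by norm_num)).1 h5
  rw [← hn] at hm ⊢
  rw [← hm]
  nlinarith

/-- The Golod–Shafarevich inequality for finite groups. -/
theorem false_of_covers (hT : Covers T) {d r : ℕ} (hr : T.card ≤ 2 ^ r)
    {X : Finset (G → ZMod 2)} (hX : ∀ χ ∈ X, ∀ g h, χ (g * h) = χ g + χ h) (hd : 2 ^ d ≤ X.card)
    (hd3 : 3 ≤ d) (hdr : 4 * (d + r) ≤ (d + 1) ^ 2) : False := by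
  have key := key_inequality hT hr hX hd
  set c : ℕ → ℕ := fun k => Module.finrank (ZMod 2) (fil G k)
  have h0 : c 0 = 0 := finrank_bot _ _
  have h1 : 1 ≤ c 1 := by
    refine Nat.one_le_iff_ne_zero.2 fun hc => ?_
    have h2 : fil G 1 = ⊥ := Submodule.finrank_eq_zero.1 hc
    have h3 : (1 : G → ZMod 2) ∈ fil G 1 := mem_fil_succ.2 fun g => by
      have : tr g (1 : G → ZMod 2) - 1 = 0 := by funext x; simp [tr_apply]
      rw [this]; exact Submodule.zero_mem _
    rw [h2, Submodule.mem_bot] at h3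
    exact one_ne_zero (congrFun h3 1)
  have hstep : ∀ k, (d + 1) * c k ≤ 2 * c (k + 1) ∧ 1 ≤ c (k + 1) := by
    intro k
    induction k with
    | zero => exact ⟨by rw [h0]; simp, h1⟩
    | succ k ih =>
      have h2 : (d + 1) * c (k + 1) ≤ c (k + 2) + (d + r) * c k := key k
      have h3 : 4 * ((d + r) * c k) ≤ 2 * ((d + 1) * c (k + 1)) := by
        calc 4 * ((d + r) * c k) = 4 * (d + r) * c k := by ring
          _ ≤ (d + 1) ^ 2 * c k := Nat.mul_le_mul_right _ hdr
          _ = (d + 1) * ((d + 1) * c k) := by ring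
          _ ≤ (d + 1) * (2 * c (k + 1)) := Nat.mul_le_mul_left _ ih.1
          _ = _ := by ring
      have h4 : (d + 1) * c (k + 1) ≤ 2 * c (k + 2) := by omega
      exact ⟨h4, by nlinarith [ih.2]⟩
  have hgrow : ∀ k, k ≤ c k := by
    intro k
    induction k with
    | zero => exact Nat.zero_le _
    | succ k ih =>
      rcases Nat.eq_zero_or_pos k with rfl | hk
      · exact h1
      · have := (hstep k).1
        nlinarith
  have := hgrow (Module.finrank (ZMod 2) (G → ZMod 2) + 1)
  have h7 := Submodule.finrank_le (fil G (Module.finrank (ZMod 2) (G → ZMod 2) + 1))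
  exact absurd (this.trans h7) (by omega)

end GolodShafarevich

end

section

open NumberField IsDedekindDomain

universe u

namespace IsQuad

/-- An automorphism multiplying `e` by a square extends to `F(√e)`. -/
theorem exists_lift {K F E : Type*} [Field K] [Field F] [Field E] [Algebra K F] [Algebra F E]
    [Algebra K E] [IsScalarTower K F E] [FiniteDimensional K E] {e : F} {s : E} (h : IsQuad e s)
    (g : F ≃ₐ[K] F) {c : F} (hc : g e = c ^ 2 * e) :
    ∃ τ : E ≃ₐ[K] E, ∀ x, τ (algebraMap F E x) = algebraMap F E (g x) := by
  have hre : ∀ x y, h.re (x + y) = h.re x + h.re y ∧ h.im (x + y) = h.im x + h.im y := fun x y =>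
    h.re_im_of_eq (by
      nth_rw 1 [h.eq_re_im x, h.eq_re_im y]; simp only [map_add]; ring)
  have hmul : ∀ x y, h.re (x * y) = h.re x * h.re y + h.im x * h.im y * e ∧
      h.im (x * y) = h.re x * h.im y + h.im x * h.re y := fun x y =>
    h.re_im_of_eq (by
      nth_rw 1 [h.eq_re_im x, h.eq_re_im y]; simp only [map_add, map_mul, ← h.sq]; ring)
  have hal : ∀ x, h.re (algebraMap F E x) = x ∧ h.im (algebraMap F E x) = 0 := fun x =>
    h.re_im_of_eq (by simp)
  let τ : E →ₐ[K] E :=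
    { toFun := fun x => algebraMap F E (g (h.re x)) + algebraMap F E (g (h.im x) * c) * s
      map_one' := by
        have := hal 1
        rw [map_one] at this
        rw [this.1, this.2]; simp
      map_zero' := by
        have := hal 0
        rw [map_zero] at this
        rw [this.1, this.2]; simp
      map_add' := fun x y => by
        rw [(hre x y).1, (hre x y).2]; simp only [map_add, map_mul]; ring
      map_mul' := fun x y => by
        rw [(hmul x y).1, (hmul x y).2]
        simp only [map_add, map_mul, hc, map_pow, ← h.sq]; ring
      commutes' := fun k => by
        rw [IsScalarTower.algebraMap_apply K F E, (hal _).1, (hal _).2]; simp }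
  refine ⟨AlgEquiv.ofBijective τ (Algebra.IsAlgebraic.algHom_bijective τ), fun x => ?_⟩
  change algebraMap F E (g (h.re (algebraMap F E x))) +
    algebraMap F E (g (h.im (algebraMap F E x)) * c) * s = _
  rw [(hal x).1, (hal x).2]; simp

theorem eq_conj {F E : Type*} [Field F] [Field E] [CharZero E] [Algebra F E] {e : F} {s : E}
    (h : IsQuad e s) {τ : E ≃ₐ[F] E} (hτ : τ ≠ 1) : τ = h.conj := by
  have h1 : τ s ^ 2 = s ^ 2 := by rw [← map_pow, h.sq, τ.commutes]
  rcases sq_eq_sq_iff_eq_or_eq_neg.1 h1 with h2 | h2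
  · refine absurd (AlgEquiv.ext fun y => ?_) hτ
    rw [h.eq_re_im y]; simp [h2]
  · refine AlgEquiv.ext fun y => ?_
    rw [h.eq_re_im y]; simp [h2]

theorem isGalois_trans {K F E : Type*} [Field K] [Field F] [Field E] [CharZero E] [Algebra K F]
    [Algebra F E] [Algebra K E] [IsScalarTower K F E] [FiniteDimensional K E]
    [FiniteDimensional K F]
    [IsGalois K F]
    {e : F} {s : E} (h : IsQuad e s) (hg : ∀ g : F ≃ₐ[K] F, ∃ c, g e = c ^ 2 * e) :
    IsGalois K E := by
  refine IsGalois.of_fixedField_eq_bot K E (le_bot_iff.1 fun x hx => ?_)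
  have hx' : ∀ τ : E ≃ₐ[K] E, τ x = x := fun τ => hx ⟨τ, trivial⟩
  obtain ⟨y, rfl⟩ := h.exists_of_conj_eq (hx' (h.conj.restrictScalars K))
  have hy : y ∈ (⊥ : IntermediateField K F) := by
    rw [IsGalois.mem_bot_iff_fixed]
    intro g
    obtain ⟨c, hc⟩ := hg g
    obtain ⟨τ, hτ⟩ := h.exists_lift g hc
    have := hx' τ
    rw [hτ] at this
    exact (algebraMap F E).injective this
  obtain ⟨k, rfl⟩ := IntermediateField.mem_bot.1 hy
  exact IntermediateField.mem_bot.2 ⟨k, IsScalarTower.algebraMap_apply K F E k⟩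

end IsQuad

namespace Pl

theorem SpSplit.of_isQuad {F E : Type*} [Field F] [NumberField F] [Field E] [NumberField E]
    [Algebra F E] {q : ℕ} (hF : SpSplit q F) {e : F} {s : E} (h : IsQuad e s) {u : Fˣ}
    (hu : (u : F) = e) (hl : ∀ v : Pl F, 0 < v (q : F) → u ∈ v.lsq) : SpSplit q E := by
  have := h.finite
  obtain ⟨S, hS, hcard⟩ := hF
  refine ⟨(finite_over (E := E) (S : Set (Pl F)) S.finite_toSet).toFinset, fun P hP => ?_, ?_⟩
  · rw [Set.Finite.mem_toFinset] at hP
    obtain ⟨v, hv, k, hk⟩ := hP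
    have := hk.2 (q : F)
    rw [map_natCast] at this
    rw [this]
    exact mul_pos (by exact_mod_cast hk.1) (hS v hv)
  · have h1 := card_above_ge h (Finset.Subset.refl S) fun v hv => ⟨u, hu, hl v (hS v hv)⟩
    have h2 := Module.finrank_mul_finrank ℚ F E
    rw [h.finrank_eq] at h2
    omega

end Pl

/-- The 2-extensions `L / K` entering the tower over `K`. -/
structure InTower (p : ℕ) (K L : Type*) [Field K] [NumberField K] [Field L] [NumberField L]
    [Algebra K L] : Prop where
  isGalois : IsGalois K L
  isTotallyReal : IsTotallyReal L
  isPGroup : IsPGroup 2 (L ≃ₐ[K] L)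
  two : Pl.SpSplit 2 L
  split : Pl.SpSplit p L
  noInertia : Pl.NoInertia K L
  unif : ∀ P : Pl L, ∃ k : K, k ≠ 0 ∧ P (algebraMap K L k) = 1

namespace InTower

variable {p : ℕ} {K : Type u} [Field K] [NumberField K]

theorem self [IsTotallyReal K] (h2 : Pl.SpSplit 2 K) (hp : Pl.SpSplit p K) : InTower p K K where
  isGalois := inferInstance
  isTotallyReal := inferInstance
  isPGroup := by
    have : Subsingleton (K ≃ₐ[K] K) := ⟨fun a b => AlgEquiv.ext fun x => by
      exact (a.commutes x).trans (b.commutes x).symm⟩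
    exact IsPGroup.of_card (n := 0) (by rw [pow_zero]; exact Nat.card_unique)
  two := h2
  split := hp
  noInertia := fun σ hσ => (hσ (AlgEquiv.ext fun x => σ.commutes x)).elim
  unif := fun P => P.exists_unif

theorem exists_step {L : Type u} [Field L] [NumberField L] [Algebra K L] (hL : InTower p K L)
    {a : Lˣ} (ha : ¬ IsSquare (a : L)) (hg : ∀ g : L ≃ₐ[K] L, ∃ c, g a = c ^ 2 * a)
    (hev : ∀ P : Pl L, Even (P (a : L)))
    (h2 : ∀ P : Pl L, 0 < P ((2 : ℕ) : L) → a ∈ P.lsq)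
    (hp : ∀ P : Pl L, 0 < P (p : L) → a ∈ P.lsq)
    (hpos : TotPos (a : L)) :
    ∃ (E : Type u) (_ : Field E) (_ : NumberField E) (_ : Algebra K E),
      InTower p K E ∧ Module.finrank K L < Module.finrank K E := by
  obtain ⟨E, _, _, _, s, h⟩ := exists_isQuad ha
  let : Algebra K E := ((algebraMap L E).comp (algebraMap K L)).toAlgebra
  have : IsScalarTower K L E := IsScalarTower.of_algebraMap_eq fun _ => rfl
  have : FiniteDimensional K E := Module.Finite.of_restrictScalars_finite ℚ K E
  have : FiniteDimensional K L := Module.Finite.of_restrictScalars_finite ℚ K L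
  have := h.finite
  have := hL.isGalois
  have := hL.isTotallyReal
  have hgal : IsGalois K E := h.isGalois_trans hg
  have hfr := Module.finrank_mul_finrank K L E
  rw [h.finrank_eq] at hfr
  have hfrL : 0 < Module.finrank K L := Module.finrank_pos
  have htw : ∀ Q : Pl E, 0 < Q ((2 : ℕ) : E) → Q.tw h.conj ≠ Q := fun Q hQ => by
    obtain ⟨v, k, hv⟩ := Q.exists_over (E := L)
    have := hv.2 ((2 : ℕ) : L)
    rw [map_natCast] at this
    rw [this] at hQ
    exact h.comap_ne_of_mem_lsq hv rfl (h2 v (pos_of_mul_pos_right hQ (by positivity)))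
  have hnoin : Pl.NoInertia L E := by
    intro τ hτ Q
    rw [h.eq_conj hτ]
    by_cases hQ : 0 < Q ((2 : ℕ) : E)
    · exact Pl.exists_int_of_tw_ne (htw Q hQ)
    · have hQ2 : Q (2 : E) = 0 := by
        have := Q.ord_natCast_nonneg 2
        push_cast at this hQ
        omega
      obtain ⟨v, k, hv⟩ := Q.exists_over (E := L)
      obtain ⟨b, hb0, hb⟩ : ∃ b : L, b ≠ 0 ∧ v (b ^ 2 * a) = 0 := by
        obtain ⟨m, hm⟩ := hev v
        obtain ⟨π, hπ0, hπ⟩ := v.exists_unif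
        refine ⟨π ^ (-m), zpow_ne_zero _ hπ0, ?_⟩
        rw [v.ord_mul (pow_ne_zero _ (zpow_ne_zero _ hπ0)) a.ne_zero, v.ord_sq, v.ord_zpow, hπ, hm]
        ring
      have hw0 : algebraMap L E b * s ≠ 0 :=
        mul_ne_zero ((map_ne_zero _).2 hb0) h.root_ne_zero
      have hw : Q (algebraMap L E b * s) = 0 := by
        have h3 : (algebraMap L E b * s) ^ 2 = algebraMap L E (b ^ 2 * a) := by
          rw [mul_pow, h.sq]; simp
        have h4 := Q.ord_sq (algebraMap L E b * s)
        rw [h3, (hv.eq_zero_iff _).2 hb] at h4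
        omega
      refine Pl.exists_int_of_mem (y := algebraMap L E b * s) (fun _ => hw.ge) fun h5 => ?_
      have h6 : h.conj (algebraMap L E b * s) - algebraMap L E b * s =
          - (2 * (algebraMap L E b * s)) := by
        rw [map_mul, h.conj_root, h.conj.commutes]; ring
      rw [h6, AddSubgroup.neg_mem_iff, Pl.mem_ge_iff _ (mul_ne_zero two_ne_zero hw0),
        Q.ord_mul two_ne_zero hw0, hQ2, hw] at h5
      omega
  refine ⟨E, inferInstance, inferInstance, inferInstance, ?_, by omega⟩
  refine ⟨hgal, h.isTotallyReal hpos, ?_, hL.two.of_isQuad h rfl h2, hL.split.of_isQuad h rfl hp,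
    ?_, fun Q => ?_⟩
  · obtain ⟨n, hn⟩ := IsPGroup.iff_card.1 hL.isPGroup
    rw [IsGalois.card_aut_eq_finrank] at hn
    refine IsPGroup.of_card (n := n + 1) ?_
    rw [IsGalois.card_aut_eq_finrank, ← hfr, hn, pow_succ]
  · intro τ hτ Q
    by_cases hr : AlgEquiv.restrictNormalHom L τ = 1
    · have hτL : ∀ x : L, τ (algebraMap L E x) = algebraMap L E x := fun x => by
        have := AlgEquiv.restrictNormal_commutes τ L x
        rw [← this]
        change algebraMap L E (AlgEquiv.restrictNormalHom L τ x) = _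
        rw [hr]; rfl
      obtain ⟨y, hy⟩ := hnoin (AlgEquiv.ofRingEquiv (f := (τ : E ≃+* E)) hτL) (fun hc => hτ (by
        ext x; exact DFunLike.congr_fun hc x)) Q
      exact ⟨y, hy⟩
    · obtain ⟨v, k, hv⟩ := Q.exists_over (E := L)
      obtain ⟨y, hy⟩ := hL.noInertia _ hr v
      refine Pl.exists_int_of_mem (y := algebraMap L E (algebraMap (𝓞 L) L y)) ?_ fun hc => hy ?_
      · have := hv.mem_ge (v.algebraMap_mem_ge y)
        simpa using this
      · intro h0
        have h7 : τ (algebraMap L E (algebraMap (𝓞 L) L y)) =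
            algebraMap L E (AlgEquiv.restrictNormalHom L τ (algebraMap (𝓞 L) L y)) :=
          (AlgEquiv.restrictNormal_commutes τ L _).symm
        rw [h7, ← map_sub, Pl.mem_ge_iff _ ((map_ne_zero _).2 h0), hv.2] at hc
        exact pos_of_mul_pos_right (a := (k : ℤ)) (by omega) (by positivity)
  · obtain ⟨v, k, hv⟩ := Q.exists_over (E := L)
    obtain ⟨x, hx0, hx⟩ := hL.unif v
    obtain ⟨y, hy⟩ := hnoin h.conj (fun hc => h.root_ne_zero (by
      have := h.conj_root
      rw [hc, AlgEquiv.one_apply] at this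
      exact self_eq_neg.1 this)) Q
    have hk := h.over_one hv (Or.inr ⟨_, Q.algebraMap_mem_ge y, hy⟩)
    refine ⟨x, hx0, ?_⟩
    rw [IsScalarTower.algebraMap_apply K L E, hv.2, hx, hk]; rfl

end InTower

end

section

open NumberField IsDedekindDomain

universe u

/-- The character of `ZMod 2` with values `±1`. -/
def sgn (A : Type*) [Ring A] (c : ZMod 2) : Aˣ := if c = 0 then 1 else -1

section sgn
variable {A : Type*} [Ring A]

theorem sgn_zero : sgn A 0 = 1 := rfl

theorem sgn_one : sgn A 1 = -1 := rfl

theorem eq_zero_or_one_of_two : ∀ a : ZMod 2, a = 0 ∨ a = 1 := by decide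

theorem sgn_add (a b : ZMod 2) : sgn A (a + b) = sgn A a * sgn A b := by
  have h : (1 : ZMod 2) + 1 = 0 := rfl
  rcases eq_zero_or_one_of_two a with rfl | rfl <;>
      rcases eq_zero_or_one_of_two b with rfl | rfl <;>
    simp [sgn_zero, sgn_one, h]

theorem sgn_mul_self (a : ZMod 2) : sgn A a * sgn A a = 1 := by
  rw [← sgn_add, CharTwo.add_self_eq_zero, sgn_zero]

theorem smul_sgn {K L : Type*} [Field K] [Field L] [Algebra K L] (g : L ≃ₐ[K] L) (a : ZMod 2) :
    g • sgn L a = sgn L a := by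
  ext
  rw [AlgEquiv.coe_smul_units]
  rcases eq_zero_or_one_of_two a with rfl | rfl <;> simp [sgn_zero, sgn_one]

theorem sgn_injective {A : Type*} [Field A] [CharZero A] : Function.Injective (sgn A) := by
  have h : (1 : Aˣ) ≠ -1 := fun h => by
    have := congrArg Units.val h
    rw [Units.val_one, Units.val_neg, Units.val_one] at this
    exact one_ne_zero (self_eq_neg.1 this)
  intro a b hab
  rcases eq_zero_or_one_of_two a with rfl | rfl <;> rcases eq_zero_or_one_of_two b with rfl | rfl
  · rfl
  · exact (h hab).elim
  · exact (h hab.symm).elim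
  · rfl

theorem exists_sgn_of_sq_eq {A : Type*} [Field A] {x y : Aˣ} (h : x ^ 2 = y ^ 2) :
    ∃ c, x = sgn A c * y := by
  have h1 : (x : A) ^ 2 = (y : A) ^ 2 := by exact_mod_cast congrArg Units.val h
  rcases sq_eq_sq_iff_eq_or_eq_neg.1 h1 with h2 | h2
  · exact ⟨0, by rw [sgn_zero, one_mul]; exact Units.ext h2⟩
  · exact ⟨1, by rw [sgn_one]; ext; simp [h2]⟩

end sgn

variable {K L : Type*} [Field K] [NumberField K] [Field L] [NumberField L] [Algebra K L]

/-- The classes of `Lˣ / Lˣ²` fixed by the Galois group. -/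
def IsSqInv (K : Type*) {L : Type*} [Field K] [Field L] [Algebra K L] (a : Lˣ) : Prop :=
  ∀ g : L ≃ₐ[K] L, ∃ c : Lˣ, g • a = c ^ 2 * a

open GolodShafarevich in
theorem InTower.exists_covers {p : ℕ} {L : Type u} [Field L] [NumberField L] [Algebra K L]
    (hL : InTower p K L) {ι : Type*} [Fintype ι] (Φ : Lˣ → ι)
    (hΦ : ∀ a b : Lˣ, IsSqInv K a → IsSqInv K b → Φ a = Φ b →
      ∃ (k : Kˣ) (y : Lˣ), a = b * Units.map (algebraMap K L).toMonoidHom k * y ^ 2) :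
    ∃ T : Finset ((L ≃ₐ[K] L) → (L ≃ₐ[K] L) → ZMod 2), Covers T ∧ T.card ≤ Fintype.card ι := by
  classical
  have := hL.isGalois
  have := hL.isTotallyReal
  have : FiniteDimensional K L := Module.Finite.of_restrictScalars_finite ℚ K L
  let R : ι → ((L ≃ₐ[K] L) → (L ≃ₐ[K] L) → ZMod 2) → Prop := fun i c =>
    ∃ (a : Lˣ) (x : (L ≃ₐ[K] L) → Lˣ), (∀ g, g • a = x g ^ 2 * a) ∧ Φ a = i ∧
      ∀ g h, sgn L (c g h) = cob x g h
  let t : ι → ((L ≃ₐ[K] L) → (L ≃ₐ[K] L) → ZMod 2) := fun i =>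
    if h : ∃ c, R i c then h.choose else 0
  refine ⟨Finset.univ.image t, fun c hc => ?_, Finset.card_image_le⟩
  let f : (L ≃ₐ[K] L) → (L ≃ₐ[K] L) → Lˣ := fun g h => sgn L (c g h)
  have hf : IsCocycle f := fun g h k => by
    simp only [f, smul_sgn, ← sgn_add]
    rw [hc, add_comm]
  have hf0 : ∀ g h (P : Pl L), P (f g h : L) = 0 := fun g h P => by
    simp only [f, sgn]
    split_ifs
    · simp [P.ord_one]
    · rw [Units.val_neg, Units.val_one, P.ord_neg_one]
  obtain ⟨x, hx⟩ := Pl.exists_eq_cob (K := K) _ L le_rfl hL.two hL.noInertia hL.isPGroup f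
    (fun _ _ => 0) hf (fun g h P => by rw [hf0]; rfl)
  have hfx : ∀ g h, sgn L (c g h) = cob x g h := fun g h => congrFun (congrFun hx g) h
  obtain ⟨a, ha⟩ := groupCohomology.isMulCoboundary₁_of_isMulCocycle₁_of_aut_to_units
    (K := K) (fun g => x g ^ 2) (fun g h => by
      have h1 := hfx g h
      have h2 := congrArg (· ^ 2) h1
      simp only [cob] at h2
      rw [sq, sgn_mul_self, div_pow, eq_comm, div_eq_one, mul_pow] at h2
      change x (g * h) ^ 2 = g • (x h ^ 2) * x g ^ 2
      rw [smul_pow', ← h2, mul_comm])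
  have hxa : ∀ g, g • a = x g ^ 2 * a := fun g => by
    have h1 : g • a / a = x g ^ 2 := ha g
    rw [← h1, div_mul_cancel]
  have hR : R (Φ a) c := ⟨a, x, hxa, rfl, hfx⟩
  have hex : ∃ c, R (Φ a) c := ⟨c, hR⟩
  obtain ⟨a', x', hxa', hΦ', hfx'⟩ : R (Φ a) (t (Φ a)) := by
    simp only [t, dif_pos hex]
    exact hex.choose_spec
  refine ⟨t (Φ a), Finset.mem_image_of_mem _ (Finset.mem_univ _), ?_⟩
  obtain ⟨k, y, hky⟩ := hΦ a a' (fun g => ⟨_, hxa g⟩) (fun g => ⟨_, hxa' g⟩) hΦ'.symm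
  have hk : ∀ g : L ≃ₐ[K] L, g • Units.map (algebraMap K L).toMonoidHom k =
      Units.map (algebraMap K L).toMonoidHom k := fun g => by
    ext; exact g.commutes _
  have h3 : ∀ g, ∃ e, x g = sgn L e * (x' g * (g • y / y)) := fun g => by
    refine exists_sgn_of_sq_eq ?_
    have h4 := hxa g
    rw [hky, smul_mul', smul_mul', hxa', hk, smul_pow'] at h4
    rw [mul_pow, div_pow, mul_div_assoc', eq_div_iff_mul_eq']
    refine mul_right_cancel (b := a' * Units.map (algebraMap K L).toMonoidHom k) ?_
    calc _ = x g ^ 2 * (a' * Units.map (algebraMap K L).toMonoidHom k * y ^ 2) := by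
          simp only [mul_comm, mul_left_comm, mul_assoc]
      _ = _ := by rw [← h4]; simp only [mul_comm, mul_left_comm, mul_assoc]
  choose e he using h3
  refine ⟨e, fun g h => sgn_injective (A := L) ?_⟩
  have h5 : x = (fun g => sgn L (e g)) * (x' * fun g => g • y / y) := funext he
  rw [sgn_add, hfx, hfx', h5, cob_mul, cob_mul]
  have h6 : cob (fun g : L ≃ₐ[K] L => g • y / y) = 1 := by
    funext g h
    simp only [cob, smul_div', mul_smul, Pi.one_apply, div_eq_one]
    rw [mul_comm, div_mul_div_cancel]
  rw [h6, mul_one]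
  simp only [Pi.mul_apply, cob, smul_sgn]
  rw [mul_comm]
  congr 1
  rw [sgn_add, sub_eq_add_neg, sgn_add, div_eq_mul_inv, ZMod.neg_eq_self_mod_two,
    eq_comm, inv_eq_of_mul_eq_one_left (sgn_mul_self _)]
  simp only [mul_comm, mul_left_comm]

end

section

open NumberField IsDedekindDomain

universe u

theorem finite_realEmbeddings (F : Type*) [Field F] [NumberField F] :
    Finite (F →+* ℝ) ∧ Nat.card (F →+* ℝ) ≤ Module.finrank ℚ F := by
  classical
  let j : (F →+* ℝ) → (F →+* ℂ) := fun φ => Complex.ofRealHom.comp φ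
  have hj : Function.Injective j := fun φ ψ h => by
    ext x
    exact Complex.ofReal_injective (RingHom.congr_fun h x)
  refine ⟨Finite.of_injective j hj, ?_⟩
  rw [← Embeddings.card F ℂ, ← Nat.card_eq_fintype_card]
  exact Nat.card_le_card_of_injective j hj

theorem exists_realEmbedding {K L : Type*} [Field K] [NumberField K] [Field L] [NumberField L]
    [Algebra K L] [IsTotallyReal L] (φ : K →+* ℝ) :
    ∃ ψ : L →+* ℝ, ψ.comp (algebraMap K L) = φ := by
  have : FiniteDimensional K L := Module.Finite.of_restrictScalars_finite ℚ K L
  obtain ⟨ψ, hψ⟩ : ∃ ψ : L →+* ℂ, ψ.comp (algebraMap K L) = (algebraMap ℝ ℂ).comp φ := by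
    let := ((algebraMap ℝ ℂ).comp φ).toAlgebra
    let ψ := IsAlgClosed.lift (R := K) (S := L) (M := ℂ)
    exact ⟨ψ.toRingHom, by ext x; exact ψ.commutes x⟩
  have hr := IsTotallyReal.complexEmbedding_isReal ψ
  refine ⟨hr.embedding, RingHom.ext fun x => Complex.ofReal_injective ?_⟩
  have := RingHom.congr_fun hψ x
  simpa using this

theorem exists_realEmbedding_eq_comp {K L : Type*} [Field K] [Field L] [Algebra K L]
    [IsGalois K L] {φ ψ : L →+* ℝ}
    (h : φ.comp (algebraMap K L) = ψ.comp (algebraMap K L)) :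
    ∃ g : L ≃ₐ[K] L, ∀ x, ψ x = φ (g x) := by
  obtain ⟨σ, hσ⟩ := ComplexEmbedding.exists_comp_symm_eq_of_comp_eq (k := K)
    (Complex.ofRealHom.comp φ) (Complex.ofRealHom.comp ψ) (by
      rw [RingHom.comp_assoc, RingHom.comp_assoc, h])
  exact ⟨σ.symm, fun x => Complex.ofReal_injective (RingHom.congr_fun hσ x).symm⟩

namespace Pl

variable {K L : Type*} [Field K] [NumberField K] [Field L] [NumberField L] [Algebra K L]

/-- The Galois group acts transitively on the places above a given one. -/
theorem Over.exists_tw_eq [IsGalois K L] {P Q : Pl L} {v : Pl K} {k l : ℕ} (hP : P.Over v k)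
    (hQ : Q.Over v l) : ∃ g : L ≃ₐ[K] L, Q = P.tw g := by
  classical
  have : FiniteDimensional K L := Module.Finite.of_restrictScalars_finite ℚ K L
  by_contra! hcon
  obtain ⟨y, hy⟩ := exists_approx (insert Q (Set.range fun g : L ≃ₐ[K] L => P.tw g))
    ((Set.finite_range _).insert _) (fun R => if R = Q then 0 else 1) 1
  set x := algebraMap (𝓞 L) L y
  have hyQ : x ∈ Q.ge 1 := by
    have := hy Q (Set.mem_insert _ _)
    simpa using this
  have hyP : ∀ g : L ≃ₐ[K] L, g x ≠ 0 ∧ P (g x) = 0 := fun g => by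
    have h1 := hy (P.tw g) (Set.mem_insert_of_mem _ ⟨g, rfl⟩)
    rw [if_neg (Ne.symm (hcon g))] at h1
    push_cast at h1
    obtain ⟨h2, h3⟩ := (P.tw g).ord_eq_zero_of_sub_one_mem (y := x) (by simpa using h1)
    exact ⟨(map_ne_zero _).2 h2, h3⟩
  have hN := Algebra.norm_eq_prod_automorphisms K x
  have h1 : (algebraMap K L (Algebra.norm K x)) ≠ 0 ∧
      P (algebraMap K L (Algebra.norm K x)) = 0 := by
    rw [hN]
    refine Finset.prod_induction (fun g : L ≃ₐ[K] L => g x) (fun z => z ≠ 0 ∧ P z = 0) ?_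
      ⟨one_ne_zero, P.ord_one⟩ fun g _ => hyP g
    rintro a b ⟨ha, ha'⟩ ⟨hb, hb'⟩
    exact ⟨mul_ne_zero ha hb, by rw [P.ord_mul ha hb, ha', hb']; rfl⟩
  have h2 : algebraMap K L (Algebra.norm K x) ∈ Q.ge 1 := by
    rw [hN, ← Finset.mul_prod_erase _ _ (Finset.mem_univ (1 : L ≃ₐ[K] L)), mul_comm]
    refine Q.mul_mem_ge_zero ?_ hyQ
    refine Finset.prod_induction (fun g : L ≃ₐ[K] L => g x) (· ∈ Q.ge 0)
      (fun a b ha hb => Q.mul_mem_ge_zero ha hb) Q.one_mem_ge fun g _ => ?_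
    have := algebraMap_mem_ge (Q.tw g) y
    rwa [mem_tw_ge] at this
  have h3 := h2 h1.1
  rw [(hQ.eq_zero_iff _).2 ((hP.eq_zero_iff _).1 h1.2)] at h3
  omega

theorem mem_lsq_tw {P : Pl L} {g : L ≃ₐ[K] L} {a : Lˣ} (h : g • a ∈ P.lsq) :
    a ∈ (P.tw g).lsq := by
  obtain ⟨c, hc, h⟩ := h
  refine ⟨g.symm c, (map_ne_zero _).2 hc, ?_⟩
  rw [mem_tw_ge, tw_apply, map_ofNat]
  simpa using h

theorem _root_.IsSqInv.mem_lsq_tw {a : Lˣ} (ha : IsSqInv K a) {P : Pl L} (h : a ∈ P.lsq)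
    (g : L ≃ₐ[K] L) : a ∈ (P.tw g).lsq := by
  obtain ⟨c, hc⟩ := ha g
  refine Pl.mem_lsq_tw ?_
  rw [hc, mul_comm, mul_sq_mem_lsq]
  exact h

theorem _root_.IsSqInv.even_tw {a : Lˣ} (ha : IsSqInv K a) (P : Pl L) (g : L ≃ₐ[K] L) :
    ((P.tw g (a : L) : ℤ) : ZMod 2) = ((P (a : L) : ℤ) : ZMod 2) := by
  obtain ⟨c, hc⟩ := ha g
  have h1 := congrArg Units.val hc
  rw [AlgEquiv.coe_smul_units] at h1
  rw [tw_apply, h1, Units.val_mul, Units.val_pow_eq_pow_val,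
    P.ord_mul (pow_ne_zero _ c.ne_zero) a.ne_zero, P.ord_sq]
  push_cast
  rw [show (2 : ZMod 2) = 0 from rfl]; ring

theorem _root_.IsSqInv.pos_comp {a : Lˣ} (ha : IsSqInv K a) {φ : L →+* ℝ} (h : 0 < φ a)
    (g : L ≃ₐ[K] L) : 0 < φ (g a) := by
  obtain ⟨c, hc⟩ := ha g
  have h1 := congrArg Units.val hc
  rw [AlgEquiv.coe_smul_units] at h1
  rw [h1, Units.val_mul, Units.val_pow_eq_pow_val, map_mul, map_pow]
  have : φ c ≠ 0 := by simp
  positivity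

end Pl

theorem IsSqInv.mul {K L : Type*} [Field K] [Field L] [Algebra K L] {a b : Lˣ} (ha : IsSqInv K a)
    (hb : IsSqInv K b) : IsSqInv K (a * b) := fun g => by
  obtain ⟨c, hc⟩ := ha g
  obtain ⟨d, hd⟩ := hb g
  exact ⟨c * d, by rw [smul_mul', hc, hd, mul_pow, mul_mul_mul_comm]⟩

theorem IsSqInv.inv {K L : Type*} [Field K] [Field L] [Algebra K L] {a : Lˣ} (ha : IsSqInv K a) :
    IsSqInv K a⁻¹ := fun g => by
  obtain ⟨c, hc⟩ := ha g
  exact ⟨c⁻¹, by rw [smul_inv', hc, mul_inv, inv_pow]⟩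

theorem isSqInv_map {K L : Type*} [Field K] [Field L] [Algebra K L] (k : Kˣ) :
    IsSqInv K (Units.map (algebraMap K L).toMonoidHom k) := fun g =>
  ⟨1, by rw [one_pow, one_mul]; ext; exact g.commutes _⟩

end

section

open NumberField IsDedekindDomain

universe u

/-- `Kˣ`-parities of places, up to principal ones, are separated by `ψ`. -/
def SepParity (K : Type*) [Field K] {κ : Type*} (ψ : (Pl K → ZMod 2) → κ) : Prop :=
  ∀ f f' : Pl K → ZMod 2, {v | f v ≠ 0}.Finite → {v | f' v ≠ 0}.Finite → ψ f = ψ f' →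
    ∃ k : Kˣ, ∀ v : Pl K, ((v (k : K) : ℤ) : ZMod 2) = f v - f' v

namespace InTower

open GolodShafarevich

variable {p : ℕ} [Fact p.Prime] {K : Type u} [Field K] [NumberField K]

theorem exists_local_subgroup {L : Type u} [Field L] [NumberField L] [Algebra K L]
    (hL : InTower p K L) {q : ℕ} [Fact q.Prime] (hK : Module.finrank ℚ K = 2) :
    ∃ C : Subgroup Lˣ, C.index ≠ 0 ∧ C.index ≤ 2 ^ 6 ∧
      ∀ a ∈ C, IsSqInv K a → ∀ P : Pl L, 0 < P (q : L) → a ∈ P.lsq := by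
  classical
  have := hL.isGalois
  have : FiniteDimensional K L := Module.Finite.of_restrictScalars_finite ℚ K L
  have hq0 : (q : K) ≠ 0 := by exact_mod_cast (Fact.out : q.Prime).ne_zero
  have hfin : {v : Pl K | 0 < v (q : K)}.Finite :=
    (Pl.support_finite hq0).subset fun v hv => (hv : 0 < v (q : K)).ne'
  choose A e hA using Pl.exists_above (F := L) (E := K)
  set S := hfin.toFinset
  have hS : S.card ≤ 2 := by
    rw [← hK]
    exact Pl.card_le_finrank (q := q) S fun v hv => by simpa [S] using hv
  have hidx : ∀ P : Pl L, P.lsq.index ≠ 0 ∧ P.lsq.index ≤ 8 := fun P => by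
    have h2 := P.ord_two_nonneg
    rcases h2.eq_or_lt with h | h
    · exact ⟨(P.index_lsq_le_four h.symm).1, (P.index_lsq_le_four h.symm).2.trans (by norm_num)⟩
    · exact P.index_lsq_le_eight hL.two h
  refine ⟨⨅ v : S, (A v).lsq, Subgroup.index_iInf_ne_zero fun v => (hidx _).1,
    (Subgroup.index_iInf_le _).trans ?_, fun a ha hinv P hP => ?_⟩
  · calc ∏ v : S, (A v).lsq.index ≤ ∏ v : S, 8 := Finset.prod_le_prod' fun v _ => (hidx _).2
      _ = 8 ^ S.card := by simp
      _ ≤ 8 ^ 2 := Nat.pow_le_pow_right (by norm_num) hS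
      _ = 2 ^ 6 := by norm_num
  · obtain ⟨v, k, hv⟩ := P.exists_over (E := K)
    have h1 := hv.2 (q : K)
    rw [map_natCast] at h1
    rw [h1] at hP
    have hvS : v ∈ S := by simpa [S] using pos_of_mul_pos_right hP (by positivity)
    obtain ⟨g, rfl⟩ := (hA v).exists_tw_eq hv
    exact hinv.mem_lsq_tw (Subgroup.mem_iInf.1 ha ⟨v, hvS⟩) g

theorem exists_pos_subgroup {L : Type u} [Field L] [NumberField L] [Algebra K L]
    (hL : InTower p K L) (hK : Module.finrank ℚ K = 2) :
    ∃ C : Subgroup Lˣ, C.index ≠ 0 ∧ C.index ≤ 2 ^ 2 ∧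
      ∀ a ∈ C, IsSqInv K a → TotPos (a : L) := by
  have := hL.isGalois
  have := hL.isTotallyReal
  obtain ⟨h1, h2⟩ := finite_realEmbeddings K
  have := Fintype.ofFinite (K →+* ℝ)
  rw [hK, Nat.card_eq_fintype_card] at h2
  choose ψ hψ using exists_realEmbedding (K := K) (L := L)
  refine ⟨⨅ φ : K →+* ℝ, posUnits (ψ φ), Subgroup.index_iInf_ne_zero fun φ =>
    (index_posUnits_le _).1, (Subgroup.index_iInf_le _).trans ?_, fun a ha hinv φ => ?_⟩
  · calc ∏ φ : K →+* ℝ, (posUnits (ψ φ)).index ≤ ∏ φ : K →+* ℝ, 2 :=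
          Finset.prod_le_prod' fun v _ => (index_posUnits_le _).2
      _ = 2 ^ Fintype.card (K →+* ℝ) := by simp
      _ ≤ 2 ^ 2 := Nat.pow_le_pow_right (by norm_num) h2
  · obtain ⟨g, hg⟩ := exists_realEmbedding_eq_comp (K := K)
      (φ := ψ (φ.comp (algebraMap K L))) (ψ := φ) (hψ _)
    rw [hg]
    exact hinv.pos_comp (Subgroup.mem_iInf.1 ha (φ.comp (algebraMap K L))) g

/-- For a maximal field of the tower the Galois group has few relations. -/
theorem exists_covers_of_maximal {L : Type u} [Field L] [NumberField L] [Algebra K L]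
    (hL : InTower p K L) (hK : Module.finrank ℚ K = 2)
    (hmax : ∀ (E : Type u) [Field E] [NumberField E] [Algebra K E], InTower p K E →
      Module.finrank K E ≤ Module.finrank K L)
    {κ : Type*} [Fintype κ] {ψ : (Pl K → ZMod 2) → κ} (hψ : SepParity K ψ) :
    ∃ T : Finset ((L ≃ₐ[K] L) → (L ≃ₐ[K] L) → ZMod 2),
      Covers T ∧ T.card ≤ Fintype.card κ * 2 ^ 14 := by
  classical
  have := hL.isGalois
  have : FiniteDimensional K L := Module.Finite.of_restrictScalars_finite ℚ K L
  obtain ⟨C₁, h10, h1, hC₁⟩ := hL.exists_local_subgroup (q := 2) hK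
  obtain ⟨C₂, h20, h2, hC₂⟩ := hL.exists_local_subgroup (q := p) hK
  obtain ⟨C₃, h30, h3, hC₃⟩ := hL.exists_pos_subgroup hK
  set C := C₁ ⊓ C₂ ⊓ C₃
  have hC0 : C.index ≠ 0 := Subgroup.index_inf_ne_zero (Subgroup.index_inf_ne_zero h10 h20) h30
  have hC : C.index ≤ 2 ^ 14 := calc
    C.index ≤ (C₁ ⊓ C₂).index * C₃.index := Subgroup.index_inf_le
    _ ≤ C₁.index * C₂.index * C₃.index := Nat.mul_le_mul_right _ (Subgroup.index_inf_le)
    _ ≤ 2 ^ 6 * 2 ^ 6 * 2 ^ 2 := by gcongr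
    _ = 2 ^ 14 := by norm_num
  have hsq : ∀ a : Lˣ, a ∈ C → IsSqInv K a → (∀ P : Pl L, Even (P (a : L))) → IsSquare (a : L) := by
    intro a ha hinv hev
    by_contra hns
    obtain ⟨E, _, _, _, hE, hlt⟩ := hL.exists_step hns (fun g => by
      obtain ⟨c, hc⟩ := hinv g
      exact ⟨c, by simpa using congrArg Units.val hc⟩) hev (hC₁ a ha.1.1 hinv)
      (hC₂ a ha.1.2 hinv) (hC₃ a ha.2 hinv)
    exact absurd (hmax E hE) (by omega)
  choose A e hA using Pl.exists_above (F := L) (E := K)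
  let par : Lˣ → Pl K → ZMod 2 := fun a v => ((A v (a : L) : ℤ) : ZMod 2)
  have hpar : ∀ a, {v | par a v ≠ 0}.Finite := fun a => by
    have h4 := (Pl.support_finite a.ne_zero).preimage (f := A) (Function.Injective.injOn
      fun v w hvw => by
        have h5 := hA w
        rw [← hvw] at h5
        exact (hA v).unique h5)
    refine h4.subset fun v hv hv0 => hv ?_
    simp only [par]
    rw [hv0]; rfl
  have hover : ∀ (P : Pl L) (v : Pl K) (k : ℕ), P.Over v k → k = 1 := fun P v k h => by
    obtain ⟨x, hx0, hx⟩ := hL.unif P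
    rw [h.2] at hx
    have := Int.isUnit_iff.1 (IsUnit.of_mul_eq_one _ hx)
    omega
  have hrep : ∀ i, ∃ r : Lˣ, (∃ a, IsSqInv K a ∧ ψ (par a) = i) → IsSqInv K r ∧ ψ (par r) = i := by
    intro i
    by_cases h : ∃ a, IsSqInv K a ∧ ψ (par a) = i
    · obtain ⟨a, ha⟩ := h; exact ⟨a, fun _ => ha⟩
    · exact ⟨1, fun h' => (h h').elim⟩
  choose r hr using hrep
  have hk : ∀ a : Lˣ, ∃ k : Kˣ, IsSqInv K a → ∀ P : Pl L,
      Even (P (((a * (r (ψ (par a)))⁻¹ * Units.map (algebraMap K L).toMonoidHom k : Lˣ)) : L)) := by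
    intro a
    by_cases ha : IsSqInv K a
    swap
    · exact ⟨1, fun h => (ha h).elim⟩
    obtain ⟨hr1, hr2⟩ := hr _ ⟨a, ha, rfl⟩
    obtain ⟨k, hk⟩ := hψ (par a) (par (r (ψ (par a)))) (hpar _) (hpar _) hr2.symm
    refine ⟨k, fun _ P => ?_⟩
    obtain ⟨v, l, hv⟩ := P.exists_over (E := K)
    obtain ⟨g, rfl⟩ := (hA v).exists_tw_eq hv
    have h6 := ha.even_tw (A v) g
    have h7 := hr1.even_tw (A v) g
    have h8 := hk v
    have h9 := hv.2 (k : K)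
    rw [hover _ _ _ hv] at h9
    rw [← ZMod.intCast_eq_zero_iff_even]
    rw [Units.val_mul, Pl.ord_mul _ (Units.ne_zero _) (Units.ne_zero _),
      Units.val_mul, Pl.ord_mul _ (Units.ne_zero _) (Units.ne_zero _), Units.val_inv_eq_inv_val,
          Pl.ord_inv]
    have h10 : ((Units.map (algebraMap K L).toMonoidHom k : Lˣ) : L) = algebraMap K L (k : K) := rfl
    rw [h10, h9]
    push_cast
    rw [h6, h7, h8, one_mul]
    change par a v + -par (r (ψ (par a))) v + (par a v - par (r (ψ (par a))) v) = 0
    linear_combination (par a v - par (r (ψ (par a))) v) * CharTwo.two_eq_zero (R := ZMod 2)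
  choose k hk using hk
  have : Fintype (Lˣ ⧸ C) := Subgroup.fintypeOfIndexNeZero hC0
  obtain ⟨T, hT, hcard⟩ := hL.exists_covers (ι := κ × (Lˣ ⧸ C)) (fun a => (ψ (par a),
    QuotientGroup.mk (a * (r (ψ (par a)))⁻¹ * Units.map (algebraMap K L).toMonoidHom (k a)))) (by
      intro a b ha hb hab
      obtain ⟨h11, h12⟩ := Prod.ext_iff.1 hab
      simp only at h11 h12
      rw [← h11] at h12
      have hae := hk a ha
      have hbe := hk b hb
      rw [← h11] at hbe
      obtain ⟨hr1, -⟩ := hr _ ⟨a, ha, rfl⟩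
      set ρ := r (ψ (par a))
      set ka : Lˣ := Units.map (algebraMap K L).toMonoidHom (k a)
      set kb : Lˣ := Units.map (algebraMap K L).toMonoidHom (k b)
      have h13 := QuotientGroup.eq.1 h12.symm
      obtain ⟨y, hy⟩ := hsq _ h13 (((hb.mul hr1.inv).mul (isSqInv_map _)).inv.mul
        ((ha.mul hr1.inv).mul (isSqInv_map _))) fun P => by
          rw [Units.val_mul, Pl.ord_mul _ (Units.ne_zero _) (Units.ne_zero _),
            Units.val_inv_eq_inv_val, Pl.ord_inv]
          exact (hbe P).neg.add (hae P)
      have hy0 : y ≠ 0 := by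
        rintro rfl
        rw [mul_zero] at hy
        exact Units.ne_zero _ hy
      refine ⟨k b * (k a)⁻¹, Units.mk0 y hy0, ?_⟩
      have h14 : (b * ρ⁻¹ * kb)⁻¹ * (a * ρ⁻¹ * ka) = Units.mk0 y hy0 ^ 2 := by
        ext; rw [hy, Units.val_pow_eq_pow_val, Units.val_mk0, sq]
      rw [← h14, map_mul, map_inv]
      change a = b * (kb * ka⁻¹) * _
      ext
      push_cast
      field_simp)
  refine ⟨T, hT, hcard.trans ?_⟩
  rw [Fintype.card_prod, ← Nat.card_eq_fintype_card (α := Lˣ ⧸ C)]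
  exact Nat.mul_le_mul_left _ hC

end InTower

end

section

open NumberField IsDedekindDomain

universe u

namespace Pl

variable {K : Type u} [Field K] [NumberField K]

/-- The parities of an `S`-unit at the places of `S`. -/
noncomputable def parHom (S : Finset (Pl K)) :
    Additive (sUnits (S : Set (Pl K))) →+ (S → ZMod 2) where
  toFun x v := ((v.1 ((x.toMul : Kˣ) : K) : ℤ) : ZMod 2)
  map_zero' := by
    funext v
    change ((v.1 ((1 : K)) : ℤ) : ZMod 2) = 0
    rw [ord_one]; rfl
  map_add' x y := by
    funext v
    change ((v.1 (((x.toMul : Kˣ) : K) * ((y.toMul : Kˣ) : K)) : ℤ) : ZMod 2) = _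
    rw [ord_mul _ (Units.ne_zero _) (Units.ne_zero _)]
    push_cast; rfl

theorem card_range_parHom_ge (S : Finset (Pl K)) {ι : Type*} [Finite ι]
    (s : Kˣ → ι) (hs : ∀ x y : Kˣ, (∀ P : Pl K, Even (P (x : K))) → (∀ P : Pl K, Even (P (y : K))) →
      s x = s y → IsSquare (x / y)) :
    2 ^ (Units.rank K + S.card + 1) ≤ Nat.card (parHom S).range * Nat.card ι := by
  classical
  rw [← index_sq_sUnits, ← Nat.card_prod]
  choose u hu using fun w : (parHom S).range => w.2
  let W : sUnits (S : Set (Pl K)) → (parHom S).range :=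
      fun x => ⟨parHom S (Additive.ofMul x), _, rfl⟩
  let Q := sUnits (S : Set (Pl K)) ⧸ (powMonoidHom 2 : sUnits (S : Set (Pl K)) →* _).range
  let j : Q → (parHom S).range × ι := fun q => (W q.out, s (q.out / (u (W q.out)).toMul :))
  refine Nat.card_le_card_of_injective j fun q q' h => ?_
  obtain ⟨h1, h2⟩ := Prod.ext_iff.1 h
  simp only [j] at h1 h2
  have hev : ∀ x : sUnits (S : Set (Pl K)), ∀ P : Pl K,
      Even (P (((x / (u (W x)).toMul : sUnits (S : Set (Pl K))) : Kˣ) : K)) := fun x P => by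
    by_cases hP : P ∈ S
    · have h3 : parHom S (Additive.ofMul (x / (u (W x)).toMul)) = 0 := by
        rw [ofMul_div, map_sub, ofMul_toMul, hu, sub_self]
      exact ZMod.intCast_eq_zero_iff_even.1 (congrFun h3 ⟨P, hP⟩)
    · rw [(x / (u (W x)).toMul).2 P hP]; exact Even.zero
  have h4 := hs _ _ (hev _) (hev _) h2
  rw [h1] at h4
  obtain ⟨c, hc⟩ := h4
  have h5 : (q.out : Kˣ) / (q'.out : Kˣ) = c * c := by
    rw [← hc]; push_cast; rw [div_div_div_cancel_right]
  have hcS : c ∈ sUnits (S : Set (Pl K)) := fun P hP => by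
    have h6 := (q.out / q'.out).2 P hP
    rw [Subgroup.coe_div, h5, Units.val_mul, ord_mul _ c.ne_zero c.ne_zero] at h6
    omega
  rw [← QuotientGroup.out_eq' q, ← QuotientGroup.out_eq' q']
  have h7 : q'.out⁻¹ * q.out ∈ (powMonoidHom 2 : sUnits (S : Set (Pl K)) →* _).range := by
    refine MonoidHom.mem_range.2 ⟨⟨c, hcS⟩, Subtype.ext ?_⟩
    change c ^ 2 = (q'.out : Kˣ)⁻¹ * (q.out : Kˣ)
    rw [sq, ← h5, div_eq_inv_mul]
  exact (QuotientGroup.eq.2 h7).symm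

theorem exists_sepParity [IsTotallyReal K] (hK : Module.finrank ℚ K = 2) {ι : Type*} [Finite ι]
    (s : Kˣ → ι) (hs : ∀ x y : Kˣ, (∀ P : Pl K, Even (P (x : K))) → (∀ P : Pl K, Even (P (y : K))) →
      s x = s y → IsSquare (x / y)) :
    ∃ (κ : Type u) (_ : Fintype κ) (ψ : (Pl K → ZMod 2) → κ),
      SepParity K ψ ∧ 4 * Fintype.card κ ≤ Nat.card ι := by
  classical
  obtain ⟨S, hS⟩ : ∃ S : Finset (Pl K), ClTrivial (S : Set (Pl K)) := by
    obtain ⟨S, hf, -, hS⟩ := exists_classGroup_trivial (F := K) ∅ Set.finite_empty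
    lift S to Finset (Pl K) using hf
    exact ⟨S, hS⟩
  have hcl : ∀ f : Pl K → ZMod 2, ∃ y : Kˣ, {v | f v ≠ 0}.Finite →
      ∀ v ∉ S, ((v (y : K) : ℤ) : ZMod 2) = f v := fun f => by
    by_cases hf : {v | f v ≠ 0}.Finite
    · obtain ⟨y, hy⟩ := hS.exists_ord_eq (fun v => (f v).val) (hf.subset fun v hv => by
        intro h
        exact hv.2 (by rw [h]; rfl))
      refine ⟨y, fun _ v hv => ?_⟩
      rw [hy v hv]; simp
    · exact ⟨1, fun h => (hf h).elim⟩
  choose y hy using hcl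
  let Q := (S → ZMod 2) ⧸ (parHom S).range
  have : Fintype Q := Fintype.ofFinite Q
  refine ⟨Q, inferInstance, fun f => QuotientAddGroup.mk
    fun v => f v - ((v.1 (y f : K) : ℤ) : ZMod 2), fun f f' hf hf' h => ?_, ?_⟩
  · obtain ⟨u, hu⟩ := QuotientAddGroup.eq.1 h.symm
    refine ⟨(u.toMul : Kˣ) * (y f / y f'), fun v => ?_⟩
    rw [Units.val_mul, Units.val_div_eq_div_val, ord_mul _ (Units.ne_zero _)
      (div_ne_zero (Units.ne_zero _) (Units.ne_zero _)),
          ord_div _ (Units.ne_zero _) (Units.ne_zero _)]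
    push_cast
    by_cases hv : v ∈ S
    · have h1 := congrFun hu ⟨v, hv⟩
      have h2 : ((v ((u.toMul : Kˣ) : K) : ℤ) : ZMod 2) = parHom S u ⟨v, hv⟩ := rfl
      rw [h2, h1]
      simp only [Pi.add_apply, Pi.neg_apply]
      ring
    · rw [hy f hf v hv, hy f' hf' v hv, u.toMul.2 v hv]
      simp
  · have h1 := card_range_parHom_ge S s hs
    have h2 := rank_add_one_eq (F := K)
    rw [hK] at h2
    have h3 := AddSubgroup.card_eq_card_quotient_mul_card_addSubgroup (parHom S).range
    have h4 : Nat.card (S → ZMod 2) = 2 ^ S.card := by simp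
    rw [h4, Nat.card_eq_fintype_card (α := (S → ZMod 2) ⧸ (parHom S).range)] at h3
    rw [show Units.rank K + S.card + 1 = S.card + 2 by omega, pow_add] at h1
    have h5 : 0 < Nat.card (parHom S).range := Nat.card_pos
    refine Nat.le_of_mul_le_mul_left (c := Nat.card (parHom S).range) ?_ h5
    calc _ = 2 ^ S.card * 2 ^ 2 := by rw [h3]; ring
      _ ≤ _ := h1

end Pl

end

section

open NumberField IsDedekindDomain

universe u

/-- The `ℓ`-adic valuation of the rationals. -/
noncomputable def ratPl (ℓ : ℕ) [hℓ : Fact ℓ.Prime] : Pl ℚ where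
  ord := padicValRat ℓ
  ord_zero' := padicValRat.zero
  ord_mul' _ _ hx hy := padicValRat.mul hx hy
  ord_add' _ _ _ _ h := padicValRat.min_le_padicValRat_add h
  exists_one' := ⟨ℓ, padicValRat.self hℓ.out.one_lt⟩

theorem ratPl_self (ℓ : ℕ) [hℓ : Fact ℓ.Prime] : ratPl ℓ (ℓ : ℚ) = 1 :=
  padicValRat.self hℓ.out.one_lt

theorem Rat.isSquare_of_even {q : ℚ} (hq : 0 < q)
    (h : ∀ (ℓ : ℕ) [Fact ℓ.Prime], Even (ratPl ℓ q)) : IsSquare q := by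
  have hn : (q.num.natAbs : ℚ) = q.num := by
    have h1 := Rat.num_pos.2 hq
    have h2 : (q.num.natAbs : ℤ) = q.num := by omega
    rw [← Int.cast_natCast, h2]
  have hd : (q.den : ℚ) ≠ 0 := by exact_mod_cast q.den_ne_zero
  have hqd : q * (q.den : ℚ) ^ 2 = ((q.num.natAbs * q.den : ℕ) : ℚ) := by
    push_cast [hn]
    nth_rewrite 1 [← Rat.num_div_den q]
    field_simp
  obtain ⟨a, b, hab, hsq⟩ := Nat.sq_mul_squarefree (q.num.natAbs * q.den)
  rw [← hab] at hqd
  have hb : (b : ℚ) ≠ 0 := by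
    rintro hb
    have : q * (q.den : ℚ) ^ 2 = 0 := by rw [hqd]; push_cast; rw [hb]; ring
    exact mul_ne_zero hq.ne' (pow_ne_zero _ hd) this
  have ha : a = 1 := by
    by_contra ha
    obtain ⟨ℓ, hℓ, hdvd⟩ := Nat.exists_prime_and_dvd ha
    have := Fact.mk hℓ
    have h1 := congrArg (ratPl ℓ) hqd
    push_cast at h1
    have ha0 : (a : ℚ) ≠ 0 := by exact_mod_cast hsq.ne_zero
    rw [Pl.ord_mul _ hq.ne' (pow_ne_zero _ hd), Pl.ord_mul _ (pow_ne_zero _ hb) ha0, Pl.ord_pow,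
      Pl.ord_pow] at h1
    have h2 : ratPl ℓ (a : ℚ) = 1 := by
      change padicValRat ℓ (a : ℚ) = 1
      rw [padicValRat.of_nat]
      have h3 := hsq.natFactorization_le_one ℓ
      rw [Nat.factorization_def _ hℓ] at h3
      have h4 := one_le_padicValNat_of_dvd hsq.ne_zero hdvd
      omega
    obtain ⟨k, hk⟩ := h ℓ
    rw [h2, hk] at h1
    push_cast at h1
    omega
  refine ⟨b / q.den, ?_⟩
  rw [ha] at hqd
  push_cast at hqd
  field_simp
  linarith

namespace Pl

variable {F : Type*} [Field F] (P : Pl F)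

theorem lsq_of_modEq_one {m : ℕ} (hm : m ≡ 1 [MOD 8]) (h2 : 0 < P ((2 : ℕ) : F))
    {u : Fˣ} (hu : (u : F) = m) : u ∈ P.lsq := by
  refine ⟨1, one_ne_zero, ?_⟩
  obtain ⟨k, hk⟩ := hm.symm.dvd
  rw [one_pow, one_mul, hu]
  have h1 : (m : F) - 1 = ((2 : ℕ) : F) ^ 3 * ((k : ℤ) : F) := by
    have : ((m : ℤ) : F) - ((1 : ℕ) : ℤ) = (((8 : ℕ) : ℤ) : F) * (k : ℤ) := by
      rw [← Int.cast_sub, hk, Int.cast_mul]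
    push_cast at this ⊢
    rw [this]; ring
  rw [h1]
  push_cast at h2 ⊢
  have h3 := P.mul_mem_ge (P.mem_ge_self ((2 : F) ^ 3)) (P.intCast_mem_ge (k : ℤ))
  refine P.ge_anti ?_ h3
  rw [ord_pow]; push_cast; omega

theorem lsq_of_isSquare_zmod [CharZero F] {p : ℕ} [hp : Fact p.Prime] (hp2 : p ≠ 2) {m : ℕ}
    (hm : ¬ p ∣ m) (hsq : IsSquare (m : ZMod p)) (h : 0 < P (p : F))
    {u : Fˣ} (hu : (u : F) = m) : u ∈ P.lsq := by
  have hP2 : P (2 : F) = 0 := by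
    have := (P.ord_intCast_of_coprime h (n := 2) ?_).2
    · exact_mod_cast this
    · have := (Nat.coprime_primes Nat.prime_two hp.out).2 (Ne.symm hp2)
      exact_mod_cast Nat.isCoprime_iff_coprime.2 this
  obtain ⟨z, hz⟩ := hsq
  have hz0 : z ≠ 0 := by
    rintro rfl
    rw [mul_zero, ZMod.natCast_eq_zero_iff] at hz
    exact hm hz
  set c : ℕ := (z⁻¹).val
  have hc : (c : ZMod p) = z⁻¹ := ZMod.natCast_zmod_val _
  have hd : ((c ^ 2 * m - 1 : ℤ) : ZMod p) = 0 := by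
    push_cast
    rw [hc, hz]; field_simp; ring
  obtain ⟨k, hk⟩ := (ZMod.intCast_zmod_eq_zero_iff_dvd _ p).1 hd
  have hc0 : c ≠ 0 := by
    intro h0
    rw [h0] at hc
    simp at hc
    exact hz0 hc.symm
  have hk' : (c : F) ^ 2 * m - 1 = (p : F) * ((k : ℤ) : F) := by
    have := congrArg (Int.cast : ℤ → F) hk
    push_cast at this
    exact this
  refine ⟨c, by exact_mod_cast hc0, ?_⟩
  rw [hu, hk', hP2]
  refine P.ge_anti ?_ (P.mul_mem_ge (P.mem_ge_self (p : F)) (P.intCast_mem_ge k))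
  omega

end Pl

/-- Products of the primes of a family. -/
def famProd {J : Type*} (q : J → ℕ) (A : Finset J) : ℕ := ∏ j ∈ A, q j

/-- A family of distinct primes, congruent to `1` modulo `8`, prime to `p`, and with the same
quadratic character modulo `p`. -/
structure PrimeFam {J : Type*} (p : ℕ) (q : J → ℕ) : Prop where
  prime : ∀ j, (q j).Prime
  inj : Function.Injective q
  mod8 : ∀ j, q j ≡ 1 [MOD 8]
  ne : ∀ j, q j ≠ p
  char : ∀ i j, IsSquare (q i : ZMod p) ↔ IsSquare (q j : ZMod p)

namespace PrimeFam

variable {J : Type*} {p : ℕ} {q : J → ℕ} (h : PrimeFam p q)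
include h

theorem pos (A : Finset J) : 0 < famProd q A := Finset.prod_pos fun j _ => (h.prime j).pos

theorem famProd_mod8 (A : Finset J) : famProd q A ≡ 1 [MOD 8] := by
  classical
  induction A using Finset.induction_on with
  | empty => exact rfl
  | insert j A hj ih =>
    rw [famProd, Finset.prod_insert hj]
    exact (h.mod8 j).mul ih

theorem not_dvd [hp : Fact p.Prime] (A : Finset J) : ¬ p ∣ famProd q A := by
  intro hd
  obtain ⟨j, -, hj⟩ := (Nat.Prime.prime hp.out).exists_mem_finset_dvd hd
  exact h.ne j ((Nat.prime_dvd_prime_iff_eq hp.out (h.prime j)).1 hj).symm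

theorem ord_eq_zero {F : Type*} [Field F] [CharZero F] {P : Pl F} {i j : J} (hij : i ≠ j)
    (hP : 0 < P (q i : F)) : P (q j : F) = 0 := by
  have := (P.ord_intCast_of_coprime hP (n := q j) ?_).2
  · exact_mod_cast this
  · exact Nat.isCoprime_iff_coprime.2
      ((Nat.coprime_primes (h.prime j) (h.prime i)).2 fun hh => hij (h.inj hh).symm)

theorem ord_famProd {F : Type*} [Field F] [CharZero F] [DecidableEq J] {P : Pl F} {j : J}
    (hP : 0 < P (q j : F)) (A : Finset J) :
    P (famProd q A : F) = if j ∈ A then P (q j : F) else 0 := by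
  have hq : ∀ i, (q i : F) ≠ 0 := fun i => by exact_mod_cast (h.prime i).ne_zero
  induction A using Finset.induction_on with
  | empty => simp [famProd]
  | insert i A hi ih =>
    rw [famProd, Finset.prod_insert hi, Nat.cast_mul, Pl.ord_mul _ (hq i)
      (by exact_mod_cast (h.pos A).ne')]
    rw [famProd] at ih
    rw [ih]
    by_cases hij : j = i
    · subst hij; simp [hi]
    · rw [h.ord_eq_zero hij hP]; simp [hij]

theorem ord_famProd_of_forall {F : Type*} [Field F] [CharZero F] {P : Pl F} {A : Finset J}
    (hP : ∀ j ∈ A, P (q j : F) = 0) : P (famProd q A : F) = 0 := by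
  classical
  have hq : ∀ i, (q i : F) ≠ 0 := fun i => by exact_mod_cast (h.prime i).ne_zero
  induction A using Finset.induction_on with
  | empty => simp [famProd]
  | insert i A hi ih =>
    rw [famProd, Finset.prod_insert hi, Nat.cast_mul, Pl.ord_mul _ (hq i)
      (by exact_mod_cast (h.pos A).ne'), hP i (Finset.mem_insert_self _ _), zero_add]
    exact ih fun j hj => hP j (Finset.mem_insert_of_mem hj)

theorem ord_famProd_ne_zero {F : Type*} [Field F] [CharZero F] {P : Pl F} {A : Finset J}
    (hP : P (famProd q A : F) ≠ 0) : ∃ j ∈ A, 0 < P (q j : F) := by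
  contrapose! hP
  exact h.ord_famProd_of_forall fun j hj => le_antisymm (hP j hj) (P.ord_natCast_nonneg _)

theorem isSquare_mul [hp : Fact p.Prime] (i j : J) : IsSquare ((q i * q j : ℕ) : ZMod p) := by
  push_cast
  by_cases hi : IsSquare (q i : ZMod p)
  · exact hi.mul ((h.char i j).1 hi)
  · have hj := fun hj => hi ((h.char i j).2 hj)
    have hp2 : ringChar (ZMod p) ≠ 2 := by
      rw [ZMod.ringChar_zmod_n]
      rintro rfl
      exact hi (FiniteField.isSquare_of_char_two (ZMod.ringChar_zmod_n 2) _)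
    have h1 := quadraticChar_neg_one_iff_not_isSquare.2 hi
    have h2 := quadraticChar_neg_one_iff_not_isSquare.2 hj
    have h3 : quadraticChar (ZMod p) ((q i : ZMod p) * q j) = 1 := by
      rw [map_mul, h1, h2]; norm_num
    refine (quadraticChar_one_iff_isSquare ?_).1 h3
    intro h0
    rw [h0, quadraticChar_zero] at h3
    exact zero_ne_one h3

theorem lsq_p [hp : Fact p.Prime] {F : Type*} [Field F] [CharZero F] {P : Pl F} {A : Finset J}
    (hA : IsSquare (famProd q A : ZMod p)) (hP : 0 < P (p : F)) {u : Fˣ}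
    (hu : (u : F) = famProd q A) : u ∈ P.lsq := by
  by_cases hp2 : p = 2
  · subst hp2
    exact P.lsq_of_modEq_one (h.famProd_mod8 A) hP hu
  · exact P.lsq_of_isSquare_zmod hp2 (h.not_dvd A) hA hP hu

end PrimeFam

end

section

open NumberField IsDedekindDomain

universe u

namespace PrimeFam

variable {J : Type*} {p : ℕ} {q : J → ℕ}

/-- The sign of a rational number and its parities at the primes of a family. -/
noncomputable def signParity (q : J → ℕ) (x : ℚ) : Bool × (J → ZMod 2) :=
  (decide (0 < x), fun j => (padicValRat (q j) x : ZMod 2))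

theorem isSquare_div_of_signParity {x y : ℚ} (hx0 : x ≠ 0) (hy0 : y ≠ 0)
    (hxy : signParity q x = signParity q y)
    (hx : ∀ (ℓ : ℕ) [Fact ℓ.Prime], (∀ j, q j ≠ ℓ) → Even (ratPl ℓ x))
    (hy : ∀ (ℓ : ℕ) [Fact ℓ.Prime], (∀ j, q j ≠ ℓ) → Even (ratPl ℓ y)) : IsSquare (x / y) := by
  obtain ⟨h1, h2⟩ := Prod.ext_iff.1 hxy
  refine Rat.isSquare_of_even ?_ fun ℓ _ => ?_
  · have h3 : 0 < x ↔ 0 < y := by simpa [signParity] using h1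
    rcases lt_or_gt_of_ne hx0 with hx' | hx'
    · have : ¬ 0 < y := fun hh => (h3.2 hh).not_gt hx'
      exact div_pos_of_neg_of_neg hx' (lt_of_le_of_ne (not_lt.1 this) hy0)
    · exact div_pos hx' (h3.1 hx')
  · rw [Pl.ord_div _ hx0 hy0]
    by_cases hℓ : ∀ j, q j ≠ ℓ
    · exact (hx ℓ hℓ).sub (hy ℓ hℓ)
    · push Not at hℓ
      obtain ⟨j, rfl⟩ := hℓ
      have h3 : ((padicValRat (q j) x : ℤ) : ZMod 2) = (padicValRat (q j) y : ℤ) := congrFun h2 j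
      refine ZMod.intCast_eq_zero_iff_even.1 ?_
      change ((padicValRat (q j) x - padicValRat (q j) y : ℤ) : ZMod 2) = 0
      push_cast
      rw [h3, sub_self]

variable [Fintype J] {K : Type u} [Field K] [NumberField K] {s : K}

theorem even_of_even_map (h : PrimeFam p q)
    (hQ : IsQuad ((famProd q Finset.univ : ℕ) : ℚ) s) {x : ℚ}
    (hx : ∀ P : Pl K, Even (P (algebraMap ℚ K x))) (ℓ : ℕ) [hℓ : Fact ℓ.Prime]
    (hne : ∀ j, q j ≠ ℓ) : Even (ratPl ℓ x) := by
  set D := famProd q Finset.univ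
  have hℓD : ¬ ℓ ∣ D := by
    intro hd
    obtain ⟨j, -, hj⟩ := (Nat.Prime.prime hℓ.out).exists_mem_finset_dvd hd
    exact hne j ((Nat.prime_dvd_prime_iff_eq hℓ.out (h.prime j)).1 hj).symm
  obtain ⟨P, k, hP⟩ := Pl.exists_above (F := K) (ratPl ℓ)
  suffices hk : k = 1 by
    have := hx P
    rwa [hP.2, hk, Nat.cast_one, one_mul] at this
  refine hQ.over_one hP ?_
  have hD0 : (D : ℚ) ≠ 0 := hQ.ne_zero
  by_cases hℓ2 : ℓ = 2
  · left
    subst hℓ2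
    refine hQ.comap_ne_of_mem_lsq hP (u := Units.mk0 _ hD0) rfl ?_
    refine (ratPl 2).lsq_of_modEq_one (h.famProd_mod8 _) ?_ rfl
    rw [ratPl_self]; norm_num
  · right
    have hs2 : s ^ 2 = ((D : ℕ) : K) := by rw [hQ.sq, map_natCast]
    have hPD : P (D : K) = 0 := by
      have h1 : ratPl ℓ ((D : ℤ) : ℚ) = 0 := by
        refine ((ratPl ℓ).ord_intCast_of_coprime (q := ℓ) (by rw [ratPl_self]; norm_num) ?_).2
        exact Nat.isCoprime_iff_coprime.2 ((Nat.Prime.coprime_iff_not_dvd hℓ.out).2 hℓD).symm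
      have h2 := hP.2 (D : ℚ)
      rw [map_natCast] at h2
      rw [h2]
      push_cast at h1
      rw [h1, mul_zero]
    have hPs : P s = 0 := by
      have := P.ord_sq s
      rw [hs2, hPD] at this
      omega
    have hP2 : P (2 : K) = 0 := by
      have hPℓ : 0 < P (ℓ : K) := by
        have h2 := hP.2 (ℓ : ℚ)
        rw [map_natCast, ratPl_self] at h2
        rw [h2]; have := hP.1; positivity
      have := (P.ord_intCast_of_coprime hPℓ (n := 2) ?_).2
      · exact_mod_cast this
      · have := (Nat.coprime_primes Nat.prime_two hℓ.out).2 (Ne.symm hℓ2)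
        exact_mod_cast Nat.isCoprime_iff_coprime.2 this
    have hs0 := hQ.root_ne_zero
    refine ⟨s, fun _ => hPs.ge, fun hmem => ?_⟩
    rw [hQ.conj_root, show -s - s = (-1) * (2 * s) by ring] at hmem
    have h2s : (2 : K) * s ≠ 0 := mul_ne_zero two_ne_zero hs0
    have := hmem (mul_ne_zero (neg_ne_zero.2 one_ne_zero) h2s)
    rw [Pl.ord_mul _ (neg_ne_zero.2 one_ne_zero) h2s, Pl.ord_mul _ two_ne_zero hs0, hPs, hP2,
      Pl.ord_neg_one] at this
    norm_num at this

/-- An element whose norm is a square is rational up to squares. -/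
theorem _root_.IsQuad.exists_of_isSquare_nm {F E : Type*} [Field F] [Field E] [CharZero E]
    [Algebra F E] {e : F} {s : E} (h : IsQuad e s) {z : E} (hz : z ≠ 0) (hsq : IsSquare (h.nm z)) :
    ∃ (r : F) (k : E), r ≠ 0 ∧ k ≠ 0 ∧ z = k ^ 2 * algebraMap F E r := by
  obtain ⟨n, hn⟩ := hsq
  have h1 : z * h.conj z = algebraMap F E n ^ 2 := by
    rw [← h.algebraMap_nm, hn, map_mul, sq]
  have hcz : h.conj z ≠ 0 := by simpa using hz
  have hn0 : n ≠ 0 := by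
    rintro rfl
    rw [map_zero, zero_pow two_ne_zero] at h1
    exact mul_ne_zero hz hcz h1
  have hn1 : algebraMap F E n ≠ 0 := by simpa using hn0
  by_cases hu : algebraMap F E n + z = 0
  · refine ⟨-n, 1, neg_ne_zero.2 hn0, one_ne_zero, ?_⟩
    rw [map_neg, one_pow, one_mul]
    linear_combination hu
  · set w := algebraMap F E n + z
    have hcw : h.conj w ≠ 0 := by simpa using hu
    have h2 : h.conj w * z = algebraMap F E n * w := by
      simp only [w, map_add, AlgEquiv.commutes]
      linear_combination h1
    have hnw : algebraMap F E (h.nm w) = w * h.conj w := h.algebraMap_nm w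
    have hnw0 : h.nm w ≠ 0 := by
      intro h0
      rw [h0, map_zero] at hnw
      exact mul_ne_zero hu hcw hnw.symm
    refine ⟨n / h.nm w, w, div_ne_zero hn0 hnw0, hu, ?_⟩
    rw [map_div₀, hnw]
    field_simp
    linear_combination h2

theorem exists_selmer_bound (h : PrimeFam p q)
    (hQ : IsQuad ((famProd q Finset.univ : ℕ) : ℚ) s) :
    ∃ σ : Kˣ → (Bool × (J → ZMod 2)) × (Bool × (J → ZMod 2)), ∀ x y : Kˣ,
      (∀ P : Pl K, Even (P (x : K))) → (∀ P : Pl K, Even (P (y : K))) →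
      σ x = σ y → IsSquare (x / y) := by
  classical
  set κ := Bool × (J → ZMod 2)
  let Ev : Kˣ → Prop := fun x => ∀ P : Pl K, Even (P (x : K))
  have hdiv : ∀ x y : Kˣ, Ev x → Ev y → Ev (x / y) := fun x y hx hy P => by
    rw [Units.val_div_eq_div_val, P.ord_div x.ne_zero y.ne_zero]
    exact (hx P).sub (hy P)
  let N : Kˣ → κ := fun x => signParity q (hQ.nm (x : K))
  have hN0 : ∀ x : Kˣ, hQ.nm (x : K) ≠ 0 := fun x => by
    intro h0
    have := hQ.algebraMap_nm (x : K)
    rw [h0, map_zero] at this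
    exact mul_ne_zero x.ne_zero (by simp) this.symm
  have hNev : ∀ x, Ev x → ∀ (ℓ : ℕ) [Fact ℓ.Prime], (∀ j, q j ≠ ℓ) →
      Even (ratPl ℓ (hQ.nm (x : K))) := fun x hx => h.even_of_even_map hQ fun P => by
    rw [hQ.algebraMap_nm, P.ord_mul x.ne_zero (by simp)]
    exact (hx P).add (hx (P.tw hQ.conj))
  have hNsq : ∀ x y, Ev x → Ev y → N x = N y → IsSquare (hQ.nm ((x / y : Kˣ) : K)) :=
    fun x y hx hy hxy => by
      have := isSquare_div_of_signParity (hN0 x) (hN0 y) hxy (hNev x hx) (hNev y hy)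
      have hd : hQ.nm ((x / y : Kˣ) : K) = hQ.nm (x : K) / hQ.nm (y : K) := by
        rw [eq_div_iff (hN0 y), ← map_mul, ← Units.val_mul, div_mul_cancel]
      rwa [hd]
  have hrep : ∀ c : κ, ∃ z : Kˣ, (∃ x, Ev x ∧ N x = c) → Ev z ∧ N z = c := fun c => by
    by_cases hc : ∃ x, Ev x ∧ N x = c
    · obtain ⟨x, hx⟩ := hc; exact ⟨x, fun _ => hx⟩
    · exact ⟨1, fun hh => (hc hh).elim⟩
  choose z hz using hrep
  have hrat : ∀ x : Kˣ, ∃ r : ℚ, r ≠ 0 ∧ (IsSquare (hQ.nm (x : K)) →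
      ∃ k : K, k ≠ 0 ∧ (x : K) = k ^ 2 * algebraMap ℚ K r) := fun x => by
    by_cases hx : IsSquare (hQ.nm (x : K))
    · obtain ⟨r, k, hr, hk, he⟩ := hQ.exists_of_isSquare_nm x.ne_zero hx
      exact ⟨r, hr, fun _ => ⟨k, hk, he⟩⟩
    · exact ⟨1, one_ne_zero, fun hh => (hx hh).elim⟩
  choose r hr0 hr using hrat
  have hrev : ∀ x, Ev x → IsSquare (hQ.nm (x : K)) → ∀ (ℓ : ℕ) [Fact ℓ.Prime], (∀ j, q j ≠ ℓ) →
      Even (ratPl ℓ (r x)) := fun x hx hsq => h.even_of_even_map hQ fun P => by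
    obtain ⟨k, hk, he⟩ := hr x hsq
    have h1 := hx P
    rw [he, P.ord_mul (pow_ne_zero _ hk) (by simpa using hr0 x), P.ord_sq] at h1
    exact (Int.even_add.1 h1).1 (even_two_mul _)
  refine ⟨fun x => (N x, signParity q (r (x / z (N x)))), fun x y hx hy hxy => ?_⟩
  obtain ⟨h1, h2⟩ := Prod.ext_iff.1 hxy
  simp only at h1 h2
  obtain ⟨hz1, hz2⟩ := hz (N x) ⟨x, hx, rfl⟩
  rw [← h1] at h2
  have hsx := hNsq x _ hx hz1 hz2.symm
  have hsy := hNsq y _ hy hz1 (h1.symm.trans hz2.symm)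
  obtain ⟨m, hm⟩ := isSquare_div_of_signParity (hr0 _) (hr0 _) h2
    (hrev _ (hdiv _ _ hx hz1) hsx) (hrev _ (hdiv _ _ hy hz1) hsy)
  obtain ⟨k, hk, hkx⟩ := hr _ hsx
  obtain ⟨k', hk', hky⟩ := hr _ hsy
  have hm0 : m ≠ 0 := by
    rintro rfl
    rw [mul_zero] at hm
    exact div_ne_zero (hr0 _) (hr0 _) hm
  have hm1 : algebraMap ℚ K m ≠ 0 := by simpa using hm0
  refine ⟨Units.mk0 (k * k'⁻¹ * algebraMap ℚ K m)
      (mul_ne_zero (mul_ne_zero hk (inv_ne_zero hk')) hm1), ?_⟩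
  rw [← div_div_div_cancel_right x y (z (N x))]
  ext
  rw [Units.val_div_eq_div_val, hkx, hky, Units.val_mul, Units.val_mk0]
  have h3 : algebraMap ℚ K (r (x / z (N x))) =
      algebraMap ℚ K m * algebraMap ℚ K m * algebraMap ℚ K (r (y / z (N x))) := by
    rw [← map_mul, ← map_mul, ← hm, div_mul_cancel₀ _ (hr0 _)]
  have h4 : algebraMap ℚ K (r (y / z (N x))) ≠ 0 := by simpa using hr0 _
  rw [h3]
  field_simp

end PrimeFam

end

section

open NumberField IsDedekindDomain

universe u

namespace PrimeFam

section
variable {I : Type*} [DecidableEq I] {p : ℕ} {q : I × Bool → ℕ} (h : PrimeFam p q)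

/-- The indices of a pair of primes of the family. -/
def pair (i : I) : Finset (I × Bool) := {i} ×ˢ Finset.univ

theorem famProd_pair (i : I) : famProd q (pair i) = q (i, true) * q (i, false) := by
  rw [famProd, pair, Finset.prod_product]; simp

include h

theorem even_famProd_pair [Fintype I] {F : Type*} [Field F] [CharZero F] {s : F}
    (hs : s ^ 2 = (famProd q Finset.univ : ℕ)) (P : Pl F) (i : I) :
    Even (P (famProd q (pair i) : F)) := by
  by_cases h0 : P (famProd q (pair i) : F) = 0
  · rw [h0]; exact Even.zero
  · obtain ⟨j, hj, hP⟩ := h.ord_famProd_ne_zero h0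
    have h1 := P.ord_sq s
    rw [hs, h.ord_famProd hP, if_pos (Finset.mem_univ _)] at h1
    rw [h.ord_famProd hP, if_pos hj, h1]
    exact even_two_mul _

/-- The square roots of the pair products generate independent quadratic extensions. -/
theorem eq_empty_of_isSquare [Fintype I] {K : Type*} [Field K] [CharZero K] {s : K} [Algebra ℚ K]
    (hQ : IsQuad ((famProd q Finset.univ : ℕ) : ℚ) s) {C : Finset I} {i₀ : I} (hi₀ : i₀ ∉ C)
    {x : K} (hx : x ^ 2 = (famProd q (C ×ˢ Finset.univ) : ℕ)) : C = ∅ := by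
  by_contra hC
  obtain ⟨i, hi⟩ := Finset.nonempty_iff_ne_empty.2 hC
  set e : ℚ := ((famProd q (C ×ˢ Finset.univ) : ℕ) : ℚ) with he
  have he0 : e ≠ 0 := by rw [he]; exact_mod_cast (h.pos _).ne'
  have hD0 := hQ.ne_zero
  have hval : ∀ (j : I × Bool) [Fact (q j).Prime] (A : Finset (I × Bool)),
      ratPl (q j) (famProd q A : ℚ) = if j ∈ A then 1 else 0 := fun j _ A => by
    have h1 := ratPl_self (q j)
    rw [h.ord_famProd (by rw [h1]; norm_num), h1]
  have := Fact.mk (h.prime (i, true))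
  have := Fact.mk (h.prime (i₀, true))
  have hcases : hQ.conj x = x ∨ hQ.conj x = -x := by
    refine sq_eq_sq_iff_eq_or_eq_neg.1 ?_
    rw [← map_pow, hx, map_natCast]
  have hinj : ∀ a b : ℚ, algebraMap ℚ K a = algebraMap ℚ K b → a = b :=
    fun a b hab => (algebraMap ℚ K).injective hab
  rcases hcases with hc | hc
  · obtain ⟨a, ha⟩ := hQ.exists_of_conj_eq hc
    have h1 : e = a ^ 2 := hinj _ _ (by rw [map_pow, ha, hx, map_natCast])
    have h2 := congrArg (ratPl (q (i, true))) h1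
    rw [he, hval, if_pos (by simp [hi]), Pl.ord_sq] at h2
    omega
  · obtain ⟨a, ha⟩ := hQ.exists_of_conj_eq_neg hc
    have h1 : e = a ^ 2 * (famProd q Finset.univ : ℕ) := hinj _ _ (by
      rw [map_mul, map_pow, ← hQ.sq, ← mul_pow, map_natCast, ← hx]
      rw [ha])
    have ha0 : a ^ 2 ≠ 0 := by
      intro h0
      rw [h0, zero_mul] at h1
      exact he0 h1
    have h2 := congrArg (ratPl (q (i₀, true))) h1
    rw [Pl.ord_mul _ ha0 hD0, he, hval, hval, if_neg (by simp [hi₀]), if_pos (by simp),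
        Pl.ord_sq] at h2
    omega

end

variable {p : ℕ} {q : Option (Fin 23) × Bool → ℕ}

theorem exists_characters (h : PrimeFam p q) {K L : Type*} [Field K] [NumberField K] {s : K}
    (hQ : IsQuad ((famProd q Finset.univ : ℕ) : ℚ) s) [Field L] [NumberField L] [Algebra K L]
    [IsGalois K L] (hsq : ∀ i, IsSquare (famProd q (pair i) : L)) :
    ∃ X : Finset ((L ≃ₐ[K] L) → ZMod 2), (∀ χ ∈ X, ∀ g h, χ (g * h) = χ g + χ h) ∧
      2 ^ 23 ≤ X.card := by
  classical
  have hpos : ∀ A, (famProd q A : L) ≠ 0 := fun A => by exact_mod_cast (h.pos A).ne'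
  have hr : ∀ i : Fin 23, ∃ r : Lˣ, (r : L) ^ 2 = famProd q (pair (some i)) := fun i => by
    obtain ⟨r, hr⟩ := hsq (some i)
    refine ⟨Units.mk0 r ?_, by rw [Units.val_mk0, hr, sq]⟩
    rintro rfl
    exact hpos _ (by rw [hr, mul_zero])
  choose r hr using hr
  have hχ : ∀ (i : Fin 23) (g : L ≃ₐ[K] L), ∃ c, g • r i = sgn L c * r i := fun i g => by
    refine exists_sgn_of_sq_eq (Units.ext ?_)
    push_cast
    rw [AlgEquiv.coe_smul_units, ← map_pow, hr, map_natCast]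
  choose χ hχ using hχ
  have hadd : ∀ i g g', χ i (g * g') = χ i g + χ i g' := fun i g g' => by
    refine sgn_injective (A := L) (mul_right_cancel (b := r i) ?_)
    rw [← hχ, mul_smul, hχ i g', smul_mul', smul_sgn, hχ i g, sgn_add, mul_left_comm,
      mul_assoc]
  let f : Finset (Fin 23) → (L ≃ₐ[K] L) → ZMod 2 := fun A g => ∑ i ∈ A, χ i g
  have hf : Function.Injective f := fun A B hAB => by
    set C := symmDiff A B with hC
    have h1 : ∀ g, ∑ i ∈ C, χ i g = 0 := fun g => by
      have h2 : ∀ A : Finset (Fin 23), ∑ i ∈ A, χ i g = ∑ i, if i ∈ A then χ i g else 0 :=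
        fun A => by simp
      have h3 : ∑ i ∈ A, χ i g + ∑ i ∈ B, χ i g = 0 := by
        rw [show ∑ i ∈ A, χ i g = ∑ i ∈ B, χ i g from congrFun hAB g, CharTwo.add_self_eq_zero]
      rw [h2 A, h2 B, ← Finset.sum_add_distrib] at h3
      refine (h2 C).trans (Eq.trans ?_ h3)
      refine Finset.sum_congr rfl fun i _ => ?_
      by_cases ha : i ∈ A <;> by_cases hb : i ∈ B <;>
        simp [hC, Finset.mem_symmDiff, ha, hb, CharTwo.add_self_eq_zero]
    have hfix : ∀ g : L ≃ₐ[K] L, g ((∏ i ∈ C, r i : Lˣ) : L) = (∏ i ∈ C, r i : Lˣ) := fun g => by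
      have h2 : ∀ A : Finset (Fin 23),
          g • (∏ i ∈ A, r i) = sgn L (∑ i ∈ A, χ i g) * ∏ i ∈ A, r i := fun A => by
        induction A using Finset.induction_on with
        | empty => simp [sgn_zero]
        | insert i A hi ih =>
          rw [Finset.prod_insert hi, Finset.sum_insert hi, smul_mul', ih, hχ, sgn_add,
            mul_mul_mul_comm]
      have h3 := h2 C
      rw [h1 g, sgn_zero, one_mul] at h3
      rw [← AlgEquiv.coe_smul_units, h3]
    have : FiniteDimensional K L := Module.Finite.of_restrictScalars_finite ℚ K L
    obtain ⟨x, hx⟩ := (IsGalois.mem_range_algebraMap_iff_fixed _).2 hfix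
    have hprod : ((∏ i ∈ C, r i : Lˣ) : L) ^ 2 =
        (famProd q ((C.map Function.Embedding.some) ×ˢ Finset.univ) : ℕ) := by
      rw [famProd, Finset.prod_product, Finset.prod_map, Units.coe_prod, ← Finset.prod_pow]
      push_cast
      refine Finset.prod_congr rfl fun i _ => ?_
      rw [hr, famProd_pair]
      simp
    have hxx : x ^ 2 = (famProd q ((C.map Function.Embedding.some) ×ˢ Finset.univ) : ℕ) := by
      refine (algebraMap K L).injective ?_
      rw [map_pow, hx, hprod, map_natCast]
    have h2 := h.eq_empty_of_isSquare hQ (i₀ := none) (by simp) hxx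
    rw [Finset.map_eq_empty] at h2
    exact symmDiff_eq_bot.1 h2
  refine ⟨Finset.univ.image f, fun χ' hχ' g g' => ?_, ?_⟩
  · obtain ⟨A, -, rfl⟩ := Finset.mem_image.1 hχ'
    simp only [f, hadd, Finset.sum_add_distrib]
  · rw [Finset.card_image_of_injective _ hf, Finset.card_univ, Fintype.card_finset,
      Fintype.card_fin]

theorem rat_split (ℓ : ℕ) [Fact ℓ.Prime] : Pl.SpSplit ℓ ℚ :=
  ⟨{ratPl ℓ}, by simp [ratPl_self], by simp⟩

theorem totPos_natCast {F : Type*} [Field F] {m : ℕ} (hm : 0 < m) : TotPos (m : F) := fun φ => by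
  rw [map_natCast]; exact_mod_cast hm

/-- The number of pairs of the family being even, the product of all primes is a square. -/
theorem isSquare_famProd_univ [Fact p.Prime] (h : PrimeFam p q) :
    IsSquare (famProd q Finset.univ : ZMod p) := by
  rw [famProd, ← Finset.univ_product_univ, Finset.prod_product]
  push_cast
  refine Finset.isSquare_prod _ fun i _ => ?_
  have := h.isSquare_mul (i, true) (i, false)
  simpa using this

theorem base_tower [hp : Fact p.Prime] (h : PrimeFam p q) {K : Type*} [Field K] [NumberField K]
    {s : K} (hQ : IsQuad ((famProd q Finset.univ : ℕ) : ℚ) s) :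
    IsTotallyReal K ∧ Pl.SpSplit 2 K ∧ Pl.SpSplit p K := by
  have hD0 : ((famProd q Finset.univ : ℕ) : ℚ) ≠ 0 := hQ.ne_zero
  have : Fact (Nat.Prime 2) := ⟨Nat.prime_two⟩
  exact ⟨hQ.isTotallyReal (totPos_natCast (h.pos _)),
    (rat_split 2).of_isQuad hQ (u := Units.mk0 _ hD0) rfl
      fun v hv => v.lsq_of_modEq_one (h.famProd_mod8 _) hv rfl,
    (rat_split p).of_isQuad hQ (u := Units.mk0 _ hD0) rfl
      fun v hv => h.lsq_p h.isSquare_famProd_univ hv rfl⟩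

end PrimeFam

end

section

open NumberField IsDedekindDomain

universe u

namespace PrimeFam

variable {p : ℕ} {q : Option (Fin 23) × Bool → ℕ}

theorem card_signParity (J : Type*) [Fintype J] :
    Nat.card ((Bool × (J → ZMod 2)) × (Bool × (J → ZMod 2))) = 4 ^ (Fintype.card J + 1) := by
  have h : Nat.card (J → ZMod 2) = 2 ^ Fintype.card J := by
    rw [Nat.card_fun, Nat.card_zmod, Nat.card_eq_fintype_card]
  have h4 : (4 : ℕ) = 2 * 2 := rfl
  rw [Nat.card_prod, Nat.card_prod, h, Nat.card_eq_fintype_card, Fintype.card_bool, h4, mul_pow]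
  ring

/-- The tower over `ℚ(√D)` is infinite. -/
theorem exists_inTower [hp : Fact p.Prime] (h : PrimeFam p q) {K : Type u} [Field K]
    [NumberField K] {s : K} (hQ : IsQuad ((famProd q Finset.univ : ℕ) : ℚ) s) (n : ℕ) :
    ∃ (L : Type u) (_ : Field L) (_ : NumberField L) (_ : Algebra K L),
      InTower p K L ∧ n ≤ Module.finrank K L := by
  classical
  obtain ⟨hreal, h2, hpK⟩ := h.base_tower hQ
  by_contra! hcon
  let D : Set ℕ := {k | ∃ (L : Type u) (_ : Field L) (_ : NumberField L) (_ : Algebra K L),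
      InTower p K L ∧ Module.finrank K L = k}
  have hD : D.Nonempty := ⟨_, K, inferInstance, inferInstance, inferInstance,
      InTower.self h2 hpK, rfl⟩
  have hbd : BddAbove D := ⟨n, by
    rintro k ⟨L, _, _, _, hL, rfl⟩
    exact (hcon L _ _ _ hL).le⟩
  obtain ⟨L, _, _, _, hL, hmax⟩ := Nat.sSup_mem hD hbd
  have hmax : ∀ (E : Type u) [Field E] [NumberField E] [Algebra K E], InTower p K E →
      Module.finrank K E ≤ Module.finrank K L := fun E _ _ _ hE => by
    rw [hmax]; exact le_csSup hbd ⟨E, _, _, _, hE, rfl⟩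
  have hsq : ∀ i, IsSquare (famProd q (pair i) : L) := fun i => by
    by_contra hns
    have hm0 : (famProd q (pair i) : L) ≠ 0 := by exact_mod_cast (h.pos _).ne'
    obtain ⟨E, _, _, _, hE, hlt⟩ := hL.exists_step (a := Units.mk0 _ hm0) hns
      (fun g => ⟨1, by rw [Units.val_mk0, map_natCast, one_pow, one_mul]⟩)
      (h.even_famProd_pair (s := algebraMap K L s)
          (by rw [← map_pow, hQ.sq, map_natCast, map_natCast]) · i)
      (fun P hP => P.lsq_of_modEq_one (h.famProd_mod8 _) hP rfl)
      (fun P hP => h.lsq_p (by rw [famProd_pair]; exact h.isSquare_mul _ _) hP rfl)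
      (totPos_natCast (h.pos _))
    exact (hmax E hE).not_gt hlt
  have := hL.isGalois
  have : FiniteDimensional K L := Module.Finite.of_restrictScalars_finite ℚ K L
  obtain ⟨X, hX, hXc⟩ := h.exists_characters hQ hsq
  obtain ⟨σ, hσ⟩ := h.exists_selmer_bound hQ
  have hK := hQ.finrank_eq
  obtain ⟨κ, _, ψ, hψ, hκ⟩ := Pl.exists_sepParity hK σ hσ
  obtain ⟨T, hT, hTc⟩ := hL.exists_covers_of_maximal hK hmax hψ
  have hc : Fintype.card (Option (Fin 23) × Bool) = 48 := by
    rw [Fintype.card_prod, Fintype.card_option, Fintype.card_fin, Fintype.card_bool]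
  rw [card_signParity, hc] at hκ
  have hκ' : Fintype.card κ ≤ 2 ^ 96 := by
    have : (4 : ℕ) ^ (48 + 1) = 4 * 2 ^ 96 := by norm_num
    omega
  refine GolodShafarevich.false_of_covers hT (d := 23) (r := 110) ?_ hX hXc (by norm_num)
    (by norm_num)
  calc T.card ≤ Fintype.card κ * 2 ^ 14 := hTc
    _ ≤ 2 ^ 96 * 2 ^ 14 := Nat.mul_le_mul_right _ hκ'
    _ = 2 ^ 110 := by norm_num

end PrimeFam

end

section

open NumberField IsDedekindDomain

namespace PrimeFam

theorem exists_of_card_le {J : Type*} [Fintype J] (Q : Finset ℕ)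
    (hQ : ∀ x ∈ Q, x.Prime ∧ x ≡ 1 [MOD 8])
    (hc : 2 * Fintype.card J ≤ Q.card - 1) (p : ℕ) :
    ∃ q : J → Q, PrimeFam p (fun j => (q j : ℕ)) := by
  classical
  obtain ⟨T, hTQ, hT, hs⟩ : ∃ T ⊆ Q.erase p, Fintype.card J ≤ T.card ∧
      ∀ x ∈ T, ∀ y ∈ T, IsSquare (x : ZMod p) ↔ IsSquare (y : ZMod p) := by
    have h1 := Finset.card_filter_add_card_filter_not (s := Q.erase p)
      (p := fun x : ℕ => IsSquare (x : ZMod p))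
    have h2 := Finset.pred_card_le_card_erase (s := Q) (a := p)
    set A := (Q.erase p).filter fun x : ℕ => IsSquare (x : ZMod p) with hA
    set A' := (Q.erase p).filter fun x : ℕ => ¬ IsSquare (x : ZMod p) with hA'
    rcases le_total A.card A'.card with h3 | h3
    · refine ⟨A', Finset.filter_subset _ _, ?_, fun x hx y hy => ?_⟩
      rotate_left
      · exact iff_of_false (Finset.mem_filter.1 hx).2 (Finset.mem_filter.1 hy).2
      · omega
    · refine ⟨A, Finset.filter_subset _ _, ?_, fun x hx y hy => ?_⟩
      rotate_left
      · exact iff_of_true (Finset.mem_filter.1 hx).2 (Finset.mem_filter.1 hy).2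
      · omega
  obtain ⟨f⟩ := Function.Embedding.nonempty_of_card_le (α := J) (β := T) (by simpa using hT)
  have hmem : ∀ j, (f j : ℕ) ∈ Q := fun j => Finset.mem_of_mem_erase (hTQ (f j).2)
  refine ⟨fun j => ⟨f j, hmem j⟩, fun j => (hQ _ (hmem j)).1, fun i j hij => ?_,
    fun j => (hQ _ (hmem j)).2, fun j => Finset.ne_of_mem_erase (hTQ (f j).2),
    fun i j => hs _ (f i).2 _ (f j).2⟩
  exact f.injective (Subtype.ext hij)

theorem not_isSquare_famProd {J : Type*} [Fintype J] [Nonempty J] {p : ℕ} {q : J → ℕ}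
    (h : PrimeFam p q) : ¬ IsSquare ((famProd q Finset.univ : ℕ) : ℚ) := by
  classical
  rintro ⟨x, hx⟩
  obtain ⟨j⟩ := ‹Nonempty J›
  have := Fact.mk (h.prime j)
  have h1 := ratPl_self (q j)
  have h2 := h.ord_famProd (P := ratPl (q j)) (j := j) (by rw [h1]; norm_num) Finset.univ
  rw [hx, ← sq, Pl.ord_sq, if_pos (Finset.mem_univ _), h1] at h2
  omega

end PrimeFam

/-- Real quadratic fields of bounded discriminant with infinite towers. -/
theorem exists_infinite_tower : ∃ B : ℕ, ∀ (p : ℕ) [Fact p.Prime],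
    ∃ (K : Type) (_ : Field K) (_ : NumberField K), Module.finrank ℚ K = 2 ∧
      (discr K).natAbs ≤ B ∧ ∀ n : ℕ, ∃ (L : Type) (_ : Field L) (_ : NumberField L)
        (_ : Algebra K L), InTower p K L ∧ n ≤ Module.finrank K L := by
  classical
  obtain ⟨Q, hQ, hQc⟩ :=
      (Nat.infinite_setOfPred_prime_modEq_one (k := 8) (by norm_num)).exists_subset_card_eq 97
  have hK : ∀ q : Option (Fin 23) × Bool → Q, ∃ B : ℕ, (∃ p, PrimeFam p fun j => (q j : ℕ)) →
      ∃ (K : Type) (_ : Field K) (_ : NumberField K) (s : K),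
        IsQuad ((famProd (fun j => (q j : ℕ)) Finset.univ : ℕ) : ℚ) s ∧
        (discr K).natAbs ≤ B := fun q => by
    by_cases h : ∃ p, PrimeFam p fun j => (q j : ℕ)
    · obtain ⟨p, hp⟩ := h
      obtain ⟨K, _, _, i, s, hs⟩ := exists_isQuad hp.not_isSquare_famProd
      rw [Subsingleton.elim i DivisionRing.toRatAlgebra] at hs
      exact ⟨(discr K).natAbs, fun _ => ⟨K, inferInstance, inferInstance, s, hs, le_rfl⟩⟩
    · exact ⟨0, fun hh => (h hh).elim⟩
  choose B hB using hK
  obtain ⟨b, hb⟩ := (Set.finite_range B).bddAbove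
  refine ⟨b, fun p _ => ?_⟩
  obtain ⟨q, hq⟩ := PrimeFam.exists_of_card_le (J := Option (Fin 23) × Bool) Q
    (fun x hx => hQ hx) (by
      rw [hQc, Fintype.card_prod, Fintype.card_option, Fintype.card_fin, Fintype.card_bool]) p
  obtain ⟨K, _, _, s, hs, hd⟩ := hB q ⟨p, hq⟩
  exact ⟨K, inferInstance, inferInstance, hs.finrank_eq, hd.trans (hb ⟨q, rfl⟩),
    fun n => hq.exists_inTower hs n⟩

end

section

open NumberField IsDedekindDomain
open scoped nonZeroDivisors

namespace Pl

variable {K L : Type*} [Field K] [NumberField K] [Field L] [NumberField L] [Algebra K L]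
  [IsGalois K L]

theorem NoInertia.mem_range_of_trace (h : NoInertia K L) {x : L}
    (hx : ∀ y : 𝓞 L, IsIntegral ℤ (Algebra.trace K L (x * algebraMap (𝓞 L) L y))) :
    ∃ y : 𝓞 L, algebraMap (𝓞 L) L y = x := by
  classical
  have : FiniteDimensional K L := Module.Finite.of_restrictScalars_finite ℚ K L
  refine isIntegral_of_forall fun P => ?_
  choose! y hy using fun σ (hσ : σ ≠ 1) => h σ hσ P
  set Y : (L ≃ₐ[K] L) → L := fun σ => algebraMap (𝓞 L) L (y σ)
  have hYi : ∀ τ σ : L ≃ₐ[K] L, IsIntegral ℤ (τ (Y σ)) := fun τ σ =>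
    (RingOfIntegers.isIntegral_coe (y σ)).map (τ.restrictScalars ℤ)
  have key : ∀ (T : Finset (L ≃ₐ[K] L)) (z : 𝓞 L), IsIntegral ℤ
      (∑ σ : L ≃ₐ[K] L, (∏ τ ∈ T, (σ (Y τ) - τ (Y τ))) * σ (x * algebraMap (𝓞 L) L z)) := by
    intro T
    induction T using Finset.induction_on with
    | empty =>
      intro z
      simp only [Finset.prod_empty, one_mul]
      rw [← trace_eq_sum_automorphisms]
      exact (hx z).algebraMap
    | insert τ T hτ ih =>
      intro z
      have h1 := ih (y τ * z)
      have h2 := (hYi τ τ).mul (ih z)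
      have h3 := h1.sub h2
      rw [Finset.mul_sum, ← Finset.sum_sub_distrib] at h3
      rw [Finset.sum_congr rfl fun σ _ => ?_]
      · exact h3
      rw [Finset.prod_insert hτ]
      simp only [map_mul, Y]
      ring
  have h1 := key (Finset.univ.erase 1) 1
  rw [Finset.sum_eq_single 1 (fun σ _ hσ => by
    rw [Finset.prod_eq_zero (Finset.mem_erase.2 ⟨hσ, Finset.mem_univ _⟩) (sub_self _), zero_mul])
    (by simp)] at h1
  rw [map_one, mul_one, AlgEquiv.one_apply] at h1
  set u := ∏ τ ∈ Finset.univ.erase 1, ((1 : L ≃ₐ[K] L) (Y τ) - τ (Y τ)) with hu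
  have hYu : ∀ τ ∈ Finset.univ.erase (1 : L ≃ₐ[K] L),
      (1 : L ≃ₐ[K] L) (Y τ) - τ (Y τ) ≠ 0 ∧ P ((1 : L ≃ₐ[K] L) (Y τ) - τ (Y τ)) = 0 := by
    intro τ hτ
    have h2 := hy τ (Finset.mem_erase.1 hτ).1
    have h3 : (1 : L ≃ₐ[K] L) (Y τ) - τ (Y τ) = -(τ (Y τ) - Y τ) := by
      rw [AlgEquiv.one_apply]; ring
    have h4 : (1 : L ≃ₐ[K] L) (Y τ) - τ (Y τ) ∉ P.ge 1 := by
      rw [h3, neg_mem_iff]; exact h2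
    have h5 : (1 : L ≃ₐ[K] L) (Y τ) - τ (Y τ) ∈ P.ge 0 :=
      P.mem_ge_zero_of_isIntegral ((hYi 1 τ).sub (hYi τ τ))
    have h0 : (1 : L ≃ₐ[K] L) (Y τ) - τ (Y τ) ≠ 0 := fun h0 => h4 (by rw [h0]; exact zero_mem _)
    rw [mem_ge_iff _ h0] at h4 h5
    exact ⟨h0, by omega⟩
  have hu0 : u ≠ 0 ∧ P u = 0 := by
    rw [hu]
    clear_value u
    revert hYu
    induction Finset.univ.erase (1 : L ≃ₐ[K] L) using Finset.induction_on with
    | empty => simp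
    | insert τ T hτ ih =>
      intro hYu
      have h2 := ih fun σ hσ => hYu σ (Finset.mem_insert_of_mem hσ)
      have h3 := hYu τ (Finset.mem_insert_self _ _)
      rw [Finset.prod_insert hτ, P.ord_mul h3.1 h2.1, h3.2, h2.2]
      exact ⟨mul_ne_zero h3.1 h2.1, rfl⟩
  have h2 := P.mem_ge_zero_of_isIntegral h1
  intro hx0
  have h3 := h2 (mul_ne_zero hu0.1 hx0)
  rwa [P.ord_mul hu0.1 hx0, hu0.2, zero_add] at h3

theorem NoInertia.differentIdeal_eq_top (h : NoInertia K L) : differentIdeal (𝓞 K) (𝓞 L) = ⊤ := by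
  have : FiniteDimensional K L := Module.Finite.of_restrictScalars_finite ℚ K L
  have h1 : FractionalIdeal.dual (𝓞 K) K (1 : FractionalIdeal (𝓞 L)⁰ L) = 1 := by
    refine le_antisymm (fun x hx => ?_) (FractionalIdeal.one_le_dual_one _ _)
    refine (FractionalIdeal.mem_one_iff _).2 (h.mem_range_of_trace fun y => ?_)
    rw [FractionalIdeal.mem_dual (one_ne_zero (α := FractionalIdeal (𝓞 L)⁰ L))] at hx
    obtain ⟨z, hz⟩ := hx (algebraMap (𝓞 L) L y) ((FractionalIdeal.mem_one_iff _).2 ⟨y, rfl⟩)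
    rw [Algebra.traceForm_apply] at hz
    rw [← hz]
    exact RingOfIntegers.isIntegral_coe z
  have h2 := coeIdeal_differentIdeal (𝓞 K) K L (𝓞 L)
  rw [h1, inv_one] at h2
  rw [← Ideal.one_eq_top]
  exact FractionalIdeal.coeIdeal_eq_one.1 h2

theorem NoInertia.natAbs_discr (h : NoInertia K L) :
    (discr L).natAbs = (discr K).natAbs ^ Module.finrank K L := by
  have h1 := natAbs_discr_eq_absNorm_differentIdeal_mul_natAbs_discr_pow K (𝓞 K) L (𝓞 L)
  rwa [h.differentIdeal_eq_top, Ideal.absNorm_top, one_mul] at h1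

end Pl

end

section

open NumberField IsDedekindDomain

open MeasureTheory Pointwise in
theorem measure_le_mul_of_encard_le {E : Type*} [AddCommGroup E] [MeasurableSpace E]
    [MeasurableAdd E] {μ : Measure E} [μ.IsAddLeftInvariant] {Λ : AddSubgroup E} [Countable Λ]
    {F S : Set E} (hF : IsAddFundamentalDomain Λ F μ) (hS : MeasurableSet S) (k : ℕ)
    (hk : ∀ x, {g : Λ | x ∈ g +ᵥ S}.encard ≤ k) : μ S ≤ k * μ F := by
  have hm : ∀ g : Λ, MeasurableSet (g +ᵥ S) := fun g => hS.const_vadd g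
  rw [hF.measure_eq_tsum]
  have h1 : ∀ g : Λ, μ ((g +ᵥ S) ∩ F) = ∫⁻ x in F, (g +ᵥ S).indicator 1 x ∂μ := fun g => by
    rw [lintegral_indicator_one (hm g), Measure.restrict_apply (hm g)]
  simp_rw [h1]
  rw [← lintegral_tsum fun g => (measurable_one.indicator (hm g)).aemeasurable]
  calc _ ≤ ∫⁻ _ in F, (k : ENNReal) ∂μ := lintegral_mono fun x => ?_
    _ = _ := by simp
  have h2 : ∑' g : Λ, (g +ᵥ S).indicator (1 : E → ENNReal) x =
      ∑' g : Λ, {g : Λ | x ∈ g +ᵥ S}.indicator 1 g :=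
    tsum_congr fun g => by classical simp only [Set.indicator_apply, Set.mem_ofPred_eq]; rfl
  rw [h2, ← tsum_subtype]
  have h3 := ENNReal.tsum_set_one {g : Λ | x ∈ g +ᵥ S}
  simp only [Pi.one_apply, h3]
  exact_mod_cast hk x

namespace NumberField

variable {L : Type*} [Field L] [NumberField L] [IsTotallyReal L]

theorem one_le_prod_apply {x : 𝓞 L} (hx : x ≠ 0) : 1 ≤ ∏ w : InfinitePlace L, w x := by
  have h1 := InfinitePlace.prod_eq_abs_norm (x : L)
  simp only [IsTotallyReal.mult_eq, pow_one] at h1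
  rw [h1, ← Algebra.coe_norm_int, ← Int.cast_one, ← Int.cast_abs, Rat.cast_intCast, Int.cast_le]
  exact Int.one_le_abs (Algebra.norm_ne_zero_iff.mpr hx)

/-- A box in a totally real field has few integral points compared to its volume. -/
theorem box_finite_ncard (b : InfinitePlace L → ℝ) (hb : ∀ w, 0 < b w) (t : ℕ)
    (ht : ∏ w, b w < (t : ℝ) ^ Module.finrank ℚ L) :
    {x : 𝓞 L | ∀ w : InfinitePlace L, w (x : L) ≤ b w}.Finite ∧
    {x : 𝓞 L | ∀ w : InfinitePlace L, w (x : L) ≤ b w}.ncard ≤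
        (2 * t + 1) ^ Module.finrank ℚ L := by
  classical
  have hc : Module.finrank ℚ L = Fintype.card (InfinitePlace L) := by
    rw [InfinitePlace.card_eq_nrRealPlaces_add_nrComplexPlaces, IsTotallyReal.finrank (K := L),
      IsTotallyReal.nrComplexPlaces_eq_zero, add_zero]
  have ht0 : 0 < t := by
    rcases Nat.eq_zero_or_pos t with rfl | h
    · rw [Nat.cast_zero, zero_pow Module.finrank_pos.ne'] at ht
      exact absurd ht (Finset.prod_pos fun w _ => hb w).le.not_gt
    · exact h
  have ht0' : (0 : ℝ) < t := by exact_mod_cast ht0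
  let σ : ∀ w : InfinitePlace L, L →+* ℝ := fun w =>
    InfinitePlace.embedding_of_isReal (IsTotallyReal.isReal w)
  have hσ : ∀ w x, |σ w x| = w x := fun w x => InfinitePlace.norm_embedding_of_isReal _ x
  let T : Finset (InfinitePlace L → ℤ) := Fintype.piFinset fun _ => Finset.Icc (-t : ℤ) t
  let φ : 𝓞 L → InfinitePlace L → ℤ := fun x w => ⌊t * σ w x / b w⌋
  have hmap : Set.MapsTo φ {x : 𝓞 L | ∀ w : InfinitePlace L, w (x : L) ≤ b w} T := by
    intro x hx
    simp only [T, Finset.mem_coe, Fintype.mem_piFinset, Finset.mem_Icc]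
    intro w
    have h1 := abs_le.1 ((hσ w x).trans_le (hx w))
    have h2 := hb w
    constructor
    · rw [Int.le_floor, le_div_iff₀ h2]
      push_cast
      nlinarith
    · have : (⌊t * σ w x / b w⌋ : ℝ) ≤ t := (Int.floor_le _).trans (by
        rw [div_le_iff₀ h2]; nlinarith)
      exact_mod_cast this
  have hinj : Function.Injective φ := by
    intro x y hxy
    by_contra hne
    have h1 := one_le_prod_apply (sub_ne_zero.2 hne)
    have h2 : ∀ w : InfinitePlace L, w ((x - y : 𝓞 L) : L) ≤ b w / t := by
      intro w
      have h3 := Int.abs_sub_lt_one_of_floor_eq_floor (congrFun hxy w)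
      rw [← hσ, ← sub_div, ← mul_sub, abs_div, abs_mul, abs_of_pos (hb w), abs_of_pos ht0',
        div_lt_one (hb w)] at *
      rw [le_div_iff₀ ht0', mul_comm]
      simpa using h3.le
    have h3 := h1.trans (Finset.prod_le_prod (fun w _ => apply_nonneg w _) fun w _ => h2 w)
    rw [Finset.prod_div_distrib, Finset.prod_const, Finset.card_univ, ← hc,
      one_le_div (by positivity)] at h3
    exact absurd ht h3.not_gt
  have hfin := Set.Finite.of_injOn hmap hinj.injOn T.finite_toSet
  refine ⟨hfin, (Set.ncard_le_ncard_of_injOn φ hmap hinj.injOn T.finite_toSet).trans ?_⟩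
  rw [Set.ncard_coe_finset, Fintype.card_piFinset, Finset.prod_const, Finset.card_univ, ← hc,
    Int.card_Icc]
  apply le_of_eq
  congr 1
  omega

open MeasureTheory mixedEmbedding Pointwise in
/-- A box in a totally real field has many integral points compared to its volume. -/
theorem le_box_ncard (f : InfinitePlace L → NNReal) (hf : ∀ w, 0 < f w) :
    2 ^ Module.finrank ℚ L * ∏ w, (f w : ℝ) ≤
      {x : 𝓞 L | ∀ w : InfinitePlace L, w (x : L) ≤ 2 * f w}.ncard * √|(discr L : ℝ)| := by
  classical
  set Z := {x : 𝓞 L | ∀ w : InfinitePlace L, w (x : L) ≤ 2 * f w} with hZ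
  have hfin : Z.Finite := by
    obtain ⟨t, ht⟩ := exists_nat_gt (max 1 (∏ w, (2 * f w : ℝ)))
    refine (box_finite_ncard (fun w => 2 * f w) (fun w => by have := hf w; positivity) t ?_).1
    refine ((le_max_right _ _).trans_lt ht).trans_le
      (le_self_pow₀ ((le_max_left _ _).trans ht.le) Module.finrank_pos.ne')
  have hF := ZSpan.isAddFundamentalDomain' (latticeBasis L) volume
  have : Countable (Submodule.span ℤ (Set.range (latticeBasis L))).toAddSubgroup := by
    change Countable (Submodule.span ℤ (Set.range (latticeBasis L)))
    infer_instance
  have h1 := measure_le_mul_of_encard_le (S := convexBodyLT L f) hF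
    (MeasurableSet.prod (MeasurableSet.univ_pi fun _ => measurableSet_ball)
      (MeasurableSet.univ_pi fun _ => measurableSet_ball)) Z.ncard (fun x => ?_)
  · rw [convexBodyLT_volume, volume_fundamentalDomain_latticeBasis,
      convexBodyLTFactor, IsTotallyReal.nrComplexPlaces_eq_zero, pow_zero, pow_zero, one_mul,
      mul_one, ← IsTotallyReal.finrank] at h1
    simp only [IsTotallyReal.mult_eq, pow_one] at h1
    have h2 : (2 : NNReal) ^ Module.finrank ℚ L * ∏ w, f w ≤ Z.ncard * NNReal.sqrt ‖discr L‖₊ := by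
      exact_mod_cast h1
    have h3 := NNReal.coe_le_coe.2 h2
    push_cast at h3
    simpa [Int.norm_eq_abs] using h3
  · rcases Set.eq_empty_or_nonempty
      {g : (Submodule.span ℤ (Set.range (latticeBasis L))).toAddSubgroup |
        x ∈ g +ᵥ convexBodyLT L f} with h0 | ⟨g₀, hg₀⟩
    · rw [h0]; simp
    have h2 : ∀ g : (Submodule.span ℤ (Set.range (latticeBasis L))).toAddSubgroup,
        ∃ a : 𝓞 L, mixedEmbedding L a = g := fun g => by
      have := (mem_span_latticeBasis L).1 g.2
      obtain ⟨a, ha⟩ := this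
      exact ⟨a, ha⟩
    choose a ha using h2
    have h3 : ∀ g : (Submodule.span ℤ (Set.range (latticeBasis L))).toAddSubgroup,
        x ∈ g +ᵥ convexBodyLT L f → x - g ∈ convexBodyLT L f := by
      rintro g ⟨s, hs, rfl⟩
      change (g : mixedSpace L) + s - g ∈ _
      rwa [add_sub_cancel_left]
    rw [hfin.cast_ncard_eq]
    refine Set.encard_le_encard_of_injOn (f := fun g => a g - a g₀) (fun g hg => ?_) ?_
    · have h4 := h3 g hg
      have h5 := h3 g₀ hg₀
      have h6 : mixedEmbedding L ((a g - a g₀ : 𝓞 L) : L) ∈ convexBodyLT L (2 * f) := by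
        have e : mixedEmbedding L ((a g - a g₀ : 𝓞 L) : L) = (x - g₀) - (x - g) := by
          rw [← ha, ← ha]; push_cast; rw [map_sub]; abel
        rw [e]
        constructor
        · intro w hw
          have h7 := mem_ball_zero_iff.1 (h4.1 w hw)
          have h8 := mem_ball_zero_iff.1 (h5.1 w hw)
          rw [mem_ball_zero_iff]
          refine (norm_sub_le _ _).trans_lt ?_
          simp only [Pi.mul_apply, Pi.ofNat_apply, NNReal.coe_mul, NNReal.coe_ofNat]
          linarith
        · intro w hw
          have h7 := mem_ball_zero_iff.1 (h4.2 w hw)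
          have h8 := mem_ball_zero_iff.1 (h5.2 w hw)
          rw [mem_ball_zero_iff]
          refine (norm_sub_le _ _).trans_lt ?_
          simp only [Pi.mul_apply, Pi.ofNat_apply, NNReal.coe_mul, NNReal.coe_ofNat]
          linarith
      intro w
      simpa using ((convexBodyLT_mem L _).1 h6 w).le
    · intro g hg g' hg' h
      have h4 : a g = a g' := by simpa using h
      apply Subtype.ext
      rw [← ha, ← ha, h4]

end NumberField

end

section

open NumberField IsDedekindDomain

theorem card_le_two_pow_of_sum_le {ι : Type*} [Fintype ι] [DecidableEq ι] (s : ℕ)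
    (T : Finset (ι → ℕ)) (hT : ∀ v ∈ T, ∑ i, v i ≤ s) : T.card ≤ 2 ^ (s + Fintype.card ι) := by
  have h1 : T ⊆ Fintype.piFinset fun _ : ι => Finset.range (s + 1) := fun v hv => by
    rw [Fintype.mem_piFinset]
    intro i
    rw [Finset.mem_range, Nat.lt_succ_iff]
    exact (Finset.single_le_sum (f := v) (fun _ _ => Nat.zero_le _) (Finset.mem_univ i)).trans
      (hT v hv)
  have h2 : (T.card : ℝ) * (1 / 2) ^ s ≤ 2 ^ Fintype.card ι := by
    calc (T.card : ℝ) * (1 / 2) ^ s = ∑ v ∈ T, (1 / 2 : ℝ) ^ s := by simp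
      _ ≤ ∑ v ∈ T, ∏ i, (1 / 2 : ℝ) ^ v i := Finset.sum_le_sum fun v hv => by
          rw [Finset.prod_pow_eq_pow_sum]
          exact pow_le_pow_of_le_one (by norm_num) (by norm_num) (hT v hv)
      _ ≤ ∑ v ∈ Fintype.piFinset fun _ : ι => Finset.range (s + 1), ∏ i, (1 / 2 : ℝ) ^ v i :=
          Finset.sum_le_sum_of_subset_of_nonneg h1 fun _ _ _ => by positivity
      _ = ∏ _i : ι, ∑ k ∈ Finset.range (s + 1), (1 / 2 : ℝ) ^ k :=
          (Finset.prod_univ_sum (fun _ : ι => Finset.range (s + 1))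
            fun _ k => (1 / 2 : ℝ) ^ k).symm
      _ ≤ ∏ _i : ι, 2 := Finset.prod_le_prod (fun _ _ => by positivity)
          fun _ _ => sum_geometric_two_le _
      _ = _ := by simp
  have h3 : (T.card : ℝ) ≤ 2 ^ (s + Fintype.card ι) := by
    rw [one_div, inv_pow, ← div_eq_mul_inv, div_le_iff₀ (by positivity), ← pow_add] at h2
    rwa [add_comm]
  exact_mod_cast h3

theorem prod_zpow_eq_zpow_sum {ι : Type*} (s : Finset ι) (f : ι → ℤ) :
    ∏ i ∈ s, (2 : ℝ) ^ f i = 2 ^ ∑ i ∈ s, f i := by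
  classical
  induction s using Finset.induction_on with
  | empty => simp
  | insert a s ha ih => rw [Finset.prod_insert ha, Finset.sum_insert ha, ih, zpow_add₀ two_ne_zero]

namespace NumberField

variable {L : Type*} [Field L] [NumberField L]

/-- Nonzero integers of bounded norm and bounded conjugates. -/
def boundedSet (L : Type*) [Field L] [NumberField L] (ρ H : ℕ) : Set (𝓞 L) :=
  {x | x ≠ 0 ∧ ∏ w : InfinitePlace L, w (x : L) ≤ 2 ^ (ρ * Module.finrank ℚ L) ∧
    ∀ w : InfinitePlace L, w (x : L) ≤ 2 ^ H}

variable [IsTotallyReal L]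

theorem card_infinitePlace : Fintype.card (InfinitePlace L) = Module.finrank ℚ L := by
  classical
  rw [InfinitePlace.card_eq_nrRealPlaces_add_nrComplexPlaces, IsTotallyReal.finrank (K := L),
    IsTotallyReal.nrComplexPlaces_eq_zero, add_zero]

theorem box_finite_ncard_two_pow (b : InfinitePlace L → ℝ) (hb : ∀ w, 0 < b w) (s : ℕ)
    (hs : ∏ w, b w ≤ 2 ^ (s * Module.finrank ℚ L)) :
    {x : 𝓞 L | ∀ w : InfinitePlace L, w (x : L) ≤ b w}.Finite ∧
    {x : 𝓞 L | ∀ w : InfinitePlace L, w (x : L) ≤ b w}.ncard ≤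
      2 ^ ((s + 3) * Module.finrank ℚ L) := by
  have h := box_finite_ncard b hb (2 ^ (s + 1)) (hs.trans_lt (by
    push_cast
    rw [← pow_mul]
    have := Module.finrank_pos (R := ℚ) (M := L)
    exact pow_lt_pow_right₀ one_lt_two (by nlinarith)))
  refine ⟨h.1, h.2.trans ?_⟩
  rw [pow_mul]
  refine Nat.pow_le_pow_left ?_ _
  have := Nat.one_le_two_pow (n := s)
  rw [pow_add, pow_add]
  omega

theorem neg_finrank_le_sum_log {x : 𝓞 L} (hx : x ≠ 0) :
    -(Module.finrank ℚ L : ℤ) ≤ ∑ w : InfinitePlace L, Int.log 2 (w (x : L)) := by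
  have h1 := one_le_prod_apply hx
  have h2 : ∏ w : InfinitePlace L, w (x : L) ≤
      ∏ w : InfinitePlace L, (2 : ℝ) ^ (Int.log 2 (w (x : L)) + 1) :=
    Finset.prod_le_prod (fun w _ => apply_nonneg w _) fun w _ =>
      (Int.lt_zpow_succ_log_self (b := 2) one_lt_two (w (x : L))).le
  have h3 := h1.trans h2
  rw [prod_zpow_eq_zpow_sum, ← zpow_zero (2 : ℝ), zpow_le_zpow_iff_right₀ one_lt_two,
    Finset.sum_add_distrib, Finset.sum_const, Finset.card_univ, card_infinitePlace] at h3
  simp at h3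
  linarith

theorem place_pos {x : 𝓞 L} (hx : x ≠ 0) (w : InfinitePlace L) : 0 < w (x : L) :=
  InfinitePlace.pos_iff.2 (RingOfIntegers.coe_ne_zero_iff.2 hx)

theorem boundedSet_finite (ρ H : ℕ) : (boundedSet L ρ H).Finite :=
  (box_finite_ncard_two_pow (fun _ => 2 ^ H) (fun _ => by positivity) H
    (by simp [card_infinitePlace, pow_mul])).1.subset fun _ hx => hx.2.2

theorem boundedSet_ncard_le (ρ H : ℕ) : (boundedSet L ρ H).ncard ≤
    (64 * 2 ^ ρ * (H + 1)) ^ Module.finrank ℚ L := by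
  classical
  have hfin := boundedSet_finite (L := L) ρ H
  set n := Module.finrank ℚ L with hn
  let v : 𝓞 L → InfinitePlace L → ℕ := fun x w => ((H : ℤ) - Int.log 2 (w (x : L))).toNat
  have hv : ∀ x ∈ boundedSet L ρ H, ∀ w, (v x w : ℤ) = H - Int.log 2 (w (x : L)) := by
    intro x hx w
    refine Int.toNat_of_nonneg (sub_nonneg.2 ?_)
    have h1 := (Int.zpow_log_le_self (b := 2) one_lt_two (place_pos hx.1 w)).trans (hx.2.2 w)
    rw [← zpow_natCast] at h1
    exact (zpow_le_zpow_iff_right₀ (one_lt_two : (1 : ℝ) < 2)).1 (by exact_mod_cast h1)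
  let Q : Finset (InfinitePlace L → ℕ) :=
    (Fintype.piFinset fun _ => Finset.range (n + 1)).filter fun q => ∑ w, q w ≤ n
  let R : Finset (InfinitePlace L → ℕ) := Fintype.piFinset fun _ => Finset.range (H + 1)
  have hQ : Q.card ≤ 2 ^ (n + n) := by
    have := card_le_two_pow_of_sum_le n Q fun q hq => (Finset.mem_filter.1 hq).2
    rwa [card_infinitePlace] at this
  have hR : R.card = (H + 1) ^ n := by simp [R, card_infinitePlace, hn]
  have key := Finset.card_le_mul_card_image_of_maps_to (s := hfin.toFinset) (t := Q ×ˢ R)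
    (f := fun x => (fun w => v x w / (H + 1), fun w => v x w % (H + 1))) (fun x hx => ?_)
    (2 ^ ((ρ + 1 + 3) * n)) (fun u hu => ?_)
  · rw [← Set.ncard_eq_toFinset_card _ hfin, Finset.card_product, hR] at key
    refine key.trans ?_
    calc _ ≤ 2 ^ ((ρ + 1 + 3) * n) * (2 ^ (n + n) * (H + 1) ^ n) := by gcongr
      _ = _ := by
        rw [pow_mul, pow_add 2 n n, ← mul_pow, ← mul_pow, ← mul_pow]
        congr 1
        ring
  · rw [hfin.mem_toFinset] at hx
    have h1 : ∑ w, v x w ≤ n * (H + 1) := by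
      have h2 := neg_finrank_le_sum_log hx.1
      zify
      rw [Finset.sum_congr rfl fun w _ => hv x hx w, Finset.sum_sub_distrib]
      simp only [Finset.sum_const, Finset.card_univ, card_infinitePlace, nsmul_eq_mul]
      linarith
    have h3 : ∑ w, v x w / (H + 1) ≤ n := by
      refine le_of_mul_le_mul_right (le_trans ?_ h1) (Nat.succ_pos H)
      rw [Finset.sum_mul]
      exact Finset.sum_le_sum fun w _ => Nat.div_mul_le_self _ _
    refine Finset.mem_product.2 ⟨Finset.mem_filter.2 ⟨Fintype.mem_piFinset.2 fun w => ?_, h3⟩,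
      Fintype.mem_piFinset.2 fun w => Finset.mem_range.2 (Nat.mod_lt _ (Nat.succ_pos H))⟩
    rw [Finset.mem_range, Nat.lt_succ_iff]
    exact (Finset.single_le_sum (f := fun w => v x w / (H + 1)) (fun _ _ => Nat.zero_le _)
      (Finset.mem_univ w)).trans h3
  · rcases Finset.eq_empty_or_nonempty (hfin.toFinset.filter fun x =>
      (fun w => v x w / (H + 1), fun w => v x w % (H + 1)) = u) with h0 | ⟨x₀, hx₀⟩
    · rw [h0]; simp
    rw [Finset.mem_filter, hfin.mem_toFinset] at hx₀
    obtain ⟨hx₀, rfl⟩ := hx₀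
    obtain ⟨hf, hc⟩ := box_finite_ncard_two_pow
      (fun w : InfinitePlace L => (2 : ℝ) * w (x₀ : L))
          (fun w => by have := place_pos hx₀.1 w; positivity)
      (ρ + 1) (by
        rw [Finset.prod_mul_distrib, add_mul, pow_add, mul_comm]
        simp only [Finset.prod_const, Finset.card_univ, card_infinitePlace, one_mul]
        have := hx₀.2.1
        gcongr)
    refine le_trans ?_ hc
    rw [← Set.ncard_coe_finset]
    refine Set.ncard_le_ncard (fun x hx w => ?_) hf
    rw [Finset.mem_coe, Finset.mem_filter, hfin.mem_toFinset] at hx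
    have h1 : v x w = v x₀ w := by
      have e1 : v x w / (H + 1) = v x₀ w / (H + 1) := congrFun (congrArg Prod.fst hx.2) w
      have e2 : v x w % (H + 1) = v x₀ w % (H + 1) := congrFun (congrArg Prod.snd hx.2) w
      rw [← Nat.div_add_mod (v x w) (H + 1), ← Nat.div_add_mod (v x₀ w) (H + 1), e1, e2]
    have h2 : Int.log 2 (w (x : L)) = Int.log 2 (w (x₀ : L)) := by
      have h3 := hv x hx.1 w
      have h4 := hv x₀ hx₀ w
      rw [h1] at h3
      omega
    refine (Int.lt_zpow_succ_log_self (b := 2) one_lt_two (w (x : L))).le.trans ?_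
    rw [h2, Nat.cast_ofNat, zpow_add₀ two_ne_zero, zpow_one, mul_comm]
    have := Int.zpow_log_le_self (b := 2) one_lt_two (place_pos hx₀.1 w)
    rw [Nat.cast_ofNat] at this
    gcongr

end NumberField

end

section

open NumberField IsDedekindDomain

namespace NumberField

variable {L : Type*} [Field L] [NumberField L] [IsTotallyReal L]

theorem exists_ne_zero_le_zpow (r : ℕ) (hr : √|(discr L : ℝ)| < 2 ^ (r * Module.finrank ℚ L))
    (t : InfinitePlace L → ℤ) (ht : 0 ≤ ∑ w, t w) :
    ∃ x : 𝓞 L, x ≠ 0 ∧ ∀ w : InfinitePlace L, w (x : L) ≤ 2 ^ (r + t w) := by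
  by_contra! hcon
  have h1 := le_box_ncard (L := L) (fun w => 2 ^ (r + t w) / 2) (fun w => by positivity)
  have h2 : ∀ w, (2 : ℝ) * ((2 ^ (r + t w) / 2 : NNReal) : ℝ) = 2 ^ (r + t w) := fun w => by
    push_cast; ring
  simp only [h2] at h1
  rw [← card_infinitePlace, ← Finset.card_univ, ← Finset.prod_const, ← Finset.prod_mul_distrib]
    at h1
  simp only [h2] at h1
  rw [prod_zpow_eq_zpow_sum, Finset.sum_add_distrib, Finset.sum_const, Finset.card_univ,
    card_infinitePlace, nsmul_eq_mul, zpow_add₀ two_ne_zero] at h1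
  have h3 : {x : 𝓞 L | ∀ w : InfinitePlace L, w (x : L) ≤ 2 ^ (r + t w)}.ncard ≤ 1 := by
    refine (Set.ncard_le_ncard (t := {(0 : 𝓞 L)}) (fun x hx => ?_)
      (Set.finite_singleton _)).trans (Set.ncard_singleton _).le
    by_contra h0
    obtain ⟨w, hw⟩ := hcon x h0
    exact (hx w).not_gt hw
  have h4 : (2 : ℝ) ^ ((Module.finrank ℚ L : ℤ) * r) = 2 ^ (r * Module.finrank ℚ L) := by
    rw [mul_comm, ← zpow_natCast]; norm_cast
  rw [h4] at h1
  have h5 : (1 : ℝ) ≤ 2 ^ ∑ w, t w := one_le_zpow₀ one_le_two ht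
  have h6 : (({x : 𝓞 L | ∀ w : InfinitePlace L, w (x : L) ≤ 2 ^ (r + t w)}.ncard : ℕ) : ℝ) ≤ 1 := by
    exact_mod_cast h3
  have h7 := Real.sqrt_nonneg |(discr L : ℝ)|
  have h8 : (0 : ℝ) < 2 ^ (r * Module.finrank ℚ L) := by positivity
  nlinarith

theorem pow_le_boundedSet_ncard (r : ℕ) (hr : √|(discr L : ℝ)| < 2 ^ (r * Module.finrank ℚ L))
    (E : ℕ) (hE : E ≤ Module.finrank ℚ L) :
    E ^ Module.finrank ℚ L ≤
      (boundedSet L (r + 1) (r + E)).ncard * 2 ^ ((r + 4) * Module.finrank ℚ L) := by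
  classical
  set n := Module.finrank ℚ L with hn
  have hn0 : 0 < n := Module.finrank_pos
  let τ : (InfinitePlace L → ℕ) → ℕ := fun t => (∑ w, t w) / n
  have hτ1 : ∀ t, τ t * n ≤ ∑ w, t w := fun t => Nat.div_mul_le_self _ _
  have hτ2 : ∀ t, ∑ w, t w ≤ τ t * n + n := fun t => by
    have := Nat.div_add_mod (∑ w, t w) n
    have := Nat.mod_lt (∑ w, t w) hn0
    change _ ≤ (∑ w, t w) / n * n + n
    nlinarith
  have hs : ∀ t : InfinitePlace L → ℕ, ∑ w, ((t w : ℤ) - τ t) = ∑ w, (t w : ℤ) - n * τ t :=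
    fun t => by
      rw [Finset.sum_sub_distrib]
      simp only [Finset.sum_const, Finset.card_univ, card_infinitePlace, nsmul_eq_mul, hn]
  choose x hx0 hx using fun t : InfinitePlace L → ℕ =>
    exists_ne_zero_le_zpow (L := L) r hr (fun w => (t w : ℤ) - τ t) (by
      rw [hs]
      have := hτ1 t
      zify at this
      linarith)
  let v : (InfinitePlace L → ℕ) → InfinitePlace L → ℕ := fun t w =>
    ((r : ℤ) + (t w - τ t) - Int.log 2 (w (x t : L))).toNat
  have hv : ∀ t w, (v t w : ℤ) = (r : ℤ) + (t w - τ t) - Int.log 2 (w (x t : L)) := by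
    intro t w
    refine Int.toNat_of_nonneg (sub_nonneg.2 ?_)
    have h1 := (Int.zpow_log_le_self (b := 2) one_lt_two (place_pos (hx0 t) w)).trans (hx t w)
    exact (zpow_le_zpow_iff_right₀ (one_lt_two : (1 : ℝ) < 2)).1 (by exact_mod_cast h1)
  have hvs : ∀ t, ∑ w, v t w ≤ (r + 2) * n := by
    intro t
    have h2 := neg_finrank_le_sum_log (hx0 t)
    have h3 := hτ2 t
    zify at h3 ⊢
    rw [Finset.sum_congr rfl fun w _ => hv t w, Finset.sum_sub_distrib, Finset.sum_add_distrib, hs]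
    simp only [Finset.sum_const, Finset.card_univ, card_infinitePlace, nsmul_eq_mul, ← hn]
    linarith
  let T : Finset (InfinitePlace L → ℕ) := Fintype.piFinset fun _ => Finset.range E
  have hT : T.card = E ^ n := by simp [T, card_infinitePlace, hn]
  have hfin := boundedSet_finite (L := L) (r + 1) (r + E)
  have hTτ : ∀ t ∈ T, τ t < E := by
    intro t ht
    rw [Fintype.mem_piFinset] at ht
    rw [Nat.div_lt_iff_lt_mul hn0]
    have : ∑ w, t w < ∑ _w : InfinitePlace L, E := Finset.sum_lt_sum_of_nonempty
      (Finset.card_pos.1 (by rw [Finset.card_univ, card_infinitePlace]; exact hn0))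
      fun w _ => Finset.mem_range.1 (ht w)
    rwa [Finset.sum_const, Finset.card_univ, card_infinitePlace, ← hn, smul_eq_mul, mul_comm]
      at this
  have hmap : ∀ t ∈ T, (x t, τ t, v t) ∈ hfin.toFinset ×ˢ Finset.range E ×ˢ (T.image v) := by
    intro t ht
    refine Finset.mem_product.2 ⟨hfin.mem_toFinset.2 ⟨hx0 t, ?_, fun w => ?_⟩,
      Finset.mem_product.2 ⟨Finset.mem_range.2 (hTτ t ht), Finset.mem_image_of_mem _ ht⟩⟩
    · refine (Finset.prod_le_prod (fun w _ => apply_nonneg w _) fun w _ => hx t w).trans ?_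
      rw [prod_zpow_eq_zpow_sum, ← zpow_natCast]
      refine zpow_le_zpow_right₀ one_le_two ?_
      rw [Finset.sum_add_distrib, hs]
      simp only [Finset.sum_const, Finset.card_univ, card_infinitePlace, nsmul_eq_mul, ← hn]
      have h3 := hτ2 t
      zify at h3
      push_cast
      linarith
    · refine (hx t w).trans ?_
      rw [← zpow_natCast]
      refine zpow_le_zpow_right₀ one_le_two ?_
      have := Finset.mem_range.1 (Fintype.mem_piFinset.1 ht w)
      push_cast
      omega
  have hinj : Set.InjOn (fun t => (x t, τ t, v t)) (T : Set (InfinitePlace L → ℕ)) := by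
    intro t _ t' _ h
    simp only [Prod.mk.injEq] at h
    funext w
    have h1 := hv t w
    have h2 := hv t' w
    rw [h.1, h.2.1, h.2.2] at h1
    omega
  have h1 := Finset.card_le_card_of_injOn _ hmap hinj
  have h2 : (T.image v).card ≤ 2 ^ ((r + 2) * n + n) := by
    have := card_le_two_pow_of_sum_le ((r + 2) * n) (T.image v) fun u hu => by
      obtain ⟨t, _, rfl⟩ := Finset.mem_image.1 hu
      exact hvs t
    rwa [card_infinitePlace] at this
  rw [hT, Finset.card_product, Finset.card_product, Finset.card_range,
    ← Set.ncard_eq_toFinset_card _ hfin] at h1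
  refine h1.trans (Nat.mul_le_mul_left _ ?_)
  calc E * (T.image v).card ≤ 2 ^ n * 2 ^ ((r + 2) * n + n) :=
        Nat.mul_le_mul (hE.trans Nat.lt_two_pow_self.le) h2
    _ = _ := by rw [← pow_add]; congr 1; ring

end NumberField

end

section

open NumberField IsDedekindDomain

namespace NumberField

variable {L : Type*} [Field L] [NumberField L] [IsTotallyReal L]

theorem place_coe_mul (w : InfinitePlace L) (x y : 𝓞 L) :
    w ((x * y : 𝓞 L) : L) = w (x : L) * w (y : L) :=
  (congrArg w (map_mul (algebraMap (𝓞 L) L) x y)).trans (map_mul w _ _)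

open Pointwise in
theorem card_mul_card_le_card_mul [DecidableEq (𝓞 L)] (ρ : ℕ) (M : ℝ) (hM0 : 0 < M)
    (G Y : Finset (𝓞 L)) (hG0 : ∀ g ∈ G, g ≠ 0)
    (hGw : ∀ g ∈ G, ∏ w : InfinitePlace L, w (g : L) ≤ 2 ^ (ρ * Module.finrank ℚ L))
    (hYw : ∀ y ∈ Y, ∀ w : InfinitePlace L, M ≤ w (y : L) ∧ w (y : L) ≤ 3 * M) :
    G.card * Y.card ≤ 2 ^ ((ρ + 5) * Module.finrank ℚ L) * (G * Y).card := by
  rw [← Finset.card_product]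
  refine Finset.card_le_mul_card_image_of_maps_to (f := fun q => q.1 * q.2) (fun q hq => ?_) _
    fun a ha => ?_
  · exact Finset.mul_mem_mul (Finset.mem_product.1 hq).1 (Finset.mem_product.1 hq).2
  · obtain ⟨g₀, hg₀, y₀, hy₀, rfl⟩ := Finset.mem_mul.1 ha
    obtain ⟨hf, hc⟩ := box_finite_ncard_two_pow
      (fun w : InfinitePlace L => (3 : ℝ) * w (g₀ : L))
      (fun w => by have := place_pos (hG0 g₀ hg₀) w; positivity) (ρ + 2) (by
        rw [Finset.prod_mul_distrib, Finset.prod_const, Finset.card_univ, card_infinitePlace,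
          add_comm ρ 2, add_mul, pow_add, pow_mul 2 2]
        have := hGw g₀ hg₀
        gcongr
        norm_num)
    refine le_trans ?_ hc
    rw [← Set.ncard_coe_finset]
    have hq : ∀ q ∈ (G ×ˢ Y).filter fun q => q.1 * q.2 = g₀ * y₀,
        q.1 ∈ G ∧ q.2 ∈ Y ∧ q.1 * q.2 = g₀ * y₀ := fun q hq => by
      rw [Finset.mem_filter, Finset.mem_product] at hq
      exact ⟨hq.1.1, hq.1.2, hq.2⟩
    refine Set.ncard_le_ncard_of_injOn Prod.fst (fun q hq' w => ?_) (fun q hq₁ q' hq₂ h => ?_) hf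
    · obtain ⟨b1, b2, b3⟩ := hq q hq'
      have h1 := (hYw q.2 b2 w).1
      have h2 := (hYw y₀ hy₀ w).2
      have h3 : w (q.1 : L) * w (q.2 : L) = w (g₀ : L) * w (y₀ : L) := by
        rw [← place_coe_mul, ← place_coe_mul, b3]
      have h4 := place_pos (hG0 g₀ hg₀) w
      have h5 := place_pos (hG0 q.1 b1) w
      refine le_of_mul_le_mul_right ?_ hM0
      calc w (q.1 : L) * M ≤ w (q.1 : L) * w (q.2 : L) := by gcongr
        _ = w (g₀ : L) * w (y₀ : L) := h3
        _ ≤ w (g₀ : L) * (3 * M) := by gcongr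
        _ = _ := by ring
    · obtain ⟨b1, b2, b3⟩ := hq q hq₁
      obtain ⟨c1, c2, c3⟩ := hq q' hq₂
      refine Prod.ext h (mul_left_cancel₀ (hG0 q.1 b1) ?_)
      rw [b3, h, c3]

set_option maxHeartbeats 800000 in
open Pointwise in
theorem exists_finite_sumset_mulset_small (r E : ℕ) (hE : E = 2 ^ (6 * r + 31))
    (hr : √|(discr L : ℝ)| < 2 ^ (r * Module.finrank ℚ L)) (hEn : E ≤ Module.finrank ℚ L) :
    ∃ A : Set (𝓞 L), A.Finite ∧ 2 ^ Module.finrank ℚ L ≤ A.ncard ∧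
      (A + A).ncard * 2 ^ Module.finrank ℚ L ≤ A.ncard ^ 2 ∧
      (A * A).ncard * 2 ^ Module.finrank ℚ L ≤ A.ncard ^ 2 ∧
      A.ncard ≤ (2 ^ Module.finrank ℚ L) ^ (2 * r + 2 * E + 6) := by
  classical
  set n := Module.finrank ℚ L with hn
  have hrE : r < E := by
    rw [hE]
    exact Nat.lt_two_pow_self.trans_le (Nat.pow_le_pow_right two_pos (by omega))
  set M : ℕ := 2 ^ (r + E) with hM
  have hM0 : (0 : ℝ) < M := by rw [hM]; positivity
  have hwM : ∀ w : InfinitePlace L, w ((2 * M : ℕ) : L) = 2 * M := fun w => by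
    rw [← InfinitePlace.norm_embedding_eq, map_natCast]; simp
  have hGf := boundedSet_finite (L := L) (r + 1) (r + E)
  obtain ⟨hXf, -⟩ := box_finite_ncard_two_pow (L := L) (fun _ => M) (fun _ => hM0) (r + E) (by
    simp [card_infinitePlace, pow_mul, hM])
  set X := {x : 𝓞 L | ∀ w : InfinitePlace L, w (x : L) ≤ M} with hX
  set G := hGf.toFinset with hG
  set Y := hXf.toFinset.image fun x => ((2 * M : ℕ) : 𝓞 L) + x with hY
  have hYc : Y.card = X.ncard := by
    rw [hY, Finset.card_image_of_injective _ (add_right_injective _),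
      ← Set.ncard_eq_toFinset_card _ hXf]
  have hYw : ∀ y ∈ Y, ∀ w : InfinitePlace L, (M : ℝ) ≤ w (y : L) ∧ w (y : L) ≤ 3 * M := by
    intro y hy w
    obtain ⟨x, hx, rfl⟩ := Finset.mem_image.1 hy
    have h1 : w (x : L) ≤ M := hXf.mem_toFinset.1 hx w
    have h2 := hwM w
    have h3 : w (((2 * M : ℕ) : L) + (x : L)) ≤ w ((2 * M : ℕ) : L) + w (x : L) :=
      w.1.add_le _ _
    have h4 : w ((2 * M : ℕ) : L) ≤ w (((2 * M : ℕ) : L) + (x : L)) + w (x : L) := by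
      have := w.1.add_le (((2 * M : ℕ) : L) + (x : L)) (-(x : L))
      rwa [w.1.map_neg, add_neg_cancel_right] at this
    have e : (((2 * M : ℕ) : 𝓞 L) + x : 𝓞 L) = ((2 * M : ℕ) : L) + (x : L) := by
      exact (map_add (algebraMap (𝓞 L) L) _ _).trans (by rw [map_natCast])
    rw [e]
    constructor <;> linarith
  have hGw : ∀ g ∈ G, g ≠ 0 ∧ ∏ w : InfinitePlace L, w (g : L) ≤ 2 ^ ((r + 1) * n) ∧
      ∀ w : InfinitePlace L, w (g : L) ≤ M := by
    intro g hg
    obtain ⟨h1, h2, h3⟩ := hGf.mem_toFinset.1 hg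
    exact ⟨h1, h2, fun w => (h3 w).trans (by simp [hM])⟩
  have hXn : (2 ^ n) ^ E ≤ Y.card := by
    have h1 := le_box_ncard (L := L) (fun _ => M / 2) (fun _ => by
      have : (0 : NNReal) < M := by exact_mod_cast hM0
      positivity)
    have h2 : (2 : ℝ) * ((M / 2 : NNReal) : ℝ) = M := by push_cast; ring
    rw [Finset.prod_const, Finset.card_univ, card_infinitePlace, ← mul_pow] at h1
    simp only [h2] at h1
    rw [← hX, ← hYc, ← hn] at h1
    have h3 := h1.trans (mul_le_mul_of_nonneg_left hr.le (Nat.cast_nonneg _))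
    have h4 : M ^ n ≤ Y.card * 2 ^ (r * n) := by exact_mod_cast h3
    rw [hM, ← pow_mul, add_mul, pow_add, mul_comm] at h4
    have h5 := Nat.le_of_mul_le_mul_right h4 (by positivity)
    rwa [← pow_mul, mul_comm n]
  have hGc : (2 ^ n) ^ (5 * r + 27) ≤ G.card := by
    have h1 := pow_le_boundedSet_ncard (L := L) r hr E hEn
    rw [Set.ncard_eq_toFinset_card _ hGf, ← hG, hE] at h1
    have e : (2 ^ (6 * r + 31)) ^ n = (2 ^ n) ^ (5 * r + 27) * 2 ^ ((r + 4) * n) := by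
      rw [← pow_mul, ← pow_mul, ← pow_add]; congr 1; ring
    rw [← hn, e] at h1
    exact Nat.le_of_mul_le_mul_right h1 (by positivity)
  have hfib : G.card * Y.card ≤ (2 ^ n) ^ (r + 6) * (G * Y).card := by
    rw [← pow_mul, mul_comm n]
    exact card_mul_card_le_card_mul (r + 1) M hM0 G Y (fun g hg => (hGw g hg).1)
      (fun g hg => (hGw g hg).2.1) hYw
  have hAc : (2 ^ n) ^ (4 * r + 21 + E) ≤ (G * Y).card := by
    have h1 := (Nat.mul_le_mul hGc hXn).trans hfib
    rw [← pow_add, show 5 * r + 27 + E = (r + 6) + (4 * r + 21 + E) by ring, pow_add _ (r + 6)]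
      at h1
    exact Nat.le_of_mul_le_mul_left h1 (by positivity)
  have hAA : ((G * Y) + (G * Y)).card ≤ (2 ^ n) ^ (2 * r + 2 * E + 6) := by
    obtain ⟨hf, hc⟩ := box_finite_ncard_two_pow (L := L) (fun _ => 2 ^ (2 * r + 2 * E + 3))
      (fun _ => by positivity) (2 * r + 2 * E + 3) (by simp [card_infinitePlace, pow_mul])
    rw [← pow_mul, mul_comm n]
    refine le_trans ?_ hc
    rw [← Set.ncard_coe_finset]
    refine Set.ncard_le_ncard (fun z hz w => ?_) hf
    have h1 : ∀ a ∈ G * Y, w (a : L) ≤ 3 * M ^ 2 := by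
      intro a ha
      obtain ⟨g, hg, y, hy, rfl⟩ := Finset.mem_mul.1 ha
      rw [place_coe_mul]
      have h2 := (hGw g hg).2.2 w
      have h3 := (hYw y hy w).2
      calc _ ≤ (M : ℝ) * (3 * M) := mul_le_mul h2 h3 (apply_nonneg _ _) hM0.le
        _ = _ := by ring
    obtain ⟨a, ha, b, hb, rfl⟩ := Finset.mem_add.1 (Finset.mem_coe.1 hz)
    have e : ((a + b : 𝓞 L) : L) = (a : L) + (b : L) := map_add (algebraMap (𝓞 L) L) a b
    rw [e]
    have h2 : (2 : ℝ) ^ (2 * r + 2 * E + 3) = 8 * M ^ 2 := by rw [hM]; push_cast; ring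
    rw [h2]
    have h3 : w ((a : L) + (b : L)) ≤ w (a : L) + w (b : L) := w.1.add_le _ _
    have h4 := h1 a ha
    have h5 := h1 b hb
    linarith [sq_nonneg (M : ℝ)]
  have hMM : ((G * Y) * (G * Y)).card ≤ (2 ^ n) ^ (8 * r + 41) * Y.card ^ 2 := by
    have hZf := boundedSet_finite (L := L) (2 * r + 2) (2 * r + 2 * E)
    have h1 : G * G ⊆ hZf.toFinset := by
      intro z hz
      obtain ⟨g, hg, g', hg', rfl⟩ := Finset.mem_mul.1 hz
      obtain ⟨a1, a2, a3⟩ := hGf.mem_toFinset.1 hg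
      obtain ⟨b1, b2, b3⟩ := hGf.mem_toFinset.1 hg'
      refine hZf.mem_toFinset.2 ⟨mul_ne_zero a1 b1, ?_, fun w => ?_⟩
      · simp only [place_coe_mul, Finset.prod_mul_distrib]
        rw [show (2 * r + 2) * Module.finrank ℚ L =
          (r + 1) * Module.finrank ℚ L + (r + 1) * Module.finrank ℚ L by ring, pow_add]
        exact mul_le_mul a2 b2 (Finset.prod_nonneg fun w _ => apply_nonneg w _) (by positivity)
      · rw [place_coe_mul, show 2 * r + 2 * E = (r + E) + (r + E) by ring, pow_add]
        exact mul_le_mul (a3 w) (b3 w) (apply_nonneg _ _) (by positivity)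
    have h2 := (Finset.card_le_card h1).trans
      ((Set.ncard_eq_toFinset_card _ hZf).ge.trans (boundedSet_ncard_le _ _))
    have h3 : 64 * 2 ^ (2 * r + 2) * (2 * r + 2 * E + 1) ≤ 2 ^ (8 * r + 41) := by
      calc _ ≤ 64 * 2 ^ (2 * r + 2) * (4 * E) := by gcongr; omega
        _ = _ := by rw [hE]; ring
    have h4 := h2.trans (Nat.pow_le_pow_left h3 n)
    rw [mul_mul_mul_comm]
    refine Finset.card_mul_le.trans (Nat.mul_le_mul ?_ ?_)
    · rwa [← pow_mul, mul_comm n, pow_mul]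
    · rw [sq]; exact Finset.card_mul_le
  have hn1 : 1 ≤ 2 ^ n := Nat.one_le_two_pow
  refine ⟨↑(G * Y), Finset.finite_toSet _, ?_, ?_, ?_, ?_⟩
  · rw [Set.ncard_coe_finset]
    exact (le_self_pow hn1 (by omega)).trans hAc
  · rw [← Finset.coe_add, Set.ncard_coe_finset, Set.ncard_coe_finset]
    calc _ ≤ (2 ^ n) ^ (2 * r + 2 * E + 6) * 2 ^ n := Nat.mul_le_mul_right _ hAA
      _ = (2 ^ n) ^ (2 * r + 2 * E + 7) := (pow_succ _ _).symm
      _ ≤ (2 ^ n) ^ ((4 * r + 21 + E) * 2) := Nat.pow_le_pow_right hn1 (by omega)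
      _ = ((2 ^ n) ^ (4 * r + 21 + E)) ^ 2 := pow_mul _ _ _
      _ ≤ _ := Nat.pow_le_pow_left hAc 2
  · rw [← Finset.coe_mul, Set.ncard_coe_finset, Set.ncard_coe_finset]
    refine Nat.le_of_mul_le_mul_left (c := ((2 ^ n) ^ (r + 6)) ^ 2) ?_ (by positivity)
    calc _ ≤ ((2 ^ n) ^ (r + 6)) ^ 2 * ((2 ^ n) ^ (8 * r + 41) * Y.card ^ 2 * 2 ^ n) := by gcongr
      _ = ((2 ^ n) ^ (5 * r + 27) * Y.card) ^ 2 := by generalize 2 ^ n = q; ring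
      _ ≤ (G.card * Y.card) ^ 2 := by gcongr
      _ ≤ _ := Nat.pow_le_pow_left hfib 2
      _ = _ := mul_pow _ _ _
  · rw [Set.ncard_coe_finset]
    refine le_trans ?_ hAA
    have h0 : (G * Y).Nonempty := Finset.card_pos.1 (lt_of_lt_of_le (by positivity) hAc)
    obtain ⟨a, ha⟩ := h0
    exact Finset.card_le_card_of_injOn (fun b => a + b) (fun b hb => Finset.add_mem_add ha hb)
      (add_right_injective a).injOn

end NumberField

end

section

open NumberField IsDedekindDomain

namespace Pl

variable {F : Type*} [Field F] [NumberField F] {q : ℕ} [hq : Fact q.Prime]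

omit [NumberField F] in
theorem pow_dvd_of_intCast_mem_ge (P : Pl F) (h1 : P (q : F) = 1) (k : ℕ) {m : ℤ}
    (hm : (m : F) ∈ P.ge k) : (q : ℤ) ^ k ∣ m := by
  have h0 : 0 < P (q : F) := by omega
  have hq0 : (q : F) ≠ 0 := ord_prime_pos_ne_zero h0
  induction k generalizing m with
  | zero => simp
  | succ k ih =>
    have hd : (q : ℤ) ∣ m := by
      by_contra hd
      have hco : IsCoprime m q :=
        ((Nat.prime_iff_prime_int.1 hq.out).coprime_iff_not_dvd.2 hd).symm
      obtain ⟨h2, h3⟩ := P.ord_intCast_of_coprime h0 hco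
      have := hm h2
      push_cast at this
      omega
    obtain ⟨l, rfl⟩ := hd
    rw [pow_succ']
    refine mul_dvd_mul_left _ (ih fun hl => ?_)
    push_cast at hm
    have := hm (mul_ne_zero hq0 hl)
    rw [P.ord_mul hq0 hl, h1] at this
    omega

section

variable (P : Pl F) (h1 : P (q : F) = 1)
  (happ : ∀ (k : ℕ) (x : 𝓞 F), ∃ i : ℤ, algebraMap (𝓞 F) F x - i ∈ P.ge k)

omit [NumberField F] in
include h1 in
theorem intCast_zmod_eq {k : ℕ} {x : F} {i j : ℤ} (hi : x - i ∈ P.ge k) (hj : x - j ∈ P.ge k) :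
    (i : ZMod (q ^ k)) = j := by
  rw [← sub_eq_zero, ← Int.cast_sub, ZMod.intCast_zmod_eq_zero_iff_dvd, Nat.cast_pow]
  refine P.pow_dvd_of_intCast_mem_ge h1 k ?_
  have := (P.ge k).sub_mem hj hi
  rwa [sub_sub_sub_cancel_left, ← Int.cast_sub] at this

/-- The reduction of `𝓞 F` modulo the `k`-th power of a place of degree one. -/
noncomputable def reduction (k : ℕ) : 𝓞 F →+* ZMod (q ^ k) where
  toFun x := ((happ k x).choose : ℤ)
  map_one' := by
    refine (P.intCast_zmod_eq h1 (j := 1) (happ k 1).choose_spec ?_).trans Int.cast_one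
    simp
  map_zero' := by
    refine (P.intCast_zmod_eq h1 (j := 0) (happ k 0).choose_spec ?_).trans Int.cast_zero
    simp
  map_mul' x y := by
    rw [← Int.cast_mul]
    refine P.intCast_zmod_eq h1 (happ k (x * y)).choose_spec ?_
    have hx := (happ k x).choose_spec
    have hy := (happ k y).choose_spec
    have h2 := (P.ge k).add_mem (P.mul_mem_ge_zero (P.algebraMap_mem_ge x) hy)
      (P.mul_mem_ge_zero (P.intCast_mem_ge (happ k y).choose) hx)
    rw [map_mul, Int.cast_mul]
    convert h2 using 1
    ring
  map_add' x y := by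
    rw [← Int.cast_add]
    refine P.intCast_zmod_eq h1 (happ k (x + y)).choose_spec ?_
    have h2 := (P.ge k).add_mem (happ k x).choose_spec (happ k y).choose_spec
    rw [map_add, Int.cast_add]
    convert h2 using 1
    ring

theorem reduction_eq {k : ℕ} {x : 𝓞 F} {i : ℤ} (hi : algebraMap (𝓞 F) F x - i ∈ P.ge k) :
    P.reduction h1 happ k x = i :=
  P.intCast_zmod_eq h1 (happ k x).choose_spec hi

include h1 happ in
theorem exists_injective_padicInt : ∃ f : 𝓞 F →+* ℤ_[q], Function.Injective f := by
  have hc : ∀ (k₁ k₂ : ℕ) (hk : k₁ ≤ k₂), (ZMod.castHom (pow_dvd_pow q hk) _).comp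
      (P.reduction h1 happ k₂) = P.reduction h1 happ k₁ := by
    intro k₁ k₂ hk
    ext x
    obtain ⟨i, hi⟩ := happ k₂ x
    rw [RingHom.comp_apply, P.reduction_eq h1 happ hi,
      P.reduction_eq h1 happ (P.ge_anti (by exact_mod_cast hk) hi), map_intCast]
  refine ⟨PadicInt.lift hc, (injective_iff_map_eq_zero _).2 fun x hx => ?_⟩
  by_contra hx0
  have hx1 : algebraMap (𝓞 F) F x ≠ 0 := by simpa using hx0
  obtain ⟨k, hk⟩ : ∃ k : ℕ, P (algebraMap (𝓞 F) F x) < k :=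
    ⟨(P (algebraMap (𝓞 F) F x)).toNat + 1, by omega⟩
  obtain ⟨i, hi⟩ := happ k x
  have h2 : P.reduction h1 happ k x = 0 := by
    rw [← PadicInt.lift_spec hc k, RingHom.comp_apply, hx, map_zero]
  rw [P.reduction_eq h1 happ hi, ZMod.intCast_zmod_eq_zero_iff_dvd] at h2
  obtain ⟨l, rfl⟩ := h2
  have h3 : (((q ^ k : ℕ) * l : ℤ) : F) ∈ P.ge k := by
    push_cast
    have h4 : (q : F) ^ k ∈ P.ge k := fun _ => by rw [ord_pow, h1]; simp
    rw [mul_comm]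
    exact P.mul_mem_ge_zero (P.intCast_mem_ge l) h4
  have h5 := (P.ge k).add_mem hi h3
  rw [sub_add_cancel] at h5
  have := h5 hx1
  omega

end

theorem SpSplit.exists_injective_padicInt (h : SpSplit q F) :
    ∃ f : 𝓞 F →+* ℤ_[q], Function.Injective f := by
  obtain ⟨S, hS, hcard⟩ := id h
  obtain ⟨P, hP⟩ := Finset.card_pos.1 (lt_of_lt_of_le Module.finrank_pos hcard)
  exact P.exists_injective_padicInt (h.ord_self (hS P hP))
    fun k x => h.approx (hS P hP) (P.algebraMap_mem_ge x) k

end Pl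

end

section

open NumberField

theorem sqrt_abs_lt_two_pow {B d m n : ℕ} {x : ℝ} (hx : |x| = (d ^ m : ℕ)) (hd0 : d ≠ 0)
    (hd : d ≤ B) (hmn : m ≤ n) (hn : n ≠ 0) : √|x| < 2 ^ (B * n) := by
  have h1 : d ^ m < 2 ^ (B * n) := by
    rw [pow_mul]
    calc d ^ m ≤ d ^ n := Nat.pow_le_pow_right (by omega) hmn
      _ < (2 ^ B) ^ n := Nat.pow_lt_pow_left (hd.trans_lt Nat.lt_two_pow_self) hn
  have h2 : (1 : ℝ) ≤ |x| := by
    rw [hx]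
    exact_mod_cast Nat.one_le_iff_ne_zero.2 (pow_ne_zero m hd0)
  calc √|x| ≤ |x| := Real.sqrt_le_iff.2 ⟨by positivity, by nlinarith⟩
    _ < 2 ^ (B * n) := by rw [hx]; exact_mod_cast h1

theorem le_rpow_two_sub {a s q t : ℕ} (ht : 0 < t) (hq : 0 < q) (ha : q ≤ a) (h : s * q ≤ a ^ 2)
    (hat : a ≤ q ^ t) : (s : ℝ) ≤ (a : ℝ) ^ ((2 : ℝ) - 1 / t) := by
  have ha0 : (0 : ℝ) < a := by exact_mod_cast hq.trans_le ha
  have hq0 : (0 : ℝ) < q := by exact_mod_cast hq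
  have h1 : (a : ℝ) ^ ((1 : ℝ) / t) ≤ q := by
    have h2 : (a : ℝ) ≤ (q : ℝ) ^ t := by exact_mod_cast hat
    calc (a : ℝ) ^ ((1 : ℝ) / t) ≤ ((q : ℝ) ^ t) ^ ((1 : ℝ) / t) := by gcongr
      _ = q := by rw [one_div]; exact Real.pow_rpow_inv_natCast hq0.le ht.ne'
  rw [Real.rpow_sub ha0, le_div_iff₀ (by positivity), Real.rpow_two]
  calc (s : ℝ) * (a : ℝ) ^ ((1 : ℝ) / t) ≤ s * q := by gcongr
    _ ≤ (a : ℝ) ^ 2 := by exact_mod_cast h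

end

open Pointwise

/-- There exists an absolute constant `c > 0`, independent of the prime `p`, such that
there are arbitrarily large finite `A ⊆ ℤ_p` with `max(|A+A|, |AA|) ≤ |A|^{2-c}`. -/
theorem statement18 :
    ∃ c : ℝ, 0 < c ∧
      ∀ (p : ℕ) [Fact p.Prime], ∀ N : ℕ,
        ∃ A : Set ℤ_[p], A.Finite ∧ N ≤ A.ncard ∧
          max ((A + A).ncard : ℝ) ((A * A).ncard : ℝ) ≤ (A.ncard : ℝ) ^ ((2 : ℝ) - c) := by
  obtain ⟨B, hB⟩ := exists_infinite_tower
  set t : ℕ := 2 * B + 2 * 2 ^ (6 * B + 31) + 6 with ht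
  refine ⟨1 / t, by positivity, fun p _ N => ?_⟩
  obtain ⟨K, _, _, hK2, hKB, hK⟩ := hB p
  obtain ⟨L, _, _, _, hL, hLn⟩ := hK (max N (2 ^ (6 * B + 31)))
  have := hL.isGalois
  have := hL.isTotallyReal
  have hn : Module.finrank ℚ L = 2 * Module.finrank K L := by
    rw [← hK2, Module.finrank_mul_finrank]
  have hn0 : 0 < Module.finrank ℚ L := Module.finrank_pos
  have hd : |(NumberField.discr L : ℝ)| =
      ((NumberField.discr K).natAbs ^ Module.finrank K L : ℕ) := by
    rw [← hL.noInertia.natAbs_discr, Nat.cast_natAbs, Int.cast_abs]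
  obtain ⟨A, hAf, hA1, hA2, hA3, hA4⟩ :=
    NumberField.exists_finite_sumset_mulset_small (L := L) B _ rfl
    (sqrt_abs_lt_two_pow hd (Int.natAbs_ne_zero.2 (NumberField.discr_ne_zero K)) hKB
        (by omega) hn0.ne')
    (by omega)
  obtain ⟨f, hf⟩ := hL.split.exists_injective_padicInt
  refine ⟨f '' A, hAf.image f, ?_, ?_⟩
  · rw [Set.ncard_image_of_injective _ hf]
    refine le_trans ?_ hA1
    have := (Nat.lt_two_pow_self (n := Module.finrank ℚ L)).le
    omega
  · rw [← Set.image_add, ← Set.image_mul, Set.ncard_image_of_injective _ hf,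
      Set.ncard_image_of_injective _ hf, Set.ncard_image_of_injective _ hf]
    exact max_le (le_rpow_two_sub (by omega) (by positivity) hA1 hA2 hA4)
      (le_rpow_two_sub (by omega) (by positivity) hA1 hA3 hA4)
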